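/- Let Ω ⊂ ℝⁿ be a simply connected, bounded Lipschitz domain, let f ∈ C²([0,∞)) be strictly convex with f(0) = f'(0) = 0, satisfying the linear growth condition νt − L ≤ f(t) ≤ L(t+1) for all t ≥ 0 (for constants 0 < ν ≤ L < ∞) and the bound f''(t) ≤ L(1+t)⁻¹ for all t ≥ 0, and let T₀ ∈ W^{2,∞}(Ω;ℝ^{N×n}) satisfy ‖T₀‖_{L^∞(Ω;ℝ^{N×n})} < f^∞(1). Then there exists a weak solution u ∈ W^{1,1}(Ω;ℝ^N) of the Neumann problem, i.e. ∫_Ω f'(|∇u|)|∇u|⁻¹ ∇u · ∇φ dx = ∫_Ω T₀ · ∇φ dx for all φ ∈ W^{1,1}(Ω;ℝ^N), and this weak solution is unique within the class of all v ∈ W^{1,1}(Ω;ℝ^N) with vanishing mean value (v)_Ω = 0. -/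

import Mathlib

open MeasureTheory Filter Topology Set
open scoped ENNReal RealInnerProductSpace

noncomputable section

/-- Euclidean space `ℝⁿ`. -/
abbrev EVec (n : ℕ) := EuclideanSpace ℝ (Fin n)

/-- Frobenius inner product of two "matrices". -/
def mdot {ι κ : Type*} [Fintype ι] [Fintype κ] (A B : ι → κ → ℝ) : ℝ :=
  ∑ a, ∑ i, A a i * B a i

/-- Frobenius norm. -/
noncomputable def mnorm {ι κ : Type*} [Fintype ι] [Fintype κ] (A : ι → κ → ℝ) : ℝ :=
  Real.sqrt (mdot A A)

/-- Euclidean norm of a vector given as a tuple. -/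
noncomputable def vnorm {ι : Type*} [Fintype ι] (v : ι → ℝ) : ℝ :=
  Real.sqrt (∑ a, v a ^ 2)

/-- `Ω ⊆ ℝⁿ` is a (nonempty, open, connected) Lipschitz domain: every boundary point has
a neighbourhood on which `Ω` can be flattened to a half space by a bi-Lipschitz map. -/
def IsLipschitzDomain {n : ℕ} (Ω : Set (EVec n)) : Prop :=
  IsOpen Ω ∧ Ω.Nonempty ∧ IsConnected Ω ∧
  ∀ x ∈ frontier Ω, ∃ (U : Set (EVec n)) (h hinv : EVec n → EVec n) (K : NNReal)
      (e : EVec n),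
    ‖e‖ = 1 ∧ IsOpen U ∧ x ∈ U ∧ LipschitzOnWith K h U ∧
    LipschitzOnWith K hinv (h '' U) ∧ (∀ y ∈ U, hinv (h y) = y) ∧
    h '' (U ∩ Ω) = (h '' U) ∩ {y : EVec n | 0 < ⟪e, y⟫}

/-- `Du` is the weak (distributional) gradient of `u` on `Ω`, and both are integrable;
i.e. `u ∈ W^{1,1}(Ω; ℝ^ι)` with weak gradient `Du`. -/
def HasWeakDerivOn {n : ℕ} {ι : Type*} [Fintype ι] (Ω : Set (EVec n))
    (u : EVec n → ι → ℝ) (Du : EVec n → ι → Fin n → ℝ) : Prop :=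
  IntegrableOn u Ω volume ∧ IntegrableOn Du Ω volume ∧
  ∀ φ : EVec n → ℝ, ContDiff ℝ 1 φ → HasCompactSupport φ → tsupport φ ⊆ Ω →
    ∀ (a : ι) (i : Fin n),
      ∫ x in Ω, u x a * fderiv ℝ φ x (EuclideanSpace.single i 1) =
        - ∫ x in Ω, Du x a i * φ x

/-- `u ∈ W^{1,2}(Ω;ℝ^ι)` with weak gradient `Du`. -/
def MemW12 {n : ℕ} {ι : Type*} [Fintype ι] (Ω : Set (EVec n))
    (u : EVec n → ι → ℝ) (Du : EVec n → ι → Fin n → ℝ) : Prop :=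
  HasWeakDerivOn Ω u Du ∧ IntegrableOn (fun x => vnorm (u x) ^ 2) Ω volume ∧
    IntegrableOn (fun x => mnorm (Du x) ^ 2) Ω volume

/-- vanishing mean value `(u)_Ω = 0`. -/
def ZeroMean {n : ℕ} {ι : Type*} [Fintype ι] (Ω : Set (EVec n))
    (u : EVec n → ι → ℝ) : Prop :=
  ∀ a : ι, ∫ x in Ω, u x a = 0

/-- The `L^∞(Ω)` norm of a matrix field (w.r.t. the pointwise Frobenius norm). -/
noncomputable def linfNormOn {n N : ℕ} (Ω : Set (EVec n))
    (T : EVec n → Fin N → Fin n → ℝ) : ℝ≥0∞ :=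
  essSup (fun x => ENNReal.ofReal (mnorm (T x))) (volume.restrict Ω)

/-- `T ∈ W^{1,∞}(Ω)`: bounded and Lipschitz on `Ω`. -/
def MemW1inf {n N : ℕ} (Ω : Set (EVec n)) (T : EVec n → Fin N → Fin n → ℝ) : Prop :=
  ∃ C : NNReal, (∀ x ∈ Ω, ‖T x‖ ≤ C) ∧ LipschitzOnWith C T Ω

/-- `T ∈ W^{2,∞}(Ω)`: `T` is bounded with bounded Lipschitz derivative on `Ω`. -/
def MemW2inf {n N : ℕ} (Ω : Set (EVec n)) (T : EVec n → Fin N → Fin n → ℝ) : Prop :=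
  ∃ (C : NNReal) (DT : EVec n → EVec n →L[ℝ] (Fin N → Fin n → ℝ)),
    (∀ x ∈ Ω, ‖T x‖ ≤ C) ∧ (∀ x ∈ Ω, HasFDerivWithinAt T (DT x) Ω x) ∧
    (∀ x ∈ Ω, ‖DT x‖ ≤ C) ∧ LipschitzOnWith C DT Ω

/-- The nonlinear map `A(z) = f'(|z|) z / |z|` (equal to `0` at `z = 0`). -/
noncomputable def Amap {N n : ℕ} (f' : ℝ → ℝ) (z : Fin N → Fin n → ℝ) :
    Fin N → Fin n → ℝ :=
  fun a i => (f' (mnorm z) / mnorm z) * z a i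

/-- `u` is a weak solution of the Neumann problem for the integrand `f(|·|)` and datum `T₀`. -/
def IsWeakSolution {n N : ℕ} (Ω : Set (EVec n)) (f' : ℝ → ℝ)
    (T₀ : EVec n → Fin N → Fin n → ℝ)
    (u : EVec n → Fin N → ℝ) (Du : EVec n → Fin N → Fin n → ℝ) : Prop :=
  HasWeakDerivOn Ω u Du ∧
  ∀ φ Dφ, HasWeakDerivOn Ω φ Dφ →
    ∫ x in Ω, mdot (Amap f' (Du x)) (Dφ x) = ∫ x in Ω, mdot (T₀ x) (Dφ x)

/-- The functional `𝔉[w] = ∫_Ω (f(|∇w|) − T₀ · ∇w) dx` (as a function of the gradient). -/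
noncomputable def FF {n N : ℕ} (Ω : Set (EVec n)) (f : ℝ → ℝ)
    (T₀ : EVec n → Fin N → Fin n → ℝ) (Du : EVec n → Fin N → Fin n → ℝ) : ℝ :=
  ∫ x in Ω, (f (mnorm (Du x)) - mdot (T₀ x) (Du x))

/-- The regularised functional `𝔉_k[w] = 𝔉[w] + (2k)⁻¹ ∫_Ω |∇w|² dx`. -/
noncomputable def FFk {n N : ℕ} (Ω : Set (EVec n)) (f : ℝ → ℝ)
    (T₀ : EVec n → Fin N → Fin n → ℝ) (k : ℕ)
    (Du : EVec n → Fin N → Fin n → ℝ) : ℝ :=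
  FF Ω f T₀ Du + (2 * (k : ℝ))⁻¹ * ∫ x in Ω, mnorm (Du x) ^ 2

end

section
open Metric (ball closedBall isOpen_ball ball_subset_closedBall mem_closedBall mem_ball_self mem_ball isBounded_ball nhds_basis_closedBall ball_mem_nhds mem_closedBall_self closedBall_subset_ball measure_ball_pos ball_subset_ball sphere)
open Real (norm_of_nonneg log norm_eq_abs smoothTransition)
open EuclideanSpace (single norm_sq_eq)
open ENNReal (ofReal ofReal_le_ofReal ofReal_lt_top ofReal_ne_top)
open Finset (sum_le_sum sum_congr sum_nonneg sum_mul mul_sum)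
open PiLp (norm_apply_le)
variable {n N : ℕ}
local notation "Ev" => EVec n

theorem aoa {α : Type*} [MeasurableSpace α] {μ : Measure α} {p : α → Prop} (h : ∀ x, p x) : ∀ᵐ x ∂μ, p x := ae_of_all _ h

structure Prof (f a : ℝ → ℝ) (L M : ℝ) : Prop where
  Lpos : 0 < L
  Mpos : 0 < M
  a0 : a 0 = 0
  f0 : f 0 = 0
  fcont : ContinuousOn f (Ici 0)
  cont : ContinuousOn a (Ici 0)
  smono : StrictMonoOn a (Ici 0)
  leM : ∀ t, 0 ≤ t → a t ≤ M
  slope : ∀ s r, 0 ≤ s → s ≤ r → a r - a s ≤ L / (1 + s) * (r - s)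
  breg : ∀ r s, 0 ≤ r → 0 ≤ s → (a r - a s) ^ 2 / (2 * L) ≤ f r - f s - a s * (r - s)
  coer : ∀ m, m < M → ∃ C, 0 ≤ C ∧ ∀ t, 0 ≤ t → m * t - C ≤ f t

theorem prof_of_hyp (ν L : ℝ) (hν : 0 < ν) (hνL : ν ≤ L)
    (f f' f'' : ℝ → ℝ)
    (hderiv : ∀ t ∈ Set.Ici (0:ℝ), HasDerivWithinAt f (f' t) (Set.Ici 0) t)
    (hderiv' : ∀ t ∈ Set.Ici (0:ℝ), HasDerivWithinAt f' (f'' t) (Set.Ici 0) t)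
    (hstrict : StrictConvexOn ℝ (Set.Ici 0) f)
    (hf0 : f 0 = 0) (hf'0 : f' 0 = 0)
    (hgrowth : ∀ t ∈ Set.Ici (0:ℝ), ν * t - L ≤ f t ∧ f t ≤ L * (t + 1))
    (hsec : ∀ t ∈ Set.Ici (0:ℝ), f'' t ≤ L * (1 + t)⁻¹)
    (finf : ℝ) (hfinf : Filter.Tendsto (fun t => f t / t) Filter.atTop (nhds finf)) :
    Prof f f' L finf := by
  have ja : 0 < L := hν.trans_le hνL
  have hsm : StrictMonoOn f' (Ici 0) := by
    intro x hx y hy hxy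
    have aa := (hstrict.convexOn).le_slope_of_hasDerivWithinAt hx hy hxy (hderiv x hx)
    have ab := (hstrict.convexOn).slope_le_of_hasDerivWithinAt hx hy hxy (hderiv y hy)
    set m := (x + y) / 2
    have hm : m ∈ Ici (0:ℝ) := by
      simp only [mem_Ici] at *; simp only [m]; linarith
    have hxm : x < m := by simp only [m]; linarith
    have hmy : m < y := by simp only [m]; linarith
    have ad := (hstrict.convexOn).le_slope_of_hasDerivWithinAt hx hm hxm (hderiv x hx)
    have ai := (hstrict.convexOn).slope_le_of_hasDerivWithinAt hm hy hmy (hderiv y hy)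
    have al := hstrict.slope_strict_mono_adjacent hx hy hxm hmy
    rw [slope_def_field] at ad ai
    linarith
  have hcont : ContinuousOn f (Ici 0) := fun t ht => (hderiv t ht).continuousWithinAt
  have hcont' : ContinuousOn f' (Ici 0) := fun t ht => (hderiv' t ht).continuousWithinAt
  have hd : ∀ t, 0 < t → HasDerivAt f (f' t) t := fun t ht =>
    (hderiv t ht.le).hasDerivAt (Ici_mem_nhds ht)
  have hd' : ∀ t, 0 < t → HasDerivAt f' (f'' t) t := fun t ht =>
    (hderiv' t ht.le).hasDerivAt (Ici_mem_nhds ht)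
  have hslope : ∀ s r, 0 ≤ s → s ≤ r → f' r - f' s ≤ L / (1 + s) * (r - s) := by
    intro s r hs hsr
    have := (convex_Icc s r).image_sub_le_mul_sub_of_deriv_le (f := f')
      (hcont'.mono (fun x hx => hs.trans hx.1))
      (fun x hx => by
        rw [interior_Icc] at hx
        exact (hd' x (hs.trans_lt hx.1)).differentiableAt.differentiableWithinAt)
      (C := L / (1 + s)) (fun x hx => by
        rw [interior_Icc] at hx
        rw [(hd' x (hs.trans_lt hx.1)).deriv]
        refine (hsec x (hs.trans hx.1.le)).trans ?_
        rw [div_eq_mul_inv]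
        have := hx.1
        gcongr) s (left_mem_Icc.2 hsr) r (right_mem_Icc.2 hsr) hsr
    exact this
  have hleM : ∀ t, 0 ≤ t → f' t ≤ finf := by
    intro t ht
    have aa : Tendsto (fun s : ℝ => f t / s + f' t * (1 - t / s)) atTop (𝓝 (0 + f' t * (1 - 0))) := by
      refine Tendsto.add ?_ (Tendsto.const_mul _ (Tendsto.const_sub _ ?_))
      · exact tendsto_const_nhds.div_atTop tendsto_id
      · exact tendsto_const_nhds.div_atTop tendsto_id
    simp only [zero_add, sub_zero, mul_one] at aa
    refine le_of_tendsto_of_tendsto aa hfinf ?_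
    filter_upwards [eventually_gt_atTop t] with s hs
    have ab := (hstrict.convexOn).le_slope_of_hasDerivWithinAt ht (ht.trans hs.le) hs (hderiv t ht)
    rw [slope_def_field, le_div_iff₀ (by linarith)] at ab
    have hs0 : 0 < s := lt_of_le_of_lt ht hs
    have : f t / s + f' t * (1 - t / s) = (f t + f' t * (s - t)) / s := by field_simp
    rw [this]
    gcongr
    linarith
  refine ⟨ja, ?_, hf'0, hf0, hcont, hcont', hsm, hleM, hslope, ?_, ?_⟩
  · have aa := hsm (mem_Ici.2 le_rfl) (mem_Ici.2 zero_le_one) zero_lt_one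
    have := hleM 1 zero_le_one
    linarith
  · intro r s hr hs
    set G : ℝ → ℝ := fun r => f r - f s - f' s * (r - s) - (f' r - f' s) ^ 2 / (2 * L)
    have ak : ∀ x, 0 < x → HasDerivAt G ((f' x - f' s) * (1 - f'' x / L)) x := by
      intro x hx
      have := ((((hd x hx).sub_const (f s)).sub (((hasDerivAt_id x).sub_const s).const_mul (f' s))).sub
        ((((hd' x hx).sub_const (f' s)).pow 2).div_const (2 * L)))
      refine this.congr_deriv ?_
      field_simp
      push_cast
      ring
    have kg : ContinuousOn G (Ici 0) := by
      apply ContinuousOn.sub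
      · exact (hcont.sub continuousOn_const).sub (by fun_prop)
      · exact ((hcont'.sub continuousOn_const).pow 2).div_const _
    have hf'' : ∀ x, 0 < x → 0 ≤ 1 - f'' x / L := by
      intro x hx
      have aa := hsec x hx.le
      have ab : L * (1 + x)⁻¹ ≤ L := by
        have : (1 + x)⁻¹ ≤ 1 := inv_le_one_of_one_le₀ (by linarith)
        nlinarith
      rw [sub_nonneg, div_le_one ja]
      linarith
    have ma : G s = 0 := by simp [G]
    have key : 0 ≤ G r := by
      rcases le_total s r with hsr | hrs
      · have : MonotoneOn G (Icc s r) := by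
          apply monotoneOn_of_deriv_nonneg (convex_Icc _ _) (kg.mono fun x hx => hs.trans hx.1)
          · intro x hx
            rw [interior_Icc] at hx
            exact (ak x (hs.trans_lt hx.1)).differentiableAt.differentiableWithinAt
          · intro x hx
            rw [interior_Icc] at hx
            rw [(ak x (hs.trans_lt hx.1)).deriv]
            exact mul_nonneg (sub_nonneg.2 (hsm.monotoneOn hs (hs.trans hx.1.le) hx.1.le))
              (hf'' x (hs.trans_lt hx.1))
        have := this (left_mem_Icc.2 hsr) (right_mem_Icc.2 hsr) hsr
        linarith
      · have : AntitoneOn G (Icc r s) := by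
          apply antitoneOn_of_deriv_nonpos (convex_Icc _ _) (kg.mono fun x hx => hr.trans hx.1)
          · intro x hx
            rw [interior_Icc] at hx
            exact (ak x (hr.trans_lt hx.1)).differentiableAt.differentiableWithinAt
          · intro x hx
            rw [interior_Icc] at hx
            rw [(ak x (hr.trans_lt hx.1)).deriv]
            exact mul_nonpos_of_nonpos_of_nonneg
              (sub_nonpos.2 (hsm.monotoneOn (hr.trans hx.1.le) hs hx.2.le))
              (hf'' x (hr.trans_lt hx.1))
        have := this (left_mem_Icc.2 hrs) (right_mem_Icc.2 hrs) hrs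
        linarith
    simp only [G] at key
    linarith
  · intro m hm
    have aa := (hfinf.eventually (eventually_gt_nhds hm)).and (eventually_gt_atTop 0)
    obtain ⟨fx, aa⟩ := eventually_atTop.1 aa
    have hfnn : ∀ t, 0 ≤ t → 0 ≤ f t := by
      intro t ht
      rcases ht.eq_or_lt with rfl | ht'
      · exact hf0.ge
      have ab := (hstrict.convexOn).le_slope_of_hasDerivWithinAt (mem_Ici.2 le_rfl) ht ht'
        (hderiv 0 (mem_Ici.2 le_rfl))
      rw [slope_def_field, le_div_iff₀ (by linarith)] at ab
      simp only [hf'0, hf0] at ab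
      linarith
    refine ⟨|m| * |fx|, by positivity, fun t ht => ?_⟩
    rcases le_total fx t with h | h
    · obtain ⟨ab, ad⟩ := aa t h
      rw [lt_div_iff₀ ad] at ab
      have : 0 ≤ |m| * |fx| := by positivity
      linarith
    · have ab := hfnn t ht
      have ad : m * t ≤ |m| * |fx| :=
        mul_le_mul (le_abs_self m) (h.trans (le_abs_self _)) ht (abs_nonneg _)
      linarith

section Radial
variable {E : Type*} [NormedAddCommGroup E] [InnerProductSpace ℝ E]

noncomputable def radA (a : ℝ → ℝ) (x : E) : E := (a ‖x‖ / ‖x‖) • x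

noncomputable def cosA (x y : E) : ℝ := ⟪x, y⟫ / (‖x‖ * ‖y‖)

theorem cosA_le_one (x y : E) : cosA x y ≤ 1 := by
  unfold cosA
  exact div_le_one_of_le₀ (real_inner_le_norm x y) (by positivity)

theorem inner_eq_cosA (x y : E) : ⟪x, y⟫ = ‖x‖ * ‖y‖ * cosA x y := by
  unfold cosA
  by_cases hx : ‖x‖ = 0
  · simp [norm_eq_zero.1 hx]
  by_cases hy : ‖y‖ = 0
  · simp [norm_eq_zero.1 hy]
  field_simp

theorem radA_zero (a : ℝ → ℝ) : radA a (0 : E) = 0 := by simp [radA]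

theorem inner_radA_left (a : ℝ → ℝ) (a0 : a 0 = 0) (x y : E) :
    ⟪radA a x, y⟫ = a ‖x‖ * ‖y‖ * cosA x y := by
  rw [radA, real_inner_smul_left, inner_eq_cosA]
  by_cases hx : ‖x‖ = 0
  · simp [hx, a0]
  field_simp

theorem norm_radA (a : ℝ → ℝ) (a0 : a 0 = 0) (x : E) : ‖radA a x‖ = |a ‖x‖| := by
  rw [radA, norm_smul, norm_eq_abs, abs_div, abs_norm]
  by_cases hx : ‖x‖ = 0
  · simp [hx, a0]
  field_simp

theorem inner_radA_radA (a : ℝ → ℝ) (a0 : a 0 = 0) (x y : E) :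
    ⟪radA a x, radA a y⟫ = a ‖x‖ * a ‖y‖ * cosA x y := by
  rw [radA, radA, real_inner_smul_left, real_inner_smul_right, inner_eq_cosA]
  by_cases hx : ‖x‖ = 0
  · simp [hx, a0]
  by_cases hy : ‖y‖ = 0
  · simp [hy, a0]
  field_simp

theorem normsq_radA_sub (a : ℝ → ℝ) (a0 : a 0 = 0) (x y : E) :
    ‖radA a x - radA a y‖ ^ 2 = (a ‖x‖ - a ‖y‖) ^ 2 + 2 * a ‖x‖ * a ‖y‖ * (1 - cosA x y) := by
  rw [norm_sub_sq_real, inner_radA_radA a a0, norm_radA a a0, norm_radA a a0, sq_abs, sq_abs]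
  ring

theorem inner_radA_sub (a : ℝ → ℝ) (a0 : a 0 = 0) (x y : E) :
    ⟪radA a x - radA a y, x - y⟫ = (a ‖x‖ - a ‖y‖) * (‖x‖ - ‖y‖)
      + (a ‖x‖ * ‖y‖ + a ‖y‖ * ‖x‖) * (1 - cosA x y) := by
  have hself : ∀ x : E, ⟪radA a x, x⟫ = a ‖x‖ * ‖x‖ := by
    intro x
    rw [radA, real_inner_smul_left, real_inner_self_eq_norm_sq]
    by_cases hx : ‖x‖ = 0
    · simp [hx]
    field_simp
  have hc : cosA y x = cosA x y := by simp [cosA, real_inner_comm, mul_comm]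
  simp only [inner_sub_left, inner_sub_right]
  rw [hself, hself, inner_radA_left a a0 x y, inner_radA_left a a0 y x, hc]
  ring

theorem radA_add_eps (a : ℝ → ℝ) (ε : ℝ) (x : E) :
    radA (fun t => a t + ε * t) x = radA a x + ε • x := by
  unfold radA
  by_cases hx : ‖x‖ = 0
  · simp [norm_eq_zero.1 hx]
  rw [← add_smul]
  congr 1
  field_simp

theorem radA_cocoer (a : ℝ → ℝ) (a0 : a 0 = 0) (hmono : MonotoneOn a (Ici 0)) (Λ : ℝ)
    (x y : E) (h : ‖y‖ ≤ ‖x‖) (aa : a ‖x‖ - a ‖y‖ ≤ Λ * (‖x‖ - ‖y‖)) (ab : a ‖y‖ ≤ Λ * ‖y‖ / 2) :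
    ‖radA a x - radA a y‖ ^ 2 ≤ Λ * ⟪radA a x - radA a y, x - y⟫ := by
  rw [normsq_radA_sub a a0, inner_radA_sub a a0]
  have hc := cosA_le_one x y
  have hy : 0 ≤ a ‖y‖ := a0 ▸ hmono (mem_Ici.2 le_rfl) (norm_nonneg y) (norm_nonneg y)
  have hx : a ‖y‖ ≤ a ‖x‖ := hmono (norm_nonneg y) (norm_nonneg x) h
  have hyn := norm_nonneg y
  have jp : 0 ≤ Λ * ‖y‖ := by linarith
  have gy : 0 ≤ Λ * ‖x‖ := by
    by_cases hy0 : ‖y‖ = 0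
    · rw [hy0] at aa hx hy; simp only [a0, sub_zero] at aa hx; linarith
    · have : 0 ≤ Λ := nonneg_of_mul_nonneg_left jp (lt_of_le_of_ne hyn (Ne.symm hy0))
      exact mul_nonneg this (norm_nonneg x)
  have ag : (a ‖x‖ - a ‖y‖) * (a ‖x‖ - a ‖y‖) ≤ (a ‖x‖ - a ‖y‖) * (Λ * (‖x‖ - ‖y‖)) :=
    mul_le_mul_of_nonneg_left aa (by linarith)
  have aq : a ‖x‖ * a ‖y‖ ≤ a ‖x‖ * (Λ * ‖y‖ / 2) := mul_le_mul_of_nonneg_left ab (by linarith)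
  have cf : 0 ≤ a ‖y‖ * (Λ * ‖x‖) := mul_nonneg hy gy
  have gf : 2 * a ‖x‖ * a ‖y‖ ≤ Λ * (a ‖x‖ * ‖y‖ + a ‖y‖ * ‖x‖) := by nlinarith
  have jj := mul_le_mul_of_nonneg_right gf (sub_nonneg.2 hc)
  nlinarith

variable {f a : ℝ → ℝ} {L M : ℝ}

theorem Prof.nonneg (hp : Prof f a L M) {t : ℝ} (ht : 0 ≤ t) : 0 ≤ a t :=
  hp.a0 ▸ hp.smono.monotoneOn (mem_Ici.2 le_rfl) ht ht

theorem Prof.le_lin (hp : Prof f a L M) {t : ℝ} (ht : 0 ≤ t) : a t ≤ L * t := by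
  have := hp.slope 0 t le_rfl ht
  simpa [hp.a0] using this

theorem Prof.norm_radA_le (hp : Prof f a L M) (x : E) : ‖radA a x‖ ≤ M := by
  rw [norm_radA a hp.a0, abs_of_nonneg (hp.nonneg (norm_nonneg x))]
  exact hp.leM _ (norm_nonneg x)

theorem Prof.le_frac (hp : Prof f a L M) {t : ℝ} (ht : 0 ≤ t) :
    a t ≤ 2 * (L + M) / (1 + t) * t := by
  have bc := hp.Lpos
  have ck := hp.Mpos
  rw [div_mul_eq_mul_div, le_div_iff₀ (by linarith)]
  have aa := hp.le_lin ht
  have ab := hp.leM t ht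
  have ad := hp.nonneg ht
  rcases le_total t 1 with h | h
  · nlinarith [mul_nonneg ck.le ht, mul_nonneg bc.le ht]
  · nlinarith [mul_nonneg ck.le ht, mul_nonneg bc.le ht]

theorem Prof.cocoer (hp : Prof f a L M) {ε : ℝ} (ba : 0 ≤ ε) (x y : E) :
    ‖radA (fun t => a t + ε * t) x - radA (fun t => a t + ε * t) y‖ ^ 2 ≤
      (4 * (L + M) / (1 + min ‖x‖ ‖y‖) + 2 * ε) *
        ⟪radA (fun t => a t + ε * t) x - radA (fun t => a t + ε * t) y, x - y⟫ := by
  wlog h : ‖y‖ ≤ ‖x‖ generalizing x y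
  · have := this y x (le_of_not_ge h)
    rw [min_comm, norm_sub_rev, ← neg_sub (radA _ y), ← neg_sub y x, inner_neg_neg]
    exact this
  have bc := hp.Lpos
  have ck := hp.Mpos
  rw [min_eq_right h]
  have hy := norm_nonneg y
  refine radA_cocoer _ (by simp [hp.a0]) ?_ _ x y h ?_ ?_
  · intro s hs t ht hst
    have := hp.smono.monotoneOn hs ht hst
    have := mul_le_mul_of_nonneg_left hst ba
    simp only; linarith
  · have aa := hp.slope ‖y‖ ‖x‖ hy h
    have ab : L / (1 + ‖y‖) * (‖x‖ - ‖y‖) ≤ 4 * (L + M) / (1 + ‖y‖) * (‖x‖ - ‖y‖) := by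
      have : 0 ≤ ‖x‖ - ‖y‖ := by linarith
      gcongr
      linarith
    have ad : 0 ≤ ε * (‖x‖ - ‖y‖) := mul_nonneg ba (by linarith)
    nlinarith
  · have aa := hp.le_frac hy
    have ab : 4 * (L + M) / (1 + ‖y‖) = 2 * (2 * (L + M) / (1 + ‖y‖)) := by ring
    rw [ab]
    nlinarith

theorem Prof.lip (hp : Prof f a L M) (x y : E) :
    ‖radA a x - radA a y‖ ≤ 4 * (L + M) * ‖x - y‖ := by
  have aa := hp.cocoer (E := E) le_rfl x y
  simp only [zero_mul, add_zero, mul_zero] at aa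
  have bc := hp.Lpos
  have ck := hp.Mpos
  have ab : 4 * (L + M) / (1 + min ‖x‖ ‖y‖) ≤ 4 * (L + M) :=
    div_le_self (by linarith) (by have : 0 ≤ min ‖x‖ ‖y‖ := by positivity
                                  linarith)
  have ae : 0 ≤ 4 * (L + M) / (1 + min ‖x‖ ‖y‖) := by positivity
  have ad := real_inner_le_norm (radA a x - radA a y) (x - y)
  have ai : ‖radA a x - radA a y‖ ^ 2 ≤ 4 * (L + M) * (‖radA a x - radA a y‖ * ‖x - y‖) :=
    aa.trans ((mul_le_mul_of_nonneg_left ad ae).trans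
      (mul_le_mul_of_nonneg_right ab (by positivity)))
  by_cases al : ‖radA a x - radA a y‖ = 0
  · rw [al]; positivity
  · have : 0 < ‖radA a x - radA a y‖ := lt_of_le_of_ne (norm_nonneg _) (Ne.symm al)
    nlinarith

theorem Prof.continuous_radA (hp : Prof f a L M) : Continuous (radA a : E → E) := by
  refine LipschitzWith.continuous (K := Real.toNNReal (4 * (L + M))) ?_
  refine LipschitzWith.of_dist_le' fun x y => ?_
  rw [dist_eq_norm, dist_eq_norm]
  exact hp.lip x y

theorem Prof.continuous_F (hp : Prof f a L M) : Continuous (fun x : E => f ‖x‖) :=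
  hp.fcont.comp_continuous continuous_norm fun x => norm_nonneg x

theorem Prof.breg_radA (hp : Prof f a L M) (x y : E) :
    (2 * L)⁻¹ * ‖radA a x - radA a y‖ ^ 2 ≤ f ‖x‖ - f ‖y‖ - ⟪radA a y, x - y⟫ := by
  have aa := hp.breg ‖x‖ ‖y‖ (norm_nonneg x) (norm_nonneg y)
  have hself : ⟪radA a y, y⟫ = a ‖y‖ * ‖y‖ := by
    rw [radA, real_inner_smul_left, real_inner_self_eq_norm_sq]
    by_cases hx : ‖y‖ = 0
    · simp [hx]
    field_simp
  have hc : cosA y x = cosA x y := by simp [cosA, real_inner_comm, mul_comm]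
  rw [normsq_radA_sub a hp.a0, inner_sub_right, hself, inner_radA_left a hp.a0, hc]
  have bc := hp.Lpos
  have ab : (2 * L)⁻¹ * (2 * a ‖x‖ * a ‖y‖ * (1 - cosA x y)) ≤ a ‖y‖ * ‖x‖ * (1 - cosA x y) := by
    have ad : (2 * L)⁻¹ * (2 * a ‖x‖ * a ‖y‖ * (1 - cosA x y))
      = (a ‖x‖ / L) * (a ‖y‖ * (1 - cosA x y)) := by field_simp
    have ai : a ‖x‖ / L ≤ ‖x‖ := by
      rw [div_le_iff₀ bc, mul_comm]; exact hp.le_lin (norm_nonneg x)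
    rw [ad]
    calc _ ≤ ‖x‖ * (a ‖y‖ * (1 - cosA x y)) := mul_le_mul_of_nonneg_right ai
          (mul_nonneg (hp.nonneg (norm_nonneg y)) (sub_nonneg.2 (cosA_le_one x y)))
      _ = _ := by ring
  have al : (2 * L)⁻¹ * (a ‖x‖ - a ‖y‖) ^ 2 = (a ‖x‖ - a ‖y‖) ^ 2 / (2 * L) := by ring
  rw [mul_add, al]
  nlinarith

theorem Prof.mid (hp : Prof f a L M) (x y : E) :
    (4 * L)⁻¹ * ‖radA a x - radA a y‖ ^ 2 ≤ f ‖x‖ + f ‖y‖ - 2 * f ‖(1/2 : ℝ) • (x + y)‖ := by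
  set w := (1/2 : ℝ) • (x + y)
  have aa := hp.breg_radA x w
  have ab := hp.breg_radA y w
  have ad : ⟪radA a w, x - w⟫ + ⟪radA a w, y - w⟫ = 0 := by
    rw [← inner_add_right]
    have : x - w + (y - w) = 0 := by simp only [w]; module
    rw [this, inner_zero_right]
  have ai : ‖radA a x - radA a y‖ ≤ ‖radA a x - radA a w‖ + ‖radA a y - radA a w‖ := by
    have := norm_sub_le (radA a x - radA a w) (radA a y - radA a w)
    rwa [sub_sub_sub_cancel_right] at this
  have bc := hp.Lpos
  have al : ‖radA a x - radA a y‖ ^ 2 ≤ 2 * (‖radA a x - radA a w‖ ^ 2 + ‖radA a y - radA a w‖ ^ 2) := by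
    have := norm_nonneg (radA a x - radA a y)
    nlinarith [sq_nonneg (‖radA a x - radA a w‖ - ‖radA a y - radA a w‖)]
  have da : (4 * L)⁻¹ = (2 * L)⁻¹ / 2 := by field_simp; norm_num
  have cy : 0 < (2 * L)⁻¹ := by positivity
  rw [da]
  nlinarith

theorem Prof.upper (hp : Prof f a L M) (x h : E) :
    f ‖x + h‖ ≤ f ‖x‖ + ⟪radA a x, h⟫ + ‖h‖ * min (2 * M) (4 * (L + M) * ‖h‖) := by
  have aa := hp.breg_radA x (x + h)
  have bc := hp.Lpos
  have ab : 0 ≤ (2 * L)⁻¹ * ‖radA a x - radA a (x + h)‖ ^ 2 := by positivity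
  have ad : x - (x + h) = - h := by abel
  rw [ad, inner_neg_right] at aa
  have ai : ⟪radA a (x + h), h⟫ = ⟪radA a x, h⟫ + ⟪radA a (x + h) - radA a x, h⟫ := by
    rw [inner_sub_left]; ring
  have al := real_inner_le_norm (radA a (x + h) - radA a x) h
  have da : ‖radA a (x + h) - radA a x‖ ≤ min (2 * M) (4 * (L + M) * ‖h‖) := by
    apply le_min
    · have := norm_sub_le (radA a (x + h)) (radA a x)
      have := hp.norm_radA_le (x + h)
      have := hp.norm_radA_le x
      linarith
    · simpa using hp.lip (x + h) x
  have cy := mul_le_mul_of_nonneg_right da (norm_nonneg h)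
  linarith

theorem Prof.lipF (hp : Prof f a L M) (x y : E) : |f ‖x‖ - f ‖y‖| ≤ M * ‖x - y‖ := by
  have key : ∀ x y : E, f ‖y‖ - f ‖x‖ ≤ M * ‖x - y‖ := by
    intro x y
    have aa := hp.breg_radA x y
    have bc := hp.Lpos
    have ab : 0 ≤ (2 * L)⁻¹ * ‖radA a x - radA a y‖ ^ 2 := by positivity
    have ad := abs_real_inner_le_norm (radA a y) (x - y)
    have ai := mul_le_mul_of_nonneg_right (hp.norm_radA_le y) (norm_nonneg (x - y))
    have := neg_abs_le (⟪radA a y, x - y⟫ : ℝ)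
    linarith
  rw [abs_le]
  have aa := key x y
  have ab := key y x
  rw [norm_sub_rev] at ab
  constructor <;> linarith

theorem Prof.inner_nonneg (hp : Prof f a L M) (x y : E) : 0 ≤ ⟪radA a x - radA a y, x - y⟫ := by
  have aa := hp.breg_radA x y
  have ab := hp.breg_radA y x
  have bc := hp.Lpos
  have ad : 0 ≤ (2 * L)⁻¹ * ‖radA a x - radA a y‖ ^ 2 := by positivity
  have ai : 0 ≤ (2 * L)⁻¹ * ‖radA a y - radA a x‖ ^ 2 := by positivity
  have al : ⟪radA a x, y - x⟫ = - ⟪radA a x, x - y⟫ := by rw [← inner_neg_right, neg_sub]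
  rw [al] at ab
  rw [inner_sub_left]
  linarith

theorem Prof.inj (hp : Prof f a L M) {x y : E} (h : radA a x = radA a y) : x = y := by
  have aa : a ‖x‖ = a ‖y‖ := by
    have := congrArg norm h
    rwa [norm_radA a hp.a0, norm_radA a hp.a0, abs_of_nonneg (hp.nonneg (norm_nonneg x)),
      abs_of_nonneg (hp.nonneg (norm_nonneg y))] at this
  have ab : ‖x‖ = ‖y‖ := hp.smono.injOn (norm_nonneg x) (norm_nonneg y) aa
  unfold radA at h
  rw [ab] at h
  by_cases hy : ‖y‖ = 0
  · rw [norm_eq_zero.1 hy]; rw [hy] at ab; exact norm_eq_zero.1 ab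
  have ad : a ‖y‖ ≠ 0 := by
    have := hp.smono (mem_Ici.2 le_rfl) (norm_nonneg y) (lt_of_le_of_ne (norm_nonneg y) (Ne.symm hy))
    rw [hp.a0] at this
    exact this.ne'
  exact smul_right_injective E (div_ne_zero ad hy) h

theorem Prof.inner_eq_zero (hp : Prof f a L M) {x y : E}
    (h : ⟪radA a x - radA a y, x - y⟫ = 0) : x = y := by
  have aa := hp.cocoer (E := E) le_rfl x y
  simp only [zero_mul, add_zero, mul_zero] at aa
  rw [h, mul_zero] at aa
  have ab : ‖radA a x - radA a y‖ = 0 := by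
    have := norm_nonneg (radA a x - radA a y)
    nlinarith
  exact hp.inj (sub_eq_zero.1 (norm_eq_zero.1 ab))

theorem Prof.tendsto_of (hp : Prof f a L M) [FiniteDimensional ℝ E] {z : ℕ → E} {y : E}
    (h : Tendsto (fun k => radA a (z k)) atTop (𝓝 (radA a y))) : Tendsto z atTop (𝓝 y) := by
  have hb : ∀ᶠ k in atTop, z k ∈ closedBall (0:E) (‖y‖ + 1) := by
    have aa : Tendsto (fun k => a ‖z k‖) atTop (𝓝 (a ‖y‖)) := by
      have := h.norm
      simpa only [norm_radA a hp.a0, abs_of_nonneg (hp.nonneg (norm_nonneg _))] using this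
    have ab : a ‖y‖ < a (‖y‖ + 1) :=
      hp.smono (norm_nonneg y) (by have := norm_nonneg y; simp only [mem_Ici]; linarith) (by linarith)
    filter_upwards [aa.eventually (eventually_lt_nhds ab)] with k hk
    have hy := norm_nonneg y
    have ad : ‖z k‖ < ‖y‖ + 1 := (hp.smono.lt_iff_lt (norm_nonneg (z k)) (mem_Ici.2 (by linarith))).1 hk
    simpa using ad.le
  refine (isCompact_closedBall (0:E) (‖y‖+1)).tendsto_nhds_of_unique_mapClusterPt hb ?_
  intro x _ hx
  have aa : MapClusterPt (radA a x) atTop (fun k => radA a (z k)) :=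
    hx.continuousAt_comp hp.continuous_radA.continuousAt
  have ab : radA a x = radA a y := by
    by_contra hne
    have hd := (disjoint_nhds_nhds.2 hne)
    have : (𝓝 (radA a x) ⊓ map (fun k => radA a (z k)) atTop).NeBot := aa
    exact this.ne (disjoint_iff.1 (hd.mono_right h))
  exact hp.inj ab

end Radial

section P3
set_option linter.unusedSectionVars false
variable {α : Type*} [MeasurableSpace α] {W Z : Type*}
  [NormedAddCommGroup W] [InnerProductSpace ℝ W]
  [NormedAddCommGroup Z] [InnerProductSpace ℝ Z]
  {μ ν : Measure α} {f a : ℝ → ℝ} {L M : ℝ} {T : α → Z} {τ ε : ℝ}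
  {S : Submodule ℝ ((α → W) × (α → Z))}

theorem iadd {V : Type*} [NormedAddCommGroup V] {u v : α → V} (hu : Integrable u μ) (hv : Integrable v μ) :
    Integrable (fun x => u x + v x) μ := hu.add hv
theorem isub {V : Type*} [NormedAddCommGroup V] {u v : α → V} (hu : Integrable u μ) (hv : Integrable v μ) :
    Integrable (fun x => u x - v x) μ := hu.sub hv

noncomputable def JJ (f : ℝ → ℝ) (μ ν : Measure α) (T : α → Z) (ε : ℝ)
    (p : (α → W) × (α → Z)) : ℝ :=
  ∫ x, (f ‖p.2 x‖ - ⟪T x, p.2 x⟫) ∂μ + ε / 2 * ∫ x, (‖p.2 x‖ ^ 2 + ‖p.1 x‖ ^ 2) ∂ν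

structure Adm (μ ν : Measure α) (S : Submodule ℝ ((α → W) × (α → Z))) : Prop where
  int : ∀ p ∈ S, Integrable p.2 μ
  l2w : ∀ p ∈ S, MemLp p.1 2 ν
  l2z : ∀ p ∈ S, MemLp p.2 2 ν

structure TOk (μ : Measure α) (T : α → Z) (τ : ℝ) : Prop where
  meas : AEStronglyMeasurable T μ
  bd : ∀ᵐ x ∂μ, ‖T x‖ ≤ τ

theorem Prof.intF (hp : Prof f a L M) {z : α → Z} (hz : Integrable z μ) :
    Integrable (fun x => f ‖z x‖) μ := by
  refine Integrable.mono' (g := fun x => M * ‖z x‖) (hz.norm.const_mul M)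
    (hp.continuous_F.comp_aestronglyMeasurable hz.1) ?_
  refine aoa fun x => ?_
  have := hp.lipF (z x) 0
  simpa [hp.f0] using this

theorem Prof.measA (hp : Prof f a L M) {z : α → Z} (hz : AEStronglyMeasurable z μ) :
    AEStronglyMeasurable (fun x => radA a (z x)) μ :=
  hp.continuous_radA.comp_aestronglyMeasurable hz

theorem int_inner_bd {T z : α → Z} {c : ℝ} (hT : AEStronglyMeasurable T μ)
    (hb : ∀ᵐ x ∂μ, ‖T x‖ ≤ c) (hz : Integrable z μ) : Integrable (fun x => ⟪T x, z x⟫) μ := by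
  refine Integrable.mono' (g := fun x => c * ‖z x‖) (hz.norm.const_mul c) (hT.inner hz.1) ?_
  filter_upwards [hb] with x hx
  calc ‖⟪T x, z x⟫‖ ≤ ‖T x‖ * ‖z x‖ := norm_inner_le_norm _ _
    _ ≤ c * ‖z x‖ := by gcongr

theorem Prof.intA (hp : Prof f a L M) {z y : α → Z} (hz : AEStronglyMeasurable z μ)
    (hy : Integrable y μ) : Integrable (fun x => ⟪radA a (z x), y x⟫) μ :=
  int_inner_bd (hp.measA hz) (aoa fun x => hp.norm_radA_le (z x)) hy

theorem sqint {z : α → Z} (hz : MemLp z 2 ν) : Integrable (fun x => ‖z x‖ ^ 2) ν :=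
  hz.integrable_norm_pow (by norm_num)

theorem int_inner_l2 {y z : α → Z} (hy : MemLp y 2 ν) (hz : MemLp z 2 ν) :
    Integrable (fun x => ⟪y x, z x⟫) ν := by
  refine Integrable.mono' (g := fun x => ‖y x‖ ^ 2 + ‖z x‖ ^ 2) ((sqint hy).add (sqint hz))
    (hy.1.inner hz.1) (aoa fun x => ?_)
  have := norm_inner_le_norm (𝕜 := ℝ) (y x) (z x)
  nlinarith [sq_nonneg (‖y x‖ - ‖z x‖), sq_nonneg (‖y x‖), sq_nonneg ‖z x‖]

theorem Prof.l2A [IsFiniteMeasure μ] (hp : Prof f a L M) {z : α → Z}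
    (hz : AEStronglyMeasurable z μ) : MemLp (fun x => radA a (z x)) 2 μ :=
  MemLp.of_bound (hp.measA hz) M (aoa fun x => hp.norm_radA_le (z x))

theorem JJ_coer [IsFiniteMeasure μ] (hp : Prof f a L M) (hT : TOk μ T τ) (bn : τ < M)
    (af : Adm μ ν S) : ∃ C c : ℝ, 0 < c ∧ ∀ ε, 0 ≤ ε → ∀ p ∈ S,
      c * ∫ x, ‖p.2 x‖ ∂μ ≤ JJ f μ ν T ε p + C := by
  obtain ⟨C, ar, h⟩ := hp.coer ((τ + M) / 2) (by linarith)
  refine ⟨∫ _, C ∂μ, (M - τ) / 2, by linarith, fun ε ba p hpS => ?_⟩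
  have aa := af.int p hpS
  have ab : 0 ≤ ε / 2 * ∫ x, (‖p.2 x‖ ^ 2 + ‖p.1 x‖ ^ 2) ∂ν :=
    mul_nonneg (by linarith) (integral_nonneg fun x => by positivity)
  unfold JJ
  rw [← integral_const_mul]
  have ad : ∫ x, (M - τ) / 2 * ‖p.2 x‖ ∂μ ≤ ∫ x, ((f ‖p.2 x‖ - ⟪T x, p.2 x⟫) + C) ∂μ := by
    refine integral_mono_ae (aa.norm.const_mul _)
      (iadd (isub (hp.intF aa) (int_inner_bd hT.meas hT.bd aa)) (integrable_const C)) ?_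
    filter_upwards [hT.bd] with x hx
    have ai := h ‖p.2 x‖ (norm_nonneg _)
    have al := real_inner_le_norm (T x) (p.2 x)
    have da : ‖T x‖ * ‖p.2 x‖ ≤ τ * ‖p.2 x‖ := by gcongr
    linarith
  rw [integral_add (isub (hp.intF aa) (int_inner_bd hT.meas hT.bd aa)) (integrable_const C)] at ad
  linarith

theorem JJ_mid [IsFiniteMeasure μ] (hp : Prof f a L M) (hT : TOk μ T τ)
    (af : Adm μ ν S) (m : ℝ) (hm : ∀ p ∈ S, m ≤ JJ f μ ν T ε p) {p q : (α → W) × (α → Z)}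
    (hpS : p ∈ S) (hqS : q ∈ S) :
    (4 * L)⁻¹ * ∫ x, ‖radA a (p.2 x) - radA a (q.2 x)‖ ^ 2 ∂μ
      + ε / 4 * ∫ x, (‖p.2 x - q.2 x‖ ^ 2 + ‖p.1 x - q.1 x‖ ^ 2) ∂ν
      ≤ JJ f μ ν T ε p + JJ f μ ν T ε q - 2 * m := by
  have hr : (1/2 : ℝ) • (p + q) ∈ S := S.smul_mem _ (S.add_mem hpS hqS)
  have ae := hm _ hr
  have ip := af.int p hpS
  have iq := af.int q hqS
  have ir := af.int _ hr
  have lp := af.l2z p hpS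
  have lq := af.l2z q hqS
  have lp1 := af.l2w p hpS
  have lq1 := af.l2w q hqS
  set r := (1/2 : ℝ) • (p + q) with hrdef
  have hr2 : ∀ x, r.2 x = (1/2 : ℝ) • (p.2 x + q.2 x) := fun x => rfl
  have hr1 : ∀ x, r.1 x = (1/2 : ℝ) • (p.1 x + q.1 x) := fun x => rfl
  have GI : ∀ z : α → Z, Integrable z μ → Integrable (fun x => f ‖z x‖ - ⟪T x, z x⟫) μ :=
    fun z hz => (hp.intF hz).sub (int_inner_bd hT.meas hT.bd hz)
  have ev : (4 * L)⁻¹ * ∫ x, ‖radA a (p.2 x) - radA a (q.2 x)‖ ^ 2 ∂μ ≤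
      ∫ x, (f ‖p.2 x‖ - ⟪T x, p.2 x⟫) ∂μ + ∫ x, (f ‖q.2 x‖ - ⟪T x, q.2 x⟫) ∂μ
        - 2 * ∫ x, (f ‖r.2 x‖ - ⟪T x, r.2 x⟫) ∂μ := by
    rw [← integral_const_mul, ← integral_const_mul, ← integral_add (GI _ ip) (GI _ iq),
      ← integral_sub (iadd (GI _ ip) (GI _ iq)) ((GI _ ir).const_mul 2)]
    refine integral_mono ?_ (isub (iadd (GI _ ip) (GI _ iq)) ((GI _ ir).const_mul 2)) fun x => ?_
    · exact (sqint ((hp.l2A ip.1).sub (hp.l2A iq.1))).const_mul _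
    · have := hp.mid (p.2 x) (q.2 x)
      simp only
      rw [hr2, inner_smul_right, inner_add_right]
      linarith
  have av : ε / 4 * ∫ x, (‖p.2 x - q.2 x‖ ^ 2 + ‖p.1 x - q.1 x‖ ^ 2) ∂ν =
      ε / 2 * ∫ x, (‖p.2 x‖ ^ 2 + ‖p.1 x‖ ^ 2) ∂ν + ε / 2 * ∫ x, (‖q.2 x‖ ^ 2 + ‖q.1 x‖ ^ 2) ∂ν
        - 2 * (ε / 2 * ∫ x, (‖r.2 x‖ ^ 2 + ‖r.1 x‖ ^ 2) ∂ν) := by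
    have e : ∀ x, ‖r.2 x‖ ^ 2 + ‖r.1 x‖ ^ 2 = (1/2) * (‖p.2 x‖ ^ 2 + ‖p.1 x‖ ^ 2)
        + (1/2) * (‖q.2 x‖ ^ 2 + ‖q.1 x‖ ^ 2)
        - (1/4) * (‖p.2 x - q.2 x‖ ^ 2 + ‖p.1 x - q.1 x‖ ^ 2) := by
      intro x
      rw [hr1, hr2, norm_smul, norm_smul, mul_pow, mul_pow, norm_add_sq_real, norm_add_sq_real,
        norm_sub_sq_real, norm_sub_sq_real]
      norm_num
      ring
    simp_rw [e]
    have bh : Integrable (fun x => ‖p.2 x‖ ^ 2 + ‖p.1 x‖ ^ 2) ν := (sqint lp).add (sqint lp1)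
    have bl : Integrable (fun x => ‖q.2 x‖ ^ 2 + ‖q.1 x‖ ^ 2) ν := (sqint lq).add (sqint lq1)
    have cv : Integrable (fun x => ‖p.2 x - q.2 x‖ ^ 2 + ‖p.1 x - q.1 x‖ ^ 2) ν :=
      (sqint (lp.sub lq)).add (sqint (lp1.sub lq1))
    rw [integral_sub (iadd (bh.const_mul _) (bl.const_mul _)) (cv.const_mul _),
      integral_add (bh.const_mul _) (bl.const_mul _), integral_const_mul, integral_const_mul,
      integral_const_mul]
    ring
  unfold JJ at *
  linarith

theorem JJ_var [IsFiniteMeasure μ] (hp : Prof f a L M) (hT : TOk μ T τ)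
    (af : Adm μ ν S) {p q : (α → W) × (α → Z)}
    (hpS : p ∈ S) (hqS : q ∈ S) {t : ℝ} (ht : 0 < t) :
    JJ f μ ν T ε (p + t • q) ≤ JJ f μ ν T ε p
      + t * (∫ x, ⟪radA a (p.2 x), q.2 x⟫ ∂μ - ∫ x, ⟪T x, q.2 x⟫ ∂μ
        + ε * ∫ x, (⟪p.2 x, q.2 x⟫ + ⟪p.1 x, q.1 x⟫) ∂ν)
      + t * ∫ x, ‖q.2 x‖ * min (2 * M) (4 * (L + M) * (t * ‖q.2 x‖)) ∂μ
      + ε / 2 * t ^ 2 * ∫ x, (‖q.2 x‖ ^ 2 + ‖q.1 x‖ ^ 2) ∂ν := by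
  have hr : p + t • q ∈ S := S.add_mem hpS (S.smul_mem _ hqS)
  have ip := af.int p hpS
  have iq := af.int q hqS
  have ir := af.int _ hr
  have lp := af.l2z p hpS
  have lq := af.l2z q hqS
  have lp1 := af.l2w p hpS
  have lq1 := af.l2w q hqS
  set r := p + t • q with hrdef
  have hr2 : ∀ x, r.2 x = p.2 x + t • q.2 x := fun x => rfl
  have hr1 : ∀ x, r.1 x = p.1 x + t • q.1 x := fun x => rfl
  have GI : ∀ z : α → Z, Integrable z μ → Integrable (fun x => f ‖z x‖ - ⟪T x, z x⟫) μ :=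
    fun z hz => (hp.intF hz).sub (int_inner_bd hT.meas hT.bd hz)
  have ck := hp.Mpos
  have bc := hp.Lpos
  have ie : Integrable (fun x => ‖q.2 x‖ * min (2 * M) (4 * (L + M) * (t * ‖q.2 x‖))) μ := by
    refine Integrable.mono' (g := fun x => (2 * M) * ‖q.2 x‖) (iq.norm.const_mul _) ?_ ?_
    · exact (Continuous.comp_aestronglyMeasurable
        (g := fun y : Z => ‖y‖ * min (2 * M) (4 * (L + M) * (t * ‖y‖))) (by fun_prop) iq.1)
    · refine aoa fun x => ?_
      rw [norm_of_nonneg (by positivity), mul_comm]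
      gcongr
      exact min_le_left _ _
  have ev : ∫ x, (f ‖r.2 x‖ - ⟪T x, r.2 x⟫) ∂μ ≤ ∫ x, (f ‖p.2 x‖ - ⟪T x, p.2 x⟫) ∂μ
      + t * (∫ x, ⟪radA a (p.2 x), q.2 x⟫ ∂μ - ∫ x, ⟪T x, q.2 x⟫ ∂μ)
      + t * ∫ x, ‖q.2 x‖ * min (2 * M) (4 * (L + M) * (t * ‖q.2 x‖)) ∂μ := by
    have cu := hp.intA ip.1 iq
    have de := int_inner_bd hT.meas hT.bd iq
    rw [← integral_sub cu de, ← integral_const_mul, ← integral_const_mul,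
      ← integral_add (GI _ ip) ((isub cu de).const_mul t),
      ← integral_add (iadd (GI _ ip) ((isub cu de).const_mul t)) (ie.const_mul t)]
    refine integral_mono (GI _ ir) (iadd (iadd (GI _ ip) ((isub cu de).const_mul t)) (ie.const_mul t))
      fun x => ?_
    have := hp.upper (p.2 x) (t • q.2 x)
    simp only
    rw [norm_smul, norm_of_nonneg ht.le, inner_smul_right] at this
    rw [hr2, inner_add_right, inner_smul_right]
    linarith
  have av : ε / 2 * ∫ x, (‖r.2 x‖ ^ 2 + ‖r.1 x‖ ^ 2) ∂ν =
      ε / 2 * ∫ x, (‖p.2 x‖ ^ 2 + ‖p.1 x‖ ^ 2) ∂ν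
      + t * (ε * ∫ x, (⟪p.2 x, q.2 x⟫ + ⟪p.1 x, q.1 x⟫) ∂ν)
      + ε / 2 * t ^ 2 * ∫ x, (‖q.2 x‖ ^ 2 + ‖q.1 x‖ ^ 2) ∂ν := by
    have e : ∀ x, ‖r.2 x‖ ^ 2 + ‖r.1 x‖ ^ 2 = (‖p.2 x‖ ^ 2 + ‖p.1 x‖ ^ 2)
        + (2 * t) * (⟪p.2 x, q.2 x⟫ + ⟪p.1 x, q.1 x⟫)
        + t ^ 2 * (‖q.2 x‖ ^ 2 + ‖q.1 x‖ ^ 2) := by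
      intro x
      rw [hr1, hr2, norm_add_sq_real, norm_add_sq_real, norm_smul, norm_smul, inner_smul_right,
        inner_smul_right, norm_of_nonneg ht.le]
      ring
    simp_rw [e]
    have bh : Integrable (fun x => ‖p.2 x‖ ^ 2 + ‖p.1 x‖ ^ 2) ν := (sqint lp).add (sqint lp1)
    have bl : Integrable (fun x => ‖q.2 x‖ ^ 2 + ‖q.1 x‖ ^ 2) ν := (sqint lq).add (sqint lq1)
    have cv : Integrable (fun x => ⟪p.2 x, q.2 x⟫ + ⟪p.1 x, q.1 x⟫) ν :=
      (int_inner_l2 lp lq).add (int_inner_l2 lp1 lq1)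
    rw [integral_add (iadd bh (cv.const_mul _)) (bl.const_mul _),
      integral_add bh (cv.const_mul _), integral_const_mul, integral_const_mul]
    ring
  unfold JJ at *
  linarith

theorem rem_tendsto {q : α → Z} (iq : Integrable q μ) {M L : ℝ} (ck : 0 < M) (bc : 0 < L) :
    Tendsto (fun t : ℝ => ∫ x, ‖q x‖ * min (2 * M) (4 * (L + M) * (t * ‖q x‖)) ∂μ)
      (𝓝[>] 0) (𝓝 0) := by
  have : (0:ℝ) = ∫ x, (0:ℝ) ∂μ := by simp
  conv => rhs; rw [this]
  refine tendsto_integral_filter_of_dominated_convergence (fun x => (2 * M) * ‖q x‖) ?_ ?_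
    (iq.norm.const_mul _) ?_
  · refine Eventually.of_forall fun t => ?_
    exact (Continuous.comp_aestronglyMeasurable
        (g := fun y : Z => ‖y‖ * min (2 * M) (4 * (L + M) * (t * ‖y‖))) (by fun_prop) iq.1)
  · filter_upwards [self_mem_nhdsWithin] with t ht
    refine aoa fun x => ?_
    have ht : 0 < t := ht
    rw [norm_of_nonneg (by positivity), mul_comm]
    gcongr
    exact min_le_left _ _
  · refine aoa fun x => ?_
    have : Continuous fun t : ℝ => ‖q x‖ * min (2 * M) (4 * (L + M) * (t * ‖q x‖)) := by fun_prop
    have h := (this.tendsto 0).mono_left (nhdsWithin_le_nhds (s := Ioi 0))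
    simpa [ck.le] using h

theorem l2lim [CompleteSpace Z] {u : ℕ → α → Z} (hu : ∀ k, MemLp (u k) 2 μ) (b : ℕ → ℝ)
    (hb : Tendsto b atTop (𝓝 0))
    (hub : ∀ k l, ∫ x, ‖u k x - u l x‖ ^ 2 ∂μ ≤ b k + b l) :
    ∃ v : α → Z, MemLp v 2 μ ∧ Tendsto (fun k => ∫ x, ‖u k x - v x‖ ^ 2 ∂μ) atTop (𝓝 0) ∧
      ∃ ns : ℕ → ℕ, StrictMono ns ∧ ∀ᵐ x ∂μ, Tendsto (fun k => u (ns k) x) atTop (𝓝 (v x)) := by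
  have key : ∀ {v w : α → Z} (hv : MemLp v 2 μ) (hw : MemLp w 2 μ),
      ‖hv.toLp v - hw.toLp w‖ ^ 2 = ∫ x, ‖v x - w x‖ ^ 2 ∂μ := by
    intro v w hv hw
    rw [← MemLp.toLp_sub, ← real_inner_self_eq_norm_sq, L2.inner_def]
    refine integral_congr_ae ?_
    filter_upwards [(hv.sub hw).coeFn_toLp] with x hx
    rw [hx, real_inner_self_eq_norm_sq]
    rfl
  have hc : CauchySeq fun k => (hu k).toLp (u k) := by
    rw [Metric.cauchySeq_iff']
    intro e he
    have : ∀ᶠ k in atTop, b k < e ^ 2 / 2 := hb.eventually (gt_mem_nhds (by positivity))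
    obtain ⟨ap, hk0⟩ := eventually_atTop.1 this
    refine ⟨ap, fun k hk => ?_⟩
    rw [dist_eq_norm]
    refine lt_of_pow_lt_pow_left₀ 2 he.le ?_
    rw [key]
    have aa := hub k ap
    have ab := hk0 k hk
    have ad := hk0 ap le_rfl
    linarith
  obtain ⟨v, hv⟩ := cauchySeq_tendsto_of_complete hc
  refine ⟨v, Lp.memLp v, ?_, ?_⟩
  · have aa := (tendsto_iff_norm_sub_tendsto_zero.1 hv).pow 2
    simp only [ne_eq, OfNat.ofNat_ne_zero, not_false_eq_true, zero_pow] at aa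
    refine aa.congr fun k => ?_
    rw [← key (hu k) (Lp.memLp v), Lp.toLp_coeFn]
  · have ab := tendstoInMeasure_of_tendsto_Lp hv
    obtain ⟨ns, hns, ad⟩ := ab.exists_seq_tendsto_ae
    refine ⟨ns, hns, ?_⟩
    have ai : ∀ᵐ x ∂μ, ∀ k, (hu k).toLp (u k) x = u k x :=
      ae_all_iff.2 fun k => (hu k).coeFn_toLp
    filter_upwards [ad, ai] with x hx hx4
    simpa only [hx4] using hx
end P3

section P4
set_option linter.unusedSectionVars false
variable {α : Type*} [MeasurableSpace α] {W Z : Type*}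
  [NormedAddCommGroup W] [InnerProductSpace ℝ W]
  [NormedAddCommGroup Z] [InnerProductSpace ℝ Z]
  {μ ν : Measure α} {f a : ℝ → ℝ} {L M : ℝ} {T : α → Z} {τ ε : ℝ}
  {S : Submodule ℝ ((α → W) × (α → Z))}

theorem exists_minseq [IsFiniteMeasure μ] (hp : Prof f a L M) (hT : TOk μ T τ) (bn : τ < M)
    (af : Adm μ ν S) (ba : 0 ≤ ε) : ∃ (m : ℝ) (p : ℕ → (α → W) × (α → Z)), (∀ k, p k ∈ S) ∧
      (∀ q ∈ S, m ≤ JJ f μ ν T ε q) ∧ (∀ k, JJ f μ ν T ε (p k) ≤ m + 1 / ((k:ℝ) + 1)) := by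
  obtain ⟨C, c, hc, h⟩ := JJ_coer hp hT bn af
  set I := (fun q => JJ f μ ν T ε q) '' (S : Set ((α → W) × (α → Z)))
  have hne : I.Nonempty := ⟨_, mem_image_of_mem _ S.zero_mem⟩
  have hbd : BddBelow I := by
    refine ⟨-C, ?_⟩
    rintro _ ⟨q, hq, rfl⟩
    have aa := h ε ba q hq
    have ab : 0 ≤ c * ∫ x, ‖q.2 x‖ ∂μ := mul_nonneg hc.le (integral_nonneg fun x => norm_nonneg _)
    simp only
    linarith
  have : ∀ k : ℕ, ∃ q ∈ S, JJ f μ ν T ε q < sInf I + 1 / ((k:ℝ) + 1) := by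
    intro k
    obtain ⟨_, ⟨q, hq, rfl⟩, ad⟩ := Real.lt_sInf_add_pos hne (ε := 1 / ((k:ℝ) + 1)) (by positivity)
    exact ⟨q, hq, ad⟩
  choose p hpS hp2 using this
  exact ⟨sInf I, p, hpS, fun q hq => csInf_le hbd (mem_image_of_mem _ hq), fun k => (hp2 k).le⟩

theorem euler_ineq [IsFiniteMeasure μ] (hp : Prof f a L M) (hT : TOk μ T τ)
    (af : Adm μ ν S) {m : ℝ} {p : ℕ → (α → W) × (α → Z)} (hpS : ∀ k, p k ∈ S)
    (hm : ∀ q ∈ S, m ≤ JJ f μ ν T ε q) (hlim : Tendsto (fun k => JJ f μ ν T ε (p k)) atTop (𝓝 m))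
    {σ : α → Z} (dd : ∀ᵐ x ∂μ, Tendsto (fun k => radA a ((p k).2 x)) atTop (𝓝 (σ x)))
    {q : (α → W) × (α → Z)} (hq : q ∈ S) {c : ℝ}
    (hc : Tendsto (fun k => ε * ∫ x, (⟪(p k).2 x, q.2 x⟫ + ⟪(p k).1 x, q.1 x⟫) ∂ν) atTop (𝓝 c)) :
    0 ≤ ∫ x, ⟪σ x, q.2 x⟫ ∂μ - ∫ x, ⟪T x, q.2 x⟫ ∂μ + c := by
  have iq := af.int q hq
  have aa : Tendsto (fun k => ∫ x, ⟪radA a ((p k).2 x), q.2 x⟫ ∂μ) atTop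
      (𝓝 (∫ x, ⟪σ x, q.2 x⟫ ∂μ)) := by
    refine tendsto_integral_of_dominated_convergence (fun x => M * ‖q.2 x‖)
      (fun k => (hp.intA (af.int _ (hpS k)).1 iq).1) (iq.norm.const_mul _) ?_ ?_
    · intro k
      refine aoa fun x => ?_
      calc _ ≤ ‖radA a ((p k).2 x)‖ * ‖q.2 x‖ := norm_inner_le_norm _ _
        _ ≤ _ := by gcongr; exact hp.norm_radA_le _
    · filter_upwards [dd] with x hx
      exact hx.inner tendsto_const_nhds
  set X := ∫ x, ⟪σ x, q.2 x⟫ ∂μ - ∫ x, ⟪T x, q.2 x⟫ ∂μ + c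
  set Y := ∫ x, (‖q.2 x‖ ^ 2 + ‖q.1 x‖ ^ 2) ∂ν
  have ab : ∀ t : ℝ, 0 < t → 0 ≤ X
      + ∫ x, ‖q.2 x‖ * min (2 * M) (4 * (L + M) * (t * ‖q.2 x‖)) ∂μ + ε / 2 * t * Y := by
    intro t ht
    have ad : ∀ k, m ≤ _ := fun k => (hm _ (S.add_mem (hpS k) (S.smul_mem t hq))).trans
      (JJ_var hp hT af (hpS k) hq ht)
    have ai := (((hlim.add (((aa.sub (tendsto_const_nhds (x := ∫ x, ⟪T x, q.2 x⟫ ∂μ))).add hc).const_mul t)).add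
      (tendsto_const_nhds (x := t * ∫ x, ‖q.2 x‖ * min (2 * M) (4 * (L + M) * (t * ‖q.2 x‖)) ∂μ))).add
      (tendsto_const_nhds (x := ε / 2 * t ^ 2 * Y)))
    have al := ge_of_tendsto' ai ad
    have da : 0 ≤ t * (X + ∫ x, ‖q.2 x‖ * min (2 * M) (4 * (L + M) * (t * ‖q.2 x‖)) ∂μ
      + ε / 2 * t * Y) := by
      have : t * (X + ∫ x, ‖q.2 x‖ * min (2 * M) (4 * (L + M) * (t * ‖q.2 x‖)) ∂μ
        + ε / 2 * t * Y) = t * X + t * ∫ x, ‖q.2 x‖ * min (2 * M) (4 * (L + M) * (t * ‖q.2 x‖)) ∂μ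
        + ε / 2 * t ^ 2 * Y := by ring
      rw [this]
      linarith
    exact (mul_nonneg_iff_of_pos_left ht).1 da
  have ad := (tendsto_const_nhds (x := X)).add (rem_tendsto iq hp.Mpos hp.Lpos)
  have ai : Tendsto (fun t : ℝ => ε / 2 * t * Y) (𝓝[>] 0) (𝓝 0) := by
    have : Continuous fun t : ℝ => ε / 2 * t * Y := by fun_prop
    simpa using (this.tendsto 0).mono_left (nhdsWithin_le_nhds (s := Ioi 0))
  have al := ad.add ai
  simp only [add_zero] at al
  refine ge_of_tendsto al ?_
  filter_upwards [self_mem_nhdsWithin] with t ht using ab t ht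

theorem euler_eq [IsFiniteMeasure μ] (hp : Prof f a L M) (hT : TOk μ T τ)
    (af : Adm μ ν S) {m : ℝ} {p : ℕ → (α → W) × (α → Z)} (hpS : ∀ k, p k ∈ S)
    (hm : ∀ q ∈ S, m ≤ JJ f μ ν T ε q) (hlim : Tendsto (fun k => JJ f μ ν T ε (p k)) atTop (𝓝 m))
    {σ : α → Z} (dd : ∀ᵐ x ∂μ, Tendsto (fun k => radA a ((p k).2 x)) atTop (𝓝 (σ x)))
    {q : (α → W) × (α → Z)} (hq : q ∈ S) {c : ℝ}
    (hc : Tendsto (fun k => ε * ∫ x, (⟪(p k).2 x, q.2 x⟫ + ⟪(p k).1 x, q.1 x⟫) ∂ν) atTop (𝓝 c)) :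
    ∫ x, ⟪σ x, q.2 x⟫ ∂μ - ∫ x, ⟪T x, q.2 x⟫ ∂μ + c = 0 := by
  refine le_antisymm ?_ (euler_ineq hp hT af hpS hm hlim dd hq hc)
  have := euler_ineq hp hT af hpS hm hlim dd (S.neg_mem hq) (c := -c) (by
    refine hc.neg.congr fun k => ?_
    simp only [Prod.snd_neg, Prod.fst_neg, Pi.neg_apply, inner_neg_right]
    rw [← mul_neg, ← integral_neg]
    congr 2
    ext x
    ring)
  simp only [Prod.snd_neg, Pi.neg_apply, inner_neg_right, integral_neg] at this
  linarith

theorem exists_limit [IsFiniteMeasure μ] [FiniteDimensional ℝ Z] (hp : Prof f a L M)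
    {z : ℕ → α → Z} (hz : ∀ k, Integrable (z k) μ) {C : ℝ} (ar : ∀ k, ∫ x, ‖z k x‖ ∂μ ≤ C)
    (b : ℕ → ℝ) (hb : Tendsto b atTop (𝓝 0))
    (hub : ∀ k l, ∫ x, ‖radA a (z k x) - radA a (z l x)‖ ^ 2 ∂μ ≤ b k + b l) :
    ∃ (g : α → Z) (ns : ℕ → ℕ), StrictMono ns ∧ Integrable g μ ∧ ∫ x, ‖g x‖ ∂μ ≤ C ∧
      ∀ᵐ x ∂μ, Tendsto (fun k => z (ns k) x) atTop (𝓝 (g x)) := by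
  have : CompleteSpace Z := FiniteDimensional.complete ℝ Z
  obtain ⟨σ, dd, -, ns, hns, hlim⟩ := l2lim (fun k => hp.l2A (hz k).1) b hb hub
  have jf : ∀ k, ∫⁻ x, ‖z (ns k) x‖ₑ ∂μ ≤ ofReal C := by
    intro k
    rw [← ofReal_integral_norm_eq_lintegral_enorm (hz _)]
    exact ofReal_le_ofReal (ar _)
  have hfat : ∫⁻ x, liminf (fun k => ‖z (ns k) x‖ₑ) atTop ∂μ ≤ ofReal C := by
    refine (lintegral_liminf_le' fun k => (hz _).1.enorm).trans ?_
    exact liminf_le_of_le (by isBoundedDefault) fun b hb => by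
      obtain ⟨k, hk⟩ := hb.exists
      exact hk.trans (jf k)
  have hfin : ∀ᵐ x ∂μ, liminf (fun k => ‖z (ns k) x‖ₑ) atTop < ∞ := by
    refine ae_lt_top' ?_ (hfat.trans_lt ofReal_lt_top).ne
    refine ⟨fun x => liminf (fun k => (hz (ns k)).1.enorm.mk _ x) atTop,
      Measurable.liminf fun k => (hz (ns k)).1.enorm.measurable_mk, ?_⟩
    have aa : ∀ᵐ x ∂μ, ∀ k, ‖z (ns k) x‖ₑ = (hz (ns k)).1.enorm.mk _ x :=
      ae_all_iff.2 fun k => (hz (ns k)).1.enorm.ae_eq_mk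
    filter_upwards [aa] with x hx
    simp only [hx]
  have hex : ∀ᵐ x ∂μ, ∃ y, Tendsto (fun k => z (ns k) x) atTop (𝓝 y) := by
    filter_upwards [hlim, hfin] with x hx hf
    obtain ⟨R, dg, iv⟩ := exists_between hf
    have hfr : ∃ᶠ k in atTop, ‖z (ns k) x‖ₑ < R := by
      refine Filter.frequently_lt_of_liminf_lt (by isBoundedDefault) dg
    have hfr2 : ∃ᶠ k in atTop, z (ns k) x ∈ closedBall (0:Z) R.toReal := by
      refine hfr.mono fun k hk => ?_
      rw [mem_closedBall_zero_iff, ← toReal_enorm]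
      exact ENNReal.toReal_mono iv.ne hk.le
    obtain ⟨y, -, φ, am, hy⟩ := (isCompact_closedBall (0:Z) R.toReal).tendsto_subseq' hfr2
    refine ⟨y, hp.tendsto_of ?_⟩
    have aa : Tendsto (fun k => radA a (z (ns (φ k)) x)) atTop (𝓝 (radA a y)) :=
      (hp.continuous_radA.tendsto y).comp hy
    have ab := tendsto_nhds_unique (hx.comp am.tendsto_atTop) aa
    rw [← ab]
    exact hx
  obtain ⟨g, hg, hlimg⟩ := exists_stronglyMeasurable_limit_of_tendsto_ae (fun k => (hz (ns k)).1) hex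
  have hgl : ∫⁻ x, ‖g x‖ₑ ∂μ ≤ ofReal C := by
    refine le_trans (lintegral_mono_ae ?_) hfat
    filter_upwards [hlimg] with x hx
    exact (((continuous_enorm.tendsto _).comp hx).liminf_eq).ge
  have hgi : Integrable g μ := ⟨hg.aestronglyMeasurable, hgl.trans_lt ofReal_lt_top⟩
  refine ⟨g, ns, hns, hgi, ?_, hlimg⟩
  have ae : 0 ≤ C := (integral_nonneg fun x => norm_nonneg _).trans (ar 0)
  rw [← ofReal_integral_norm_eq_lintegral_enorm hgi] at hgl
  exact (ENNReal.ofReal_le_ofReal_iff ae).1 hgl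

theorem min_pack [IsFiniteMeasure μ] [FiniteDimensional ℝ Z] (hp : Prof f a L M)
    (hT : TOk μ T τ) (bn : τ < M) (af : Adm μ ν S) (ba : 0 ≤ ε) {C c : ℝ} (hc : 0 < c)
    (hcoer : ∀ p ∈ S, c * ∫ x, ‖p.2 x‖ ∂μ ≤ JJ f μ ν T ε p + C) :
    ∃ (m : ℝ) (p : ℕ → (α → W) × (α → Z)) (g : α → Z), (∀ k, p k ∈ S) ∧
      (∀ q ∈ S, m ≤ JJ f μ ν T ε q) ∧ Tendsto (fun k => JJ f μ ν T ε (p k)) atTop (𝓝 m) ∧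
      (∀ k l, (4 * L)⁻¹ * ∫ x, ‖radA a ((p k).2 x) - radA a ((p l).2 x)‖ ^ 2 ∂μ
        + ε / 4 * ∫ x, (‖(p k).2 x - (p l).2 x‖ ^ 2 + ‖(p k).1 x - (p l).1 x‖ ^ 2) ∂ν
          ≤ 1 / ((k:ℝ) + 1) + 1 / ((l:ℝ) + 1)) ∧
      Integrable g μ ∧ ∫ x, ‖g x‖ ∂μ ≤ (1 + C) / c ∧
      ∀ᵐ x ∂μ, Tendsto (fun k => (p k).2 x) atTop (𝓝 (g x)) := by
  obtain ⟨m, p, hpS, hm, hlim⟩ := exists_minseq hp hT bn af ba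
  have bc := hp.Lpos
  have hmid : ∀ k l, (4 * L)⁻¹ * ∫ x, ‖radA a ((p k).2 x) - radA a ((p l).2 x)‖ ^ 2 ∂μ
        + ε / 4 * ∫ x, (‖(p k).2 x - (p l).2 x‖ ^ 2 + ‖(p k).1 x - (p l).1 x‖ ^ 2) ∂ν
          ≤ 1 / ((k:ℝ) + 1) + 1 / ((l:ℝ) + 1) := by
    intro k l
    have := JJ_mid hp hT af m hm (hpS k) (hpS l)
    linarith [hlim k, hlim l]
  have hb0 : Tendsto (fun k : ℕ => 1 / ((k:ℝ) + 1)) atTop (𝓝 0) := tendsto_one_div_add_atTop_nhds_zero_nat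
  have hle1 : ∀ k : ℕ, 1 / ((k:ℝ) + 1) ≤ 1 := fun k => by
    rw [div_le_one (by positivity)]; linarith [(Nat.cast_nonneg k : (0:ℝ) ≤ k)]
  have hm0 : m ≤ 0 := by
    have := hm 0 S.zero_mem
    simpa [JJ, hp.f0] using this
  obtain ⟨g, ns, hns, hg, hgC, hgl⟩ := exists_limit hp (fun k => af.int _ (hpS k)) (C := (1 + C) / c)
    (fun k => by
      rw [le_div_iff₀ hc, mul_comm]
      refine (hcoer _ (hpS k)).trans ?_
      linarith [hlim k, hle1 k]) (fun k => 4 * L * (1 / ((k:ℝ) + 1))) (by simpa using hb0.const_mul (4 * L))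
    (fun k l => by
      have aa := hmid k l
      have ab : 0 ≤ ε / 4 * ∫ x, (‖(p k).2 x - (p l).2 x‖ ^ 2 + ‖(p k).1 x - (p l).1 x‖ ^ 2) ∂ν :=
        mul_nonneg (by linarith) (integral_nonneg fun x => by positivity)
      rw [← mul_add, ← div_le_iff₀' (by positivity), div_eq_inv_mul]
      linarith)
  have hmono : ∀ k, 1 / ((ns k : ℝ) + 1) ≤ 1 / ((k:ℝ) + 1) := fun k => by
    have : (k:ℝ) ≤ ns k := by exact_mod_cast hns.id_le k
    gcongr
  refine ⟨m, fun k => p (ns k), g, fun k => hpS _, hm, ?_, fun k l => (hmid _ _).trans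
    (add_le_add (hmono k) (hmono l)), hg, hgC, hgl⟩
  refine tendsto_of_tendsto_of_tendsto_of_le_of_le tendsto_const_nhds
    (by simpa using (tendsto_const_nhds (x := m)).add hb0) (fun k => hm _ (hpS _)) fun k => ?_
  exact (hlim _).trans (by simpa using hmono k)

theorem compare_limits [IsFiniteMeasure μ] (hp : Prof f a L M)
    (hT : TOk μ T τ) (af : Adm μ (0 : Measure α) S) {m ed : ℝ}
    (hm : ∀ q ∈ S, m ≤ JJ f μ 0 T 0 q) {p cg : ℕ → (α → W) × (α → Z)} (hpS : ∀ k, p k ∈ S)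
    (hpS' : ∀ k, cg k ∈ S) {g fg : α → Z}
    (hlim : Tendsto (fun k => JJ f μ 0 T 0 (p k)) atTop (𝓝 m))
    (ba : 0 ≤ ε) (hlim' : Tendsto (fun k => JJ f μ ν T ε (cg k)) atTop (𝓝 ed))
    (hg : ∀ᵐ x ∂μ, Tendsto (fun k => (p k).2 x) atTop (𝓝 (g x)))
    (hg' : ∀ᵐ x ∂μ, Tendsto (fun k => (cg k).2 x) atTop (𝓝 (fg x))) :
    (4 * L)⁻¹ * ∫ x, ‖radA a (fg x) - radA a (g x)‖ ^ 2 ∂μ ≤ ed - m := by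
  have aa : ∀ k, (4 * L)⁻¹ * ∫ x, ‖radA a ((cg k).2 x) - radA a ((p k).2 x)‖ ^ 2 ∂μ ≤
      JJ f μ ν T ε (cg k) + JJ f μ 0 T 0 (p k) - 2 * m := by
    intro k
    have := JJ_mid hp hT af m hm (hpS' k) (hpS k)
    have ab : JJ f μ 0 T 0 (cg k) ≤ JJ f μ ν T ε (cg k) := by
      unfold JJ
      have : 0 ≤ ε / 2 * ∫ x, (‖(cg k).2 x‖ ^ 2 + ‖(cg k).1 x‖ ^ 2) ∂ν :=
        mul_nonneg (by linarith) (integral_nonneg fun x => by positivity)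
      simp only [zero_div, zero_mul, add_zero]
      linarith
    simp only [zero_div, zero_mul, add_zero] at this
    linarith
  have ab : Tendsto (fun k => ∫ x, ‖radA a ((cg k).2 x) - radA a ((p k).2 x)‖ ^ 2 ∂μ) atTop
      (𝓝 (∫ x, ‖radA a (fg x) - radA a (g x)‖ ^ 2 ∂μ)) := by
    refine tendsto_integral_of_dominated_convergence (fun _ => (2 * M) ^ 2) (fun k => ?_)
      (integrable_const _) (fun k => aoa fun x => ?_) ?_
    · exact (sqint ((hp.l2A (af.int _ (hpS' k)).1).sub (hp.l2A (af.int _ (hpS k)).1))).1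
    · rw [norm_of_nonneg (by positivity)]
      gcongr
      have aa := hp.norm_radA_le ((cg k).2 x)
      have ab := hp.norm_radA_le ((p k).2 x)
      have := norm_sub_le (radA a ((cg k).2 x)) (radA a ((p k).2 x))
      linarith
    · filter_upwards [hg, hg'] with x hx hx'
      exact ((((hp.continuous_radA.tendsto _).comp hx').sub
        ((hp.continuous_radA.tendsto _).comp hx)).norm).pow 2
  have ad := (ab.const_mul (4 * L)⁻¹)
  have ai := (hlim'.add hlim).sub_const (2 * m)
  have al := le_of_tendsto_of_tendsto' ad ai aa
  linarith
end P4

set_option linter.unusedSectionVars false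

section moll

def WD (Ω : Set Ev) (i : Fin n) (u v : Ev → ℝ) : Prop :=
  ∀ φ : Ev → ℝ, ContDiff ℝ 1 φ → HasCompactSupport φ → tsupport φ ⊆ Ω →
    ∫ x, u x * fderiv ℝ φ x (single i 1) = - ∫ x, v x * φ x

theorem trans_cont {p : ℝ≥0∞} [Fact (1 ≤ p)] [hp : Fact (p ≠ ∞)] {u : Ev → ℝ}
    (hu : MemLp u p volume) :
    Tendsto (fun h : Ev => eLpNorm (fun x => u (x + h) - u x) p volume) (𝓝 0) (𝓝 0) := by
  have aa : Continuous (fun h : Ev => (DomAddAct.mk h) +ᵥ (hu.toLp u)) := by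
    have : Continuous (fun h : Ev => (DomAddAct.mk h)) := DomAddAct.continuous_mk
    exact this.vadd continuous_const
  have ab : Tendsto (fun h : Ev => edist ((DomAddAct.mk h) +ᵥ (hu.toLp u)) (hu.toLp u))
      (𝓝 0) (𝓝 0) := by
    have := (aa.edist (continuous_const (y := hu.toLp u))).tendsto 0
    simpa using this
  refine ab.congr fun h => ?_
  rw [DomAddAct.mk_vadd_toLp, Lp.edist_toLp_toLp]
  congr 1
  ext x
  simp [vadd_eq_add, add_comm]

theorem trans_L1 {u : Ev → ℝ} (hu : Integrable u) :
    Tendsto (fun h : Ev => ∫ x, ‖u (x + h) - u x‖) (𝓝 0) (𝓝 0) := by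
  haveI : Fact ((1:ℝ≥0∞) ≠ ∞) := ⟨by simp⟩
  have := trans_cont (memLp_one_iff_integrable.2 hu)
  have ad := (ENNReal.continuousAt_toReal (by simp : (0:ℝ≥0∞) ≠ ∞)).tendsto.comp this
  refine (by simpa using ad : Tendsto _ _ (𝓝 (0:ℝ))).congr fun h => ?_
  simp only [Function.comp]
  rw [eLpNorm_one_eq_lintegral_enorm, ← ofReal_integral_norm_eq_lintegral_enorm,
    ENNReal.toReal_ofReal (integral_nonneg fun _ => norm_nonneg _)]
  exact (hu.comp_add_right h).sub hu

theorem trans_L2 {u : Ev → ℝ} (hu : MemLp u 2 volume) :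
    Tendsto (fun h : Ev => ∫ x, (u (x + h) - u x) ^ 2) (𝓝 0) (𝓝 0) := by
  haveI : Fact ((2:ℝ≥0∞) ≠ ∞) := ⟨by simp⟩
  have := trans_cont hu
  have ad := (ENNReal.continuousAt_toReal (by simp : (0:ℝ≥0∞) ≠ ∞)).tendsto.comp this
  have ai := ad.pow 2
  refine (by simpa using ai : Tendsto _ _ (𝓝 (0:ℝ))).congr fun h => ?_
  have hm : MemLp (fun x => u (x + h) - u x) 2 volume :=
    (hu.comp_measurePreserving (measurePreserving_add_right volume h)).sub hu
  rw [hm.eLpNorm_eq_integral_rpow_norm (by simp) (by simp),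
    ENNReal.toReal_ofReal (by positivity)]
  rw [← Real.rpow_natCast, ← Real.rpow_mul (integral_nonneg fun _ => by positivity)]
  norm_num

noncomputable def bmp (n k : ℕ) : ContDiffBump (0 : EVec n) where
  rIn := 1 / (2 * ((k:ℝ) + 1))
  rOut := 1 / ((k:ℝ) + 1)
  rIn_pos := by positivity
  rIn_lt_rOut := by
    apply one_div_lt_one_div_of_lt <;> nlinarith [(Nat.cast_nonneg k : (0:ℝ) ≤ k)]

noncomputable def rho (k : ℕ) : Ev → ℝ := (bmp n k).normed volume

theorem rho_nonneg (k : ℕ) (x : Ev) : 0 ≤ rho k x := (bmp n k).nonneg_normed x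
theorem rho_smooth (k : ℕ) {m : ℕ∞} : ContDiff ℝ m (rho k : Ev → ℝ) := (bmp n k).contDiff_normed
theorem rho_int (k : ℕ) : Integrable (rho k : Ev → ℝ) := (bmp n k).integrable_normed
theorem rho_one (k : ℕ) : ∫ x, (rho k : Ev → ℝ) x = 1 := (bmp n k).integral_normed
theorem rho_cpt (k : ℕ) : HasCompactSupport (rho k : Ev → ℝ) := (bmp n k).hasCompactSupport_normed
theorem rho_ts (k : ℕ) : tsupport (rho k : Ev → ℝ) = closedBall 0 (1 / ((k:ℝ) + 1)) :=
  (bmp n k).tsupport_normed_eq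
theorem rho_zero (k : ℕ) {x : Ev} (hx : 1 / ((k:ℝ)+1) < ‖x‖) : rho k x = 0 := by
  have : x ∉ tsupport (rho k : Ev → ℝ) := by
    rw [rho_ts]; simpa using hx
  exact image_eq_zero_of_notMem_tsupport this

noncomputable def moll (k : ℕ) (u : Ev → ℝ) (x : Ev) : ℝ := ∫ t, u t * rho k (x - t)

theorem moll_conv (k : ℕ) (u : Ev → ℝ) :
    moll k u = convolution u (rho k) (ContinuousLinearMap.lsmul ℝ ℝ) volume := by
  ext x; simp [moll, convolution]

theorem moll_eq (k : ℕ) (u : Ev → ℝ) (x : Ev) : moll k u x = ∫ y, rho k y * u (x - y) := by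
  rw [moll, ← integral_sub_left_eq_self _ volume x]
  simp [mul_comm]

theorem moll_smooth (k : ℕ) {u : Ev → ℝ} (hu : LocallyIntegrable u) {m : ℕ∞} :
    ContDiff ℝ m (moll k u) := by
  rw [moll_conv]
  exact (rho_cpt k).contDiff_convolution_right _ hu (rho_smooth k)

theorem moll_int (k : ℕ) {u : Ev → ℝ} (hu : Integrable u) : Integrable (moll k u) := by
  rw [moll_conv]; exact hu.integrable_convolution _ (rho_int k)

theorem moll_pd (k : ℕ) {u : Ev → ℝ} (hu : LocallyIntegrable u) (x : Ev) : ∃ ψ : Ev → ℝ,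
    ContDiff ℝ 1 ψ ∧ HasCompactSupport ψ ∧ tsupport ψ ⊆ closedBall x (1/((k:ℝ)+1)) ∧
    (∀ v, moll k v x = ∫ t, v t * ψ t) ∧ ∀ i : Fin n,
    ψ = (fun t => rho k (x - t)) ∧
    fderiv ℝ (moll k u) x (single i 1) = - ∫ t, u t * fderiv ℝ ψ t (single i 1) := by
  have aa := (rho_cpt k).hasFDerivAt_convolution_right (ContinuousLinearMap.lsmul ℝ ℝ) hu
    (rho_smooth k (m := 1)) x
  rw [moll_conv, aa.fderiv]
  have hd : ∀ y, HasFDerivAt (fun t => rho k (x - t)) (-(fderiv ℝ (rho k) (x - y))) y := fun y => by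
    have ha : HasFDerivAt (rho k) (fderiv ℝ (rho k) (x - y)) (x - y) :=
      ((rho_smooth k (m := 1)).differentiable (by simp)).differentiableAt.hasFDerivAt
    have := ha.comp y ((hasFDerivAt_const x y).sub (hasFDerivAt_id y))
    have ae : -(fderiv ℝ (rho k) (x - y)) = (fderiv ℝ (rho k) (x - y)).comp (0 - ContinuousLinearMap.id ℝ Ev) := by
      ext; simp
    rw [ae]; exact this
  have hs : tsupport (fun t => rho k (x - t)) ⊆ closedBall x (1/((k:ℝ)+1)) := by
    apply closure_minimal _ Metric.isClosed_closedBall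
    intro t ht
    by_contra hc
    apply ht
    apply rho_zero
    simpa [dist_eq_norm, norm_sub_rev] using hc
  refine ⟨fun t => rho k (x - t), (rho_smooth k (m := 1)).comp (contDiff_const.sub contDiff_id),
    HasCompactSupport.of_support_subset_isCompact (isCompact_closedBall x (1/((k:ℝ)+1)))
      ((subset_tsupport _).trans hs), hs, fun v => rfl, fun i => ⟨rfl, ?_⟩⟩
  simp only [fun y => (hd y).fderiv]
  rw [convolution, ContinuousLinearMap.integral_apply]
  · simp only [neg_apply, mul_neg, integral_neg, neg_neg]
    simp [ContinuousLinearMap.precompR]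
  · exact ((rho_cpt k).fderiv ℝ).convolutionExists_right _ hu
      ((rho_smooth k (m := 1)).continuous_fderiv (by simp)) x

theorem moll_fderiv (k : ℕ) {u v : Ev → ℝ} (hu : LocallyIntegrable u) {Ω : Set Ev}
    {i : Fin n} (h : WD Ω i u v) {x : Ev} (hx : closedBall x (1/((k:ℝ)+1)) ⊆ Ω) :
    fderiv ℝ (moll k u) x (single i 1) = moll k v x := by
  obtain ⟨ψ, aa, ab, ad, ai, al⟩ := moll_pd k hu x
  rw [(al i).2, ai, h ψ aa ab (ad.trans hx), neg_neg]

theorem moll_L1_le (k : ℕ) {u : EVec n → ℝ} (hu : Integrable u) {c : ℝ}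
    (hc : ∀ y : EVec n, ‖y‖ ≤ 1 / ((k:ℝ)+1) → ∫ x, ‖u (x - y) - u x‖ ≤ c) :
    ∫ x, ‖moll k u x - u x‖ ≤ c := by
  have bj : Integrable (fun p : EVec n × EVec n => rho k p.2 * (u (p.1 - p.2) - u p.1))
      (volume.prod volume) := by
    have aa := (rho_int k).convolution_integrand (ContinuousLinearMap.lsmul ℝ ℝ) hu
    have ab := (hu.mul_prod (rho_int (n := n) k))
    refine (aa.sub ab).congr (Eventually.of_forall fun p => ?_)
    simp; ring
  have hp : ∀ᵐ x, ‖moll k u x - u x‖ ≤ ∫ y, ‖rho k y * (u (x - y) - u x)‖ := by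
    have aa := (rho_int (n := n) k).convolution_integrand (ContinuousLinearMap.lsmul ℝ ℝ) hu
    filter_upwards [aa.prod_right_ae] with x hx
    have : moll k u x - u x = ∫ y, rho k y * (u (x - y) - u x) := by
      simp only [mul_sub]
      rw [integral_sub (by simpa using hx) ((rho_int k).mul_const _), integral_mul_const, rho_one, moll_eq]; simp
    rw [this]; exact norm_integral_le_integral_norm _
  calc ∫ x, ‖moll k u x - u x‖ ≤ ∫ x, ∫ y, ‖rho k y * (u (x - y) - u x)‖ :=
        integral_mono_ae ((moll_int k hu).sub hu).norm bj.norm.integral_prod_left hp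
    _ = ∫ y, ∫ x, ‖rho k y * (u (x - y) - u x)‖ := integral_integral_swap bj.norm
    _ ≤ ∫ y, rho k y * c := by
        refine integral_mono bj.norm.integral_prod_right ((rho_int k).mul_const c) fun y => ?_
        simp only [norm_mul, integral_const_mul, norm_of_nonneg (rho_nonneg k y)]
        rcases le_or_gt ‖y‖ (1 / ((k:ℝ)+1)) with h | h
        · exact mul_le_mul_of_nonneg_left (hc y h) (rho_nonneg k y)
        · simp [rho_zero k h]
    _ = c := by rw [integral_mul_const, rho_one, one_mul]

theorem moll_L1 {u : Ev → ℝ} (hu : Integrable u) :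
    Tendsto (fun k : ℕ => ∫ x, ‖moll k u x - u x‖) atTop (𝓝 0) := by
  rw [Metric.tendsto_atTop]
  intro ε ba
  obtain ⟨δ, ah, h⟩ := Metric.tendsto_nhds_nhds.1 (trans_L1 hu) (ε/2) (by positivity)
  obtain ⟨K, ay⟩ := exists_nat_one_div_lt ah
  refine ⟨K, fun k hk => ?_⟩
  have : ∫ x, ‖moll k u x - u x‖ ≤ ε/2 := by
    apply moll_L1_le k hu
    intro y hy
    have aa : 1 / ((k:ℝ)+1) ≤ 1/((K:ℝ)+1) := by
      apply one_div_le_one_div_of_le (by positivity); gcongr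
    have := h (x := -y) (by rw [dist_zero_right, norm_neg]; linarith)
    rw [dist_zero_right, norm_of_nonneg (integral_nonneg fun _ => norm_nonneg _)] at this
    simpa [sub_eq_add_neg] using this.le
  rw [dist_zero_right, norm_of_nonneg (integral_nonneg fun _ => norm_nonneg _)]
  linarith

end moll

section trunc
variable {E : Type*} [NormedAddCommGroup E] [InnerProductSpace ℝ E] [FiniteDimensional ℝ E]

noncomputable def gT (δ t : ℝ) : ℝ := 1 - smoothTransition (δ * (log (1 + t) - log 2))
noncomputable def gT' (δ t : ℝ) : ℝ :=
  -(deriv smoothTransition (δ * (log (1 + t) - log 2)) * (δ * (1 + t)⁻¹))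
noncomputable def HH (δ : ℝ) (z : E) : E := gT δ (‖z‖ ^ 2) • z

theorem gT_nonneg (δ t : ℝ) : 0 ≤ gT δ t := by
  have := Real.smoothTransition.le_one (δ * (log (1 + t) - log 2)); simp only [gT]; linarith
theorem gT_le (δ t : ℝ) : gT δ t ≤ 1 := by
  have := Real.smoothTransition.nonneg (δ * (log (1 + t) - log 2)); simp only [gT]; linarith

theorem HH_norm_le (δ : ℝ) (z : E) : ‖HH δ z‖ ≤ ‖z‖ := by
  rw [HH, norm_smul, norm_of_nonneg (gT_nonneg _ _)]
  exact mul_le_of_le_one_left (norm_nonneg _) (gT_le _ _)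

theorem HH_tendsto (z : E) : Tendsto (fun δ => HH δ z) (𝓝 0) (𝓝 z) := by
  have : Continuous (fun δ => HH δ z) := by
    unfold HH gT
    refine Continuous.smul (continuous_const.sub (Real.smoothTransition.continuous.comp ?_)) continuous_const
    fun_prop
  have := this.tendsto 0
  simpa [HH, gT] using this

theorem gT_hasDeriv {δ t : ℝ} (ht : 0 ≤ t) : HasDerivAt (gT δ) (gT' δ t) t := by
  have aa : HasDerivAt (fun t : ℝ => δ * (log (1 + t) - log 2)) (δ * (1 + t)⁻¹) t := by
    have := (((hasDerivAt_id t).const_add 1).log (by simp; linarith)).sub_const (log 2)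
    simpa [one_div] using this.const_mul δ
  have ab : HasDerivAt smoothTransition (deriv smoothTransition (δ * (log (1 + t) - log 2)))
      (δ * (log (1 + t) - log 2)) :=
    ((Real.smoothTransition.contDiff (n := 1)).differentiable (by simp)).differentiableAt.hasDerivAt
  exact (ab.comp t aa).const_sub 1

theorem HH_contDiff (δ : ℝ) : ContDiff ℝ 2 (HH δ : E → E) := by
  unfold HH gT
  refine ContDiff.smul (contDiff_const.sub ((Real.smoothTransition.contDiff (n := 2)).comp ?_)) contDiff_id
  refine contDiff_const.mul (ContDiff.sub (ContDiff.log (contDiff_const.add (contDiff_norm_sq ℝ)) ?_) contDiff_const)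
  intro x; positivity

theorem HH_zero {δ : ℝ} (ah : 0 < δ) {z : E} (hz : 1 + 2 * Real.exp (1/δ) < ‖z‖) : HH δ z = 0 := by
  have ae : 0 < Real.exp (1/δ) := Real.exp_pos _
  have aa : log 2 + 1/δ ≤ log (1 + ‖z‖^2) := by
    rw [Real.le_log_iff_exp_le (by positivity), Real.exp_add, Real.exp_log (by norm_num)]
    nlinarith
  have ab : 1 ≤ δ * (log (1 + ‖z‖^2) - log 2) := by
    have : δ * (1/δ) ≤ δ * (log (1 + ‖z‖^2) - log 2) := by gcongr; linarith
    rwa [mul_one_div_cancel ah.ne'] at this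
  simp [HH, gT, Real.smoothTransition.one_of_one_le ab]

theorem HH_cpt {δ : ℝ} (ah : 0 < δ) : HasCompactSupport (HH δ : E → E) := by
  refine HasCompactSupport.of_support_subset_isCompact
    (isCompact_closedBall (0:E) (1 + 2 * Real.exp (1/δ))) fun z hz => ?_
  by_contra hc
  exact hz (HH_zero ah (by simpa using hc))

theorem sT_deriv_bdd : ∃ C, 0 < C ∧ ∀ t, |deriv smoothTransition t| ≤ C := by
  have hc : Continuous (deriv smoothTransition) :=
    (Real.smoothTransition.contDiff (n := 1)).continuous_deriv (by simp)
  have ae : ∀ t, t ∉ Icc (0:ℝ) 1 → deriv smoothTransition t = 0 := by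
    intro t ht
    rcases lt_or_ge t 0 with h | h
    · have : smoothTransition =ᶠ[𝓝 t] fun _ => 0 := by
        filter_upwards [Iio_mem_nhds h] with s hs using Real.smoothTransition.zero_of_nonpos (le_of_lt hs)
      simp [this.deriv_eq]
    · have aa : 1 < t := by by_contra ab; exact ht ⟨h, not_lt.1 ab⟩
      have : smoothTransition =ᶠ[𝓝 t] fun _ => 1 := by
        filter_upwards [Ioi_mem_nhds aa] with s hs using Real.smoothTransition.one_of_one_le (le_of_lt hs)
      simp [this.deriv_eq]
  obtain ⟨C, ar⟩ := (isCompact_Icc (a := (0:ℝ)) (b := 1)).exists_bound_of_continuousOn hc.continuousOn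
  refine ⟨|C| + 1, by positivity, fun t => ?_⟩
  by_cases ht : t ∈ Icc (0:ℝ) 1
  · exact (ar t ht).trans (by linarith [le_abs_self C])
  · rw [ae t ht]; simp; positivity

theorem gT'_zero {δ t : ℝ} (ah : 0 < δ) (ht : 0 ≤ t) (h : t < 1) : gT' δ t = 0 := by
  have aa : δ * (log (1 + t) - log 2) < 0 := by
    apply mul_neg_of_pos_of_neg ah
    have := Real.log_lt_log (by linarith) (by linarith : 1 + t < 2); linarith
  have : smoothTransition =ᶠ[𝓝 (δ * (log (1 + t) - log 2))] fun _ => 0 := by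
    filter_upwards [Iio_mem_nhds aa] with s hs using Real.smoothTransition.zero_of_nonpos (le_of_lt hs)
  simp [gT', this.deriv_eq]

theorem HH_hasFDeriv (δ : ℝ) (y : E) : HasFDerivAt (HH δ) (gT δ (‖y‖^2) • ContinuousLinearMap.id ℝ E +
        (gT' δ (‖y‖^2) • (2 • innerSL ℝ y)).smulRight y) y := by
  have aa : HasFDerivAt (fun y : E => gT δ (‖y‖^2)) (gT' δ (‖y‖^2) • (2 • innerSL ℝ y)) y :=
    HasDerivAt.comp_hasFDerivAt (h₂ := gT δ) (f := fun y : E => ‖y‖^2) y (gT_hasDeriv (δ := δ) (sq_nonneg ‖y‖))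
      (hasStrictFDerivAt_norm_sq y).hasFDerivAt
  exact aa.smul (hasFDerivAt_id y)

theorem HH_fderiv_sub (δ : ℝ) (x y : E) : fderiv ℝ (HH δ) y (x - y) -
    (gT δ (‖y‖^2) + 2 * gT' δ (‖y‖^2) * ‖y‖^2) • (x - y) =
    (2 * gT' δ (‖y‖^2)) • (⟪y, x⟫ • y - ‖y‖^2 • x) := by
  rw [(HH_hasFDeriv δ y).fderiv]
  simp only [add_apply, smul_apply,
        ContinuousLinearMap.smulRight_apply, innerSL_apply_apply, inner_sub_right, real_inner_self_eq_norm_sq,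
        ContinuousLinearMap.id_apply, smul_sub, smul_eq_mul, nsmul_eq_mul, sub_smul, smul_smul, mul_sub, add_smul]
  push_cast
  module

theorem HH_taylor {δ : ℝ} {C : NNReal} (ar : LipschitzWith C (fderiv ℝ (HH δ : E → E))) (x y : E) :
    ‖HH δ x - HH δ y - fderiv ℝ (HH δ) y (x - y)‖ ≤ C * ‖x - y‖ ^ 2 := by
  have aa : ‖HH δ x - HH δ y - fderiv ℝ (HH δ) y (x - y)‖ ≤ (C * ‖x - y‖) * ‖x - y‖ := by
    refine (convex_segment y x).norm_image_sub_le_of_norm_hasFDerivWithin_le'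
      (f' := fderiv ℝ (HH δ)) (fun w _ => ((HH_hasFDeriv δ w).differentiableAt.hasFDerivAt).hasFDerivWithinAt)
      (fun w hw => ?_) (left_mem_segment ℝ y x) (right_mem_segment ℝ y x)
    refine (ar.norm_sub_le w y).trans ?_
    gcongr
    exact norm_sub_le_of_mem_segment hw
  exact aa.trans (le_of_eq (by ring))

theorem gT'_bd {δ bg : ℝ} (ah : 0 < δ) (eb : 0 < bg) (cp : ∀ t, |deriv smoothTransition t| ≤ bg) (t : ℝ) (ht : 0 ≤ t) :
    |2 * gT' δ t * t| ≤ 2 * δ * bg := by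
  rw [gT', show 2 * -(deriv smoothTransition (δ * (log (1 + t) - log 2)) * (δ * (1 + t)⁻¹)) * t
    = -(2 * δ * deriv smoothTransition (δ * (log (1 + t) - log 2)) * (t / (1+t))) by
      rw [div_eq_mul_inv]; ring, abs_neg, abs_mul, abs_mul, abs_of_pos (by positivity : 0 < 2 * δ),
    abs_of_nonneg (by positivity : 0 ≤ t / (1 + t))]
  have aa : t / (1+t) ≤ 1 := by rw [div_le_one (by positivity)]; linarith
  calc _ ≤ 2 * δ * bg * 1 := by gcongr; exact cp _
    _ = _ := by ring

theorem HH_lip {δ : ℝ} (ah : 0 < δ) : ∃ C : NNReal, LipschitzWith C (fderiv ℝ (HH δ : E → E)) := by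
  have hcd : ContDiff ℝ 1 (fderiv ℝ (HH δ : E → E)) := (HH_contDiff δ).fderiv_right (by norm_num)
  exact hcd.lipschitzWith_of_hasCompactSupport ((HH_cpt ah).fderiv ℝ) (by simp)

theorem mm_cont (δ : ℝ) : Continuous fun y : E => gT δ (‖y‖^2) + 2 * gT' δ (‖y‖^2) * ‖y‖^2 := by
  have aa : Continuous fun y : E => δ * (log (1 + ‖y‖^2) - log 2) := by
    refine continuous_const.mul (Continuous.sub (Continuous.log (by fun_prop) ?_) continuous_const)
    intro x; positivity
  have ab : Continuous (deriv smoothTransition) :=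
    (Real.smoothTransition.contDiff (n := 1)).continuous_deriv (by simp)
  have ad : Continuous fun y : E => (1 + ‖y‖^2)⁻¹ := by
    refine Continuous.inv₀ (by fun_prop) ?_
    intro x; positivity
  refine Continuous.add (continuous_const.sub (Real.smoothTransition.continuous.comp aa)) ?_
  exact (continuous_const.mul (((ab.comp aa).mul (continuous_const.mul ad)).neg)).mul (by fun_prop)

set_option maxHeartbeats 400000 in
theorem HH_est {f a : ℝ → ℝ} {L M : ℝ} (aj : Prof f a L M) : ∃ bk, 0 < bk ∧ ∀ δ, 0 < δ →
    ∃ (mm : E → ℝ) (C R : ℝ), 0 ≤ C ∧ Continuous mm ∧ (∀ z, |mm z| ≤ R) ∧ (∀ z : E, ‖HH δ z‖ ≤ R) ∧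
      ∀ t, 0 < t → ∀ x y : E, ‖HH δ x - HH δ y - mm y • (x - y)‖ ≤ C * ‖x - y‖ ^ 2 +
        δ * bk * (t * ‖x‖ + t⁻¹ * ⟪radA a x - radA a y, x - y⟫) := by
  obtain ⟨bg, eb, cp⟩ := sT_deriv_bdd
  have ha1 : 0 < a 1 := by
    have := aj.smono (mem_Ici.2 le_rfl) (mem_Ici.2 zero_le_one) zero_lt_one
    rwa [aj.a0] at this
  refine ⟨2 * bg * (1 + (a 1)⁻¹), by positivity, fun δ ah => ?_⟩
  have hg' := gT'_bd ah eb cp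
  obtain ⟨C, ar⟩ := HH_lip (E := E) ah
  refine ⟨fun y => gT δ (‖y‖^2) + 2 * gT' δ (‖y‖^2) * ‖y‖^2, C,
    max (1 + 2 * δ * bg) (1 + 2 * Real.exp (1/δ)), C.2, ?_, ?_, ?_, ?_⟩
  · exact mm_cont δ
  · intro z
    refine le_trans ?_ (le_max_left _ _)
    refine (abs_add_le _ _).trans (add_le_add ?_ (hg' _ (by positivity)))
    rw [abs_of_nonneg (gT_nonneg _ _)]; exact gT_le _ _
  · intro z
    refine le_trans ?_ (le_max_right _ _)
    by_cases h : ‖z‖ ≤ 1 + 2 * Real.exp (1/δ)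
    · exact (HH_norm_le _ _).trans h
    · rw [HH_zero ah (not_le.1 h), norm_zero]; positivity
  · intro t ht x y
    set e : E := ⟪y, x⟫ • y - ‖y‖^2 • x with he
    have ab : HH δ x - HH δ y - (gT δ (‖y‖^2) + 2 * gT' δ (‖y‖^2) * ‖y‖^2) • (x - y) =
      (HH δ x - HH δ y - fderiv ℝ (HH δ) y (x - y)) + (2 * gT' δ (‖y‖^2)) • e := by
      rw [← HH_fderiv_sub]; abel
    rw [ab]
    refine (norm_add_le _ _).trans (add_le_add (HH_taylor ar x y) ?_)
    have bj := aj.inner_nonneg x y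
    by_cases hs : ‖y‖ < 1
    · rw [gT'_zero ah (sq_nonneg _) (by nlinarith [norm_nonneg y])]
      simp only [mul_zero, zero_smul, norm_zero]
      positivity
    have hs := not_lt.1 hs
    have hy0 : 0 < ‖y‖ := by linarith
    have jc : a 1 * (‖x‖ * (1 - cosA x y)) ≤ ⟪radA a x - radA a y, x - y⟫ := by
      rw [inner_radA_sub a aj.a0]
      have hc := cosA_le_one x y
      have il : 0 ≤ (a ‖x‖ - a ‖y‖) * (‖x‖ - ‖y‖) := by
        rcases le_total ‖x‖ ‖y‖ with h | h
        · have := aj.smono.monotoneOn (norm_nonneg x) (norm_nonneg y) h; nlinarith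
        · have := aj.smono.monotoneOn (norm_nonneg y) (norm_nonneg x) h; nlinarith
      have ik : a 1 ≤ a ‖y‖ := aj.smono.monotoneOn (mem_Ici.2 zero_le_one) (norm_nonneg y) hs
      have lx : 0 ≤ a ‖x‖ := aj.nonneg (norm_nonneg x)
      have lw : 0 ≤ a ‖x‖ * ‖y‖ * (1 - cosA x y) := by
        have : 0 ≤ 1 - cosA x y := by linarith
        positivity
      have lv : a 1 * (‖x‖ * (1 - cosA x y)) ≤ a ‖y‖ * (‖x‖ * (1 - cosA x y)) := by
        have : 0 ≤ 1 - cosA x y := by linarith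
        gcongr
      linarith
    have hee : ‖e‖ ≤ ‖y‖^2 * (t * ‖x‖ + t⁻¹ * (‖x‖ * (1 - cosA x y))) := by
      have hc := cosA_le_one x y
      have hc' : 0 ≤ 1 - cosA x y := by linarith
      refine le_of_sq_le_sq ?_ (by positivity)
      have ag : ‖e‖^2 = ‖y‖^4 * (‖x‖^2 * (1 - cosA x y ^ 2)) := by
        rw [← real_inner_self_eq_norm_sq e, he]
        simp only [inner_sub_left, inner_sub_right, real_inner_smul_left, real_inner_smul_right,
          real_inner_self_eq_norm_sq, real_inner_comm y x]
        simp only [norm_smul, mul_pow, norm_eq_abs, sq_abs, real_inner_comm x y]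
        rw [inner_eq_cosA x y]; ring
      have aq : (t * ‖x‖) * (t⁻¹ * (‖x‖ * (1 - cosA x y))) = ‖x‖^2 * (1 - cosA x y) := by
        field_simp
      have cf : ‖x‖^2 * (1 - cosA x y ^ 2) ≤ 2 * (‖x‖^2 * (1 - cosA x y)) := by
        nlinarith [mul_nonneg (sq_nonneg ‖x‖) (sq_nonneg (1 - cosA x y))]
      rw [ag, mul_pow, ← pow_mul]
      refine mul_le_mul_of_nonneg_left ?_ (by positivity)
      nlinarith [sq_nonneg (t * ‖x‖), sq_nonneg (t⁻¹ * (‖x‖ * (1 - cosA x y)))]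
    have al : t⁻¹ * (‖x‖ * (1 - cosA x y)) ≤ (a 1)⁻¹ * (t⁻¹ * ⟪radA a x - radA a y, x - y⟫) := by
      rw [show (a 1)⁻¹ * (t⁻¹ * ⟪radA a x - radA a y, x - y⟫) = t⁻¹ * ((a 1)⁻¹ * ⟪radA a x - radA a y, x - y⟫) by ring]
      exact mul_le_mul_of_nonneg_left ((le_inv_mul_iff₀ ha1).2 jc) (by positivity)
    calc ‖(2 * gT' δ (‖y‖^2)) • e‖ = |2 * gT' δ (‖y‖^2)| * ‖e‖ := by rw [norm_smul, norm_eq_abs]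
      _ ≤ |2 * gT' δ (‖y‖^2)| * (‖y‖^2 * (t * ‖x‖ + t⁻¹ * (‖x‖ * (1 - cosA x y)))) := by gcongr
      _ = |2 * gT' δ (‖y‖^2) * ‖y‖^2| * (t * ‖x‖ + t⁻¹ * (‖x‖ * (1 - cosA x y))) := by
        rw [abs_mul (2 * gT' δ (‖y‖^2)) (‖y‖^2), abs_of_nonneg (sq_nonneg ‖y‖)]; ring
      _ ≤ (2 * δ * bg) * (t * ‖x‖ + (a 1)⁻¹ * (t⁻¹ * ⟪radA a x - radA a y, x - y⟫)) := by
        have : 0 ≤ 1 - cosA x y := by linarith [cosA_le_one x y]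
        gcongr
        exact hg' _ (sq_nonneg _)
      _ ≤ (2 * δ * bg) * ((1 + (a 1)⁻¹) * (t * ‖x‖ + t⁻¹ * ⟪radA a x - radA a y, x - y⟫)) := by
        gcongr
        have : 0 ≤ (a 1)⁻¹ * (t * ‖x‖) := by positivity
        have : 0 ≤ t⁻¹ * ⟪radA a x - radA a y, x - y⟫ := by positivity
        nlinarith
      _ = _ := by ring

end trunc

section wd

noncomputable abbrev es (i : Fin n) : Ev := single i 1
noncomputable abbrev lam : Measure ℝ := volume.restrict (Icc (0:ℝ) 1)

theorem es_norm (i : Fin n) : ‖es i‖ = 1 := by simp [es]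

instance : IsProbabilityMeasure lam := ⟨by simp [lam]⟩

theorem sq_int_le {α : Type*} [MeasurableSpace α] {μ : Measure α} [IsProbabilityMeasure μ] {f : α → ℝ}
    (aa : Integrable f μ) (ab : Integrable (fun x => f x ^ 2) μ) : (∫ x, f x ∂μ) ^ 2 ≤ ∫ x, f x ^ 2 ∂μ := by
  set m := ∫ x, f x ∂μ
  have ad : ∫ x, (f x - m) ^ 2 ∂μ = ∫ x, f x ^ 2 ∂μ - m ^ 2 := by
    have : ∀ x, (f x - m) ^ 2 = f x ^ 2 - 2 * m * f x + m ^ 2 := fun x => by ring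
    simp only [this]
    rw [integral_add (isub ab (aa.const_mul _)) (integrable_const _), integral_sub ab (aa.const_mul _),
      integral_const_mul]
    simp [m]; ring
  have : 0 ≤ ∫ x, (f x - m) ^ 2 ∂μ := integral_nonneg fun _ => sq_nonneg _
  linarith

theorem avg_int {g : Ev → ℝ} (hm : StronglyMeasurable g) (hg : Integrable g) (y : Ev) :
    Integrable (fun p : Ev × ℝ => g (p.1 + p.2 • y)) (volume.prod lam) := by
  have hm' : StronglyMeasurable (fun p : Ev × ℝ => g (p.1 + p.2 • y)) :=
    hm.comp_measurable (by fun_prop)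
  rw [integrable_prod_iff' hm'.aestronglyMeasurable]
  refine ⟨Eventually.of_forall fun t => hg.comp_add_right (t • y), ?_⟩
  have : ∀ t : ℝ, ∫ x, ‖g (x + t • y)‖ = ∫ x, ‖g x‖ := fun t =>
    integral_add_right_eq_self (fun x => ‖g x‖) (t • y)
  simp only [this]
  exact integrable_const _

theorem avg_le {g : Ev → ℝ} (hm : StronglyMeasurable g) (hg : Integrable g) (y : Ev) :
    ∫ x, ‖∫ t, g (x + t • y) ∂lam‖ ≤ ∫ x, ‖g x‖ := by
  have bj := avg_int hm hg y
  calc ∫ x, ‖∫ t, g (x + t • y) ∂lam‖ ≤ ∫ x, ∫ t, ‖g (x + t • y)‖ ∂lam :=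
        integral_mono bj.integral_prod_left.norm bj.norm.integral_prod_left
          fun x => norm_integral_le_integral_norm _
    _ = ∫ t, ∫ x, ‖g (x + t • y)‖ ∂volume ∂lam := integral_integral_swap bj.norm
    _ = ∫ x, ‖g x‖ := by
      have : ∀ t : ℝ, ∫ x, ‖g (x + t • y)‖ = ∫ x, ‖g x‖ := fun t =>
        integral_add_right_eq_self (fun x => ‖g x‖) (t • y)
      simp only [this, integral_const]; simp

theorem moll_ftc (k : ℕ) {u v : Ev → ℝ} (hu : Integrable u) (hv : Integrable v) {B : Set Ev}
    {i : Fin n} (h : WD B i u v) {x : Ev} {r s : ℝ} (hx : closedBall x r ⊆ B)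
    (hs : 0 ≤ s) (hsr : s + 1/((k:ℝ)+1) ≤ r) :
    moll k u (x + s • es i) - moll k u x = s * ∫ t, moll k v (x + t • (s • es i)) ∂lam := by
  have hd : ∀ t ∈ uIcc (0:ℝ) 1, HasDerivAt (fun t : ℝ => moll k u (x + t • (s • es i)))
      (s * moll k v (x + t • (s • es i))) t := by
    intro t ht
    rw [uIcc_of_le zero_le_one] at ht
    have aa : HasFDerivAt (moll k u) (fderiv ℝ (moll k u) (x + t • (s • es i))) (x + t • (s • es i)) :=
      ((moll_smooth k hu.locallyIntegrable (m := 1)).differentiable (by simp)).differentiableAt.hasFDerivAt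
    have ab : HasDerivAt (fun t : ℝ => x + t • (s • es i)) (s • es i) t := by
      simpa using ((hasDerivAt_id t).smul_const (s • es i)).const_add x
    have ad := aa.comp_hasDerivAt t ab
    rw [map_smul, moll_fderiv k hu.locallyIntegrable h ?_] at ad
    · exact ad
    · refine (Metric.closedBall_subset_closedBall' ?_).trans hx
      have : dist (x + t • s • es i) x ≤ s := by
        rw [dist_eq_norm, add_sub_cancel_left, norm_smul, norm_smul, norm_of_nonneg ht.1,
          norm_of_nonneg hs, es_norm]
        rw [mul_one]; exact mul_le_of_le_one_left hs ht.2
      linarith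
  have hc : Continuous (fun t : ℝ => s * moll k v (x + t • (s • es i))) := by
    have := (moll_smooth k hv.locallyIntegrable (m := 1)).continuous
    fun_prop
  have := intervalIntegral.integral_eq_sub_of_hasDerivAt hd (hc.intervalIntegrable _ _)
  rw [intervalIntegral.integral_of_le zero_le_one, ← integral_Icc_eq_integral_Ioc, integral_const_mul] at this
  simpa using this.symm

theorem dq_rep {u v : Ev → ℝ} (hu : Integrable u) (hv : Integrable v) (hvm : StronglyMeasurable v)
    {B K : Set Ev} {i : Fin n} (h : WD B i u v) {r s : ℝ} (hs : 0 ≤ s) (hsr : s < r)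
    (bw : MeasurableSet K) (ay : ∀ x ∈ K, closedBall x r ⊆ B) :
    ∀ᵐ x ∂(volume.restrict K), u (x + s • es i) - u x = s * ∫ t, v (x + t • (s • es i)) ∂lam := by
  set R : Ev → ℝ := fun x => u (x + s • es i) - u x - s * ∫ t, v (x + t • (s • es i)) ∂lam with bt
  have jy : Integrable R := ((hu.comp_add_right _).sub hu).sub
    ((avg_int hvm hv (s • es i)).integral_prod_left.const_mul s)
  have key : ∀ᶠ k : ℕ in atTop, ∫ x in K, ‖R x‖ ≤ 2 * (∫ x, ‖moll k u x - u x‖) + s * ∫ x, ‖moll k v x - v x‖ := by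
    obtain ⟨jm, hk₀⟩ := exists_nat_one_div_lt (sub_pos.2 hsr)
    filter_upwards [eventually_ge_atTop jm] with k hk
    have hk1 : 1/((k:ℝ)+1) ≤ 1/((jm:ℝ)+1) := by
      apply one_div_le_one_div_of_le (by positivity); gcongr
    have hcv := (moll_smooth k hv.locallyIntegrable (m := 1)).continuous
    have hdu : Integrable (fun x => moll k u x - u x) := (moll_int k hu).sub hu
    have hdv : Integrable (fun x => moll k v x - v x) := (moll_int k hv).sub hv
    have hdvm : StronglyMeasurable (fun x => moll k v x - v x) := hcv.stronglyMeasurable.sub hvm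
    have ev := (avg_int hdvm hdv (s • es i))
    calc ∫ x in K, ‖R x‖ ≤ ∫ x in K, (‖moll k u (x + s • es i) - u (x + s • es i)‖ + ‖moll k u x - u x‖
          + s * ‖∫ t, (moll k v (x + t • (s • es i)) - v (x + t • (s • es i))) ∂lam‖) := by
          refine integral_mono_ae jy.norm.integrableOn (((hdu.comp_add_right _).norm.add hdu.norm).add
            (ev.integral_prod_left.norm.const_mul s)).integrableOn ?_
          have aa := ae_restrict_of_ae (s := K) (avg_int hvm hv (s • es i)).prod_right_ae
          filter_upwards [ae_restrict_mem bw, aa] with x hx aa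
          have ab := moll_ftc k hu hv h (ay x hx) hs (by linarith)
          have ad : Integrable (fun t : ℝ => moll k v (x + t • (s • es i))) lam :=
            Continuous.integrableOn_Icc (by fun_prop)
          rw [integral_sub ad aa]
          simp only [bt]
          have : u (x + s • es i) - u x - s * ∫ t, v (x + t • (s • es i)) ∂lam =
            -(moll k u (x + s • es i) - u (x + s • es i)) + (moll k u x - u x) +
            s * (∫ t, moll k v (x + t • (s • es i)) ∂lam - ∫ t, v (x + t • (s • es i)) ∂lam) := by
            rw [mul_sub, ← ab]; ring
          rw [this]
          refine (norm_add_le _ _).trans (add_le_add ((norm_add_le _ _).trans (by rw [norm_neg])) ?_)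
          rw [norm_mul, norm_of_nonneg hs]
      _ ≤ ∫ x, (‖moll k u (x + s • es i) - u (x + s • es i)‖ + ‖moll k u x - u x‖
          + s * ‖∫ t, (moll k v (x + t • (s • es i)) - v (x + t • (s • es i))) ∂lam‖) := by
          refine setIntegral_le_integral (((hdu.comp_add_right _).norm.add hdu.norm).add
            (ev.integral_prod_left.norm.const_mul s)) (Eventually.of_forall fun x => ?_)
          simp only [Pi.zero_apply]; positivity
      _ ≤ _ := by
          rw [integral_add (iadd (hdu.comp_add_right _).norm hdu.norm) (ev.integral_prod_left.norm.const_mul s),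
            integral_add (hdu.comp_add_right _).norm hdu.norm, integral_const_mul,
            integral_add_right_eq_self (fun x => ‖moll k u x - u x‖) (s • es i)]
          have := mul_le_mul_of_nonneg_left (avg_le hdvm hdv (s • es i)) hs
          linarith
  have hlim : Tendsto (fun k : ℕ => 2 * (∫ x, ‖moll k u x - u x‖) + s * ∫ x, ‖moll k v x - v x‖) atTop (𝓝 0) := by
    simpa using ((moll_L1 hu).const_mul 2).add ((moll_L1 hv).const_mul s)
  have ae : ∫ x in K, ‖R x‖ ≤ 0 := ge_of_tendsto hlim key
  have aa := (integral_eq_zero_iff_of_nonneg (fun x => norm_nonneg (R x)) jy.norm.integrableOn).1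
    (le_antisymm ae (integral_nonneg fun x => norm_nonneg (R x)))
  filter_upwards [aa] with x hx
  have : R x = 0 := by simpa using hx
  simp only [bt] at this
  linarith

theorem dq_L2' {u v : Ev → ℝ} (hu : Integrable u) (hv : Integrable v) (hv2 : MemLp v 2)
    (hvm : StronglyMeasurable v)
    {B K : Set Ev} {i : Fin n} (h : WD B i u v) {r : ℝ} (hr : 0 < r)
    (bw : MeasurableSet K) (ay : ∀ x ∈ K, closedBall x r ⊆ B) :
    Tendsto (fun s : ℝ => ∫ x in K, ((u (x + s • es i) - u x) / s - v x) ^ 2) (𝓝[>] 0) (𝓝 0) := by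
  rw [Metric.tendsto_nhdsWithin_nhds]
  intro ε ba
  obtain ⟨δ, ah, hd⟩ := Metric.tendsto_nhds_nhds.1 (trans_L2 hv2) (ε/2) (by positivity)
  refine ⟨min δ r, lt_min ah hr, fun {s} hs hs' => ?_⟩
  have hs : 0 < s := hs
  rw [dist_zero_right, norm_of_nonneg hs.le, lt_min_iff] at hs'
  rw [dist_zero_right, norm_of_nonneg (integral_nonneg fun _ => sq_nonneg _)]
  refine lt_of_le_of_lt ?_ (half_lt_self ba)
  have hrep := dq_rep hu hv hvm h hs.le hs'.2 bw ay
  have hm : StronglyMeasurable (fun p : Ev × ℝ => (v (p.1 + p.2 • (s • es i)) - v p.1) ^ 2) :=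
    ((hvm.comp_measurable (by fun_prop)).sub (hvm.comp_measurable (by fun_prop))).pow 2
  have hbd : ∀ t ∈ Icc (0:ℝ) 1, ∫ x, (v (x + t • (s • es i)) - v x) ^ 2 ≤ ε/2 := by
    intro t ht
    have := hd (x := t • (s • es i)) (by
      rw [dist_zero_right, norm_smul, norm_smul, norm_of_nonneg ht.1,
          norm_of_nonneg hs.le, es_norm]
      rw [mul_one]; exact lt_of_le_of_lt (mul_le_of_le_one_left hs.le ht.2) hs'.1)
    rw [dist_zero_right, norm_of_nonneg (integral_nonneg fun _ => sq_nonneg _)] at this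
    exact this.le
  have hint : ∀ t : ℝ, Integrable (fun x => (v (x + t • (s • es i)) - v x) ^ 2) := fun t =>
    ((hv2.comp_measurePreserving (measurePreserving_add_right volume _)).sub hv2).integrable_sq
  have bj : Integrable (fun p : Ev × ℝ => (v (p.1 + p.2 • (s • es i)) - v p.1) ^ 2) (volume.prod lam) := by
    rw [integrable_prod_iff' hm.aestronglyMeasurable]
    refine ⟨Eventually.of_forall hint, ?_⟩
    refine Integrable.mono' (integrable_const (ε/2)) hm.norm.integral_prod_left'.aestronglyMeasurable ?_
    filter_upwards [ae_restrict_mem measurableSet_Icc] with t ht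
    simp only [norm_of_nonneg (sq_nonneg _)]
    rw [norm_of_nonneg (integral_nonneg fun _ => sq_nonneg _)]
    exact hbd t ht
  have kc := bj.integral_prod_left
  calc ∫ x in K, ((u (x + s • es i) - u x) / s - v x) ^ 2
      ≤ ∫ x in K, ∫ t, (v (x + t • (s • es i)) - v x) ^ 2 ∂lam := by
        refine integral_mono_of_nonneg (Eventually.of_forall fun x => sq_nonneg _) kc.integrableOn ?_
        filter_upwards [hrep, ae_restrict_of_ae (s := K) (avg_int hvm hv (s • es i)).prod_right_ae,
          ae_restrict_of_ae (s := K) bj.prod_right_ae] with x aa ab ad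
        have : (u (x + s • es i) - u x) / s - v x = ∫ t, (v (x + t • (s • es i)) - v x) ∂lam := by
          rw [integral_sub ab (integrable_const _), aa]
          simp; field_simp
        rw [this]
        exact sq_int_le (ab.sub (integrable_const _)) ad
    _ ≤ ∫ x, ∫ t, (v (x + t • (s • es i)) - v x) ^ 2 ∂lam :=
        setIntegral_le_integral kc (Eventually.of_forall fun x => integral_nonneg fun _ => sq_nonneg _)
    _ = ∫ t, ∫ x, (v (x + t • (s • es i)) - v x) ^ 2 ∂volume ∂lam := integral_integral_swap bj
    _ ≤ ∫ t, ε/2 ∂lam := by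
        refine integral_mono_ae bj.integral_prod_right (integrable_const _) ?_
        filter_upwards [ae_restrict_mem measurableSet_Icc] with t ht using hbd t ht
    _ = ε/2 := by simp

theorem WD.congr_ae {B : Set Ev} {i : Fin n} {u v cd v' : Ev → ℝ} (h : WD B i u v)
    (hu : ∀ᵐ x, x ∈ B → cd x = u x) (hv : ∀ᵐ x, x ∈ B → v' x = v x) : WD B i cd v' := by
  intro φ aa ab ad
  have := h φ aa ab ad
  have ag : ∫ x, cd x * fderiv ℝ φ x (single i 1)
      = ∫ x, u x * fderiv ℝ φ x (single i 1) := by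
    apply integral_congr_ae
    filter_upwards [hu] with x hx
    by_cases hxB : x ∈ B
    · rw [hx hxB]
    · have : fderiv ℝ φ x = 0 := by
        have ai : x ∉ tsupport (fderiv ℝ φ) := fun al => hxB (ad (tsupport_fderiv_subset ℝ al))
        exact image_eq_zero_of_notMem_tsupport ai
      simp [this]
  have aq : ∫ x, v' x * φ x = ∫ x, v x * φ x := by
    apply integral_congr_ae
    filter_upwards [hv] with x hx
    by_cases hxB : x ∈ B
    · rw [hx hxB]
    · simp [image_eq_zero_of_notMem_tsupport fun al => hxB (ad al)]
  rw [ag, aq, this]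

theorem dq_L2 {u v : Ev → ℝ} (hu : Integrable u) (hv : Integrable v) (hv2 : MemLp v 2)
    {B K : Set Ev} {i : Fin n} (h : WD B i u v) {r : ℝ} (hr : 0 < r)
    (bw : MeasurableSet K) (ay : ∀ x ∈ K, closedBall x r ⊆ B) :
    Tendsto (fun s : ℝ => ∫ x in K, ((u (x + s • es i) - u x) / s - v x) ^ 2) (𝓝[>] 0) (𝓝 0) := by
  have hae := hv.1.ae_eq_mk
  have := dq_L2' hu (hv.congr hae) (hv2.ae_eq hae) hv.1.stronglyMeasurable_mk
    (h.congr_ae (Eventually.of_forall fun _ _ => rfl) (hae.mono fun x hx _ => hx.symm)) hr bw ay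
  refine this.congr fun s => ?_
  apply integral_congr_ae
  filter_upwards [ae_restrict_of_ae (s := K) hae] with x hx
  rw [hx]

end wd

section wdops
variable {B : Set (EVec n)} {i : Fin n} {u v cd v' : EVec n → ℝ}

theorem int_mul_cc {u φ : Ev → ℝ} (hu : LocallyIntegrable u) (am : Continuous φ) (hc : HasCompactSupport φ) :
    Integrable (fun x => u x * φ x) := by
  have := hu.integrable_smul_right_of_hasCompactSupport am hc
  simpa [smul_eq_mul] using this

theorem pd_cont {φ : Ev → ℝ} (am : ContDiff ℝ 1 φ) (i : Fin n) :
    Continuous (fun x => fderiv ℝ φ x (es i)) :=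
  (am.continuous_fderiv (by simp)).clm_apply continuous_const

theorem pd_cpt {φ : Ev → ℝ} (hc : HasCompactSupport φ) (i : Fin n) :
    HasCompactSupport (fun x => fderiv ℝ φ x (es i)) := hc.fderiv_apply (𝕜 := ℝ) (es i)

theorem WD.mono {B' : Set Ev} (h : WD B i u v) (av : B' ⊆ B) : WD B' i u v :=
  fun φ aa ab ad => h φ aa ab (ad.trans av)

theorem WD.lin (h : WD B i u v) (db : WD B i cd v') (hu : LocallyIntegrable u) (hv : LocallyIntegrable v)
    (hu' : LocallyIntegrable cd) (hv' : LocallyIntegrable v') (c gi : ℝ) :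
    WD B i (fun x => c * u x + gi * cd x) (fun x => c * v x + gi * v' x) := by
  intro φ aa ab ad
  have ag := h φ aa ab ad
  have aq := db φ aa ab ad
  simp only [add_mul, mul_assoc]
  rw [integral_add ((int_mul_cc hu (pd_cont aa i) (pd_cpt ab i)).const_mul c)
      ((int_mul_cc hu' (pd_cont aa i) (pd_cpt ab i)).const_mul gi),
    integral_add ((int_mul_cc hv aa.continuous ab).const_mul c) ((int_mul_cc hv' aa.continuous ab).const_mul gi)]
  simp only [integral_const_mul]
  rw [ag, aq]; ring

theorem WD.shift (h : WD B i u v) (y : Ev) :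
    WD {x | x + y ∈ B} i (fun x => u (x + y)) (fun x => v (x + y)) := by
  intro φ aa ab ad
  have hd : ∀ x, fderiv ℝ (fun x => φ (x - y)) x = fderiv ℝ φ (x - y) := fun x => fderiv_comp_sub y
  have hts : tsupport (fun x => φ (x - y)) ⊆ B := by
    have : tsupport (fun x => φ (x - y)) ⊆ (fun x => x - y) ⁻¹' (tsupport φ) :=
      tsupport_comp_subset_preimage φ (by fun_prop)
    intro x hx
    have := ad (this hx)
    simpa using this
  have e := h (fun x => φ (x - y)) (aa.comp (contDiff_id.sub contDiff_const))
    (ab.comp_homeomorph (Homeomorph.subRight y)) hts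
  simp only [hd] at e
  rw [← integral_add_right_eq_self _ y, ← integral_add_right_eq_self (fun x => v x * φ (x - y)) y] at e
  simpa using e

theorem WD.mulc (h : WD B i u v) (hu : LocallyIntegrable u) (hv : LocallyIntegrable v) {θ : Ev → ℝ}
    (aw : ContDiff ℝ 1 θ) (hc : HasCompactSupport θ) (hs : tsupport θ ⊆ B) :
    WD univ i (fun x => θ x * u x) (fun x => θ x * v x + fderiv ℝ θ x (es i) * u x) := by
  intro φ aa ab _
  have e := h (fun x => θ x * φ x) (aw.mul aa) hc.mul_right
    ((tsupport_mul_subset_left).trans hs)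
  have hd : ∀ x, fderiv ℝ (fun x => θ x * φ x) x (es i)
      = θ x * fderiv ℝ φ x (es i) + φ x * fderiv ℝ θ x (es i) := fun x => by
    rw [fderiv_fun_mul (aw.differentiable (by simp) x) (aa.differentiable (by simp) x)]; simp
  simp only [es] at hd
  simp only [hd, mul_add] at e
  have bh : Integrable (fun x => u x * (θ x * fderiv ℝ φ x (es i))) :=
    int_mul_cc hu (aw.continuous.mul (pd_cont aa i)) hc.mul_right
  have bl : Integrable (fun x => u x * (φ x * fderiv ℝ θ x (es i))) :=
    int_mul_cc hu (aa.continuous.mul (pd_cont aw i)) ab.mul_right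
  have cv : Integrable (fun x => v x * (θ x * φ x)) :=
    int_mul_cc hv (aw.continuous.mul aa.continuous) hc.mul_right
  simp only [es] at bh bl
  rw [integral_add bh bl] at e
  have ag : ∀ x, θ x * u x * fderiv ℝ φ x (single i 1)
    = u x * (θ x * fderiv ℝ φ x (single i 1)) := fun x => by ring
  have aq : ∀ x, (θ x * v x + fderiv ℝ θ x (single i 1) * u x) * φ x
    = v x * (θ x * φ x) + u x * (φ x * fderiv ℝ θ x (single i 1)) := fun x => by ring
  simp only [es, ag, aq]
  rw [integral_add cv bl]
  linarith

end wdops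

section dq

abbrev WW (N : ℕ) := EuclideanSpace ℝ (Fin N)
abbrev ZZ (N n : ℕ) := EuclideanSpace ℝ (Fin N × Fin n)

def WP (B : Set Ev) (w : Ev → WW N) (z : Ev → ZZ N n) : Prop :=
  ∀ a i, WD B i (fun x => w x a) (fun x => z x (a, i))

noncomputable def tens (p : Fin n → ℝ) (ω : WW N) : ZZ N n := WithLp.toLp 2 fun q => p q.2 * ω q.1

theorem tens_norm (p : Fin n → ℝ) (ω : WW N) : ‖tens p ω‖ ^ 2 = (∑ i, p i ^ 2) * ‖ω‖ ^ 2 := by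
  rw [norm_sq_eq, norm_sq_eq, Fintype.sum_prod_type, Finset.sum_mul_sum,
    Finset.sum_comm]
  refine sum_congr rfl fun i _ => sum_congr rfl fun j _ => ?_
  simp [tens, mul_pow]

noncomputable def dq {F : Type*} [NormedAddCommGroup F] [NormedSpace ℝ F] (h : ℝ) (i : Fin n)
    (g : Ev → F) (x : Ev) : F := h⁻¹ • (g (x + h • es i) - g x)

section
variable {F : Type*} [NormedAddCommGroup F] [InnerProductSpace ℝ F]

theorem l2_shift {g : Ev → F} (hg : MemLp g 2) (y : Ev) : MemLp (fun x => g (x + y)) 2 :=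
  hg.comp_measurePreserving (measurePreserving_add_right volume y)

theorem l2_dq {g : Ev → F} (hg : MemLp g 2) (h : ℝ) (i : Fin n) : MemLp (dq h i g) 2 :=
  ((l2_shift hg _).sub hg).const_smul h⁻¹

theorem dq_adj {G V : Ev → F} (ak : MemLp G 2) (dp : MemLp V 2) (h : ℝ) (i : Fin n) :
    ∫ x, ⟪G x, h⁻¹ • (V x - V (x + (-(h • es i))))⟫ = - ∫ x, ⟪dq h i G x, V x⟫ := by
  have ag : ∫ x, ⟪G x, V (x + (-(h • es i)))⟫ = ∫ x, ⟪G (x + h • es i), V x⟫ := by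
    rw [← integral_add_right_eq_self _ (h • es i)]; simp
  simp only [dq, inner_smul_right, real_inner_smul_left, integral_const_mul, inner_sub_left, inner_sub_right]
  rw [integral_sub (int_inner_l2 ak dp) (int_inner_l2 ak (l2_shift dp _)), ag,
    integral_sub (int_inner_l2 (l2_shift ak _) dp) (int_inner_l2 ak dp)]
  ring

end

theorem coord_int {κ : Type*} [Fintype κ] {g : Ev → EuclideanSpace ℝ κ} (hg : Integrable g) (a : κ) :
    Integrable (fun x => g x a) := (EuclideanSpace.proj (𝕜 := ℝ) a).integrable_comp hg

theorem coord_l2 {κ : Type*} [Fintype κ] {g : Ev → EuclideanSpace ℝ κ} (hg : MemLp g 2) (a : κ) :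
    MemLp (fun x => g x a) 2 := (EuclideanSpace.proj (𝕜 := ℝ) a).comp_memLp' hg

theorem toLp_meas {κ : Type*} [Fintype κ] {μ : Measure Ev} {g : Ev → κ → ℝ}
    (hg : ∀ a, AEStronglyMeasurable (fun x => g x a) μ) :
    AEStronglyMeasurable (fun x => (WithLp.toLp 2 (g x) : EuclideanSpace ℝ κ)) μ :=
  (PiLp.continuous_toLp 2 (fun _ : κ => ℝ)).comp_aestronglyMeasurable
    ((aemeasurable_pi_iff.2 fun a => (hg a).aemeasurable).aestronglyMeasurable)

structure Loc (B : Set Ev) (a : ℝ → ℝ) (ε : ℝ) (d w : Ev → WW N) (z : Ev → ZZ N n) : Prop where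
  w2 : MemLp w 2
  z2 : MemLp z 2
  d2 : MemLp d 2
  w1 : Integrable w
  z1 : Integrable z
  wp : WP B w z
  eq : ∀ (φ : Ev → WW N) (ζ : Ev → ZZ N n), MemLp φ 2 → MemLp ζ 2 → WP univ φ ζ →
    (∃ K, IsCompact K ∧ K ⊆ B ∧ ∀ x ∉ K, φ x = 0 ∧ ζ x = 0) →
    (∫ x, ⟪radA (fun t => a t + ε * t) (z x), ζ x⟫) + ε * (∫ x, ⟪w x, φ x⟫) + ∫ x, ⟪d x, φ x⟫ = 0

noncomputable def Ae (a : ℝ → ℝ) (ε : ℝ) (z : Ev → ZZ N n) (x : Ev) : ZZ N n :=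
  radA (fun t => a t + ε * t) (z x)

theorem Ae_l2 {f a : ℝ → ℝ} {L M : ℝ} (aj : Prof f a L M) (ε : ℝ) {z : Ev → ZZ N n} (hz : MemLp z 2) :
    MemLp (Ae a ε z) 2 := by
  have aa : MemLp (fun x => radA a (z x)) 2 := by
    refine hz.of_le_mul (c := L) (aj.continuous_radA.comp_aestronglyMeasurable hz.1) (aoa fun x => ?_)
    rw [norm_radA a aj.a0, abs_of_nonneg (aj.nonneg (norm_nonneg _))]
    exact aj.le_lin (norm_nonneg _)
  have : Ae a ε z = fun x => radA a (z x) + ε • z x := by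
    ext1 x; exact radA_add_eps a ε (z x)
  rw [this]
  exact aa.add (hz.const_smul ε)

theorem mul_l2 {F : Type*} [NormedAddCommGroup F] [NormedSpace ℝ F] {θ : Ev → ℝ} (aw : Continuous θ)
    (hc : HasCompactSupport θ) {g : Ev → F} (hg : MemLp g 2) : MemLp (fun x => θ x • g x) 2 := by
  obtain ⟨C, ar⟩ := hc.exists_bound_of_continuous aw
  refine hg.of_le_mul (c := C) (aw.aestronglyMeasurable.smul hg.1) (aoa fun x => ?_)
  rw [norm_smul]; gcongr; exact ar x

theorem tens_l2 {θ : Ev → ℝ} (aw : ContDiff ℝ 1 θ)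
    (hc : HasCompactSupport θ) {g : Ev → WW N} (hg : MemLp g 2) :
    MemLp (fun x => tens (fun i => fderiv ℝ θ x (es i)) (g x)) 2 := by
  have hb : ∃ C, ∀ x, √(∑ i, fderiv ℝ θ x (es i) ^ 2) ≤ C := by
    have aa : Continuous (fun x => √(∑ i, fderiv ℝ θ x (es i) ^ 2)) :=
      (continuous_finsetSum _ fun i _ => (pd_cont aw i).pow 2).sqrt
    have ab : HasCompactSupport (fun x => √(∑ i, fderiv ℝ θ x (es i) ^ 2)) := by
      refine (hc.fderiv (𝕜 := ℝ)).comp_left (g := fun l : Ev →L[ℝ] ℝ => √(∑ i, l (es i) ^ 2)) ?_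
      simp
    obtain ⟨C, ar⟩ := ab.exists_bound_of_continuous aa
    exact ⟨C, fun x => (le_abs_self _).trans (ar x)⟩
  obtain ⟨C, ar⟩ := hb
  refine hg.of_le_mul (c := C) (toLp_meas fun p => ?_) (aoa fun x => ?_)
  · exact (pd_cont aw p.2).aestronglyMeasurable.mul (coord_l2 hg p.1).1
  · have ae : 0 ≤ ∑ i, fderiv ℝ θ x (es i) ^ 2 := sum_nonneg fun _ _ => sq_nonneg _
    have : ‖tens (fun i => fderiv ℝ θ x (es i)) (g x)‖ = √(∑ i, fderiv ℝ θ x (es i) ^ 2) * ‖g x‖ := by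
      rw [← Real.sqrt_sq (norm_nonneg (tens _ _)), tens_norm, Real.sqrt_mul ae, Real.sqrt_sq (norm_nonneg _)]
    rw [this]; gcongr; exact ar x

theorem dq_identity {f a : ℝ → ℝ} {L M : ℝ} (aj : Prof f a L M) {B : Set Ev} {ε : ℝ}
    {d w : Ev → WW N} {z : Ev → ZZ N n} (hl : Loc B a ε d w z)
    {θ : Ev → ℝ} (aw : ContDiff ℝ 1 θ) (hc : HasCompactSupport θ) {r : ℝ}
    (hr : ∀ x ∈ tsupport θ, closedBall x r ⊆ B) {h : ℝ} (ae : 0 < h) (hhr : h < r) (s : Fin n) :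
    (∫ x, ⟪dq h s (Ae a ε z) x, θ x • dq h s z x + tens (fun i => fderiv ℝ θ x (es i)) (dq h s w x)⟫)
      + ε * (∫ x, ⟪dq h s w x, θ x • dq h s w x⟫) + ∫ x, ⟪dq h s d x, θ x • dq h s w x⟫ = 0 := by
  set V : Ev → WW N := fun x => θ x • dq h s w x with dp
  set Y : Ev → ZZ N n := fun x => θ x • dq h s z x + tens (fun i => fderiv ℝ θ x (es i)) (dq h s w x) with ku
  have ch : MemLp V 2 := mul_l2 aw.continuous hc (l2_dq hl.w2 h s)
  have df : MemLp Y 2 := (mul_l2 aw.continuous hc (l2_dq hl.z2 h s)).add (tens_l2 aw hc (l2_dq hl.w2 h s))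
  have hli : ∀ {κ : Type} [Fintype κ] {g : Ev → EuclideanSpace ℝ κ}, MemLp g 2 → ∀ b,
      LocallyIntegrable (fun x => g x b) := fun hg b => (coord_l2 hg b).locallyIntegrable (by simp)
  have hmem : ∀ x ∈ tsupport θ, x ∈ B ∧ x + h • es s ∈ B := by
    intro x hx
    refine ⟨hr x hx (mem_closedBall_self (by linarith)), hr x hx ?_⟩
    rw [mem_closedBall, dist_eq_norm, add_sub_cancel_left, norm_smul, es_norm, norm_of_nonneg ae.le]
    linarith
  have kw : WP univ V Y := by
    intro b i
    have aa := (hl.wp b i)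
    have ab := aa.shift (h • es s)
    have ad := (ab.mono (B' := {x | x ∈ B ∧ x + h • es s ∈ B}) (fun x hx => hx.2)).lin
      (aa.mono (B' := {x | x ∈ B ∧ x + h • es s ∈ B}) (fun x hx => hx.1)) (hli (l2_shift hl.w2 _) b)
      (hli (l2_shift hl.z2 _) (b, i)) (hli hl.w2 b) (hli hl.z2 (b,i)) h⁻¹ (-h⁻¹)
    have ag : ∀ x, h⁻¹ * w (x + h • es s) b + -h⁻¹ * w x b = dq h s w x b := fun x => by
      simp [dq]; ring
    have aq : ∀ x, h⁻¹ * z (x + h • es s) (b, i) + -h⁻¹ * z x (b, i) = dq h s z x (b, i) := fun x => by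
      simp [dq]; ring
    simp only [ag, aq] at ad
    have ai := ad.mulc (hli (l2_dq hl.w2 h s) b) (hli (l2_dq hl.z2 h s) (b, i)) aw hc hmem
    exact ai
  set φ : Ev → WW N := fun x => h⁻¹ • (V x - V (x + (-(h • es s)))) with am
  set ζ : Ev → ZZ N n := fun x => h⁻¹ • (Y x - Y (x + (-(h • es s)))) with cc
  have cn : MemLp φ 2 := (ch.sub (l2_shift ch _)).const_smul h⁻¹
  have gw : MemLp ζ 2 := (df.sub (l2_shift df _)).const_smul h⁻¹
  have it : WP univ φ ζ := by
    intro b i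
    have aa := kw b i
    have ab := aa.shift (-(h • es s))
    have ad := aa.lin (ab.mono (fun x _ => mem_univ _)) (hli ch b) (hli df (b,i)) (hli (l2_shift ch _) b)
      (hli (l2_shift df _) (b,i)) h⁻¹ (-h⁻¹)
    refine ad.congr_ae (aoa fun x _ => ?_) (aoa fun x _ => ?_)
    · simp only [am, PiLp.smul_apply, PiLp.sub_apply, smul_eq_mul]; ring
    · simp only [cc, PiLp.smul_apply, PiLp.sub_apply, smul_eq_mul]; ring
  have hz0 : ∀ x ∉ tsupport θ, V x = 0 ∧ Y x = 0 := by
    intro x hx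
    have ag : θ x = 0 := image_eq_zero_of_notMem_tsupport hx
    have aq : fderiv ℝ θ x = 0 := image_eq_zero_of_notMem_tsupport fun al => hx (tsupport_fderiv_subset ℝ al)
    refine ⟨by simp [dp, ag], ?_⟩
    simp only [ku, ag, aq]
    ext q; simp [tens]
  have hcK : IsCompact (tsupport θ) := hc
  have := hl.eq φ ζ cn gw it ⟨tsupport θ ∪ (fun x => x + h • es s) '' tsupport θ,
    hcK.union (hcK.image (by fun_prop)), ?_, ?_⟩
  · have el := dq_adj (Ae_l2 aj ε hl.z2) df h s
    have ek := dq_adj hl.w2 ch h s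
    have jl := dq_adj hl.d2 ch h s
    have ag : ∫ x, ⟪radA (fun t => a t + ε * t) (z x), ζ x⟫ = _ := el
    rw [ag, ek, jl] at this
    linarith
  · rintro x (hx | ⟨y, hy, rfl⟩)
    · exact (hmem x hx).1
    · exact (hmem y hy).2
  · intro x hx
    rw [mem_union, not_or] at hx
    have aa := hz0 x hx.1
    have ab := hz0 (x + -(h • es s)) fun ad => hx.2 ⟨_, ad, by simp⟩
    simp only [am, cc, aa.1, aa.2, ab.1, ab.2]
    simp

end dq

section qh

theorem pt_alg {P ε m y δ ρ ω : ℝ} (aj : 0 ≤ P) (ae : 0 < ε) (aa : ε ≤ 1) (hm : 0 ≤ m) (hy : 0 ≤ y)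
    (hd : 0 ≤ δ) (hym : y ≤ m + δ) (lr : 0 ≤ ω) (kj : ω ≤ y + ρ) :
    (4 * P / (1 + m) + 2 * ε) * ω ^ 2 ≤ (8 * P + 4) * (y + ε * y ^ 2 + ρ ^ 2 + ε⁻¹ * δ ^ 2) := by
  have ag : ω ^ 2 ≤ 2 * y ^ 2 + 2 * ρ ^ 2 := by nlinarith [sq_nonneg (y - ρ)]
  have aq : y * δ ≤ ε * y ^ 2 + ε⁻¹ * δ ^ 2 := by
    have : ε * ε⁻¹ = 1 := mul_inv_cancel₀ ae.ne'
    have hi : 0 < ε⁻¹ := inv_pos.2 ae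
    have : ε * y ^ 2 + ε⁻¹ * δ ^ 2 - 2 * (y * δ) = ε * (y - ε⁻¹ * δ) ^ 2 := by
      have cf : ε * (y - ε⁻¹ * δ) ^ 2 = ε * y ^ 2 - 2 * (ε * ε⁻¹) * (y * δ) + (ε * ε⁻¹) * ε⁻¹ * δ ^ 2 := by ring
      rw [cf, this]; ring
    nlinarith [mul_nonneg ae.le (sq_nonneg (y - ε⁻¹ * δ)), mul_nonneg hy hd]
  have hb : (1 + m)⁻¹ ≤ 1 := inv_le_one_of_one_le₀ (by linarith)
  have hb0 : 0 < (1 + m)⁻¹ := by positivity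
  have gf : (1 + m)⁻¹ * y ^ 2 ≤ y + y * δ := by
    rw [inv_mul_le_iff₀ (by linarith)]
    nlinarith [mul_nonneg hy hm, mul_nonneg (mul_nonneg hy hm) hd]
  have jj : (1 + m)⁻¹ * ω ^ 2 ≤ 2 * (y + ε * y ^ 2 + ρ ^ 2 + ε⁻¹ * δ ^ 2) := by
    nlinarith [sq_nonneg ρ, mul_le_mul_of_nonneg_left ag hb0.le]
  have hi : 0 ≤ ε⁻¹ * δ ^ 2 := by positivity
  have lj : ε * ω ^ 2 ≤ 2 * (y + ε * y ^ 2 + ρ ^ 2 + ε⁻¹ * δ ^ 2) := by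
    nlinarith [sq_nonneg ρ, mul_le_mul_of_nonneg_left ag ae.le, mul_le_of_le_one_left (sq_nonneg ρ) aa]
  rw [div_eq_mul_inv]
  nlinarith [mul_le_mul_of_nonneg_left jj aj]

theorem pt_main {f a : ℝ → ℝ} {L M : ℝ} (aj : Prof f a L M) {ε : ℝ} (ae : 0 ≤ ε) {h : ℝ}
    (X Y T : ZZ N n) {e c o : ℝ} (hc : 0 ≤ c) (hT : ‖T‖ ^ 2 ≤ 4 * e ^ 2 * c * o ^ 2) :
    0 ≤ ⟪h⁻¹ • (radA (fun t => a t + ε * t) X - radA (fun t => a t + ε * t) Y), h⁻¹ • (X - Y)⟫ ∧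
    -⟪h⁻¹ • (radA (fun t => a t + ε * t) X - radA (fun t => a t + ε * t) Y), T⟫ ≤
      1 / 2 * (e ^ 2 * ⟪h⁻¹ • (radA (fun t => a t + ε * t) X - radA (fun t => a t + ε * t) Y), h⁻¹ • (X - Y)⟫)
      + 2 * c * ((4 * (L + M) / (1 + min ‖X‖ ‖Y‖) + 2 * ε) * o ^ 2) := by
  have aa := aj.cocoer ae X Y
  have bc := aj.Lpos
  have ck := aj.Mpos
  have hmin : 0 ≤ min ‖X‖ ‖Y‖ := le_min (norm_nonneg _) (norm_nonneg _)
  have hnn : 0 ≤ ⟪radA (fun t => a t + ε * t) X - radA (fun t => a t + ε * t) Y, X - Y⟫ := by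
    have lk := aj.inner_nonneg X Y
    rw [radA_add_eps, radA_add_eps, show radA a X + ε • X - (radA a Y + ε • Y) =
      (radA a X - radA a Y) + ε • (X - Y) by module, inner_add_left, real_inner_smul_left,
      real_inner_self_eq_norm_sq]
    positivity
  set Λ := 4 * (L + M) / (1 + min ‖X‖ ‖Y‖) + 2 * ε
  have jp : 0 ≤ Λ := by positivity
  set D := radA (fun t => a t + ε * t) X - radA (fun t => a t + ε * t) Y
  have hq : ⟪h⁻¹ • D, h⁻¹ • (X - Y)⟫ = h⁻¹ ^ 2 * ⟪D, X - Y⟫ := by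
    rw [real_inner_smul_left, inner_smul_right]; ring
  have hqn : 0 ≤ ⟪h⁻¹ • D, h⁻¹ • (X - Y)⟫ := by rw [hq]; positivity
  refine ⟨hqn, ?_⟩
  have ab : ‖h⁻¹ • D‖ ^ 2 ≤ Λ * ⟪h⁻¹ • D, h⁻¹ • (X - Y)⟫ := by
    rw [hq, norm_smul, mul_pow, norm_eq_abs, sq_abs]
    nlinarith [mul_le_mul_of_nonneg_left aa (sq_nonneg h⁻¹)]
  set q := ⟪h⁻¹ • D, h⁻¹ • (X - Y)⟫
  refine (neg_le_abs _).trans ((abs_real_inner_le_norm _ _).trans ?_)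
  refine abs_le_of_sq_le_sq' ?_ (by positivity) |>.2
  have ad : ‖h⁻¹ • D‖ ^ 2 * ‖T‖ ^ 2 ≤ (Λ * q) * (4 * e ^ 2 * c * o ^ 2) :=
    mul_le_mul ab hT (by positivity) (by positivity)
  rw [mul_pow]
  nlinarith [sq_nonneg (1 / 2 * (e ^ 2 * q) - 2 * c * (Λ * o ^ 2))]

noncomputable def zs (s : Fin n) (Z : ZZ N n) : WW N := WithLp.toLp 2 fun b => Z (b, s)

theorem zs_norm (s : Fin n) (Z : ZZ N n) : ‖zs s Z‖ ≤ ‖Z‖ := by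
  refine abs_le_of_sq_le_sq' ?_ (norm_nonneg _) |>.2
  rw [norm_sq_eq, norm_sq_eq, Fintype.sum_prod_type]
  refine sum_le_sum fun b _ => ?_
  exact Finset.single_le_sum (f := fun i => ‖Z (b, i)‖ ^ 2) (fun i _ => sq_nonneg _) (Finset.mem_univ s)

theorem zs_l2 (s : Fin n) {z : Ev → ZZ N n} (hz : MemLp z 2) : MemLp (fun x => zs s (z x)) 2 :=
  hz.of_le (toLp_meas fun b => (coord_l2 hz (b, s)).1) (aoa fun x => zs_norm s _)

theorem rho_lim {B K : Set Ev} {a : ℝ → ℝ} {ε : ℝ} {d w : Ev → WW N} {z : Ev → ZZ N n}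
    (hl : Loc B a ε d w z) {r : ℝ} (hr : 0 < r) (ay : MeasurableSet K)
    (eh : ∀ x ∈ K, closedBall x r ⊆ B) (s : Fin n) :
    Tendsto (fun h : ℝ => ∫ x in K, ‖dq h s w x - zs s (z x)‖ ^ 2) (𝓝[>] 0) (𝓝 0) := by
  have aa : ∀ h : ℝ, ∫ x in K, ‖dq h s w x - zs s (z x)‖ ^ 2 =
      ∑ b, ∫ x in K, ((w (x + h • es s) b - w x b) / h - z x (b, s)) ^ 2 := by
    intro h
    rw [← integral_finsetSum]
    · congr 1; ext x
      rw [norm_sq_eq]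
      refine sum_congr rfl fun b _ => ?_
      simp [dq, zs]; ring
    · intro b _
      have := (coord_l2 ((l2_dq hl.w2 h s).sub (zs_l2 s hl.z2)) b).integrable_sq.integrableOn (s := K)
      refine this.congr (aoa fun x => ?_)
      simp [dq, zs]; ring
  simp only [aa]
  rw [show 𝓝 (0:ℝ) = 𝓝 (∑ b : Fin N, 0) by simp]
  refine tendsto_finsetSum _ fun b _ => ?_
  exact dq_L2 (coord_int hl.w1 b) (coord_int hl.z1 (b, s)) (coord_l2 hl.z2 (b, s)) (hl.wp b s) hr ay eh

theorem trans_lim {z : Ev → ZZ N n} (hz : MemLp z 2) :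
    Tendsto (fun y : Ev => ∫ x, ‖z (x + y) - z x‖ ^ 2) (𝓝 0) (𝓝 0) := by
  have aa : ∀ y, ∫ x, ‖z (x + y) - z x‖ ^ 2 = ∑ p, ∫ x, (z (x + y) p - z x p) ^ 2 := by
    intro y
    rw [← integral_finsetSum]
    · congr 1; ext x
      rw [norm_sq_eq]
      refine sum_congr rfl fun b _ => ?_
      simp
    · intro b _
      exact (coord_l2 ((l2_shift hz y).sub hz) b).integrable_sq
  simp only [aa]
  have ab := tendsto_finsetSum Finset.univ fun (p : Fin N × Fin n) _ => trans_L2 (coord_l2 hz p)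
  rwa [Finset.sum_const_zero] at ab

theorem shift_lim (s : Fin n) : Tendsto (fun h : ℝ => h • (es s : Ev)) (𝓝[>] 0) (𝓝 0) := by
  have : Tendsto (fun h : ℝ => h • (es s : Ev)) (𝓝 0) (𝓝 ((0:ℝ) • es s)) :=
    (continuous_id.smul continuous_const).tendsto 0
  rw [zero_smul] at this
  exact this.mono_left nhdsWithin_le_nhds

structure Cut (B : Set Ev) (η : Ev → ℝ) (G r : ℝ) : Prop where
  smooth : ContDiff ℝ 1 η
  cpt : HasCompactSupport η
  le1 : ∀ x, η x ^ 2 ≤ 1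
  grad : ∀ x, ∑ i, fderiv ℝ η x (es i) ^ 2 ≤ G
  rpos : 0 < r
  sub : ∀ x ∈ tsupport η, closedBall x r ⊆ B

theorem qh_pt {f a : ℝ → ℝ} {L M : ℝ} (aj : Prof f a L M) {B : Set Ev} {η : Ev → ℝ} {G r : ℝ}
    (ax : Cut B η G r) {Ld : ℝ} (dh : 0 ≤ Ld) {ε : ℝ} (ae : 0 < ε) (aa : ε ≤ 1)
    {d w : Ev → WW N} {z : Ev → ZZ N n}
    (hd : ∀ x ∈ B, ∀ y ∈ B, ‖d x - d y‖ ≤ Ld * ‖x - y‖) (s : Fin n) {h : ℝ} (hh : 0 < h) (hhr : h < r)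
    (x : Ev) :
    1 / 2 * (η x ^ 2 * ⟪dq h s (Ae a ε z) x, dq h s z x⟫) ≤
      ⟪dq h s (Ae a ε z) x, (η x ^ 2) • dq h s z x + tens (fun i => fderiv ℝ (fun x => η x ^ 2) x (es i)) (dq h s w x)⟫
      + ⟪dq h s d x, (η x ^ 2) • dq h s w x⟫ + (tsupport η).indicator (fun x =>
      (2 * G * (8 * (L + M) + 4) + Ld) * (1 + ‖z x‖ + ε * ‖z x‖ ^ 2 + ‖dq h s w x - zs s (z x)‖ ^ 2
        + ε⁻¹ * ‖z (x + h • es s) - z x‖ ^ 2)) x := by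
  by_cases hx : x ∈ tsupport η
  swap
  · have ag : η x = 0 := image_eq_zero_of_notMem_tsupport hx
    have aq : ∀ i, fderiv ℝ (fun x => η x ^ 2) x (es i) = 0 := fun i => by
      rw [fderiv_fun_pow _ (ax.smooth.differentiable one_ne_zero x)]; simp [ag]
    rw [indicator_of_notMem hx]
    have cf : tens (fun i => fderiv ℝ (fun x => η x ^ 2) x (es i)) (dq h s w x) = 0 := by
      simp only [aq]; ext q; simp [tens]
    rw [cf]; simp [ag]
  rw [indicator_of_mem hx]
  have ak : 0 ≤ G := (sum_nonneg fun _ _ => sq_nonneg _).trans (ax.grad x)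
  have bc := aj.Lpos
  have ck := aj.Mpos
  set o := dq h s w x with ho
  have hT : ‖tens (fun i => fderiv ℝ (fun x => η x ^ 2) x (es i)) o‖ ^ 2 ≤ 4 * η x ^ 2 * G * ‖o‖ ^ 2 := by
    rw [tens_norm]
    gcongr
    have : ∀ i, fderiv ℝ (fun x => η x ^ 2) x (es i) ^ 2 = 4 * η x ^ 2 * fderiv ℝ η x (es i) ^ 2 := fun i => by
      rw [fderiv_fun_pow _ (ax.smooth.differentiable one_ne_zero x)]; simp; ring
    simp only [this, ← mul_sum]
    gcongr; exact ax.grad x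
  have hm := (pt_main aj ae.le (h := h) (z (x + h • es s)) (z x) _ ak hT).2
  set ρ := dq h s w x - zs s (z x) with au
  have hoy : ‖o‖ ≤ ‖z x‖ + ‖ρ‖ := by
    have : o = zs s (z x) + ρ := by rw [au]; abel
    rw [this]; exact (norm_add_le _ _).trans (by gcongr; exact zs_norm s _)
  have ha := pt_alg (P := L + M) (δ := ‖z (x + h • es s) - z x‖) (by positivity) ae aa
    (le_min (norm_nonneg (z (x + h • es s))) (norm_nonneg (z x))) (norm_nonneg (z x)) (norm_nonneg _) ?_
    (norm_nonneg o) hoy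
  swap
  · rw [min_def]; split_ifs
    · rw [norm_sub_rev]; exact norm_le_norm_add_norm_sub' _ _
    · have := norm_nonneg (z (x + h • es s) - z x); linarith
  have hdd : -⟪dq h s d x, (η x ^ 2) • o⟫ ≤ Ld * ‖o‖ := by
    refine (neg_le_abs _).trans ((abs_real_inner_le_norm _ _).trans ?_)
    have hb : h⁻¹ * (Ld * h) = Ld := by field_simp
    have ag : ‖dq h s d x‖ ≤ Ld := by
      have ab := hd (x + h • es s) (ax.sub x hx ?_) x (ax.sub x hx (mem_closedBall_self ax.rpos.le))
      · rw [dq, norm_smul, norm_of_nonneg (inv_pos.2 hh).le]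
        rw [add_sub_cancel_left, norm_smul, es_norm, norm_of_nonneg hh.le, mul_one] at ab
        calc _ ≤ h⁻¹ * (Ld * h) := by gcongr
          _ = Ld := hb
      · rw [mem_closedBall, dist_eq_norm, add_sub_cancel_left, norm_smul, es_norm, norm_of_nonneg hh.le]
        linarith
    have aq : ‖(η x ^ 2) • o‖ ≤ ‖o‖ := by
      rw [norm_smul, norm_of_nonneg (sq_nonneg _)]
      exact mul_le_of_le_one_left (norm_nonneg _) (ax.le1 x)
    exact mul_le_mul ag aq (norm_nonneg _) dh
  rw [inner_add_right, inner_smul_right]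
  have ks : ⟪dq h s (Ae a ε z) x, dq h s z x⟫ = ⟪h⁻¹ • (radA (fun t => a t + ε * t) (z (x + h • es s))
    - radA (fun t => a t + ε * t) (z x)), h⁻¹ • (z (x + h • es s) - z x)⟫ := rfl
  have kr : ⟪dq h s (Ae a ε z) x, tens (fun i => fderiv ℝ (fun x => η x ^ 2) x (es i)) o⟫ =
    ⟪h⁻¹ • (radA (fun t => a t + ε * t) (z (x + h • es s))
    - radA (fun t => a t + ε * t) (z x)), tens (fun i => fderiv ℝ (fun x => η x ^ 2) x (es i)) o⟫ := rfl
  rw [← ks, ← kr] at hm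
  have dy : ‖ρ‖ ≤ 1 + ‖ρ‖ ^ 2 := by nlinarith [sq_nonneg (‖ρ‖ - 1), norm_nonneg ρ]
  have hi : 0 ≤ ε⁻¹ * ‖z (x + h • es s) - z x‖ ^ 2 := by positivity
  have hi2 : 0 ≤ ε * ‖z x‖ ^ 2 := by positivity
  have f1 : Ld * ‖o‖ ≤ Ld * (1 + ‖z x‖ + ε * ‖z x‖ ^ 2 + ‖ρ‖ ^ 2 + ε⁻¹ * ‖z (x + h • es s) - z x‖ ^ 2) :=
    mul_le_mul_of_nonneg_left (by linarith) dh
  have f2 := mul_le_mul_of_nonneg_left ha (show 0 ≤ 2 * G by positivity)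
  have f3 : 0 ≤ 2 * G * (8 * (L + M) + 4) := by positivity
  linarith

theorem qh_bound {f a : ℝ → ℝ} {L M : ℝ} (aj : Prof f a L M) {B : Set Ev} {η : Ev → ℝ} {G r : ℝ}
    (ax : Cut B η G r) {Ld : ℝ} (dh : 0 ≤ Ld) : ∃ C, 0 ≤ C ∧ ∀ (ε : ℝ) (d w : Ev → WW N) (z : Ev → ZZ N n),
    0 < ε → ε ≤ 1 → Loc B a ε d w z → (∀ x ∈ B, ∀ y ∈ B, ‖d x - d y‖ ≤ Ld * ‖x - y‖) → ∀ s,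
    ∀ᶠ h in 𝓝[>] (0:ℝ), ∫ x, η x ^ 2 * ⟪dq h s (Ae a ε z) x, dq h s z x⟫ ≤
      C * (1 + (∫ x, ‖z x‖) + ε * ∫ x, ‖z x‖ ^ 2) := by
  have bc := aj.Lpos
  have ck := aj.Mpos
  have ak : 0 ≤ G := (sum_nonneg fun _ _ => sq_nonneg _).trans (ax.grad 0)
  set K := tsupport η with ay
  have eg : IsCompact K := ax.cpt
  have bw : MeasurableSet K := eg.measurableSet
  set bg := 2 * G * (8 * (L + M) + 4) + Ld with eb
  have dt : 0 ≤ bg := by positivity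
  refine ⟨2 * bg * (volume.real K + 3), by positivity, ?_⟩
  intro ε d w z ae aa hl hd s
  have cr := rho_lim hl ax.rpos bw ax.sub s
  have dm := (trans_lim hl.z2).comp (shift_lim s)
  filter_upwards [cr.eventually_lt_const one_pos, dm.eventually_lt_const ae, self_mem_nhdsWithin,
    mem_nhdsWithin_of_mem_nhds (Iio_mem_nhds ax.rpos)] with h ag aq hh hhr
  simp only [Function.comp] at aq
  have hh' : 0 < h := hh
  have aw : ContDiff ℝ 1 (fun x => η x ^ 2) := ax.smooth.pow 2
  have hts : tsupport (fun x => η x ^ 2) ⊆ K :=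
    closure_mono fun x hx => by
      simp only [Function.mem_support, ne_eq] at hx ⊢; exact fun h => hx (by simp [h])
  have hc : HasCompactSupport (fun x => η x ^ 2) := eg.of_isClosed_subset (isClosed_tsupport _) hts
  have hid := dq_identity aj hl aw hc (fun x hx => ax.sub x (hts hx)) hh' hhr s
  have jw := l2_dq (Ae_l2 aj ε hl.z2) h s
  have iz := l2_dq hl.z2 h s
  have iw := l2_dq hl.w2 h s
  have id' := l2_dq hl.d2 h s
  have bh : Integrable fun x => η x ^ 2 * ⟪dq h s (Ae a ε z) x, dq h s z x⟫ := by
    have := int_inner_l2 jw (mul_l2 aw.continuous hc iz)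
    simpa only [inner_smul_right] using this
  have bl : Integrable (fun x => ⟪dq h s (Ae a ε z) x, (η x ^ 2) • dq h s z x +
    tens (fun i => fderiv ℝ (fun x => η x ^ 2) x (es i)) (dq h s w x)⟫) := int_inner_l2 jw ((mul_l2 aw.continuous hc iz).add (tens_l2 aw hc iw))
  have cv := int_inner_l2 id' (mul_l2 aw.continuous hc iw)
  have jn := sqint (iw.sub (zs_l2 s hl.z2))
  have fu := sqint ((l2_shift hl.z2 (h • es s)).sub hl.z2)
  have jx : IntegrableOn (fun x => bg * (1 + ‖z x‖ + ε * ‖z x‖ ^ 2 + ‖dq h s w x - zs s (z x)‖ ^ 2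
        + ε⁻¹ * ‖z (x + h • es s) - z x‖ ^ 2)) K := by
    refine Integrable.const_mul ?_ _
    refine iadd (iadd (iadd (iadd ?_ hl.z1.norm.integrableOn) ((sqint hl.z2).integrableOn.const_mul ε)) jn.integrableOn)
      (fu.integrableOn.const_mul _)
    exact integrableOn_const eg.measure_lt_top.ne
  have hle := integral_mono (bh.const_mul (1 / 2)) (iadd (iadd bl cv) ((integrable_indicator_iff bw).2 jx))
    (fun x => qh_pt aj ax dh ae aa hd s hh' hhr x)
  rw [integral_const_mul, integral_add (iadd bl cv) ((integrable_indicator_iff bw).2 jx), integral_add bl cv,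
    integral_indicator bw] at hle
  have ba : 0 ≤ ε * ∫ x, ⟪dq h s w x, (η x ^ 2) • dq h s w x⟫ := by
    refine mul_nonneg ae.le (integral_nonneg fun x => ?_)
    simp only [inner_smul_right]
    exact mul_nonneg (sq_nonneg _) real_inner_self_nonneg
  have af : ∫ x in K, bg * (1 + ‖z x‖ + ε * ‖z x‖ ^ 2 + ‖dq h s w x - zs s (z x)‖ ^ 2
        + ε⁻¹ * ‖z (x + h • es s) - z x‖ ^ 2) ≤ bg * (volume.real K + (∫ x, ‖z x‖) + ε * (∫ x, ‖z x‖ ^ 2) + 1 + 1) := by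
    rw [integral_const_mul]
    refine mul_le_mul_of_nonneg_left ?_ dt
    have fz : IntegrableOn (fun _ => (1:ℝ)) K := integrableOn_const eg.measure_lt_top.ne
    have cu := hl.z1.norm.integrableOn (s := K)
    have de := (sqint hl.z2).integrableOn (s := K)
    have fa := jn.integrableOn (s := K)
    have jv := fu.integrableOn (s := K)
    simp only [Pi.sub_apply] at fa jv
    rw [integral_add (iadd (iadd (iadd fz cu) (de.const_mul ε)) fa) (jv.const_mul _),
      integral_add (iadd (iadd fz cu) (de.const_mul ε)) fa, integral_add (iadd fz cu) (de.const_mul ε),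
      integral_add fz cu, integral_const_mul, integral_const_mul]
    have ap : ∫ _ in K, (1:ℝ) = volume.real K := by simp
    have ct : ∫ x in K, ‖z x‖ ≤ ∫ x, ‖z x‖ := setIntegral_le_integral hl.z1.norm (aoa fun x => norm_nonneg _)
    have ca : ∫ x in K, ‖z x‖ ^ 2 ≤ ∫ x, ‖z x‖ ^ 2 :=
      setIntegral_le_integral (sqint hl.z2) (aoa fun x => sq_nonneg _)
    have ef : ∫ x in K, ‖z (x + h • es s) - z x‖ ^ 2 ≤ ε :=
      (setIntegral_le_integral fu (aoa fun x => sq_nonneg _)).trans aq.le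
    have ju : ε⁻¹ * ∫ x in K, ‖z (x + h • es s) - z x‖ ^ 2 ≤ 1 := by
      rw [inv_mul_le_iff₀ ae, mul_one]; exact ef
    have ly := mul_le_mul_of_nonneg_left ca ae.le
    linarith
  have eo : 0 ≤ ∫ x, ‖z x‖ := integral_nonneg fun _ => norm_nonneg _
  have en : 0 ≤ ε * ∫ x, ‖z x‖ ^ 2 := mul_nonneg ae.le (integral_nonneg fun _ => sq_nonneg _)
  have cs : 0 ≤ volume.real K := measureReal_nonneg
  have fin : bg * (volume.real K + (∫ x, ‖z x‖) + ε * (∫ x, ‖z x‖ ^ 2) + 1 + 1) ≤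
    bg * ((volume.real K + 3) * (1 + (∫ x, ‖z x‖) + ε * ∫ x, ‖z x‖ ^ 2)) :=
    mul_le_mul_of_nonneg_left (by nlinarith) dt
  linarith

end qh

section curl

theorem dq_weak {g ψ : Ev → ℝ} (hg : Integrable g) (hg2 : MemLp g 2) (bf : ContDiff ℝ 1 ψ)
    (hc : HasCompactSupport ψ) (j : Fin n) :
    Tendsto (fun h : ℝ => ∫ x, dq h j g x * ψ x) (𝓝[>] 0) (𝓝 (-∫ x, g x * fderiv ℝ ψ x (es j))) := by
  have cm : MemLp ψ 2 := bf.continuous.memLp_of_hasCompactSupport hc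
  have aa : ∀ h : ℝ, ∫ x, dq h j g x * ψ x = -∫ x, g x * (h⁻¹ * (ψ x - ψ (x + (-(h • es j))))) := by
    intro h
    have := dq_adj hg2 cm h j
    simp only [RCLike.inner_apply, conj_trivial, smul_eq_mul] at this
    rw [← neg_eq_iff_eq_neg] at this
    rw [show (fun x => dq h j g x * ψ x) = fun x => ψ x * dq h j g x by ext; ring, ← this]
    congr 1; congr 1; ext x; ring
  simp only [aa]
  refine Tendsto.neg ?_
  obtain ⟨C, ar⟩ := ContDiff.lipschitzWith_of_hasCompactSupport hc bf one_ne_zero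
  refine tendsto_integral_filter_of_dominated_convergence (fun x => ‖g x‖ * C) ?_ ?_ (hg.norm.mul_const _) ?_
  · refine Eventually.of_forall fun h => hg.1.mul ?_
    have := bf.continuous
    exact Continuous.aestronglyMeasurable (by fun_prop)
  · filter_upwards [self_mem_nhdsWithin] with h hh
    have hh' : 0 < h := hh
    refine aoa fun x => ?_
    rw [norm_mul]
    gcongr
    rw [norm_mul, norm_of_nonneg (inv_pos.2 hh').le, inv_mul_le_iff₀ hh']
    have := ar.dist_le_mul x (x + (-(h • es j)))
    rw [dist_eq_norm, dist_eq_norm] at this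
    refine this.trans ?_
    rw [sub_add_cancel_left, neg_neg, norm_smul, es_norm, norm_of_nonneg hh'.le]
    linarith
  · refine aoa fun x => Tendsto.const_mul _ ?_
    have ab := ((bf.differentiable one_ne_zero x).hasFDerivAt.hasLineDerivAt (-es j)).tendsto_slope_zero_right.neg
    rw [map_neg, neg_neg] at ab
    refine ab.congr fun h => ?_
    simp only [smul_eq_mul, smul_neg]; ring

theorem wcurl {B : Set Ev} {i j : Fin n} {w zi zj : Ev → ℝ} (aa : WD B i w zi) (ab : WD B j w zj)
    {ψ : Ev → ℝ} (bf : ContDiff ℝ 2 ψ) (hc : HasCompactSupport ψ) (hs : tsupport ψ ⊆ B) :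
    ∫ x, zi x * fderiv ℝ ψ x (es j) = ∫ x, zj x * fderiv ℝ ψ x (es i) := by
  have hd : ContDiff ℝ 1 (fderiv ℝ ψ) := bf.fderiv_right (by norm_num)
  have key : ∀ k : Fin n, ContDiff ℝ 1 (fun x => fderiv ℝ ψ x (es k)) ∧
      HasCompactSupport (fun x => fderiv ℝ ψ x (es k)) ∧ tsupport (fun x => fderiv ℝ ψ x (es k)) ⊆ B := by
    intro k
    refine ⟨hd.clm_apply contDiff_const, ?_, ?_⟩
    · exact (hc.fderiv (𝕜 := ℝ)).comp_left (g := fun l : Ev →L[ℝ] ℝ => l (es k)) (by simp)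
    · refine Subset.trans (closure_mono ?_) ((tsupport_fderiv_subset ℝ (f := ψ)).trans hs)
      intro x hx; simp only [Function.mem_support] at hx ⊢; intro ae; exact hx (by rw [ae]; simp)
  have hs2 : ∀ (k l : Fin n) x, fderiv ℝ (fun x => fderiv ℝ ψ x (es k)) x (es l) =
      fderiv ℝ (fderiv ℝ ψ) x (es l) (es k) := by
    intro k l x
    have := ((hd.differentiable one_ne_zero x).hasFDerivAt.clm_apply (hasFDerivAt_const (es k) x)).fderiv
    rw [this]; simp
  have el := aa _ (key j).1 (key j).2.1 (key j).2.2
  have ek := ab _ (key i).1 (key i).2.1 (key i).2.2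
  rw [← neg_inj, ← el, ← ek]
  congr 1; ext x
  have hsym := (bf.contDiffAt (x := x)).isSymmSndFDerivAt (by simp)
  rw [hs2, hs2, hsym]

theorem l2_approx {g : Ev → ℝ} (hg : MemLp g 2) {e : ℝ} (he : 0 < e) :
    ∃ κ : Ev → ℝ, HasCompactSupport κ ∧ ContDiff ℝ 2 κ ∧ ∫ x, (g x - κ x) ^ 2 ≤ e := by
  obtain ⟨κ, aa, ab, ad⟩ := hg.exist_eLpNorm_sub_le (by simp) (by norm_num) (Real.sqrt_pos.2 he)
  have ex : ContDiff ℝ 2 κ := ab.of_le (by norm_cast)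
  refine ⟨κ, aa, ex, ?_⟩
  have hm : MemLp (g - κ) 2 := hg.sub (ex.continuous.memLp_of_hasCompactSupport aa)
  rw [hm.eLpNorm_eq_integral_rpow_norm (by simp) (by simp), ENNReal.ofReal_le_ofReal_iff (by positivity)] at ad
  simp only [ENNReal.toReal_ofNat, Real.rpow_ofNat, Pi.sub_apply, norm_eq_abs, sq_abs] at ad
  rw [show (2:ℝ)⁻¹ = 1 / 2 by norm_num, ← Real.sqrt_eq_rpow] at ad
  exact (Real.sqrt_le_sqrt_iff he.le).1 ad

theorem curl_lin {B : Set Ev} {a : ℝ → ℝ} {ε : ℝ} {d w : Ev → WW N} {z : Ev → ZZ N n}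
    (hl : Loc B a ε d w z) {η χ g : Ev → ℝ} (hg : MemLp g 2) (di : ContDiff ℝ 1 η) (gs : HasCompactSupport η)
    (az : ContDiff ℝ 2 χ) (bq : HasCompactSupport χ) (dv : tsupport χ ⊆ B) (dw : ∀ x, |χ x| ≤ 1)
    (hgχ : ∀ x, g x ≠ 0 → χ x = 1) (dc : ∀ x, χ x ≠ 0 → η x = 1) {Q : ℝ} (i j : Fin n)
    (hi : ∀ᶠ h in 𝓝[>] (0:ℝ), ∫ x, η x ^ 2 * ‖dq h i z x‖ ^ 2 ≤ Q)
    (hj : ∀ᶠ h in 𝓝[>] (0:ℝ), ∫ x, η x ^ 2 * ‖dq h j z x‖ ^ 2 ≤ Q) (b : Fin N) :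
    Tendsto (fun h : ℝ => ∫ x, g x * (dq h j z x (b, i) - dq h i z x (b, j))) (𝓝[>] 0) (𝓝 0) := by
  have hdq : ∀ (h : ℝ) (k l : Fin n), (fun x => dq h k z x (b, l)) = dq h k (fun x => z x (b, l)) := by
    intro h k l; ext x; simp [dq]
  have hz2 := fun l : Fin n => coord_l2 hl.z2 (b, l)
  have dr : 0 ≤ Q := by
    obtain ⟨h, hh⟩ := hi.exists
    exact (integral_nonneg fun x => by positivity).trans hh
  rw [Metric.tendsto_nhds]
  intro e he
  set t := e / (4 * (Q + 1)) with ht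
  have ht0 : 0 < t := by positivity
  obtain ⟨κ, gr, ex, kk⟩ := l2_approx hg (e := t * e / 8) (by positivity)
  set ψ : Ev → ℝ := fun x => χ x * κ x with bf
  have cm : ContDiff ℝ 2 ψ := az.mul ex
  have bo : HasCompactSupport ψ := bq.mul_right
  have gj : tsupport ψ ⊆ B := (tsupport_mul_subset_left).trans dv
  have fi : ContDiff ℝ 1 ψ := cm.of_le (by norm_num)
  have bz := dq_weak (coord_int hl.z1 (b, i)) (hz2 i) fi bo j
  have ce := dq_weak (coord_int hl.z1 (b, j)) (hz2 j) fi bo i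
  have hwc := wcurl (hl.wp b i) (hl.wp b j) cm bo gj
  have ez := bz.sub ce
  rw [hwc, sub_self] at ez
  have hψl2 : MemLp ψ 2 := cm.continuous.memLp_of_hasCompactSupport bo
  filter_upwards [hi, hj, (Metric.tendsto_nhds.1 ez) (e / 4) (by positivity)] with h aa ab ad
  rw [Real.dist_eq, sub_zero] at ad ⊢
  have mi := l2_dq (hz2 i) h j
  have mj := l2_dq (hz2 j) h i
  have ii : ∀ {u v : Ev → ℝ}, MemLp u 2 → MemLp v 2 → Integrable fun x => u x * v x := fun hu hv => by
    have := int_inner_l2 hv hu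
    simpa only [RCLike.inner_apply, conj_trivial] using this
  have hdp : MemLp (fun x => g x - ψ x) 2 := hg.sub hψl2
  have mij : MemLp (fun x => dq h j (fun x => z x (b, i)) x - dq h i (fun x => z x (b, j)) x) 2 := mi.sub mj
  have hgk : Integrable (fun x => (g x - κ x) ^ 2) :=
    (hg.sub (ex.continuous.memLp_of_hasCompactSupport gr)).integrable_sq
  have eqn : ∫ x, g x * (dq h j z x (b, i) - dq h i z x (b, j)) =
      (∫ x, (g x - ψ x) * (dq h j (fun x => z x (b, i)) x - dq h i (fun x => z x (b, j)) x)) +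
      ((∫ x, dq h j (fun x => z x (b, i)) x * ψ x) - ∫ x, dq h i (fun x => z x (b, j)) x * ψ x) := by
    rw [← integral_sub (ii mi hψl2) (ii mj hψl2), ← integral_add (ii hdp mij) (isub (ii mi hψl2) (ii mj hψl2))]
    congr 1; ext x
    rw [← congrFun (hdq h j i) x, ← congrFun (hdq h i j) x]
    ring
  have ib : ∀ k, Integrable (fun x => η x ^ 2 * ‖dq h k z x‖ ^ 2) := by
    intro k
    have := sqint (mul_l2 di.continuous gs (l2_dq hl.z2 h k))
    refine this.congr (aoa fun x => ?_)
    simp only [norm_smul, mul_pow, norm_eq_abs, sq_abs]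
  have hc : ∀ k l x, |dq h k (fun x => z x (b, l)) x| ≤ ‖dq h k z x‖ := by
    intro k l x
    rw [← congrFun (hdq h k l) x]
    exact norm_apply_le (dq h k z x) (b, l)
  have bd : |∫ x, (g x - ψ x) * (dq h j (fun x => z x (b, i)) x - dq h i (fun x => z x (b, j)) x)| ≤
      ∫ x, (2 * t⁻¹ * (g x - κ x) ^ 2 + t / 4 * (η x ^ 2 * ‖dq h i z x‖ ^ 2 + η x ^ 2 * ‖dq h j z x‖ ^ 2)) := by
    rw [← norm_eq_abs]
    refine norm_integral_le_of_norm_le ?_ (aoa fun x => ?_)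
    · refine iadd (hgk.const_mul _) ((iadd (ib i) (ib j)).const_mul _)
    · by_cases hx : g x - ψ x = 0
      · rw [hx]; simp only [zero_mul, norm_zero]; positivity
      have dj : η x = 1 := by
        by_contra al
        have da : χ x = 0 := by by_contra cy; exact al (dc x cy)
        have cy : g x = 0 := by by_contra cy; have := hgχ x cy; rw [da] at this; norm_num at this
        exact hx (by simp [bf, da, cy])
      have hle : |g x - ψ x| ≤ |g x - κ x| := by
        by_cases cy : g x = 0
        · rw [cy]; simp only [bf, zero_sub, abs_neg, abs_mul]
          exact mul_le_of_le_one_left (abs_nonneg _) (dw x)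
        · simp [bf, hgχ x cy]
      rw [dj, norm_eq_abs, abs_mul]
      have jg := (abs_sub (dq h j (fun x => z x (b, i)) x) (dq h i (fun x => z x (b, j)) x)).trans
        (add_le_add (hc j i x) (hc i j x))
      refine (mul_le_mul hle jg (abs_nonneg _) (abs_nonneg _)).trans ?_
      rw [← sq_abs (g x - κ x)]
      set p := |g x - κ x|
      set A := ‖dq h i z x‖
      set A' := ‖dq h j z x‖
      have : 2 * t⁻¹ * p ^ 2 + t / 4 * (1 ^ 2 * A ^ 2 + 1 ^ 2 * A' ^ 2) - p * (A' + A) =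
        t⁻¹ * ((p - t / 2 * A) ^ 2 + (p - t / 2 * A') ^ 2) := by field_simp; ring
      have me : 0 ≤ t⁻¹ * ((p - t / 2 * A) ^ 2 + (p - t / 2 * A') ^ 2) := by positivity
      linarith
  rw [integral_add (hgk.const_mul _) ((iadd (ib i) (ib j)).const_mul _),
    integral_const_mul, integral_const_mul, integral_add (ib i) (ib j)] at bd
  have ct : 2 * t⁻¹ * ∫ x, (g x - κ x) ^ 2 ≤ e / 4 := by
    calc _ ≤ 2 * t⁻¹ * (t * e / 8) := by gcongr
      _ = e / 4 := by field_simp; norm_num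
  have ca : t / 4 * ((∫ x, η x ^ 2 * ‖dq h i z x‖ ^ 2) + ∫ x, η x ^ 2 * ‖dq h j z x‖ ^ 2) ≤ e / 8 := by
    calc _ ≤ t / 4 * ((Q + 1) + (Q + 1)) := by gcongr <;> linarith
      _ = e / 8 := by rw [ht]; field_simp; norm_num
  have bd' : |∫ x, (g x - ψ x) * (dq h j (fun x => z x (b, i)) x - dq h i (fun x => z x (b, j)) x)| ≤ e / 4 + e / 8 :=
    bd.trans (add_le_add ct ca)
  rw [eqn]
  refine (abs_add_le _ _).trans_lt ?_
  linarith

theorem q_split (a : ℝ → ℝ) (ε h : ℝ) (s : Fin n) (z : Ev → ZZ N n) (x : Ev) :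
    ⟪dq h s (Ae a ε z) x, dq h s z x⟫ = h⁻¹ ^ 2 * ⟪radA a (z (x + h • es s)) - radA a (z x), z (x + h • es s) - z x⟫
      + ε * ‖dq h s z x‖ ^ 2 := by
  rw [dq, Ae, Ae, radA_add_eps, radA_add_eps, ← real_inner_self_eq_norm_sq, dq]
  set X := z (x + h • es s)
  rw [show radA a X + ε • X - (radA a (z x) + ε • z x) = (radA a X - radA a (z x)) + ε • (X - z x) by module,
    smul_add, inner_add_left]
  simp only [real_inner_smul_left, inner_smul_right]
  ring

theorem curl_est {f a : ℝ → ℝ} {L M : ℝ} (aj : Prof f a L M) {B : Set Ev} {η χ φ : Ev → ℝ} {G r : ℝ}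
    (ax : Cut B η G r) {Ld : ℝ} (dh : 0 ≤ Ld)
    (az : ContDiff ℝ 2 χ) (bq : HasCompactSupport χ) (dv : tsupport χ ⊆ B) (dw : ∀ x, |χ x| ≤ 1)
    (ew : ∀ x, φ x ≠ 0 → χ x = 1) (dc : ∀ x, χ x ≠ 0 → η x = 1)
    (am : ContDiff ℝ 1 φ) (bb : HasCompactSupport φ) :
    ∃ C, 0 ≤ C ∧ ∀ (δ ε : ℝ) (d w : Ev → WW N) (z : Ev → ZZ N n),
    0 < δ → 0 < ε → ε ≤ 1 → Loc B a ε d w z → (∀ x ∈ B, ∀ y ∈ B, ‖d x - d y‖ ≤ Ld * ‖x - y‖) → ∀ b i j,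
    |(∫ x, HH δ (z x) (b, i) * fderiv ℝ φ x (es j)) - ∫ x, HH δ (z x) (b, j) * fderiv ℝ φ x (es i)| ≤
      δ * C * (1 + (∫ x, ‖z x‖) + ε * ∫ x, ‖z x‖ ^ 2) := by
  obtain ⟨bk, km, hest⟩ := HH_est (E := ZZ N n) aj
  obtain ⟨CQ, md, hq⟩ := qh_bound (N := N) aj ax dh
  obtain ⟨Φ, fn⟩ := bb.exists_bound_of_continuous am.continuous
  have kl : 0 ≤ Φ := (norm_nonneg _).trans (fn 0)
  refine ⟨2 * Φ * bk * (1 + CQ), by positivity, ?_⟩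
  intro δ ε d w z ah ae aa hl hd b i j
  obtain ⟨mm, C, R, ar, hmm, hmR, lz, bv⟩ := hest δ ah
  have eo : 0 ≤ ∫ x, ‖z x‖ := integral_nonneg fun _ => norm_nonneg _
  have en : 0 ≤ ε * ∫ x, ‖z x‖ ^ 2 := mul_nonneg ae.le (integral_nonneg fun _ => sq_nonneg _)
  set S := 1 + (∫ x, ‖z x‖) + ε * ∫ x, ‖z x‖ ^ 2 with af
  have hq' := fun s => hq ε d w z ae aa hl hd s
  have di : Continuous η := ax.smooth.continuous
  have fv : ∀ x, |φ x| ≤ Φ * η x ^ 2 := by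
    intro x
    by_cases hx : φ x = 0
    · rw [hx, abs_zero]; positivity
    · rw [dc x (by rw [ew x hx]; norm_num)]; simpa using fn x
  have hqi : ∀ h s, Integrable fun x => η x ^ 2 * ⟪dq h s (Ae a ε z) x, dq h s z x⟫ := by
    intro h s
    have := int_inner_l2 (mul_l2 di ax.cpt (l2_dq (Ae_l2 aj ε hl.z2) h s)) (mul_l2 di ax.cpt (l2_dq hl.z2 h s))
    refine this.congr (aoa fun x => ?_)
    simp only [real_inner_smul_left, inner_smul_right]; ring
  have hqz : ∀ h s x, ε * ‖dq h s z x‖ ^ 2 ≤ ⟪dq h s (Ae a ε z) x, dq h s z x⟫ := by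
    intro h s x
    rw [q_split]
    have := aj.inner_nonneg (z (x + h • es s)) (z x)
    have : 0 ≤ h⁻¹ ^ 2 * ⟪radA a (z (x + h • es s)) - radA a (z x), z (x + h • es s) - z x⟫ := by positivity
    linarith
  have hzQ : ∀ s, ∀ᶠ h in 𝓝[>] (0:ℝ), ∫ x, η x ^ 2 * ‖dq h s z x‖ ^ 2 ≤ ε⁻¹ * (CQ * S) := by
    intro s
    filter_upwards [hq' s] with h hh
    rw [← inv_mul_le_iff₀ (inv_pos.2 ae), inv_inv, ← integral_const_mul]
    refine (integral_mono_of_nonneg (aoa fun x => by positivity) (hqi h s) (aoa fun x => ?_)).trans hh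
    have := mul_le_mul_of_nonneg_left (hqz h s x) (sq_nonneg (η x))
    simp only; linarith
  have kd : ∀ l : Fin n, AEStronglyMeasurable (fun x => HH δ (z x) (b, l)) volume := fun l =>
    ((EuclideanSpace.proj (𝕜 := ℝ) (b, l)).continuous.comp (HH_contDiff δ).continuous).comp_aestronglyMeasurable hl.z2.1
  have hHle : ∀ (l : Fin n) x, ‖HH δ (z x) (b, l)‖ ≤ ‖z x‖ := fun l x =>
    (norm_apply_le (HH δ (z x)) (b, l)).trans (HH_norm_le _ _)
  have fp : ∀ l : Fin n, Integrable fun x => HH δ (z x) (b, l) := fun l =>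
    hl.z1.mono (kd l) (aoa fun x => hHle l x)
  have er : ∀ l : Fin n, MemLp (fun x => HH δ (z x) (b, l)) 2 := fun l =>
    hl.z2.of_le (kd l) (aoa fun x => hHle l x)
  have cn : MemLp φ 2 := am.continuous.memLp_of_hasCompactSupport bb
  have hg2 : MemLp (fun x => φ x * mm (z x)) 2 := by
    refine cn.of_le_mul (c := R) (cn.1.mul (hmm.comp_aestronglyMeasurable hl.z2.1)) (aoa fun x => ?_)
    rw [norm_mul, mul_comm]; gcongr; exact hmR _
  have ii : ∀ {u v : Ev → ℝ}, MemLp u 2 → MemLp v 2 → Integrable fun x => u x * v x := fun hu hv => by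
    have := int_inner_l2 hv hu
    simpa only [RCLike.inner_apply, conj_trivial] using this
  have hdz : ∀ h k l, MemLp (fun x => dq h k z x (b, l)) 2 := fun h k l => coord_l2 (l2_dq hl.z2 h k) (b, l)
  have herr : ∀ k l : Fin n, ∀ᶠ h in 𝓝[>] (0:ℝ),
      |∫ x, (dq h k (fun x => HH δ (z x) (b, l)) x * φ x - (φ x * mm (z x)) * dq h k z x (b, l))| ≤
      Φ * (C * h * ε⁻¹ * (CQ * S) + δ * bk * ((∫ x, ‖z x‖) + CQ * S)) := by
    intro k l
    filter_upwards [hq' k, self_mem_nhdsWithin] with h hh hpos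
    have hpos' : 0 < h := hpos
    have hsh : ∫ x, ‖z (x + h • es k)‖ = ∫ x, ‖z x‖ := integral_add_right_eq_self (fun x => ‖z x‖) _
    have hsi : Integrable fun x => ‖z (x + h • es k)‖ := hl.z1.norm.comp_add_right _
    rw [← norm_eq_abs]
    refine (norm_integral_le_of_norm_le (g := fun x => Φ * (C * h * ε⁻¹ *
      (η x ^ 2 * ⟪dq h k (Ae a ε z) x, dq h k z x⟫) + δ * bk * (‖z (x + h • es k)‖ +
      η x ^ 2 * ⟪dq h k (Ae a ε z) x, dq h k z x⟫)))
      ((iadd ((hqi h k).const_mul _) ((iadd hsi (hqi h k)).const_mul _)).const_mul _) (aoa fun x => ?_)).trans ?_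
    · have hin := q_split a ε h k z x
      have hz1 := hqz h k x
      have hin0 := aj.inner_nonneg (z (x + h • es k)) (z x)
      set X := z (x + h • es k) with dn
      set q := ⟪dq h k (Ae a ε z) x, dq h k z x⟫
      have ag : dq h k (fun x => HH δ (z x) (b, l)) x * φ x - (φ x * mm (z x)) * dq h k z x (b, l) =
        φ x * (h⁻¹ * ((HH δ X - HH δ (z x) - mm (z x) • (X - z x)) (b, l))) := by
        simp only [dq, PiLp.smul_apply, PiLp.sub_apply, smul_eq_mul, ← dn]; ring
      rw [ag, norm_mul, norm_mul, norm_of_nonneg (inv_pos.2 hpos').le, norm_eq_abs]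
      have aq := (norm_apply_le (HH δ X - HH δ (z x) - mm (z x) • (X - z x)) (b, l)).trans
        (bv h hpos' X (z x))
      have cf : ‖X - z x‖ ^ 2 = h ^ 2 * ‖dq h k z x‖ ^ 2 := by
        rw [dq, norm_smul, mul_pow, norm_eq_abs, sq_abs, ← dn]; field_simp
      have gf : h⁻¹ * (C * ‖X - z x‖ ^ 2 + δ * bk * (h * ‖X‖ + h⁻¹ * ⟪radA a X - radA a (z x), X - z x⟫)) ≤
        C * h * ε⁻¹ * q + δ * bk * (‖X‖ + q) := by
        have jj : ‖dq h k z x‖ ^ 2 ≤ ε⁻¹ * q := by rw [le_inv_mul_iff₀ ae]; exact hz1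
        have lj : h⁻¹ ^ 2 * ⟪radA a X - radA a (z x), X - z x⟫ ≤ q := by
          have : 0 ≤ ε * ‖dq h k z x‖ ^ 2 := by positivity
          linarith
        calc _ = C * h * ‖dq h k z x‖ ^ 2 + δ * bk * (‖X‖ + h⁻¹ ^ 2 * ⟪radA a X - radA a (z x), X - z x⟫) := by
              rw [cf]; field_simp
          _ ≤ C * h * (ε⁻¹ * q) + δ * bk * (‖X‖ + q) := by gcongr
          _ = _ := by ring
      have dj := ax.le1 x
      have lu : 0 ≤ q := le_trans (by positivity) hz1
      calc _ ≤ Φ * η x ^ 2 * (C * h * ε⁻¹ * q + δ * bk * (‖X‖ + q)) := by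
            refine mul_le_mul (fv x) (le_trans ?_ gf) (by positivity) (by positivity)
            gcongr
        _ = Φ * (C * h * ε⁻¹ * (η x ^ 2 * q) + δ * bk * (η x ^ 2 * ‖X‖ + η x ^ 2 * q)) := by ring
        _ ≤ _ := by
          gcongr; exact mul_le_of_le_one_left (norm_nonneg _) dj
    · rw [integral_const_mul, integral_add ((hqi h k).const_mul _) ((iadd hsi (hqi h k)).const_mul _),
        integral_const_mul, integral_const_mul, integral_add hsi (hqi h k), hsh]
      gcongr
  have bz := dq_weak (fp i) (er i) am bb j
  have ce := dq_weak (fp j) (er j) am bb i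
  have ez := curl_lin hl hg2 ax.smooth ax.cpt az bq dv dw (fun x hx => ew x (left_ne_zero_of_mul hx)) dc
    i j (hzQ i) (hzQ j) b
  have hlim := (bz.sub ce).abs
  have hT : Tendsto (fun h : ℝ => 2 * (Φ * (C * h * ε⁻¹ * (CQ * S) + δ * bk * ((∫ x, ‖z x‖) + CQ * S))) +
      |∫ x, (φ x * mm (z x)) * (dq h j z x (b, i) - dq h i z x (b, j))|) (𝓝[>] 0)
      (𝓝 (2 * (Φ * (C * 0 * ε⁻¹ * (CQ * S) + δ * bk * ((∫ x, ‖z x‖) + CQ * S))) + |(0:ℝ)|)) := by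
    refine Tendsto.add ?_ ez.abs
    refine Tendsto.mono_left (Continuous.tendsto ?_ 0) nhdsWithin_le_nhds
    fun_prop
  have hfin := le_of_tendsto_of_tendsto hlim hT ?_
  · have ag : |(∫ x, HH δ (z x) (b, i) * fderiv ℝ φ x (es j)) - ∫ x, HH δ (z x) (b, j) * fderiv ℝ φ x (es i)| =
      |(-∫ x, HH δ (z x) (b, i) * fderiv ℝ φ x (es j)) - -∫ x, HH δ (z x) (b, j) * fderiv ℝ φ x (es i)| := by
      rw [← abs_neg]; congr 1; ring
    rw [ag]
    refine hfin.trans ?_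
    rw [abs_zero]
    have : (∫ x, ‖z x‖) ≤ S := by rw [af]; linarith
    calc _ = 2 * Φ * (δ * bk) * ((∫ x, ‖z x‖) + CQ * S) := by ring
      _ ≤ 2 * Φ * (δ * bk) * (S + CQ * S) := by gcongr
      _ = _ := by ring
  · filter_upwards [herr j i, herr i j] with h aa ab
    have ia : ∀ k l, Integrable fun x => dq h k (fun x => HH δ (z x) (b, l)) x * φ x := fun k l =>
      ii (l2_dq (er l) h k) cn
    have ib : ∀ k l, Integrable fun x => (φ x * mm (z x)) * dq h k z x (b, l) := fun k l => ii hg2 (hdz h k l)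
    rw [integral_sub (ia _ _) (ib _ _)] at aa ab
    have cf : ∫ x, (φ x * mm (z x)) * (dq h j z x (b, i) - dq h i z x (b, j)) =
      (∫ x, (φ x * mm (z x)) * dq h j z x (b, i)) - ∫ x, (φ x * mm (z x)) * dq h i z x (b, j) := by
      rw [← integral_sub (ib _ _) (ib _ _)]; congr 1; ext x; ring
    rw [cf]
    rw [abs_le] at aa ab
    have ad := abs_le.1 (le_refl |(∫ x, (φ x * mm (z x)) * dq h j z x (b, i)) - ∫ x, (φ x * mm (z x)) * dq h i z x (b, j)|)
    rw [abs_le]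
    constructor <;> linarith

end curl

section space

theorem l2_to_l1 {α : Type*} [MeasurableSpace α] {μ : Measure α} [IsFiniteMeasure μ] {F : Type*}
    [NormedAddCommGroup F] [InnerProductSpace ℝ F] {v : ℕ → α → F} (hv : ∀ k, MemLp (v k) 2 μ)
    (h : Tendsto (fun k => ∫ x, ‖v k x‖ ^ 2 ∂μ) atTop (𝓝 0)) :
    Tendsto (fun k => ∫ x, ‖v k x‖ ∂μ) atTop (𝓝 0) := by
  rw [Metric.tendsto_atTop]
  intro e he
  set c := μ.real univ with hc
  have hc0 : 0 ≤ c := measureReal_nonneg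
  set t := e / (2 * (c + 1)) with ht
  have ht0 : 0 < t := by positivity
  obtain ⟨ap, hk⟩ := eventually_atTop.1 (h.eventually_lt_const (show 0 < t * (e / 2) by positivity))
  refine ⟨ap, fun k hkk => ?_⟩
  have aa := hk k hkk
  rw [Real.dist_eq, sub_zero, abs_of_nonneg (integral_nonneg fun _ => norm_nonneg _)]
  have bh := (sqint (hv k)).const_mul t⁻¹
  calc ∫ x, ‖v k x‖ ∂μ ≤ ∫ x, (t + t⁻¹ * ‖v k x‖ ^ 2) ∂μ := by
        refine integral_mono_of_nonneg (aoa fun _ => norm_nonneg _) (iadd (integrable_const t) bh)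
          (aoa fun x => ?_)
        have : t + t⁻¹ * ‖v k x‖ ^ 2 - 2 * ‖v k x‖ = t⁻¹ * (t - ‖v k x‖) ^ 2 := by field_simp; ring
        have ab : 0 ≤ t⁻¹ * (t - ‖v k x‖) ^ 2 := by positivity
        have := norm_nonneg (v k x)
        simp only; linarith
    _ = c * t + t⁻¹ * ∫ x, ‖v k x‖ ^ 2 ∂μ := by
        rw [integral_add (integrable_const t) bh, integral_const_mul]; simp [hc]
    _ < c * t + t⁻¹ * (t * (e / 2)) := by gcongr
    _ ≤ e / 2 + e / 2 := by
        gcongr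
        · rw [ht]; rw [← mul_div_assoc, div_le_div_iff₀ (by positivity) (by norm_num)]; nlinarith
        · rw [inv_mul_cancel_left₀ ht0.ne']
    _ = e := by ring

theorem pair_lim {B : Set Ev} {u : ℕ → Ev → ℝ} {v θ : Ev → ℝ} (hu : ∀ k, IntegrableOn (u k) B)
    (hv : IntegrableOn v B) (hl : Tendsto (fun k => ∫ x in B, ‖u k x - v x‖) atTop (𝓝 0))
    (aw : Continuous θ) (hc : HasCompactSupport θ) (hs : tsupport θ ⊆ B) :
    Tendsto (fun k => ∫ x, u k x * θ x) atTop (𝓝 (∫ x, v x * θ x)) := by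
  obtain ⟨C, ar⟩ := hc.exists_bound_of_continuous aw
  have ag : ∀ u : Ev → ℝ, ∫ x, u x * θ x = ∫ x in B, u x * θ x := by
    intro u
    refine (setIntegral_eq_integral_of_forall_compl_eq_zero fun x hx => ?_).symm
    rw [image_eq_zero_of_notMem_tsupport (fun h => hx (hs h)), mul_zero]
  have hb : ∀ {u : Ev → ℝ}, IntegrableOn u B → IntegrableOn (fun x => u x * θ x) B := fun hu =>
    hu.mul_bdd aw.aestronglyMeasurable (aoa ar)
  simp only [ag]
  rw [tendsto_iff_norm_sub_tendsto_zero]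
  have ab := hl.mul_const C
  rw [zero_mul] at ab
  refine squeeze_zero (fun _ => norm_nonneg _) (fun k => ?_) ab
  rw [← integral_sub (hb (hu k)) (hb hv), ← integral_mul_const]
  refine norm_integral_le_of_norm_le (((hu k).sub hv).norm.mul_const C) (aoa fun x => ?_)
  rw [← sub_mul, norm_mul]
  gcongr; exact ar x

theorem wd_lim {B : Set Ev} {i : Fin n} {u v : ℕ → Ev → ℝ} {cd v' : Ev → ℝ}
    (hw : ∀ k, WD B i (u k) (v k))
    (hu : ∀ k, IntegrableOn (u k) B) (hv : ∀ k, IntegrableOn (v k) B) (hu' : IntegrableOn cd B)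
    (hv' : IntegrableOn v' B) (hlu : Tendsto (fun k => ∫ x in B, ‖u k x - cd x‖) atTop (𝓝 0))
    (hlv : Tendsto (fun k => ∫ x in B, ‖v k x - v' x‖) atTop (𝓝 0)) : WD B i cd v' := by
  intro φ aa ab ad
  have hts : tsupport (fun x => fderiv ℝ φ x (es i)) ⊆ tsupport φ := by
    refine Subset.trans (closure_mono ?_) (tsupport_fderiv_subset ℝ (f := φ))
    intro x hx; simp only [Function.mem_support] at hx ⊢; intro ae; exact hx (by rw [ae]; simp)
  have bz := pair_lim hu hu' hlu (pd_cont aa i) (pd_cpt ab i) (hts.trans ad)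
  have ce := pair_lim hv hv' hlv aa.continuous ab ad
  refine tendsto_nhds_unique bz ?_
  refine ce.neg.congr fun k => ?_
  exact (hw k φ aa ab ad).symm

noncomputable def SS (Ω : Set Ev) (ν : Measure Ev) :
    Submodule ℝ ((Ev → WW N) × (Ev → ZZ N n)) where
  carrier := {p | Integrable p.1 ∧ Integrable p.2 ∧ WP Ω p.1 p.2 ∧ MemLp p.1 2 ν ∧ MemLp p.2 2 ν}
  zero_mem' := by
    refine ⟨integrable_zero _ _ _, integrable_zero _ _ _, fun b i φ _ _ _ => by simp, MemLp.zero, MemLp.zero⟩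
  add_mem' := by
    rintro p q ⟨aa, ab, ad, ai, al⟩ ⟨ct, ca, ep, ef, ju⟩
    refine ⟨aa.add ct, ab.add ca, fun b i => ?_, ai.add ef, al.add ju⟩
    have := (ad b i).lin (ep b i) (coord_int aa b).locallyIntegrable (coord_int ab (b,i)).locallyIntegrable
      (coord_int ct b).locallyIntegrable (coord_int ca (b,i)).locallyIntegrable 1 1
    simpa using this
  smul_mem' := by
    rintro c p ⟨aa, ab, ad, ai, al⟩
    refine ⟨aa.smul c, ab.smul c, fun b i => ?_, ai.const_smul c, al.const_smul c⟩
    have := (ad b i).lin (ad b i) (coord_int aa b).locallyIntegrable (coord_int ab (b,i)).locallyIntegrable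
      (coord_int aa b).locallyIntegrable (coord_int ab (b,i)).locallyIntegrable c 0
    simpa using this

theorem SS_adm (Ω : Set Ev) (ν : Measure Ev) : Adm (volume.restrict Ω) ν (SS (N := N) Ω ν) :=
  ⟨fun _ hp => hp.2.1.integrableOn, fun _ hp => hp.2.2.2.1, fun _ hp => hp.2.2.2.2⟩

theorem SS_base {Ω : Set Ev} {ν : Measure Ev} {p} (hp : p ∈ SS (N := N) Ω ν) : p ∈ SS (N := N) Ω 0 :=
  ⟨hp.1, hp.2.1, hp.2.2.1, by simp, by simp⟩

theorem moll_bdd (k : ℕ) {u : Ev → ℝ} (hu : Integrable u) {B : Set Ev} (av : Bornology.IsBounded B)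
    (bm : MeasurableSet B) : MemLp (moll k u) 2 (volume.restrict B) := by
  have hc : Continuous (moll k u) := (moll_smooth k hu.locallyIntegrable (m := 1)).continuous
  have ay : IsCompact (closure B) := av.isCompact_closure
  obtain ⟨C, ar⟩ := ay.exists_bound_of_continuousOn hc.continuousOn
  haveI : IsFiniteMeasure (volume.restrict B) := ⟨by simpa using av.measure_lt_top⟩
  refine MemLp.of_bound hc.aestronglyMeasurable C ?_
  filter_upwards [ae_restrict_mem bm] with x hx using ar x (subset_closure hx)

theorem toLp_l2 {κ : Type*} [Fintype κ] {μ : Measure Ev} {g : Ev → κ → ℝ}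
    (hg : ∀ a, MemLp (fun x => g x a) 2 μ) : MemLp (fun x => (WithLp.toLp 2 (g x) : EuclideanSpace ℝ κ)) 2 μ := by
  have h := memLp_finsetSum Finset.univ (f := fun a x => |g x a|) (fun a _ => (hg a).abs)
  refine h.of_le (toLp_meas fun a => (hg a).1) (aoa fun x => ?_)
  have ae : 0 ≤ ∑ a, |g x a| := sum_nonneg fun _ _ => abs_nonneg _
  rw [norm_of_nonneg ae]
  refine abs_le_of_sq_le_sq' ?_ ae |>.2
  rw [norm_sq_eq]
  simpa using Finset.sum_sq_le_sq_sum_of_nonneg (s := Finset.univ) (f := fun a => |g x a|) fun _ _ => abs_nonneg _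

end space

section dens

theorem norm_le_abs_sum {κ : Type*} [Fintype κ] (z : EuclideanSpace ℝ κ) : ‖z‖ ≤ ∑ a, |z a| := by
  refine abs_le_of_sq_le_sq' ?_ (sum_nonneg fun _ _ => abs_nonneg _) |>.2
  rw [norm_sq_eq]
  simpa using Finset.sum_sq_le_sq_sum_of_nonneg (s := Finset.univ) (f := fun a => |z a|) fun _ _ => abs_nonneg _

theorem toLp_int {κ : Type*} [Fintype κ] {μ : Measure Ev} {g : Ev → κ → ℝ}
    (hg : ∀ a, Integrable (fun x => g x a) μ) : Integrable (fun x => (WithLp.toLp 2 (g x) : EuclideanSpace ℝ κ)) μ :=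
  (integrable_finsetSum Finset.univ (f := fun a x => |g x a|) fun a _ => (hg a).abs).mono'
    (toLp_meas fun a => (hg a).1) (aoa fun x => norm_le_abs_sum _)

theorem WD_moll (k : ℕ) {Ω : Set Ev} {i : Fin n} {u v : Ev → ℝ} (hu : LocallyIntegrable u)
    (hv : LocallyIntegrable v) (h : WD Ω i u v) :
    WD {x | closedBall x (1/((k:ℝ)+1)) ⊆ Ω} i (moll k u) (moll k v) := by
  intro φ aa ab ad
  have ey := moll_smooth k hu (m := 1)
  have ls : Continuous (moll k v) := (moll_smooth k hv (m := 1)).continuous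
  have fh := pd_cont ey i
  rw [integral_mul_fderiv_eq_neg_fderiv_mul_of_integrable]
  · congr 1
    refine integral_congr_ae (aoa fun x => ?_)
    by_cases hx : x ∈ tsupport φ
    · simp only [moll_fderiv k hu h (ad hx)]
    · simp [image_eq_zero_of_notMem_tsupport hx]
  · exact (fh.mul aa.continuous).integrable_of_hasCompactSupport ab.mul_left
  · exact (ey.continuous.mul (pd_cont aa i)).integrable_of_hasCompactSupport (pd_cpt ab i).mul_left
  · exact (ey.continuous.mul aa.continuous).integrable_of_hasCompactSupport ab.mul_left
  · exact fun x _ => ey.differentiable (by simp) x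
  · exact fun x _ => aa.differentiable (by simp) x

noncomputable def sm1 (k : ℕ) (χ u : Ev → ℝ) (x : Ev) : ℝ := u x + χ x * (moll k u x - u x)
noncomputable def sm2 (k : ℕ) (i : Fin n) (χ u v : Ev → ℝ) (x : Ev) : ℝ :=
  v x + (χ x * (moll k v x - v x) + fderiv ℝ χ x (es i) * (moll k u x - u x))

theorem int_mul_bc {u φ : Ev → ℝ} (hu : Integrable u) (am : Continuous φ) (hc : HasCompactSupport φ) :
    Integrable (fun x => φ x * u x) := by
  simpa only [mul_comm] using int_mul_cc hu.locallyIntegrable am hc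

theorem sm_int (k : ℕ) (i : Fin n) {χ u v : Ev → ℝ} (hu : Integrable u) (hv : Integrable v)
    (az : ContDiff ℝ 1 χ) (hc : HasCompactSupport χ) : Integrable (sm1 k χ u) ∧ Integrable (sm2 k i χ u v) :=
  ⟨hu.add (int_mul_bc ((moll_int k hu).sub hu) az.continuous hc),
    hv.add ((int_mul_bc ((moll_int k hv).sub hv) az.continuous hc).add
      (int_mul_bc ((moll_int k hu).sub hu) (pd_cont az i) (pd_cpt hc i)))⟩

theorem sm_wd (k : ℕ) {Ω : Set Ev} {i : Fin n} {χ u v : Ev → ℝ} (hu : Integrable u) (hv : Integrable v)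
    (h : WD Ω i u v) (az : ContDiff ℝ 1 χ) (hc : HasCompactSupport χ)
    (hs : tsupport χ ⊆ {x | closedBall x (1/((k:ℝ)+1)) ⊆ Ω}) :
    WD Ω i (sm1 k χ u) (sm2 k i χ u v) := by
  have aa := WD_moll k hu.locallyIntegrable hv.locallyIntegrable h
  have hsub : {x | closedBall x (1/((k:ℝ)+1)) ⊆ Ω} ⊆ Ω := fun x hx =>
    hx (mem_closedBall_self (by positivity))
  have il := (moll_int k hu)
  have ik := (moll_int k hv)
  have ab := aa.lin (h.mono hsub) il.locallyIntegrable ik.locallyIntegrable hu.locallyIntegrable hv.locallyIntegrable 1 (-1)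
  have bz := (iadd (il.const_mul 1) (hu.const_mul (-1)))
  have ce := (iadd (ik.const_mul 1) (hv.const_mul (-1)))
  have ad := (ab.mulc bz.locallyIntegrable ce.locallyIntegrable az hc hs).mono (subset_univ Ω)
  have ai := h.lin ad hu.locallyIntegrable hv.locallyIntegrable
    (int_mul_bc bz az.continuous hc).locallyIntegrable
    (iadd (int_mul_bc ce az.continuous hc) (int_mul_bc bz (pd_cont az i) (pd_cpt hc i))).locallyIntegrable 1 1
  convert ai using 2
  · simp only [sm1]; ring
  · simp only [sm2]; ring

theorem sm_lim (i : Fin n) {χ u v : Ev → ℝ} (hu : Integrable u) (hv : Integrable v)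
    (az : ContDiff ℝ 1 χ) (hc : HasCompactSupport χ) :
    Tendsto (fun k => ∫ x, |sm2 k i χ u v x - v x|) atTop (𝓝 0) := by
  obtain ⟨C, ar⟩ := hc.exists_bound_of_continuous az.continuous
  obtain ⟨D, cb⟩ := (pd_cpt hc i).exists_bound_of_continuous (pd_cont az i)
  have h := ((moll_L1 hv).const_mul C).add ((moll_L1 hu).const_mul D)
  simp only [mul_zero, add_zero] at h
  refine squeeze_zero (fun _ => integral_nonneg fun _ => abs_nonneg _) (fun k => ?_) h
  have el : Integrable fun x => C * ‖moll k v x - v x‖ := ((moll_int k hv).sub hv).norm.const_mul C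
  have ek : Integrable fun x => D * ‖moll k u x - u x‖ := ((moll_int k hu).sub hu).norm.const_mul D
  rw [← integral_const_mul, ← integral_const_mul, ← integral_add el ek]
  refine integral_mono_of_nonneg (aoa fun _ => abs_nonneg _) (iadd el ek) (aoa fun x => ?_)
  simp only [sm2, add_sub_cancel_left]
  refine (abs_add_le _ _).trans ?_
  rw [abs_mul, abs_mul]
  exact add_le_add (mul_le_mul_of_nonneg_right (ar x) (abs_nonneg _))
    (mul_le_mul_of_nonneg_right (cb x) (abs_nonneg _))

theorem dens {Ω : Set Ev} (hΩ : IsOpen Ω) {x0 : Ev} {R : ℝ} (bt : 0 < R) (av : closedBall x0 R ⊆ Ω)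
    {q : (Ev → WW N) × (Ev → ZZ N n)} (hq : q ∈ SS (N := N) Ω 0) {e : ℝ} (he : 0 < e) :
    ∃ kt ∈ SS (N := N) Ω (volume.restrict (ball x0 R)), ∫ x in Ω, ‖kt.2 x - q.2 x‖ ≤ e := by
  obtain ⟨hq1, hq2, hq3, -, -⟩ := hq
  obtain ⟨r, hr, hrs⟩ := (isCompact_closedBall x0 R).exists_cthickening_subset_open hΩ av
  have hth := cthickening_closedBall (x := x0) hr.le bt.le
  rw [hth] at hrs
  let χ : ContDiffBump x0 := ⟨R, R + r / 2, bt, by linarith⟩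
  have az : ContDiff ℝ 1 χ := χ.contDiff
  have bq := χ.hasCompactSupport
  have hlim : Tendsto (fun k => ∑ p : Fin N × Fin n, ∫ x, |sm2 k p.2 χ (fun x => q.1 x p.1) (fun x => q.2 x p) x - q.2 x p|)
      atTop (𝓝 (∑ p : Fin N × Fin n, 0)) :=
    tendsto_finsetSum _ fun p _ => sm_lim p.2 (coord_int hq1 p.1) (coord_int hq2 p) az bq
  rw [Finset.sum_const_zero] at hlim
  obtain ⟨k, hk1, hk2⟩ := ((hlim.eventually_lt_const he).and
    (tendsto_one_div_add_atTop_nhds_zero_nat.eventually_lt_const (half_pos hr))).exists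
  have hs : tsupport χ ⊆ {x | closedBall x (1/((k:ℝ)+1)) ⊆ Ω} := by
    rw [χ.tsupport_eq]
    intro x hx
    refine Subset.trans (Metric.closedBall_subset_closedBall' ?_) hrs
    rw [mem_closedBall] at hx
    change dist x x0 ≤ R + r/2 at hx
    linarith
  have bj := fun p : Fin N × Fin n => sm_int k p.2 (coord_int hq1 p.1) (coord_int hq2 p) az bq
  have jd : ∀ b, Integrable (sm1 k χ (fun x => q.1 x b)) := fun b =>
    (coord_int hq1 b).add (int_mul_bc ((moll_int k (coord_int hq1 b)).sub (coord_int hq1 b)) az.continuous bq)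
  have hbm : MeasurableSet (ball x0 R) := measurableSet_ball
  have hone : ∀ x ∈ ball x0 R, χ x = 1 ∧ ∀ i, fderiv ℝ χ x (es i) = 0 := by
    intro x hx
    refine ⟨χ.one_of_mem_closedBall (ball_subset_closedBall hx), fun i => ?_⟩
    have : (χ : Ev → ℝ) =ᶠ[𝓝 x] fun _ => 1 := by
      filter_upwards [isOpen_ball.mem_nhds hx] with y hy using
        χ.one_of_mem_closedBall (ball_subset_closedBall hy)
    rw [this.fderiv_eq]; simp
  refine ⟨(fun x => WithLp.toLp 2 fun b => sm1 k χ (fun x => q.1 x b) x,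
    fun x => WithLp.toLp 2 fun p => sm2 k p.2 χ (fun x => q.1 x p.1) (fun x => q.2 x p) x),
    ⟨toLp_int jd, toLp_int fun p => (bj p).2, fun b i => ?_, toLp_l2 fun b => ?_, toLp_l2 fun p => ?_⟩, ?_⟩
  · exact sm_wd k (coord_int hq1 b) (coord_int hq2 (b,i)) (hq3 b i) az bq hs
  · refine (moll_bdd k (coord_int hq1 b) isBounded_ball hbm).ae_eq ?_
    filter_upwards [ae_restrict_mem hbm] with x hx
    simp [sm1, (hone x hx).1]
  · refine (moll_bdd k (coord_int hq2 p) isBounded_ball hbm).ae_eq ?_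
    filter_upwards [ae_restrict_mem hbm] with x hx
    simp [sm2, (hone x hx).1, (hone x hx).2]
  · have hi : ∀ p : Fin N × Fin n, Integrable (fun x => |sm2 k p.2 χ (fun x => q.1 x p.1) (fun x => q.2 x p) x - q.2 x p|) :=
      fun p => ((bj p).2.sub (coord_int hq2 p)).abs
    refine le_trans ?_ hk1.le
    rw [← integral_finsetSum _ fun p _ => hi p]
    refine le_trans (setIntegral_le_integral ?_ (aoa fun _ => norm_nonneg _)) ?_
    · exact ((toLp_int fun p => (bj p).2).sub hq2).norm
    · refine integral_mono ((toLp_int fun p => (bj p).2).sub hq2).norm (integrable_finsetSum _ fun p _ => hi p) fun x => ?_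
      refine (norm_le_abs_sum _).trans (le_of_eq ?_)
      simp

end dens

section reg

theorem l2_inner_lim {α : Type*} [MeasurableSpace α] {μ : Measure α} {F : Type*} [NormedAddCommGroup F]
    [InnerProductSpace ℝ F] {u : ℕ → α → F} {v q : α → F} (hu : ∀ k, MemLp (u k) 2 μ) (hv : MemLp v 2 μ)
    (hq : MemLp q 2 μ) (h : Tendsto (fun k => ∫ x, ‖u k x - v x‖ ^ 2 ∂μ) atTop (𝓝 0)) :
    Tendsto (fun k => ∫ x, ⟪u k x, q x⟫ ∂μ) atTop (𝓝 (∫ x, ⟪v x, q x⟫ ∂μ)) := by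
  set Q := ∫ x, ‖q x‖ ^ 2 ∂μ with dr
  have kz : 0 ≤ Q := integral_nonneg fun _ => by positivity
  rw [Metric.tendsto_atTop]
  intro e he
  set t := e / (2 * (Q + 1)) with ht
  have ht0 : 0 < t := by positivity
  obtain ⟨ap, hk⟩ := eventually_atTop.1 (h.eventually_lt_const (show 0 < t * (e / 2) by positivity))
  refine ⟨ap, fun k hkk => ?_⟩
  have bh : Integrable (fun x => t⁻¹ * ‖u k x - v x‖ ^ 2) μ := (sqint ((hu k).sub hv)).const_mul t⁻¹
  have bl := (sqint hq).const_mul t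
  rw [Real.dist_eq, ← integral_sub (int_inner_l2 (hu k) hq) (int_inner_l2 hv hq), ← norm_eq_abs]
  calc _ ≤ ∫ x, (t⁻¹ * ‖u k x - v x‖ ^ 2 + t * ‖q x‖ ^ 2) ∂μ := by
        refine norm_integral_le_of_norm_le (iadd bh bl) (aoa fun x => ?_)
        rw [← inner_sub_left]
        refine (norm_inner_le_norm _ _).trans ?_
        have : t⁻¹ * ‖u k x - v x‖ ^ 2 + t * ‖q x‖ ^ 2 - 2 * (‖u k x - v x‖ * ‖q x‖) = t⁻¹ * (‖u k x - v x‖ - t * ‖q x‖) ^ 2 := by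
          field_simp; ring
        have ab : 0 ≤ t⁻¹ * (‖u k x - v x‖ - t * ‖q x‖) ^ 2 := by positivity
        have ad : 0 ≤ ‖u k x - v x‖ * ‖q x‖ := by positivity
        linarith
    _ = t⁻¹ * (∫ x, ‖u k x - v x‖ ^ 2 ∂μ) + t * Q := by
        rw [integral_add bh bl, integral_const_mul, integral_const_mul]
    _ < t⁻¹ * (t * (e / 2)) + t * Q := by have := hk k hkk; gcongr
    _ ≤ e / 2 + e / 2 := by
        gcongr
        · rw [inv_mul_cancel_left₀ ht0.ne']
        · rw [ht, div_mul_eq_mul_div, div_le_div_iff₀ (by positivity) (by norm_num)]; nlinarith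
    _ = e := by ring

theorem JJ_split (f : ℝ → ℝ) (μ ν : Measure Ev) (T : Ev → ZZ N n) (ε : ℝ)
    (p : (Ev → WW N) × (Ev → ZZ N n)) :
    JJ f μ ν T ε p = JJ f μ 0 T 0 p + ε / 2 * ∫ x, (‖p.2 x‖ ^ 2 + ‖p.1 x‖ ^ 2) ∂ν := by simp [JJ]

def BP (Ω : Set Ev) (T : Ev → ZZ N n) (d : Ev → WW N) : Prop :=
  ∀ (φ : Ev → WW N) (ζ : Ev → ZZ N n), MemLp φ 2 → MemLp ζ 2 → WP univ φ ζ →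
    (∃ K, IsCompact K ∧ K ⊆ Ω ∧ ∀ x ∉ K, φ x = 0 ∧ ζ x = 0) →
    ∫ x in Ω, ⟪T x, ζ x⟫ = - ∫ x in Ω, ⟪d x, φ x⟫

theorem ind_int {B : Set Ev} (av : MeasurableSet B) {F : Type*} [NormedAddCommGroup F] [InnerProductSpace ℝ F]
    (u v : Ev → F) : ∫ x, ⟪B.indicator u x, v x⟫ = ∫ x in B, ⟪u x, v x⟫ := by
  rw [← integral_indicator av]
  congr 1; ext x
  by_cases hx : x ∈ B <;> simp [hx]

theorem set_eq {B : Set Ev} {K : Set Ev} (ay : K ⊆ B) {F : Type*} [NormedAddCommGroup F]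
    [InnerProductSpace ℝ F] {u v : Ev → F} (hv : ∀ x ∉ K, v x = 0) : ∫ x in B, ⟪u x, v x⟫ = ∫ x, ⟪u x, v x⟫ :=
  setIntegral_eq_integral_of_forall_compl_eq_zero fun x hx => by rw [hv x fun h => hx (ay h), inner_zero_right]

theorem reg_problem {Ω : Set Ev} (bs : Bornology.IsBounded Ω)
    {f a : ℝ → ℝ} {L M τ : ℝ} (hp : Prof f a L M) {T : Ev → ZZ N n}
    (hT : TOk (volume.restrict Ω) T τ) (bn : τ < M) {d : Ev → WW N} (hbp : BP Ω T d)
    {x0 : Ev} {R : ℝ} (av : closedBall x0 R ⊆ Ω)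
    (hd : MemLp ((ball x0 R).indicator d) 2) {C c : ℝ} (hc : 0 < c)
    (hcoer : ∀ p ∈ SS (N := N) Ω 0, c * ∫ x in Ω, ‖p.2 x‖ ≤ JJ f (volume.restrict Ω) 0 T 0 p + C)
    {ε : ℝ} (ba : 0 < ε) :
    ∃ (m : ℝ) (p : ℕ → (Ev → WW N) × (Ev → ZZ N n)) (g z : Ev → ZZ N n) (w : Ev → WW N),
      (∀ k, p k ∈ SS (N := N) Ω (volume.restrict (ball x0 R))) ∧
      (∀ q ∈ SS (N := N) Ω (volume.restrict (ball x0 R)), m ≤ JJ f (volume.restrict Ω) (volume.restrict (ball x0 R)) T ε q) ∧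
      Tendsto (fun k => JJ f (volume.restrict Ω) (volume.restrict (ball x0 R)) T ε (p k)) atTop (𝓝 m) ∧
      IntegrableOn g Ω ∧ ∫ x in Ω, ‖g x‖ ≤ (1 + C) / c ∧
      (∀ᵐ x ∂(volume.restrict Ω), Tendsto (fun k => (p k).2 x) atTop (𝓝 (g x))) ∧
      Loc (ball x0 R) a ε ((ball x0 R).indicator d) w z ∧
      (∀ᵐ x ∂(volume.restrict (ball x0 R)), z x = g x) ∧ (∀ x ∉ ball x0 R, z x = 0) ∧
      ε * ∫ x, ‖z x‖ ^ 2 ≤ 4 * C := by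
  set B := ball x0 R with hBdef
  have ao : B ⊆ Ω := ball_subset_closedBall.trans av
  have bm : MeasurableSet B := measurableSet_ball
  haveI : IsFiniteMeasure (volume.restrict Ω) := ⟨by simpa using bs.measure_lt_top⟩
  haveI : IsFiniteMeasure (volume.restrict B) := ⟨by simpa using isBounded_ball.measure_lt_top⟩
  have af := SS_adm (N := N) Ω (volume.restrict B)
  have hnn : ∀ p : (Ev → WW N) × (Ev → ZZ N n), 0 ≤ ∫ x in B, (‖p.2 x‖ ^ 2 + ‖p.1 x‖ ^ 2) :=
    fun p => integral_nonneg fun _ => by positivity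
  obtain ⟨m, p, g, hpS, hm, hlim, hcau, hg, hgC, hae⟩ := min_pack hp hT bn af ba.le hc (C := C) (by
    intro q hq
    have := hcoer q (SS_base hq)
    rw [JJ_split]
    have := mul_nonneg (half_pos ba).le (hnn q)
    linarith)
  have ja := hp.Lpos
  have hsum : ∀ k l, ∫ x in B, (‖(p k).2 x - (p l).2 x‖ ^ 2 + ‖(p k).1 x - (p l).1 x‖ ^ 2) ≤
      4 / ε * (1 / ((k:ℝ)+1)) + 4 / ε * (1 / ((l:ℝ)+1)) := by
    intro k l
    have aa := hcau k l
    have ab : 0 ≤ (4 * L)⁻¹ * ∫ x in Ω, ‖radA a ((p k).2 x) - radA a ((p l).2 x)‖ ^ 2 :=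
      mul_nonneg (by positivity) (integral_nonneg fun _ => by positivity)
    rw [← mul_add, div_mul_eq_mul_div, le_div_iff₀ ba]
    linarith
  have hb : Tendsto (fun k : ℕ => 4 / ε * (1 / ((k:ℝ)+1))) atTop (𝓝 0) := by
    simpa using tendsto_one_div_add_atTop_nhds_zero_nat.const_mul (4 / ε)
  have iz : ∀ k l, Integrable (fun x => ‖(p k).2 x - (p l).2 x‖ ^ 2) (volume.restrict B) := fun k l =>
    sqint ((af.l2z _ (hpS k)).sub (af.l2z _ (hpS l)))
  have iw : ∀ k l, Integrable (fun x => ‖(p k).1 x - (p l).1 x‖ ^ 2) (volume.restrict B) := fun k l =>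
    sqint ((af.l2w _ (hpS k)).sub (af.l2w _ (hpS l)))
  obtain ⟨z, hz2, hzl, ns, hns, hzae⟩ := l2lim (u := fun k => (p k).2) (fun k => af.l2z _ (hpS k)) _ hb (fun k l => by
    refine le_trans (integral_mono (iz k l) (iadd (iz k l) (iw k l)) fun x => ?_) (hsum k l)
    have := sq_nonneg ‖(p k).1 x - (p l).1 x‖
    simp only; linarith)
  obtain ⟨w, hw2, hwl, -⟩ := l2lim (u := fun k => (p k).1) (fun k => af.l2w _ (hpS k)) _ hb (fun k l => by
    refine le_trans (integral_mono (iw k l) (iadd (iz k l) (iw k l)) fun x => ?_) (hsum k l)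
    have := sq_nonneg ‖(p k).2 x - (p l).2 x‖
    simp only; linarith)
  have hzg : ∀ᵐ x ∂(volume.restrict B), z x = g x := by
    filter_upwards [hzae, ae_restrict_of_ae_restrict_of_subset ao hae] with x aa ab
    exact tendsto_nhds_unique aa (ab.comp hns.tendsto_atTop)
  have hzi := (memLp_indicator_iff_restrict bm).2 hz2
  have hwi := (memLp_indicator_iff_restrict bm).2 hw2
  have z1 := hz2.integrable (by norm_num)
  have w1 := hw2.integrable (by norm_num)
  refine ⟨m, p, g, B.indicator z, B.indicator w, hpS, hm, hlim, hg, hgC, hae, ⟨hwi, hzi, hd,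
    (integrable_indicator_iff bm).2 w1, (integrable_indicator_iff bm).2 z1, ?_, ?_⟩, ?_, ?_, ?_⟩
  · intro b i
    have cz : ∀ k, ∀ x, ‖(p k).2 x (b,i) - z x (b,i)‖ ≤ ‖(p k).2 x - z x‖ := fun k x =>
      norm_apply_le ((p k).2 x - z x) (b,i)
    have cw : ∀ k, ∀ x, ‖(p k).1 x b - w x b‖ ≤ ‖(p k).1 x - w x‖ := fun k x =>
      norm_apply_le ((p k).1 x - w x) b
    have bz := l2_to_l1 (fun k => (af.l2w _ (hpS k)).sub hw2) hwl
    have ce := l2_to_l1 (fun k => (af.l2z _ (hpS k)).sub hz2) hzl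
    have key : WD B i (fun x => w x b) (fun x => z x (b,i)) := by
      refine wd_lim (u := fun k x => (p k).1 x b) (v := fun k x => (p k).2 x (b,i)) (fun k => ((hpS k).2.2.1 b i).mono ao)
        (fun k => (coord_int (hpS k).1 b).integrableOn) (fun k => (coord_int (hpS k).2.1 (b,i)).integrableOn)
        ((EuclideanSpace.proj (𝕜 := ℝ) b).integrable_comp w1) ((EuclideanSpace.proj (𝕜 := ℝ) (b,i)).integrable_comp z1) ?_ ?_
      · refine squeeze_zero (fun _ => integral_nonneg fun _ => norm_nonneg _) (fun k => ?_) bz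
        exact integral_mono_of_nonneg (aoa fun _ => norm_nonneg _)
          (((hpS k).1.integrableOn.sub w1).norm) (aoa (cw k))
      · refine squeeze_zero (fun _ => integral_nonneg fun _ => norm_nonneg _) (fun k => ?_) ce
        exact integral_mono_of_nonneg (aoa fun _ => norm_nonneg _)
          (((hpS k).2.1.integrableOn.sub z1).norm) (aoa (cz k))
    exact key.congr_ae (aoa fun x hx => by simp [hx]) (aoa fun x hx => by simp [hx])
  · intro φ ζ am cc hwp ay
    obtain ⟨K, eg, eh, bu⟩ := ay
    have hbp' := hbp φ ζ am cc hwp ⟨K, eg, eh.trans ao, bu⟩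
    have bw := eg.measurableSet
    haveI : IsFiniteMeasure (volume.restrict K) := ⟨by simpa using eg.measure_lt_top⟩
    have hq : (φ, ζ) ∈ SS (N := N) Ω (volume.restrict B) := by
      refine ⟨?_, ?_, fun b i => (hwp b i).mono (subset_univ _), am.restrict _, cc.restrict _⟩
      · exact (integrableOn_iff_integrable_of_support_subset fun x hx => by_contra fun h => hx (bu x h).1).1
          ((am.restrict K).integrable (by norm_num))
      · exact (integrableOn_iff_integrable_of_support_subset fun x hx => by_contra fun h => hx (bu x h).2).1
          ((cc.restrict K).integrable (by norm_num))
    have dd : ∀ᵐ x ∂(volume.restrict Ω), Tendsto (fun k => radA a ((p k).2 x)) atTop (𝓝 (radA a (g x))) := by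
      filter_upwards [hae] with x hx using (hp.continuous_radA.tendsto _).comp hx
    have hcl : Tendsto (fun k => ε * ∫ x in B, (⟪(p k).2 x, ζ x⟫ + ⟪(p k).1 x, φ x⟫)) atTop
        (𝓝 (ε * ((∫ x in B, ⟪z x, ζ x⟫) + ∫ x in B, ⟪w x, φ x⟫))) := by
      refine Tendsto.const_mul ε ?_
      have := (l2_inner_lim (fun k => af.l2z _ (hpS k)) hz2 (cc.restrict B) hzl).add
        (l2_inner_lim (fun k => af.l2w _ (hpS k)) hw2 (am.restrict B) hwl)
      refine this.congr fun k => ?_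
      rw [integral_add (int_inner_l2 (af.l2z _ (hpS k)) (cc.restrict B)) (int_inner_l2 (af.l2w _ (hpS k)) (am.restrict B))]
    have ei := euler_eq hp hT af hpS hm hlim dd hq hcl
    simp only at ei
    rw [set_eq (eh.trans ao) (u := fun x => radA a (g x)) (fun x hx => (bu x hx).2),
      ← set_eq eh (u := fun x => radA a (g x)) (fun x hx => (bu x hx).2), hbp', set_eq (eh.trans ao) (u := d) (fun x hx => (bu x hx).1),
      ← set_eq eh (u := d) (fun x hx => (bu x hx).1)] at ei
    rw [ind_int bm, ind_int bm, ← set_eq eh (u := fun x => radA (fun t => a t + ε * t) (B.indicator z x)) (fun x hx => (bu x hx).2)]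
    have ag : ∫ x in B, ⟪radA (fun t => a t + ε * t) (B.indicator z x), ζ x⟫ =
        (∫ x in B, ⟪radA a (g x), ζ x⟫) + ε * ∫ x in B, ⟪z x, ζ x⟫ := by
      rw [← integral_const_mul, ← integral_add (hp.intA (hg.1.mono_measure (Measure.restrict_mono ao le_rfl)) hq.2.1.integrableOn)
        ((int_inner_l2 hz2 (cc.restrict B)).const_mul ε)]
      refine integral_congr_ae ?_
      filter_upwards [hzg, ae_restrict_mem bm] with x aa ab
      simp only [indicator_of_mem ab]
      rw [radA_add_eps, inner_add_left, real_inner_smul_left, aa]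
    rw [ag]
    linarith
  · filter_upwards [hzg, ae_restrict_mem bm] with x aa ab
    rw [indicator_of_mem ab, aa]
  · intro x hx; simp [hx]
  · have ag : ∫ x, ‖B.indicator z x‖ ^ 2 = ∫ x in B, ‖z x‖ ^ 2 := by
      rw [← integral_indicator bm]; congr 1; ext x; by_cases hx : x ∈ B <;> simp [hx]
    rw [ag]
    have hm0 : m ≤ 0 := by
      have := hm 0 (Submodule.zero_mem _)
      simpa [JJ, hp.f0] using this
    have hl : Tendsto (fun k => 4 * (JJ f (volume.restrict Ω) (volume.restrict B) T ε (p k) + C) + 2 * ε * ∫ x in B, ‖(p k).2 x - z x‖ ^ 2)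
        atTop (𝓝 (4 * (m + C) + 2 * ε * 0)) := ((hlim.add_const C).const_mul 4).add (hzl.const_mul _)
    refine le_trans (ge_of_tendsto' hl fun k => ?_) (by linarith)
    have aa := hcoer _ (SS_base (hpS k))
    have ab : 0 ≤ c * ∫ x in Ω, ‖(p k).2 x‖ := mul_nonneg hc.le (integral_nonneg fun _ => norm_nonneg _)
    rw [JJ_split f]
    have cu := sqint (af.l2z _ (hpS k))
    have de := sqint (af.l2w _ (hpS k))
    have fa : Integrable (fun x => ‖(p k).2 x - z x‖ ^ 2) (volume.restrict B) := sqint ((af.l2z _ (hpS k)).sub hz2)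
    have ad : ∫ x in B, ‖z x‖ ^ 2 ≤ 2 * (∫ x in B, (‖(p k).2 x‖ ^ 2 + ‖(p k).1 x‖ ^ 2)) + 2 * ∫ x in B, ‖(p k).2 x - z x‖ ^ 2 := by
      rw [← integral_const_mul, ← integral_const_mul, ← integral_add ((iadd cu de).const_mul 2) (fa.const_mul 2)]
      refine integral_mono (sqint hz2) (iadd ((iadd cu de).const_mul 2) (fa.const_mul 2)) fun x => ?_
      simp only
      have ai : ‖z x‖ ≤ ‖(p k).2 x‖ + ‖(p k).2 x - z x‖ := by
        have := norm_sub_le ((p k).2 x) ((p k).2 x - z x); simpa using this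
      nlinarith [sq_nonneg (‖(p k).2 x‖ - ‖(p k).2 x - z x‖), norm_nonneg (z x), sq_nonneg ‖(p k).1 x‖]
    have := mul_le_mul_of_nonneg_left ad ba.le
    nlinarith

end reg

section exg

theorem m_eps {Ω : Set Ev} (hΩ : IsOpen Ω) {f a : ℝ → ℝ} {L M τ : ℝ} (hp : Prof f a L M) {T : Ev → ZZ N n}
    (hT : TOk (volume.restrict Ω) T τ)
    {x0 : Ev} {R : ℝ} (bt : 0 < R) (av : closedBall x0 R ⊆ Ω) {m : ℝ}
    {p : ℕ → (Ev → WW N) × (Ev → ZZ N n)} (hpS : ∀ k, p k ∈ SS (N := N) Ω 0)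
    (hlim : Tendsto (fun k => JJ f (volume.restrict Ω) 0 T 0 (p k)) atTop (𝓝 m)) {e : ℝ} (he : 0 < e) :
    ∃ ε0 > 0, ∀ ε, 0 < ε → ε < ε0 → ∀ ed, (∀ q ∈ SS (N := N) Ω (volume.restrict (ball x0 R)),
      ed ≤ JJ f (volume.restrict Ω) (volume.restrict (ball x0 R)) T ε q) → ed - m ≤ e := by
  obtain ⟨k, hk⟩ := (hlim.eventually_lt_const (show m < m + e / 3 by linarith)).exists
  have ck := hp.Mpos
  set A := M + |τ| + 1
  have ev : 0 < A := by positivity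
  obtain ⟨q, hq, hqe⟩ := dens hΩ bt av (hpS k) (show 0 < e / (3 * A) by positivity)
  set I := ∫ x in ball x0 R, (‖q.2 x‖ ^ 2 + ‖q.1 x‖ ^ 2)
  have bj : 0 ≤ I := integral_nonneg fun _ => by positivity
  refine ⟨e / (3 * (I + 1)), by positivity, fun ε ae aa ed hm' => ?_⟩
  have ab := hm' q hq
  rw [JJ_split] at ab
  have bh : IntegrableOn q.2 Ω := hq.2.1.integrableOn
  have bl : IntegrableOn (p k).2 Ω := (hpS k).2.1.integrableOn
  have GI : ∀ z : Ev → ZZ N n, IntegrableOn z Ω → IntegrableOn (fun x => f ‖z x‖ - ⟪T x, z x⟫) Ω :=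
    fun z hz => (hp.intF hz).sub (int_inner_bd hT.meas hT.bd hz)
  have ad : JJ f (volume.restrict Ω) 0 T 0 q - JJ f (volume.restrict Ω) 0 T 0 (p k) ≤ A * (e / (3 * A)) := by
    refine le_trans ?_ (mul_le_mul_of_nonneg_left hqe ev.le)
    simp only [JJ, zero_div, zero_mul, add_zero]
    rw [← integral_sub (GI _ bh) (GI _ bl), ← integral_const_mul]
    have cv : IntegrableOn (fun x => A * ‖q.2 x - (p k).2 x‖) Ω := (bh.sub bl).norm.const_mul A
    refine integral_mono_ae (isub (GI _ bh) (GI _ bl)) cv ?_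
    filter_upwards [hT.bd] with x hx
    have ag := (abs_le.1 (hp.lipF (q.2 x) ((p k).2 x))).2
    have aq := (abs_le.1 (abs_real_inner_le_norm (T x) (q.2 x - (p k).2 x))).1
    rw [inner_sub_right] at aq
    have cf : ‖T x‖ * ‖q.2 x - (p k).2 x‖ ≤ (|τ| + 1) * ‖q.2 x - (p k).2 x‖ := by
      gcongr; have := le_abs_self τ; linarith
    simp only [A]; nlinarith
  have ai : A * (e / (3 * A)) = e / 3 := by field_simp
  have al : ε / 2 * I ≤ e / 3 := by
    rw [lt_div_iff₀ (by positivity)] at aa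
    nlinarith
  linarith

theorem HH_lim {B : Set Ev} {δ : ℝ} (ah : 0 < δ) {z : ℕ → Ev → ZZ N n} {g : Ev → ZZ N n}
    (hz : ∀ k, AEStronglyMeasurable (z k) volume) {ψ : Ev → ℝ} (bf : Continuous ψ) (bo : HasCompactSupport ψ)
    (du : tsupport ψ ⊆ B)
    (hl : ∀ᵐ x, x ∈ B → Tendsto (fun k => z k x) atTop (𝓝 (g x))) (p : Fin N × Fin n) :
    Tendsto (fun k => ∫ x, HH δ (z k x) p * ψ x) atTop (𝓝 (∫ x, HH δ (g x) p * ψ x)) := by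
  have hc : Continuous (HH δ : ZZ N n → ZZ N n) := (HH_contDiff δ).continuous
  obtain ⟨C, ar⟩ := (HH_cpt (E := ZZ N n) ah).exists_bound_of_continuous hc
  have hpc : Continuous fun z : ZZ N n => HH δ z p := (EuclideanSpace.proj (𝕜 := ℝ) p).continuous.comp hc
  refine tendsto_integral_of_dominated_convergence (fun x => C * |ψ x|) (fun k => ?_) ?_ (fun k => ?_) ?_
  · exact (hpc.comp_aestronglyMeasurable (hz k)).mul bf.aestronglyMeasurable
  · exact ((bf.integrable_of_hasCompactSupport bo).abs).const_mul C
  · refine aoa fun x => ?_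
    rw [norm_mul]
    exact mul_le_mul_of_nonneg_right ((norm_apply_le _ p).trans (ar _)) (abs_nonneg _)
  · filter_upwards [hl] with x hx
    by_cases h : x ∈ tsupport ψ
    · exact ((hpc.tendsto _).comp (hx (du h))).mul_const _
    · simp [image_eq_zero_of_notMem_tsupport h]

theorem HH_lim0 {B : Set Ev} {g : Ev → ZZ N n} (hg : IntegrableOn g B)
    {ψ : Ev → ℝ} (bf : Continuous ψ) (bo : HasCompactSupport ψ) (du : tsupport ψ ⊆ B) (p : Fin N × Fin n) :
    Tendsto (fun k : ℕ => ∫ x, HH (1 / ((k:ℝ) + 1)) (g x) p * ψ x) atTop (𝓝 (∫ x, g x p * ψ x)) := by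
  have ag : ∀ u : Ev → ℝ, ∫ x, u x * ψ x = ∫ x in B, u x * ψ x := by
    intro u
    refine (setIntegral_eq_integral_of_forall_compl_eq_zero fun x hx => ?_).symm
    rw [image_eq_zero_of_notMem_tsupport (fun h => hx (du h)), mul_zero]
  obtain ⟨C, ar⟩ := bo.exists_bound_of_continuous bf
  simp only [ag]
  refine tendsto_integral_of_dominated_convergence (fun x => ‖g x‖ * C) (fun k => ?_) ?_ (fun k => ?_) ?_
  · refine AEStronglyMeasurable.mul (Continuous.comp_aestronglyMeasurable ((EuclideanSpace.proj (𝕜 := ℝ) p).continuous.comp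
      (HH_contDiff (E := ZZ N n) _).continuous) hg.1) bf.aestronglyMeasurable
  · exact hg.norm.mul_const C
  · refine aoa fun x => ?_
    rw [norm_mul]
    exact mul_le_mul ((norm_apply_le _ p).trans (HH_norm_le _ _)) (ar x) (norm_nonneg _) (norm_nonneg _)
  · refine aoa fun x => ?_
    have := (HH_tendsto (g x)).comp tendsto_one_div_add_atTop_nhds_zero_nat
    exact (((EuclideanSpace.proj (𝕜 := ℝ) p).continuous.tendsto _).comp this).mul_const _

theorem l2_ae {Ω : Set Ev} (bs : Bornology.IsBounded Ω) {u : ℕ → Ev → ZZ N n} {v : Ev → ZZ N n}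
    (hu : ∀ k, MemLp (u k) 2 (volume.restrict Ω)) (hv : MemLp v 2 (volume.restrict Ω))
    (h : Tendsto (fun k => ∫ x in Ω, ‖u k x - v x‖ ^ 2) atTop (𝓝 0)) :
    ∃ ns : ℕ → ℕ, StrictMono ns ∧ ∀ᵐ x ∂(volume.restrict Ω), Tendsto (fun k => u (ns k) x) atTop (𝓝 (v x)) := by
  haveI : IsFiniteMeasure (volume.restrict Ω) := ⟨by simpa using bs.measure_lt_top⟩
  have aa := l2_to_l1 (fun k => (hu k).sub hv) h
  refine (tendstoInMeasure_of_tendsto_eLpNorm (p := 1) one_ne_zero (fun k => (hu k).1) hv.1 ?_).exists_seq_tendsto_ae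
  have ab := ENNReal.tendsto_ofReal aa
  rw [ENNReal.ofReal_zero] at ab
  refine ab.congr fun k => ?_
  rw [eLpNorm_one_eq_lintegral_enorm, ← ofReal_integral_norm_eq_lintegral_enorm (((hu k).sub hv).integrable (by norm_num))]

theorem exists_g {Ω : Set Ev} (hΩ : IsOpen Ω) (bs : Bornology.IsBounded Ω)
    {f a : ℝ → ℝ} {L M τ : ℝ} (hp : Prof f a L M) {T : Ev → ZZ N n}
    (hT : TOk (volume.restrict Ω) T τ) (bn : τ < M) {d : Ev → WW N} (hbp : BP Ω T d) {Ld : ℝ} (dh : 0 ≤ Ld)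
    (hd : ∀ x ∈ Ω, ∀ y ∈ Ω, ‖d x - d y‖ ≤ Ld * ‖x - y‖) :
    ∃ g : Ev → ZZ N n, IntegrableOn g Ω ∧
      (∀ q ∈ SS (N := N) Ω 0, ∫ x in Ω, ⟪radA a (g x), q.2 x⟫ = ∫ x in Ω, ⟪T x, q.2 x⟫) ∧
      ∀ x0 R, 0 < R → closedBall x0 R ⊆ Ω → ∀ φ : Ev → ℝ, ContDiff ℝ 1 φ → HasCompactSupport φ →
        tsupport φ ⊆ ball x0 R → ∀ b i j,
        ∫ x, g x (b, i) * fderiv ℝ φ x (es j) = ∫ x, g x (b, j) * fderiv ℝ φ x (es i) := by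
  haveI : IsFiniteMeasure (volume.restrict Ω) := ⟨by simpa using bs.measure_lt_top⟩
  have af := SS_adm (N := N) Ω 0
  obtain ⟨C, c, hc, hcoer⟩ := JJ_coer hp hT bn af
  obtain ⟨m, p, g, hpS, hm, hlim, -, hg, -, hae⟩ := min_pack hp hT bn af le_rfl hc (hcoer 0 le_rfl)
  refine ⟨g, hg, fun q hq => ?_, ?_⟩
  · have dd : ∀ᵐ x ∂(volume.restrict Ω), Tendsto (fun k => radA a ((p k).2 x)) atTop (𝓝 (radA a (g x))) := by
      filter_upwards [hae] with x hx using (hp.continuous_radA.tendsto _).comp hx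
    have := euler_eq hp hT af hpS hm hlim dd hq (c := 0) (by simp)
    linarith
  intro x0 R bt av φ am bb fj b i j
  set B := ball x0 R with hBdef
  have ao : B ⊆ Ω := ball_subset_closedBall.trans av
  have bm : MeasurableSet B := measurableSet_ball
  have hdl : ∀ x ∈ B, ∀ y ∈ B, ‖B.indicator d x - B.indicator d y‖ ≤ Ld * ‖x - y‖ := fun x hx y hy => by
    rw [indicator_of_mem hx, indicator_of_mem hy]; exact hd x (ao hx) y (ao hy)
  have hd2 : MemLp (B.indicator d) 2 := by
    haveI : IsFiniteMeasure (volume.restrict B) := ⟨by simpa using isBounded_ball.measure_lt_top⟩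
    refine (memLp_indicator_iff_restrict bm).2 ?_
    have hl : LipschitzOnWith ⟨Ld, dh⟩ d B := LipschitzOnWith.of_dist_le_mul fun x hx y hy => by
      rw [dist_eq_norm, dist_eq_norm]; exact hd x (ao hx) y (ao hy)
    refine MemLp.of_bound (hl.continuousOn.aestronglyMeasurable bm) (‖d x0‖ + Ld * R) ?_
    filter_upwards [ae_restrict_mem bm] with x hx
    have aa := hd x (ao hx) x0 (ao (mem_ball_self bt))
    have ab : ‖x - x0‖ ≤ R := by rw [← dist_eq_norm]; exact (mem_ball.1 hx).le
    have ad := norm_le_insert' (d x) (d x0)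
    nlinarith
  have hreg := fun k : ℕ => reg_problem bs hp hT bn hbp av hd2 hc (hcoer 0 le_rfl) (ε := 1 / ((k:ℝ)+1)) (by positivity)
  choose ed cg fg z w ih ic kq js kp ko gz jr kn ig using hreg
  have hml : Tendsto (fun k => ∫ x in Ω, ‖radA a (fg k x) - radA a (g x)‖ ^ 2) atTop (𝓝 0) := by
    have bc := hp.Lpos
    rw [Metric.tendsto_atTop]
    intro e he
    obtain ⟨ε0, ae, aa⟩ := m_eps hΩ hp hT bt av hpS hlim (show 0 < (4 * L)⁻¹ * (e / 2) by positivity)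
    obtain ⟨ap, hk0⟩ := eventually_atTop.1 (tendsto_one_div_add_atTop_nhds_zero_nat.eventually_lt_const ae)
    refine ⟨ap, fun k hk => ?_⟩
    have ab := aa _ (by positivity) (hk0 k hk) (ed k) (ic k)
    have ad := compare_limits hp hT af hm hpS (fun l => SS_base (ih k l)) hlim (ε := 1 / ((k:ℝ)+1)) (by positivity) (kq k) hae (ko k)
    have ai := (mul_le_mul_iff_right₀ (show 0 < (4 * L)⁻¹ by positivity)).1 (ad.trans ab)
    rw [Real.dist_eq, sub_zero, abs_of_nonneg (integral_nonneg fun _ => by positivity)]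
    linarith
  obtain ⟨ns, hns, hnl⟩ := l2_ae bs (fun k => hp.l2A (js k).1) (hp.l2A hg.1) hml
  have hzl : ∀ᵐ x, x ∈ B → Tendsto (fun k => z (ns k) x) atTop (𝓝 (g x)) := by
    rw [← ae_restrict_iff' bm]
    filter_upwards [ae_restrict_of_ae_restrict_of_subset ao hnl, ae_all_iff.2 jr] with x aa ab
    simp only [ab]
    exact hp.tendsto_of aa
  obtain ⟨R1, dg, gk⟩ := exists_pos_lt_subset_ball bt (isClosed_tsupport φ) fj
  set s := (R - R1) / 4 with hs
  have hs0 : 0 < s := by have := dg.2; simp only [hs]; linarith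
  let χ : ContDiffBump x0 := ⟨R1, R1 + s, dg.1, by linarith⟩
  let η : ContDiffBump x0 := ⟨R1 + s, R1 + 2 * s, by linarith [dg.1], by linarith⟩
  have fl : ContDiff ℝ 1 η := η.contDiff
  choose D cb using fun i => (pd_cpt η.hasCompactSupport i).exists_bound_of_continuous (pd_cont fl i)
  have hcut : Cut B η (∑ i, D i ^ 2) s := by
    refine ⟨fl, η.hasCompactSupport, fun x => pow_le_one₀ η.nonneg η.le_one, fun x => sum_le_sum fun i _ => ?_, hs0, ?_⟩
    · rw [← sq_abs]; exact pow_le_pow_left₀ (abs_nonneg _) (cb i x) 2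
    · intro x hx
      rw [η.tsupport_eq, mem_closedBall] at hx
      change dist x x0 ≤ R1 + 2 * s at hx
      refine (Metric.closedBall_subset_ball' ?_)
      have : 4 * s = R - R1 := by simp only [hs]; ring
      linarith
  obtain ⟨Cc, mb, hest⟩ := curl_est (N := N) hp hcut dh (χ := χ) χ.contDiff χ.hasCompactSupport (by
      rw [χ.tsupport_eq]
      refine closedBall_subset_ball ?_
      have : 4 * s = R - R1 := by simp only [hs]; ring
      change R1 + s < R
      linarith)
    (fun x => by rw [abs_of_nonneg χ.nonneg]; exact χ.le_one)
    (fun x hx => χ.one_of_mem_closedBall (ball_subset_closedBall (gk (subset_tsupport _ hx))))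
    (fun x hx => η.one_of_mem_closedBall (by
      have : x ∈ Function.support χ := hx
      rw [χ.support_eq] at this
      exact ball_subset_closedBall this)) am bb
  have hts : ∀ i : Fin n, tsupport (fun x => fderiv ℝ φ x (es i)) ⊆ B := fun i => by
    refine Subset.trans (Subset.trans (closure_mono ?_) (tsupport_fderiv_subset ℝ (f := φ))) fj
    intro x hx; simp only [Function.mem_support] at hx ⊢; intro ae; exact hx (by rw [ae]; simp)
  set K := 1 + (1 + C) / c + 4 * C
  have hbd : ∀ δ, 0 < δ → |(∫ x, HH δ (g x) (b, i) * fderiv ℝ φ x (es j)) - ∫ x, HH δ (g x) (b, j) * fderiv ℝ φ x (es i)| ≤ δ * (Cc * K) := by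
    intro δ ah
    have bz := HH_lim ah (fun k => (gz (ns k)).z1.1) (pd_cont am j) (pd_cpt bb j) (hts j) hzl (b, i)
    have ce := HH_lim ah (fun k => (gz (ns k)).z1.1) (pd_cont am i) (pd_cpt bb i) (hts i) hzl (b, j)
    refine le_of_tendsto' (bz.sub ce).abs fun k => ?_
    have aa := hest δ _ _ _ _ ah (by positivity) (by rw [div_le_one (by positivity)]; linarith [Nat.cast_nonneg (α := ℝ) (ns k)]) (gz (ns k)) hdl b i j
    refine aa.trans ?_
    rw [mul_assoc]
    gcongr δ * (Cc * ?_)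
    have ab : ∫ x, ‖z (ns k) x‖ ≤ (1 + C) / c := by
      refine le_trans ?_ (kp (ns k))
      rw [← setIntegral_eq_integral_of_forall_compl_eq_zero (s := B) fun x hx => by rw [kn (ns k) x hx, norm_zero]]
      have : ∫ x in B, ‖z (ns k) x‖ = ∫ x in B, ‖fg (ns k) x‖ := by
        refine integral_congr_ae ?_
        filter_upwards [jr (ns k)] with x hx; rw [hx]
      rw [this]
      exact setIntegral_mono_set (js _).norm (aoa fun _ => norm_nonneg _) ao.eventuallyLE
    have := ig (ns k)
    simp only [K]; linarith
  have bz := HH_lim0 (IntegrableOn.mono_set hg ao) (pd_cont am j) (pd_cpt bb j) (hts j) (b, i)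
  have ce := HH_lim0 (IntegrableOn.mono_set hg ao) (pd_cont am i) (pd_cpt bb i) (hts i) (b, j)
  have ez := (bz.sub ce).abs
  have jt : Tendsto (fun k : ℕ => 1 / ((k:ℝ)+1) * (Cc * K)) atTop (𝓝 (0 * (Cc * K))) :=
    tendsto_one_div_add_atTop_nhds_zero_nat.mul_const _
  rw [zero_mul] at jt
  have al := le_of_tendsto_of_tendsto' ez jt fun k => hbd _ (by positivity)
  exact sub_eq_zero.1 (abs_nonpos_iff.1 al)

end exg

section bp

theorem cutoff {Ω K : Set (EVec n)} (hΩ : IsOpen Ω) (ay : IsCompact K) (h : K ⊆ Ω) :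
    ∃ χ : EVec n → ℝ, ContDiff ℝ 1 χ ∧ HasCompactSupport χ ∧ tsupport χ ⊆ Ω ∧ (∀ x ∈ K, χ =ᶠ[𝓝 x] 1) ∧
      ∀ x, χ x ∈ Icc (0:ℝ) 1 := by
  obtain ⟨L, bc, aa, ab⟩ := exists_compact_between ay hΩ h
  obtain ⟨χ, ct, ca, ep⟩ := exists_contMDiffMap_one_nhds_of_subset_interior (n := (1 : ℕ∞)) (modelWithCornersSelf ℝ (EVec n))
    ay.isClosed aa
  have ht : tsupport χ ⊆ L := closure_minimal (fun x hx => by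
    by_contra hc; exact hx (ca x hc)) bc.isClosed
  refine ⟨χ, χ.contMDiff.contDiff, HasCompactSupport.intro bc ca, ht.trans ab, fun x hx => ?_, ep⟩
  exact (eventually_nhdsSet_iff_forall.1 ct) x hx

theorem cut_c1 {Ω K : Set Ev} (hΩ : IsOpen Ω) (ay : IsCompact K) (h : K ⊆ Ω) {t : Ev → ℝ}
    {fy : Ev → Ev →L[ℝ] ℝ} (ht : ∀ x ∈ Ω, HasFDerivAt t (fy x) x) (hc : ContinuousOn fy Ω) :
    ∃ θ : Ev → ℝ, ContDiff ℝ 1 θ ∧ HasCompactSupport θ ∧ tsupport θ ⊆ Ω ∧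
      ∀ x ∈ K, θ x = t x ∧ fderiv ℝ θ x = fy x := by
  obtain ⟨χ, fh, ki, gh, jk, -⟩ := cutoff hΩ ay h
  have ts : tsupport (fun x => χ x * t x) ⊆ tsupport χ := tsupport_mul_subset_left
  refine ⟨fun x => χ x * t x, contDiff_iff_contDiffAt.2 fun x => ?_, ki.mul_right, ts.trans gh, fun x hx => ?_⟩
  · by_cases hx : x ∈ Ω
    · exact fh.contDiffAt.mul (contDiffAt_one_iff.2 ⟨fy, Ω, hΩ.mem_nhds hx, hc, ht⟩)
    · have : (fun x => χ x * t x) =ᶠ[𝓝 x] fun _ => 0 :=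
        notMem_tsupport_iff_eventuallyEq.1 fun hh => hx (gh (ts hh))
      exact contDiffAt_const.congr_of_eventuallyEq this
  · have : (fun x => χ x * t x) =ᶠ[𝓝 x] t := (jk x hx).mono fun y hy => by simp [hy]
    exact ⟨this.eq_of_nhds, by rw [this.fderiv_eq]; exact (ht x (h hx)).fderiv⟩

noncomputable def tZ (T : Ev → Fin N → Fin n → ℝ) (x : Ev) : ZZ N n := WithLp.toLp 2 fun p => T x p.1 p.2

theorem bp_of {Ω : Set Ev} (hΩ : IsOpen Ω) {T : Ev → Fin N → Fin n → ℝ}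
    {DT : Ev → Ev →L[ℝ] (Fin N → Fin n → ℝ)} {C : NNReal} (hT : ∀ x ∈ Ω, HasFDerivWithinAt T (DT x) Ω x)
    (bc : LipschitzOnWith C DT Ω) : ∃ (d : Ev → WW N) (Ld : ℝ), BP Ω (tZ T) d ∧ 0 ≤ Ld ∧
      ∀ x ∈ Ω, ∀ y ∈ Ω, ‖d x - d y‖ ≤ Ld * ‖x - y‖ := by
  have cb : ∀ b i, ∀ x ∈ Ω, HasFDerivAt (fun x => T x b i)
      ((ContinuousLinearMap.proj i ∘L (ContinuousLinearMap.proj (R := ℝ) (φ := fun _ : Fin N => Fin n → ℝ) b)) ∘L DT x) x :=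
    fun b i x hx => by
      have := (hT x hx).hasFDerivAt (hΩ.mem_nhds hx)
      exact (ContinuousLinearMap.proj (R := ℝ) (φ := fun _ : Fin n => ℝ) i ∘L (ContinuousLinearMap.proj (R := ℝ) (φ := fun _ : Fin N => Fin n → ℝ) b)).hasFDerivAt.comp x this
  refine ⟨fun x => WithLp.toLp 2 fun b => ∑ i, DT x (es i) b i, ∑ _b : Fin N, ∑ _i : Fin n, (C : ℝ), ?_, by positivity, ?_⟩
  · rintro φ ζ am cc fb ⟨K, ay, ea, hz⟩
    have key : ∀ b i, Integrable (fun x => T x b i * ζ x (b,i)) ∧ Integrable (fun x => DT x (es i) b i * φ x b) ∧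
        ∫ x, T x b i * ζ x (b,i) = - ∫ x, DT x (es i) b i * φ x b := by
      intro b i
      obtain ⟨θ, cr, dm, fw, em⟩ := cut_c1 hΩ ay ea (cb b i) (continuousOn_const.clm_comp bc.continuousOn)
      have ag : (fun x => ζ x (b,i) * θ x) = fun x => T x b i * ζ x (b,i) := by
        ext x
        by_cases hx : x ∈ K
        · rw [(em x hx).1, mul_comm]
        · simp [(hz x hx).2]
      have aq : (fun x => φ x b * fderiv ℝ θ x (es i)) = fun x => DT x (es i) b i * φ x b := by
        ext x
        by_cases hx : x ∈ K
        · rw [(em x hx).2, mul_comm]; rfl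
        · simp [(hz x hx).1]
      have h := fb b i θ cr dm (subset_univ _)
      refine ⟨ag ▸ int_mul_cc ((coord_l2 cc _).locallyIntegrable (by norm_num)) cr.continuous dm,
        aq ▸ int_mul_cc ((coord_l2 am _).locallyIntegrable (by norm_num)) (pd_cont cr i) (pd_cpt dm i), ?_⟩
      rw [← ag, ← aq]; unfold es at h ⊢; linarith
    have ey : ∫ x in Ω, ⟪tZ T x, ζ x⟫ = ∫ x, ∑ b, ∑ i, T x b i * ζ x (b,i) := by
      rw [setIntegral_eq_integral_of_forall_compl_eq_zero fun x hx => by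
        rw [(hz x fun h => hx (ea h)).2, inner_zero_right]]
      congr 1; ext x
      simp only [PiLp.inner_apply, RCLike.inner_apply, conj_trivial, tZ, Fintype.sum_prod_type]
      simp only [mul_comm]
    rw [ey, setIntegral_eq_integral_of_forall_compl_eq_zero fun x hx => by
        rw [(hz x fun h => hx (ea h)).1, inner_zero_right]]
    simp only [PiLp.inner_apply, RCLike.inner_apply, conj_trivial, mul_sum]
    rw [integral_finsetSum _ fun b _ => integrable_finsetSum _ fun i _ => (key b i).1, integral_finsetSum _ fun b _ =>
      integrable_finsetSum _ fun i _ => by simpa only [mul_comm] using (key b i).2.1, ← Finset.sum_neg_distrib]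
    refine sum_congr rfl fun b _ => ?_
    rw [integral_finsetSum _ fun i _ => (key b i).1, integral_finsetSum _ fun i _ => by
      simpa only [mul_comm] using (key b i).2.1, ← Finset.sum_neg_distrib]
    refine sum_congr rfl fun i _ => ?_
    rw [(key b i).2.2]; simp only [mul_comm]
  · intro x hx y hy
    refine (norm_le_abs_sum _).trans ?_
    rw [sum_mul]
    refine sum_le_sum fun b _ => ?_
    rw [sum_mul]
    simp only [PiLp.sub_apply, ← Finset.sum_sub_distrib]
    refine (Finset.abs_sum_le_sum_abs _ _).trans (sum_le_sum fun i _ => ?_)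
    have aa := bc.norm_sub_le hx hy
    have ab := (DT x - DT y).le_opNorm (es i)
    rw [es_norm, mul_one] at ab
    have ad := (norm_le_pi_norm (((DT x - DT y) (es i)) b) i).trans (norm_le_pi_norm _ b)
    exact ad.trans (ab.trans aa)

end bp

section poinc

theorem moll_ae {u : Ev → ℝ} (hu : LocallyIntegrable u) :
    ∀ᵐ x, Tendsto (fun k => moll k u x) atTop (𝓝 (u x)) := by
  have := ContDiffBump.ae_convolution_tendsto_right_of_locallyIntegrable (φ := fun k => bmp n k) (K := 2) (l := atTop)
    tendsto_one_div_add_atTop_nhds_zero_nat (Eventually.of_forall fun k => by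
      simp only [bmp]; apply le_of_eq; field_simp) hu
  filter_upwards [this] with x hx
  refine hx.congr fun k => ?_
  rw [moll_eq]; simp [convolution, rho]

theorem wd_zero {x0 : Ev} {R r : ℝ} (hr : r < R) {u : Ev → ℝ} (hu : LocallyIntegrable u)
    (h : ∀ i, WD (ball x0 R) i u fun _ => 0) :
    ∃ c : ℝ, ∀ᵐ x, x ∈ ball x0 r → u x = c := by
  by_cases hne : ∃ x ∈ ball x0 r, Tendsto (fun k => moll k u x) atTop (𝓝 (u x))
  · obtain ⟨y, hy, hy2⟩ := hne
    refine ⟨u y, ?_⟩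
    filter_upwards [moll_ae hu] with x hx hxr
    obtain ⟨ap, hk0⟩ := exists_nat_one_div_lt (sub_pos.2 hr)
    refine tendsto_nhds_unique hx (hy2.congr' ?_)
    filter_upwards [eventually_ge_atTop ap] with k hk
    refine isOpen_ball.is_const_of_fderiv_eq_zero (𝕜 := ℝ) (convex_ball x0 r).isPreconnected
      ((moll_smooth k hu (m := 1)).differentiable (by simp)).differentiableOn (fun z hz => ?_) hy hxr
    have hz2 : closedBall z (1/((k:ℝ)+1)) ⊆ ball x0 R := by
      intro w hw
      have : 1/((k:ℝ)+1) ≤ 1/((ap:ℝ)+1) := by gcongr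
      rw [mem_closedBall] at hw; rw [mem_ball] at hz ⊢
      linarith [dist_triangle w z x0]
    refine ContinuousLinearMap.coe_injective ((EuclideanSpace.basisFun (Fin n) ℝ).toBasis.ext fun i => ?_)
    have := moll_fderiv k hu (h i) hz2
    simpa [moll] using this
  · refine ⟨0, ?_⟩
    filter_upwards [moll_ae hu] with x hx hxr
    exact absurd ⟨x, hxr, hx⟩ hne

theorem lint_scale {G : Ev → ℝ≥0∞} (ak : Measurable G) (y : Ev) {t : ℝ} (ht : 1/2 ≤ t) :
    ∫⁻ x, G (y + t • (x - y)) ≤ 2 ^ n * ∫⁻ x, G x := by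
  have e : ∀ x, y + t • (x - y) = (y - t • y) + t • x := fun x => by rw [smul_sub]; abel
  have ht0 : t ≠ 0 := by linarith
  simp only [e]
  rw [← lintegral_map (f := fun z => G (y - t • y + z)) (g := fun x : Ev => t • x) (by fun_prop) (by fun_prop),
    Measure.map_addHaar_smul volume ht0, lintegral_smul_measure, lintegral_add_left_eq_self, smul_eq_mul]
  gcongr
  rw [show (2:ℝ≥0∞)^n = ofReal (2^n) by rw [ENNReal.ofReal_pow (by norm_num)]; simp]
  apply ofReal_le_ofReal
  have ae : 0 < t := by linarith
  rw [finrank_euclideanSpace_fin, abs_of_pos (by positivity), ← inv_pow]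
  exact pow_le_pow_left₀ (by positivity) (by rw [inv_le_comm₀ ae (by norm_num)]; linarith) n

theorem half_ftc {B : Set Ev} (av : Convex ℝ B) {D : ℝ} {v : Ev → ℝ} {v' : Ev → Ev →L[ℝ] ℝ} (hv : ∀ x ∈ B, HasFDerivAt v (v' x) x)
    (hc : ContinuousOn v' B) {G : Ev → ℝ≥0∞} (ak : ∀ x ∈ B, ‖v' x‖ₑ ≤ G x) {x y : Ev} (hx : x ∈ B) (hy : y ∈ B)
    (hd : ‖x - y‖ ≤ D) :
    ‖v x - v ((1/2:ℝ) • (x + y))‖ₑ ≤ ofReal D * ∫⁻ t in Icc (1/2:ℝ) 1, G (y + t • (x - y)) := by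
  have hm : ∀ t ∈ Icc (1/2:ℝ) 1, y + t • (x - y) ∈ B := fun t ht => by
    have := av hx hy (show (0:ℝ) ≤ t by linarith [ht.1]) (show 0 ≤ 1 - t by linarith [ht.2]) (by ring)
    convert this using 1; rw [smul_sub, sub_smul, one_smul]; abel
  have hco : ContinuousOn (fun t : ℝ => v' (y + t • (x - y)) (x - y)) (uIcc (1/2) 1) := by
    rw [uIcc_of_le (by norm_num)]
    exact (hc.comp (by fun_prop) hm).clm_apply continuousOn_const
  have aa := intervalIntegral.integral_eq_sub_of_hasDerivAt (a := (1/2:ℝ)) (b := 1) (f := fun t : ℝ => v (y + t • (x - y)))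
    (f' := fun t => v' (y + t • (x - y)) (x - y)) (fun t ht => by
      rw [uIcc_of_le (by norm_num)] at ht
      have : HasDerivAt (fun t : ℝ => y + t • (x - y)) (x - y) t := by
        simpa using ((hasDerivAt_id t).smul_const (x - y)).const_add y
      exact (hv _ (hm t ht)).comp_hasDerivAt t this) hco.intervalIntegrable
  have ag : y + (1:ℝ) • (x - y) = x := by simp
  have aq : y + (1/2:ℝ) • (x - y) = (1/2:ℝ) • (x + y) := by
    rw [smul_sub, smul_add]; nth_rw 1 [show y = (1/2:ℝ) • y + (1/2:ℝ) • y by rw [← add_smul]; norm_num]; abel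
  rw [ag, aq] at aa
  rw [← aa, intervalIntegral.integral_of_le (by norm_num), integral_Icc_eq_integral_Ioc.symm]
  refine (enorm_integral_le_lintegral_enorm _).trans ?_
  rw [← lintegral_const_mul' _ _ ofReal_ne_top]
  refine setLIntegral_mono' measurableSet_Icc fun t ht => ?_
  refine ((v' (y + t • (x - y))).le_opENorm (x - y)).trans ?_
  rw [mul_comm]
  gcongr
  · rw [← ofReal_norm]; exact ofReal_le_ofReal hd
  · exact ak _ (hm t ht)

theorem poinc {B : Set Ev} (bm : MeasurableSet B) (av : Convex ℝ B) {D : ℝ} (cb : ∀ x ∈ B, ∀ y ∈ B, ‖x - y‖ ≤ D)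
    {v : Ev → ℝ} {v' : Ev → Ev →L[ℝ] ℝ} (hv : ∀ x ∈ B, HasFDerivAt v (v' x) x)
    (hc : ContinuousOn v' B) {G : Ev → ℝ≥0∞} (fq : Measurable G) (ak : ∀ x ∈ B, ‖v' x‖ₑ ≤ G x) :
    ∫⁻ x in B, ∫⁻ y in B, ‖v x - v y‖ₑ ≤ 2 * (ofReal D * (2 ^ n * volume B)) * ∫⁻ x, G x := by
  set K : Ev → Ev → ℝ≥0∞ := fun x y => ∫⁻ t in Icc (1/2:ℝ) 1, G (y + t • (x - y)) with ay
  have bw : Measurable (Function.uncurry K) := by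
    have : Measurable fun p : (Ev × Ev) × ℝ => G (p.1.2 + p.2 • (p.1.1 - p.1.2)) := fq.comp (by fun_prop)
    exact this.lintegral_prod_right'
  have jb : ∀ x, Measurable fun y => K y x := fun x => bw.comp (by fun_prop : Measurable fun y => (y, x))
  have ds : ∀ x, Measurable fun y => K x y := fun x => bw.comp (by fun_prop : Measurable fun y => (x, y))
  have ln : ∀ y, ∫⁻ x in B, K x y ≤ 2 ^ n * ∫⁻ x, G x := by
    intro y
    have hm : Measurable fun p : Ev × ℝ => G (y + p.2 • (p.1 - y)) := fq.comp (by fun_prop)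
    calc ∫⁻ x in B, K x y = ∫⁻ t in Icc (1/2:ℝ) 1, ∫⁻ x in B, G (y + t • (x - y)) :=
          lintegral_lintegral_swap hm.aemeasurable
      _ ≤ ∫⁻ t in Icc (1/2:ℝ) 1, 2 ^ n * ∫⁻ x, G x := setLIntegral_mono' measurableSet_Icc fun t ht =>
          (setLIntegral_le_lintegral _ _).trans (lint_scale fq y ht.1)
      _ ≤ _ := by
          rw [setLIntegral_const, Real.volume_Icc]
          refine (mul_le_mul_right (?_ : _ ≤ (1:ℝ≥0∞)) _).trans (mul_one _).le
          rw [← ENNReal.ofReal_one]; exact ofReal_le_ofReal (by norm_num)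
  have lm : ∫⁻ x in B, ∫⁻ y in B, K y x ≤ 2 ^ n * volume B * ∫⁻ x, G x := by
    refine (lintegral_mono fun x => ln x).trans ?_
    rw [setLIntegral_const]; apply le_of_eq; ring
  have mf : ∫⁻ x in B, ∫⁻ y in B, K x y ≤ 2 ^ n * volume B * ∫⁻ x, G x := by
    rw [lintegral_lintegral_swap bw.aemeasurable]; exact lm
  calc ∫⁻ x in B, ∫⁻ y in B, ‖v x - v y‖ₑ
      ≤ ∫⁻ x in B, ∫⁻ y in B, (ofReal D * K x y + ofReal D * K y x) := by
        refine setLIntegral_mono' bm fun x hx => setLIntegral_mono' bm fun y hy => ?_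
        have aa := half_ftc av hv hc ak hx hy (cb x hx y hy)
        have ab := half_ftc av hv hc ak hy hx (cb y hy x hx)
        rw [add_comm y x] at ab
        calc ‖v x - v y‖ₑ = ‖(v x - v ((1/2:ℝ) • (x + y))) - (v y - v ((1/2:ℝ) • (x + y)))‖ₑ := by congr 1; ring
          _ ≤ _ := enorm_sub_le
          _ ≤ _ := add_le_add aa ab
    _ = ofReal D * (∫⁻ x in B, ∫⁻ y in B, K x y) + ofReal D * ∫⁻ x in B, ∫⁻ y in B, K y x := by
        rw [← lintegral_const_mul' _ _ ofReal_ne_top, ← lintegral_const_mul' _ _ ofReal_ne_top,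
          ← lintegral_add_left]
        · congr 1; ext x
          rw [lintegral_add_left ((ds x).const_mul _), lintegral_const_mul _ (ds x), lintegral_const_mul _ (jb x)]
        · exact (bw.lintegral_prod_right').const_mul _
    _ ≤ ofReal D * (2 ^ n * volume B * ∫⁻ x, G x) + ofReal D * (2 ^ n * volume B * ∫⁻ x, G x) := by
        gcongr
    _ = _ := by ring

end poinc

section pot

theorem poinc_avg {B : Set Ev} (bm : MeasurableSet B) (av : Convex ℝ B) (eu : volume B ≠ 0) (fr : volume B ≠ ∞) {D : ℝ}
    (cb : ∀ x ∈ B, ∀ y ∈ B, ‖x - y‖ ≤ D) :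
    ∃ C : ℝ≥0∞, C ≠ ∞ ∧ ∀ {v : Ev → ℝ} {v' : Ev → Ev →L[ℝ] ℝ}, (∀ x ∈ B, HasFDerivAt v (v' x) x) →
    ContinuousOn v' B → IntegrableOn v B → ∀ {G : Ev → ℝ≥0∞}, Measurable G → (∀ x ∈ B, ‖v' x‖ₑ ≤ G x) →
    ∫⁻ x in B, ‖v x - ⨍ y in B, v y‖ₑ ≤ C * ∫⁻ x, G x := by
  refine ⟨(volume B)⁻¹ * (2 * (ofReal D * (2 ^ n * volume B))), by finiteness, fun {v v'} hv hc hi G fq ak => ?_⟩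
  rw [mul_assoc]
  refine le_trans ?_ (mul_le_mul_right (poinc bm av cb hv hc fq ak) _)
  rw [← lintegral_const_mul' _ _ (by finiteness)]
  refine lintegral_mono fun x => ?_
  haveI : NeZero ((volume.restrict B)) := ⟨by simpa using eu⟩
  haveI : IsFiniteMeasure (volume.restrict B) := ⟨by simpa using fr.lt_top⟩
  have e : v x - ⨍ y in B, v y = ⨍ y in B, (v x - v y) := by
    have ab : Integrable v (((volume.restrict B) univ)⁻¹ • volume.restrict B) :=
      hi.smul_measure (by simpa using eu)
    rw [average, average, integral_sub (integrable_const _) ab]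
    have ad : (volume B).toReal ≠ 0 := ENNReal.toReal_ne_zero.2 ⟨eu, fr⟩
    simp [Measure.real, ad]
  rw [e, average]
  refine (enorm_integral_le_lintegral_enorm _).trans ?_
  rw [lintegral_smul_measure]; simp

theorem l1lim {α : Type*} [MeasurableSpace α] {μ : Measure α} {w : ℕ → α → ℝ} (hw : ∀ k, Integrable (w k) μ) (b : ℕ → ℝ)
    (hb : Tendsto b atTop (𝓝 0)) (h : ∀ k l, ∫ x, ‖w k x - w l x‖ ∂μ ≤ b k + b l) :
    ∃ u, Integrable u μ ∧ Tendsto (fun k => ∫ x, ‖w k x - u x‖ ∂μ) atTop (𝓝 0) := by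
  have key : ∀ {v w : α → ℝ} (hv : Integrable v μ) (hw : Integrable w μ), ‖hv.toL1 v - hw.toL1 w‖ = ∫ x, ‖v x - w x‖ ∂μ := by
    intro v w hv hw
    rw [← Integrable.toL1_sub, L1.norm_eq_integral_norm]
    refine integral_congr_ae ?_
    filter_upwards [(hv.sub hw).coeFn_toL1] with x hx
    rw [hx]; rfl
  have hc : CauchySeq fun k => (hw k).toL1 (w k) := by
    rw [Metric.cauchySeq_iff']
    intro e he
    obtain ⟨ap, hk0⟩ := eventually_atTop.1 (hb.eventually (gt_mem_nhds (show 0 < e / 2 by positivity)))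
    refine ⟨ap, fun k hk => ?_⟩
    rw [dist_eq_norm, key]
    linarith [h k ap, hk0 k hk, hk0 ap le_rfl]
  obtain ⟨v, hv⟩ := cauchySeq_tendsto_of_complete hc
  refine ⟨v, L1.integrable_coeFn v, (tendsto_iff_norm_sub_tendsto_zero.1 hv).congr fun k => ?_⟩
  have := key (hw k) (L1.integrable_coeFn v)
  rwa [Integrable.toL1_coeFn] at this

theorem wd_classical {B : Set Ev} (av : IsOpen B) {v : Ev → ℝ} {v' : Ev → Ev →L[ℝ] ℝ}
    (hv : ∀ x ∈ B, HasFDerivAt v (v' x) x) (hc : ContinuousOn v' B) (i : Fin n) : WD B i v fun x => v' x (es i) := by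
  intro φ aa ab ad
  obtain ⟨θ, cr, dm, fw, em⟩ := cut_c1 av ab ad hv hc
  have ag : (fun x => v x * fderiv ℝ φ x (es i)) = fun x => θ x * fderiv ℝ φ x (es i) := by
    ext x
    by_cases hx : x ∈ tsupport φ
    · rw [(em x hx).1]
    · have : fderiv ℝ φ x = 0 := image_eq_zero_of_notMem_tsupport fun h => hx (tsupport_fderiv_subset ℝ h)
      simp [this]
  have aq : (fun x => v' x (es i) * φ x) = fun x => fderiv ℝ θ x (es i) * φ x := by
    ext x
    by_cases hx : x ∈ tsupport φ
    · rw [(em x hx).2]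
    · simp [image_eq_zero_of_notMem_tsupport hx]
  have := integral_mul_fderiv_eq_neg_fderiv_mul_of_integrable (μ := volume) (f := θ) (g := φ) (v := es i)
    ((((pd_cont cr i).mul aa.continuous)).integrable_of_hasCompactSupport ab.mul_left)
    (((cr.continuous.mul (pd_cont aa i))).integrable_of_hasCompactSupport dm.mul_right)
    ((cr.continuous.mul aa.continuous).integrable_of_hasCompactSupport dm.mul_right)
    (fun x _ => cr.differentiable (by simp) x) (fun x _ => aa.differentiable (by simp) x)
  show ∫ x, v x * fderiv ℝ φ x (es i) = _
  rw [ag, aq]; exact this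

theorem clm_es {F : Type*} [NormedAddCommGroup F] [NormedSpace ℝ F] (ℓ : Ev →L[ℝ] F) (a : Ev) :
    ℓ a = ∑ j, a j • ℓ (es j) := by
  conv_lhs => rw [← (EuclideanSpace.basisFun (Fin n) ℝ).sum_repr a]
  simp [map_sum, es]

noncomputable def omg (g : Fin n → Ev → ℝ) (k : ℕ) (x : Ev) : Ev →L[ℝ] ℝ :=
  ∑ i, moll k (g i) x • (EuclideanSpace.proj i : Ev →L[ℝ] ℝ)

theorem omg_es (g : Fin n → Ev → ℝ) (k : ℕ) (x : Ev) (i : Fin n) : omg g k x (es i) = moll k (g i) x := by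
  simp [omg, es, Finset.sum_apply, sum_apply, Pi.single_apply]

theorem omg_diff {g : Fin n → Ev → ℝ} (hg : ∀ i, Integrable (g i)) (k : ℕ) (x : Ev) :
    HasFDerivAt (omg g k) (∑ i, (fderiv ℝ (moll k (g i)) x).smulRight (EuclideanSpace.proj i : Ev →L[ℝ] ℝ)) x := by
  refine HasFDerivAt.fun_sum fun i _ => ?_
  have := ((moll_smooth k (hg i).locallyIntegrable (m := 1)).differentiable (by simp) x).hasFDerivAt
  exact this.smul_const (EuclideanSpace.proj i : Ev →L[ℝ] ℝ)

theorem omg_sub_le (g : Fin n → Ev → ℝ) (k l : ℕ) (x : Ev) :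
    ‖omg g k x - omg g l x‖ₑ ≤ ∑ i, ‖moll k (g i) x - moll l (g i) x‖ₑ := by
  rw [omg, omg, ← Finset.sum_sub_distrib]
  refine (enorm_sum_le (ε := Ev →L[ℝ] ℝ) _ _).trans (sum_le_sum fun i _ => ?_)
  rw [show moll k (g i) x • (EuclideanSpace.proj i : Ev →L[ℝ] ℝ) - moll l (g i) x • (EuclideanSpace.proj i : Ev →L[ℝ] ℝ)
    = (moll k (g i) x - moll l (g i) x) • (EuclideanSpace.proj i : Ev →L[ℝ] ℝ) from (sub_smul _ _ _).symm, enorm_smul]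
  refine (mul_le_mul_right (?_ : _ ≤ (1:ℝ≥0∞)) _).trans (mul_one _).le
  rw [← ofReal_norm, ← ENNReal.ofReal_one]
  refine ofReal_le_ofReal (ContinuousLinearMap.opNorm_le_bound _ zero_le_one fun y => ?_)
  rw [one_mul]; exact norm_apply_le y i

theorem primitive {x0 : Ev} {R r : ℝ} {g : Fin n → Ev → ℝ} (hg : ∀ i, Integrable (g i))
    (hcurl : ∀ φ : Ev → ℝ, ContDiff ℝ 1 φ → HasCompactSupport φ → tsupport φ ⊆ ball x0 R → ∀ i j,
      ∫ x, g i x * fderiv ℝ φ x (es j) = ∫ x, g j x * fderiv ℝ φ x (es i)) {k : ℕ} (hk : r + 1/((k:ℝ)+1) < R) :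
    ∃ v, ∀ x ∈ ball x0 r, HasFDerivAt v (omg g k x) x := by
  refine (convex_ball x0 r).exists_forall_hasFDerivAt_of_fderiv_symmetric isOpen_ball
    (fun x _ => (omg_diff hg k x).differentiableAt.differentiableWithinAt) fun x hx a b => ?_
  have hz2 : closedBall x (1/((k:ℝ)+1)) ⊆ ball x0 R := by
    intro w hw
    rw [mem_closedBall] at hw; rw [mem_ball] at hx ⊢
    linarith [dist_triangle w x x0]
  have hs : ∀ i j, fderiv ℝ (moll k (g i)) x (es j) = fderiv ℝ (moll k (g j)) x (es i) := by
    intro i j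
    obtain ⟨ψ, aa, ab, ad, -, al⟩ := moll_pd k (hg i).locallyIntegrable x
    obtain ⟨ψ', -, -, -, -, fs⟩ := moll_pd k (hg j).locallyIntegrable x
    have := hcurl ψ aa ab (ad.trans hz2) i j
    unfold es at this ⊢
    rw [(al j).2, (fs i).2, this, (fs i).1, (al i).1]
  rw [(omg_diff hg k x).fderiv]
  simp only [sum_apply, ContinuousLinearMap.smulRight_apply, smul_apply,
    PiLp.proj_apply, smul_eq_mul, Finset.sum_apply]
  simp only [clm_es (fderiv ℝ (moll k _) x) a, clm_es (fderiv ℝ (moll k _) x) b, sum_mul, smul_eq_mul]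
  rw [Finset.sum_comm]
  refine sum_congr rfl fun j _ => sum_congr rfl fun i _ => ?_
  rw [hs i j]; ring

theorem potential {x0 : Ev} {R r : ℝ} (hr0 : 0 < r) (hr : r < R) {g : Fin n → Ev → ℝ} (hg : ∀ i, Integrable (g i))
    (hcurl : ∀ φ : Ev → ℝ, ContDiff ℝ 1 φ → HasCompactSupport φ → tsupport φ ⊆ ball x0 R → ∀ i j,
      ∫ x, g i x * fderiv ℝ φ x (es j) = ∫ x, g j x * fderiv ℝ φ x (es i)) :
    ∃ u, IntegrableOn u (ball x0 r) ∧ ∀ i, WD (ball x0 r) i u (g i) := by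
  set B := ball x0 r with av
  obtain ⟨ij, hr1, hr2⟩ := exists_between hr
  obtain ⟨ap, hk0⟩ := exists_nat_one_div_lt (sub_pos.2 hr2)
  have hk : ∀ k : ℕ, ij + 1/(((k + ap : ℕ) : ℝ)+1) < R := fun k => by
    have : 1/(((k + ap : ℕ) : ℝ)+1) ≤ 1/((ap:ℝ)+1) := by
      apply one_div_le_one_div_of_le (by positivity); push_cast; linarith [(Nat.cast_nonneg k : (0:ℝ) ≤ k)]
    linarith
  choose v hv using fun k => primitive hg hcurl (hk k)
  have hsub : closedBall x0 r ⊆ ball x0 ij := closedBall_subset_ball hr1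
  have hsub' : B ⊆ ball x0 ij := ball_subset_closedBall.trans hsub
  have vi : ∀ k, IntegrableOn (v k) B := fun k => by
    have : ContinuousOn (v k) (closedBall x0 r) := fun x hx => (hv k x (hsub hx)).continuousAt.continuousWithinAt
    exact (this.integrableOn_compact (isCompact_closedBall _ _)).mono_set ball_subset_closedBall
  have oc : ∀ k, Continuous (omg g k) := fun k => continuous_iff_continuousAt.2 fun x => (omg_diff hg k x).continuousAt
  haveI : IsFiniteMeasure (volume.restrict B) := ⟨by simpa using measure_ball_lt_top⟩
  obtain ⟨C, ar, aj⟩ := poinc_avg (B := B) measurableSet_ball (convex_ball x0 r) (measure_ball_pos _ _ hr0).ne'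
    measure_ball_lt_top.ne (D := 2 * r) (fun x hx y hy => by
      rw [← dist_eq_norm]; rw [av, mem_ball] at hx hy
      linarith [dist_triangle_right x y x0])
  set w : ℕ → Ev → ℝ := fun k x => v k x - ⨍ y in B, v k y with hw
  have wi : ∀ k, IntegrableOn (w k) B := fun k => (vi k).sub (integrable_const _)
  set ee : ℕ → ℝ := fun k => ∑ i, ∫ x, ‖moll (k + ap) (g i) x - g i x‖ with hee
  have hel : Tendsto ee atTop (𝓝 0) := by
    have : Tendsto ee atTop (𝓝 (∑ _i : Fin n, (0:ℝ))) := tendsto_finsetSum _ fun i _ =>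
      (moll_L1 (hg i)).comp (tendsto_add_atTop_nat ap)
    simpa using this
  have mi : ∀ k i, Integrable (fun x => moll k (g i) x - g i x) := fun k i => isub (moll_int k (hg i)) (hg i)
  have hcau : ∀ k l, ∫ x in B, ‖w k x - w l x‖ ≤ C.toReal * ee k + C.toReal * ee l := by
    intro k l
    set G : Ev → ℝ≥0∞ := fun x => ∑ i, ‖moll (k + ap) (g i) x - moll (l + ap) (g i) x‖ₑ with ak
    have mc : ∀ k i, Continuous (moll k (g i)) := fun k i => (moll_smooth k (hg i).locallyIntegrable (m := 1)).continuous
    have aa := aj (v := fun x => v k x - v l x) (v' := fun x => omg g (k + ap) x - omg g (l + ap) x) (fun x hx => (hv k x (hsub' hx)).sub (hv l x (hsub' hx)))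
      ((oc _).sub (oc _)).continuousOn ((vi k).sub (vi l)) (G := G)
      (Finset.measurable_sum _ fun i _ => ((mc _ i).sub (mc _ i)).measurable.enorm) (fun x _ => omg_sub_le _ _ _ _)
    have ab : ∫⁻ x, G x ≤ ofReal (ee k + ee l) := by
      have mm : ∀ i ∈ Finset.univ, Measurable fun x => ‖moll (k + ap) (g i) x - moll (l + ap) (g i) x‖ₑ := fun i _ =>
        ((mc _ i).sub (mc _ i)).measurable.enorm
      simp only [ak, hee]
      rw [lintegral_finsetSum _ mm]
      rw [← Finset.sum_add_distrib, ENNReal.ofReal_sum_of_nonneg fun i _ => by positivity]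
      refine sum_le_sum fun i _ => ?_
      rw [← ofReal_integral_norm_eq_lintegral_enorm (isub (moll_int _ (hg i)) (moll_int _ (hg i))),
        ← integral_add (mi _ i).norm (mi _ i).norm]
      refine ofReal_le_ofReal (integral_mono (isub (moll_int _ (hg i)) (moll_int _ (hg i))).norm
        (iadd (mi _ i).norm (mi _ i).norm) fun x => ?_)
      have := norm_sub_le (moll (k + ap) (g i) x - g i x) (moll (l + ap) (g i) x - g i x)
      simpa using this
    have lk : 0 ≤ ee k + ee l := by positivity
    have cf : ∀ x, w k x - w l x = v k x - v l x - ⨍ y in B, (v k y - v l y) := fun x => by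
      rw [setAverage_eq, integral_sub (vi k) (vi l)]
      simp only [hw, setAverage_eq, smul_eq_mul]; ring
    rw [← mul_add, ← ENNReal.ofReal_le_ofReal_iff (by positivity), ENNReal.ofReal_mul (by positivity), ENNReal.ofReal_toReal ar,
      ofReal_integral_norm_eq_lintegral_enorm (isub (wi k) (wi l))]
    simp only [cf]
    exact aa.trans (by gcongr)
  obtain ⟨u, hu, hlim⟩ := l1lim wi (fun k => C.toReal * ee k) (by simpa using hel.const_mul C.toReal) hcau
  refine ⟨u, hu, fun i => ?_⟩
  refine wd_lim (u := w) (v := fun k => moll (k + ap) (g i)) (fun k => ?_) wi (fun k => (moll_int _ (hg i)).integrableOn) hu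
    (hg i).integrableOn hlim ?_
  · have := wd_classical (B := B) isOpen_ball (v := w k) (v' := omg g (k + ap)) (fun x hx => (hv k x (hsub' hx)).sub_const _)
      (oc _).continuousOn i
    simpa only [omg_es] using this
  · refine squeeze_zero (fun k => by positivity) (fun k => ?_) ((moll_L1 (hg i)).comp (tendsto_add_atTop_nat ap))
    exact setIntegral_le_integral (mi _ i).norm (aoa fun x => norm_nonneg _)

end pot

section mono

theorem cocycle_aux {X F : Type*} [TopologicalSpace X] [SimplyConnectedSpace X] [LocallyPathConnectedSpace X] [AddCommGroup F]
    [TopologicalSpace F] [DiscreteTopology F] (b : X → Set X) (hbo : ∀ x, IsOpen (b x)) (hbm : ∀ x, x ∈ b x)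
    (hbc : ∀ x, IsPreconnected (b x)) (c : X → X → F) (hc0 : ∀ x, c x x = 0)
    (hc : ∀ x y z, (b x ∩ b y ∩ b z).Nonempty → c x y + c y z = c x z) :
    ∃ s : X → F, ∀ x y, (b x ∩ b y).Nonempty → s y = s x + c x y := by
  let Z : FiberBundleCore X X F :=
    { baseSet := b
      isOpen_baseSet := hbo
      indexAt := id
      mem_baseSet_at := hbm
      coordChange := fun i j _ v => v + c i j
      coordChange_self := fun i _ _ v => by simp [hc0]
      continuousOn_coordChange := fun i j =>
        ((continuous_of_discreteTopology (f := fun v : F => v + c i j)).comp continuous_snd).continuousOn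
      coordChange_comp := fun i j k x hx v => by rw [add_assoc, hc i j k ⟨x, hx⟩] }
  have cov : IsCoveringMap Z.proj := FiberBundle.isCoveringMap (F := F) (E := Z.Fiber)
  obtain ⟨x0⟩ : Nonempty X := inferInstance
  obtain ⟨S, ⟨-, af⟩, -⟩ := cov.existsUnique_continuousMap_lifts (ContinuousMap.id X) x0 (⟨x0, (0 : F)⟩ : Z.TotalSpace) rfl
  have hp : ∀ x, (S x).1 = x := fun x => congrFun af x
  have key : ∀ i, ∀ x ∈ b i, ((Z.localTriv i) (S x)).2 = ((Z.localTriv i) (S i)).2 := by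
    intro i x hx
    refine (hbc i).constant (f := fun x => ((Z.localTriv i) (S x)).2) ?_ hx (hbm i)
    refine continuous_snd.comp_continuousOn ((Z.localTriv i).continuousOn.comp S.continuous.continuousOn fun y hy => ?_)
    rw [Z.mem_localTriv_source]; show (S y).1 ∈ b i; rw [hp]; exact hy
  have key2 : ∀ i x, ((Z.localTriv i) (S x)).2 = (show F from (S x).2) + c x i := fun i x => by
    rw [Z.localTriv_apply]; show (show F from (S x).2) + c (S x).1 i = _; rw [hp]
  refine ⟨fun x => (show F from (S x).2), fun x y ⟨p, hpx, hpy⟩ => ?_⟩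
  have aa := key x p hpx
  have ab := key y p hpy
  rw [key2, key2, hc0, add_zero] at aa ab
  show (show F from (S y).2) = (show F from (S x).2) + c x y
  rw [← aa, ← ab, add_assoc, hc p x y ⟨p, ⟨hbm p, hpx⟩, hpy⟩]

theorem cocycle {X : Type*} [TopologicalSpace X] [SimplyConnectedSpace X] [LocallyPathConnectedSpace X]
    (b : X → Set X) (hbo : ∀ x, IsOpen (b x)) (hbm : ∀ x, x ∈ b x)
    (hbc : ∀ x, IsPreconnected (b x)) (c : X → X → ℝ) (hc0 : ∀ x, c x x = 0)
    (hc : ∀ x y z, (b x ∩ b y ∩ b z).Nonempty → c x y + c y z = c x z) :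
    ∃ s : X → ℝ, ∀ x y, (b x ∩ b y).Nonempty → s y = s x + c x y :=
  @cocycle_aux X ℝ _ _ _ _ ⊥ (@DiscreteTopology.mk ℝ ⊥ rfl) b hbo hbm hbc c hc0 hc

theorem WD.indic {B : Set Ev} {i : Fin n} {u v : Ev → ℝ} (h : WD B i u v) : WD B i (B.indicator u) v :=
  h.congr_ae (aoa fun _ hx => indicator_of_mem hx _) (aoa fun _ _ => rfl)

theorem wd_const {Ω : Set Ev} (hΩ : IsOpen Ω) (hc : IsPreconnected Ω) {u : Ev → ℝ}
    (hu : ∀ x R, closedBall x R ⊆ Ω → IntegrableOn u (ball x R)) (h : ∀ i, WD Ω i u fun _ => 0) :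
    ∃ c : ℝ, ∀ᵐ x, x ∈ Ω → u x = c := by
  have loc : ∀ x : Ω, ∃ r > 0, ball (x:Ev) r ⊆ Ω ∧ ∃ c : ℝ, ∀ᵐ y, y ∈ ball (x:Ev) r → u y = c := by
    rintro ⟨x, hx⟩
    obtain ⟨R, bt, jz⟩ := nhds_basis_closedBall.mem_iff.1 (hΩ.mem_nhds hx)
    have hb : ball x R ⊆ Ω := ball_subset_closedBall.trans jz
    have hi := (integrable_indicator_iff measurableSet_ball).2 (hu x R jz)
    obtain ⟨c, hc⟩ := wd_zero (x0 := x) (R := R) (r := R/2) (by linarith) hi.locallyIntegrable fun i =>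
      (((h i).mono hb).indic)
    refine ⟨R/2, by positivity, (ball_subset_ball (by linarith)).trans hb, c, ?_⟩
    filter_upwards [hc] with y hy hyb
    rw [← hy hyb, indicator_of_mem (ball_subset_ball (by linarith) hyb)]
  choose r hr0 hrΩ c hc' using loc
  have hloc : ∀ x y : Ω, (y : Ev) ∈ ball (x:Ev) (r x) → c y = c x := by
    intro x y hy
    have ho : IsOpen (ball (x:Ev) (r x) ∩ ball (y:Ev) (r y)) := isOpen_ball.inter isOpen_ball
    have : volume (ball (x:Ev) (r x) ∩ ball (y:Ev) (r y)) ≠ 0 :=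
      (ho.measure_pos volume ⟨y, hy, mem_ball_self (hr0 y)⟩).ne'
    obtain ⟨z, hz, aa, ab⟩ := ((frequently_ae_mem_iff.2 this).and_eventually ((hc' x).and (hc' y))).exists
    rw [← aa hz.1, ← ab hz.2]
  haveI : PreconnectedSpace Ω := Subtype.preconnectedSpace hc
  have hlc : IsLocallyConstant c := (IsLocallyConstant.iff_eventually_eq c).2 fun x => by
    filter_upwards [continuous_subtype_val.continuousAt.preimage_mem_nhds (ball_mem_nhds (x:Ev) (hr0 x))] with y hy
    exact hloc x y hy
  rcases isEmpty_or_nonempty Ω with he | ⟨⟨x0⟩⟩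
  · exact ⟨0, aoa fun x hx => (he.false ⟨x, hx⟩).elim⟩
  refine ⟨c x0, ?_⟩
  rw [ae_iff]
  refine measure_null_of_locally_null _ fun x hx => ?_
  push Not at hx
  have hz := hc' ⟨x, hx.1⟩
  rw [ae_iff] at hz
  refine ⟨_, ?_, hz⟩
  filter_upwards [self_mem_nhdsWithin, nhdsWithin_le_nhds (ball_mem_nhds x (hr0 ⟨x, hx.1⟩))] with y hy hyb
  simp only [mem_ofPred_eq, Classical.not_imp] at hy ⊢
  exact ⟨hyb, by rw [hlc.apply_eq_of_preconnectedSpace ⟨x, hx.1⟩ x0]; exact hy.2⟩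

theorem ae_open {E : Set Ev} (ei : IsOpen E) (hne : E.Nonempty) {P : Ev → Prop} (h : ∀ᵐ x, P x) : ∃ x ∈ E, P x :=
  ((frequently_ae_mem_iff.2 (ei.measure_pos volume hne).ne').and_eventually h).exists

theorem moll_germ {O : Set Ev} (lb : IsOpen O) {p : Ev} (hp : p ∈ O) {u v : Ev → ℝ}
    (h : ∀ᵐ t, t ∈ O → u t = v t) : ∀ᶠ k in atTop, moll k u p = moll k v p := by
  obtain ⟨e, he, heb⟩ := Metric.isOpen_iff.1 lb p hp
  obtain ⟨ap, hk0⟩ := exists_nat_one_div_lt he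
  filter_upwards [eventually_ge_atTop ap] with k hk
  refine integral_congr_ae ?_
  filter_upwards [h] with t ht
  by_cases h : t ∈ ball p e
  · rw [ht (heb h)]
  · have : 1/((k:ℝ)+1) ≤ 1/((ap:ℝ)+1) := by gcongr
    rw [mem_ball, dist_comm, dist_eq_norm] at h
    rw [rho_zero k (x := p - t) (by linarith), mul_zero, mul_zero]

theorem glue {Ω : Set Ev} {g : Fin n → Ev → ℝ} (r : Ω → ℝ) (hr0 : ∀ x, 0 < r x) (hrΩ : ∀ x : Ω, ball (x : Ev) (r x) ⊆ Ω)
    (W : Ω → Ev → ℝ) (ga : ∀ x, Integrable (W x)) (io : ∀ (x : Ω) i, WD (ball (x : Ev) (r x)) i (W x) (g i))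
    (hag : ∀ x y : Ω, ∀ᵐ p, p ∈ ball (x : Ev) (r x) ∩ ball (y : Ev) (r y) → W x p = W y p) :
    ∃ u, ∀ x ∈ Ω, ∃ r > 0, ball x r ⊆ Ω ∧ IntegrableOn u (ball x r) ∧ ∀ i, WD (ball x r) i u (g i) := by
  obtain ⟨u, hua⟩ : ∃ u : Ev → ℝ, ∀ x : Ω, ∀ᵐ p, p ∈ ball (x : Ev) (r x) → u p = W x p := by
    classical
    refine ⟨fun p => if h : p ∈ Ω then limUnder atTop (fun k => moll k (W ⟨p, h⟩) p) else 0, fun x => ?_⟩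
    filter_upwards [moll_ae (ga x).locallyIntegrable] with p hp hpx
    have hpΩ := hrΩ x hpx
    rw [dif_pos hpΩ]
    exact (hp.congr' (moll_germ (isOpen_ball.inter isOpen_ball) ⟨hpx, mem_ball_self (hr0 ⟨p, hpΩ⟩)⟩
      (hag x ⟨p, hpΩ⟩))).limUnder_eq
  refine ⟨u, fun x hx => ?_⟩
  have aa := hua ⟨x, hx⟩
  have ab := io ⟨x, hx⟩
  have ad := ga ⟨x, hx⟩
  have ai := hr0 ⟨x, hx⟩
  have al := hrΩ ⟨x, hx⟩
  generalize r ⟨x, hx⟩ = R at *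
  generalize W ⟨x, hx⟩ = w at *
  refine ⟨R, ai, al, ?_, fun i => (ab i).congr_ae aa (aoa fun y _ => rfl)⟩
  refine (ad.integrableOn (s := ball x R)).congr ?_
  rw [EventuallyEq, ae_restrict_iff' measurableSet_ball]
  filter_upwards [aa] with p aa ab using (aa ab).symm

theorem glob {Ω : Set Ev} (hΩ : IsOpen Ω) [SimplyConnectedSpace Ω] {g : Fin n → Ev → ℝ} (hg : ∀ i, Integrable (g i))
    (loc : ∀ x ∈ Ω, ∃ r > 0, ball x r ⊆ Ω ∧ ∃ U, IntegrableOn U (ball x r) ∧ ∀ i, WD (ball x r) i U (g i)) :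
    ∃ u, ∀ x ∈ Ω, ∃ r > 0, ball x r ⊆ Ω ∧ IntegrableOn u (ball x r) ∧ ∀ i, WD (ball x r) i u (g i) := by
  choose r hr0 hrΩ U cx fb using fun x : Ω => loc x x.2
  set B : Ω → Set Ev := fun x => ball (x : Ev) (r x) with av
  have ej : ∀ x, IsOpen (B x) := fun x => isOpen_ball
  set V : Ω → Ev → ℝ := fun x => (B x).indicator (U x) with dp
  have fc : ∀ x, Integrable (V x) := fun x => (integrable_indicator_iff measurableSet_ball).2 (cx x)
  have iu : ∀ x i, WD (B x) i (V x) (g i) := fun x i => (fb x i).indic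
  have hex : ∀ x y : Ω, ∃ c : ℝ, ∀ᵐ p, p ∈ B x ∩ B y → V x p - V y p = c := by
    intro x y
    refine wd_const ((ej x).inter (ej y)) ((convex_ball _ _).inter (convex_ball _ _)).isPreconnected
      (fun _ _ _ => ((fc x).sub (fc y)).integrableOn) fun i => ?_
    have := ((iu x i).mono inter_subset_left).lin ((iu y i).mono inter_subset_right) (fc x).locallyIntegrable
      (hg i).locallyIntegrable (fc y).locallyIntegrable (hg i).locallyIntegrable 1 (-1)
    simpa [← sub_eq_add_neg] using this
  choose c hc using hex
  haveI : LocallyPathConnectedSpace Ω := hΩ.locallyPathConnectedSpace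
  have mem : ∀ x : Ω, (x : Ev) ∈ B x := fun x => mem_ball_self (hr0 x)
  obtain ⟨s, hs⟩ := cocycle (fun x : Ω => Subtype.val ⁻¹' (B x)) (fun x => (ej x).preimage continuous_subtype_val)
    mem (fun x => by
      rw [← Topology.IsInducing.subtypeVal.isPreconnected_image, Subtype.image_preimage_coe, inter_eq_right.2 (hrΩ x)]
      exact (convex_ball _ _).isPreconnected) c
    (fun x => by
      obtain ⟨p, hp, aa⟩ := ae_open (ej x) ⟨_, mem x⟩ (hc x x)
      rw [← aa ⟨hp, hp⟩, sub_self])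
    (fun x y z ⟨p, hp⟩ => by
      obtain ⟨q, hq, aa, ab, ad⟩ := ae_open (((ej x).inter (ej y)).inter (ej z)) ⟨p, hp⟩ ((hc x y).and ((hc y z).and (hc x z)))
      rw [← aa hq.1, ← ab ⟨hq.1.2, hq.2⟩, ← ad ⟨hq.1.1, hq.2⟩]; ring)
  set W : Ω → Ev → ℝ := fun x => (B x).indicator (fun t => V x t + s x) with kv
  have ga : ∀ x, Integrable (W x) := fun x => (integrable_indicator_iff measurableSet_ball).2
    ((fc x).integrableOn.add (integrableOn_const measure_ball_lt_top.ne))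
  have io : ∀ x i, WD (B x) i (W x) (g i) := by
    intro x i
    have ae : WD (B x) i (fun _ => s x) fun _ => 0 := by
      simpa using wd_classical (ej x) (v := fun _ => s x) (v' := fun _ => 0) (fun y _ => hasFDerivAt_const _ _) continuousOn_const i
    have := ((iu x i).lin ae (fc x).locallyIntegrable (hg i).locallyIntegrable (locallyIntegrable_const _)
      (locallyIntegrable_const _) 1 1).indic
    simp only [one_mul, add_zero] at this
    exact this
  have hag : ∀ x y, ∀ᵐ p, p ∈ B x ∩ B y → W x p = W y p := by
    intro x y
    filter_upwards [hc x y] with p hp h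
    have aa := hp h
    have ab := hs x y ⟨⟨p, hrΩ x h.1⟩, h⟩
    simp only [kv]
    rw [indicator_of_mem h.1, indicator_of_mem h.2]; linarith
  exact glue r hr0 hrΩ W ga io hag

end mono

section brou

theorem nrm_lip {E : Type*} [NormedAddCommGroup E] [NormedSpace ℝ E] {a b : E} {δ : ℝ} (ah : 0 < δ) (ha : δ ≤ ‖a‖) (hb : δ ≤ ‖b‖) :
    ‖‖a‖⁻¹ • a - ‖b‖⁻¹ • b‖ ≤ 2 / δ * ‖a - b‖ := by
  have ha0 : 0 < ‖a‖ := ah.trans_le ha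
  have hb0 : 0 < ‖b‖ := ah.trans_le hb
  have : ‖a‖⁻¹ • a - ‖b‖⁻¹ • b = ‖a‖⁻¹ • ((a - b) + ((‖b‖ - ‖a‖) * ‖b‖⁻¹) • b) := by
    rw [smul_add, smul_sub, smul_smul, show ‖a‖⁻¹ * ((‖b‖ - ‖a‖) * ‖b‖⁻¹) = ‖a‖⁻¹ - ‖b‖⁻¹ by field_simp, sub_smul]; abel
  rw [this, norm_smul, norm_inv, norm_norm]
  have aa : ‖(a - b) + ((‖b‖ - ‖a‖) * ‖b‖⁻¹) • b‖ ≤ 2 * ‖a - b‖ := by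
    refine (norm_add_le _ _).trans ?_
    rw [norm_smul, norm_mul, norm_inv, norm_norm, inv_mul_cancel_right₀ hb0.ne', norm_eq_abs, abs_sub_comm]
    linarith [abs_norm_sub_norm_le a b]
  calc _ ≤ δ⁻¹ * (2 * ‖a - b‖) := by gcongr
    _ = _ := by ring

theorem prj_lip {E : Type*} [NormedAddCommGroup E] [NormedSpace ℝ E] (a b : E) :
    ‖(max 1 ‖a‖)⁻¹ • a - (max 1 ‖b‖)⁻¹ • b‖ ≤ 2 * ‖a - b‖ := by
  set m := max 1 ‖a‖
  set k := max 1 ‖b‖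
  have hm : 1 ≤ m := le_max_left _ _
  have hk : 1 ≤ k := le_max_left _ _
  have hbk : ‖b‖ ≤ k := le_max_right _ _
  have hmk : |k - m| ≤ ‖a - b‖ := by
    rw [abs_sub_comm, show m = max ‖a‖ 1 from max_comm _ _, show k = max ‖b‖ 1 from max_comm _ _]
    exact (abs_max_sub_max_le_abs ..).trans (abs_norm_sub_norm_le a b)
  have : m⁻¹ • a - k⁻¹ • b = m⁻¹ • ((a - b) + ((k - m) * k⁻¹) • b) := by
    have : m⁻¹ * ((k - m) * k⁻¹) = m⁻¹ - k⁻¹ := by field_simp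
    rw [smul_add, smul_sub, smul_smul, this, sub_smul]; abel
  rw [this, norm_smul, norm_inv, norm_of_nonneg (by linarith : (0:ℝ) ≤ m)]
  have aa : ‖(a - b) + ((k - m) * k⁻¹) • b‖ ≤ 2 * ‖a - b‖ := by
    refine (norm_add_le _ _).trans ?_
    rw [norm_smul, norm_mul, norm_inv, norm_of_nonneg (by linarith : (0:ℝ) ≤ k), norm_eq_abs, mul_assoc]
    have : k⁻¹ * ‖b‖ ≤ 1 := by rw [inv_mul_le_iff₀ (by linarith)]; linarith
    nlinarith [abs_nonneg (k - m)]
  calc _ ≤ 1 * (2 * ‖a - b‖) := by gcongr; exact inv_le_one_of_one_le₀ hm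
    _ = _ := by ring

theorem vol_lip {K : NNReal} {f : EVec n → EVec n} {s : Set (EVec n)} (h : LipschitzOnWith K f s) :
    volume (f '' s) ≤ (K:ℝ≥0∞) ^ n * volume s := by
  haveI : (Measure.hausdorffMeasure n : Measure (EVec n)).IsAddHaarMeasure := by
    simpa using MeasureTheory.isAddHaarMeasure_hausdorffMeasure (E := EVec n)
  have hv : (volume : Measure (EVec n)) = _ := Measure.isAddLeftInvariant_eq_smul volume (Measure.hausdorffMeasure n : Measure (EVec n))
  have := h.hausdorffMeasure_image_le (d := n) (by positivity)
  rw [ENNReal.rpow_natCast] at this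
  rw [hv, Measure.smul_apply, Measure.smul_apply, ENNReal.smul_def, ENNReal.smul_def, smul_eq_mul, smul_eq_mul, mul_left_comm]
  gcongr

theorem pert_ball {R : ℝ} {v : Ev → Ev} {K : NNReal} (ay : K < 1) (hv : LipschitzWith K v) (ae : ∀ x, R ≤ ‖x‖ → v x = 0) :
    Function.Injective (fun x => x + v x) ∧ (fun x => x + v x) '' ball 0 R = ball 0 R := by
  have inj : Function.Injective (fun x => x + v x) := by
    intro x y hxy
    have aa : x - y = v y - v x := by
      have : x + v x = y + v y := hxy
      rw [sub_eq_sub_iff_add_eq_add, this, add_comm]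
    have ab := hv.dist_le_mul y x
    rw [dist_eq_norm, dist_eq_norm, ← aa, norm_sub_rev y x] at ab
    have cl : (K:ℝ) < 1 := ay
    have : ‖x - y‖ ≤ 0 := by nlinarith [norm_nonneg (x - y)]
    exact sub_eq_zero.1 (norm_le_zero_iff.1 this)
  refine ⟨inj, Subset.antisymm ?_ ?_⟩
  · rintro _ ⟨x, hx, rfl⟩
    by_contra h
    rw [mem_ball_zero_iff, not_lt] at h
    have ab : (x + v x) + v (x + v x) = x + v x := by rw [ae _ h, add_zero]
    have := inj ab
    replace h : R ≤ ‖x + v x‖ := h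
    rw [this, ← not_lt] at h
    exact h (mem_ball_zero_iff.1 hx)
  · intro y hy
    have hc : ContractingWith K fun x => y - v x := ⟨ay, LipschitzWith.of_dist_le_mul fun a b => by
      rw [dist_sub_left]; exact hv.dist_le_mul a b⟩
    obtain ⟨x, hx⟩ : ∃ x, y - v x = x := ⟨_, hc.fixedPoint_isFixedPt⟩
    have hxy : x + v x = y := by nth_rewrite 1 [← hx]; abel
    refine ⟨x, ?_, hxy⟩
    by_contra h
    rw [mem_ball_zero_iff, not_lt] at h
    rw [ae x h, add_zero] at hxy
    rw [hxy, ← not_lt] at h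
    exact h (mem_ball_zero_iff.1 hy)

theorem det_interp (A : Ev →L[ℝ] Ev) (t : ℕ → ℝ) (ht : Function.Injective t) :
    (ContinuousLinearMap.id ℝ Ev + A).det = ∑ j ∈ Finset.range (n+1),
      (ContinuousLinearMap.id ℝ Ev + t j • A).det * (Lagrange.basis (Finset.range (n+1)) t j).eval 1 := by
  set b := (EuclideanSpace.basisFun (Fin n) ℝ).toBasis
  set M := LinearMap.toMatrix b b (A : Ev →ₗ[ℝ] Ev) with ck
  set p : Polynomial ℝ := Matrix.det ((Polynomial.X : Polynomial ℝ) • M.map Polynomial.C + (1 : Matrix _ _ ℝ).map Polynomial.C)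
  have hp : ∀ s : ℝ, (ContinuousLinearMap.id ℝ Ev + s • A).det = p.eval s := by
    intro s
    rw [ContinuousLinearMap.det, ← LinearMap.det_toMatrix b, ← Polynomial.coe_evalRingHom, RingHom.map_det]
    congr 1
    rw [ContinuousLinearMap.toLinearMap_add, ContinuousLinearMap.toLinearMap_smul, map_add, map_smul, ContinuousLinearMap.coe_id, LinearMap.toMatrix_id]
    ext i j
    simp [Matrix.one_apply, ← ck, add_comm]
    split_ifs <;> simp [mul_comm]
  have hd : p.degree < (Finset.range (n+1)).card := by
    refine lt_of_le_of_lt Polynomial.degree_le_natDegree ?_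
    have := Polynomial.natDegree_det_X_add_C_le M (1 : Matrix _ _ ℝ)
    rw [Fintype.card_fin] at this
    rw [Finset.card_range]; exact_mod_cast Nat.lt_succ_of_le this
  have := congrArg (Polynomial.eval 1) (Lagrange.eq_interpolate ht.injOn hd)
  rw [Lagrange.interpolate_apply, Polynomial.eval_finsetSum] at this
  have aa := hp 1
  rw [one_smul] at aa
  rw [aa, this]
  exact sum_congr rfl fun j _ => by rw [hp, Polynomial.eval_mul, Polynomial.eval_C]

theorem int_det_pert {R : ℝ} {v : Ev → Ev} {K : NNReal} (ay : K < 1) (hv : LipschitzWith K v) (ae : ∀ x, R ≤ ‖x‖ → v x = 0)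
    (hdet : ∀ x, 0 < (ContinuousLinearMap.id ℝ Ev + fderiv ℝ v x).det) :
    ∫ x in ball 0 R, (ContinuousLinearMap.id ℝ Ev + fderiv ℝ v x).det = volume.real (ball (0 : Ev) R) := by
  obtain ⟨inj, him⟩ := pert_ball ay hv ae
  set D := {x | DifferentiableAt ℝ v x} with cb
  have lf : MeasurableSet D := measurableSet_of_differentiableAt ℝ v
  have hDae : ∀ᵐ x, x ∈ D := hv.ae_differentiableAt
  have lg : volume Dᶜ = 0 := hDae
  have hs : MeasurableSet (ball (0 : Ev) R ∩ D) := measurableSet_ball.inter lf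
  have hf' : ∀ x ∈ ball (0 : Ev) R ∩ D, HasFDerivWithinAt (fun x => x + v x) (ContinuousLinearMap.id ℝ Ev + fderiv ℝ v x)
      (ball 0 R ∩ D) x := fun x hx => ((hasFDerivAt_id x).add hx.2.hasFDerivAt).hasFDerivWithinAt
  have hcv := lintegral_abs_det_fderiv_eq_addHaar_image volume hs hf' inj.injOn
  have hl : LipschitzWith (1 + K) (fun x => x + v x) := LipschitzWith.id.add hv
  have hvol : volume ((fun x => x + v x) '' (ball 0 R ∩ D)) = volume (ball (0 : Ev) R) := by
    refine le_antisymm ?_ ?_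
    · exact (measure_mono (image_mono inter_subset_left)).trans (measure_mono him.le)
    · nth_rewrite 1 [← him]
      calc volume ((fun x => x + v x) '' ball 0 R) ≤ volume ((fun x => x + v x) '' (ball 0 R ∩ D) ∪ (fun x => x + v x) '' Dᶜ) := by
            refine measure_mono ?_
            rw [← image_union]
            exact image_mono fun x hx => by by_cases h : x ∈ D; exacts [Or.inl ⟨hx, h⟩, Or.inr h]
        _ ≤ _ + _ := measure_union_le _ _
        _ ≤ _ + 0 := by
            gcongr
            refine (vol_lip hl.lipschitzOnWith).trans ?_
            rw [lg, mul_zero]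
        _ = _ := add_zero _
  rw [hvol] at hcv
  have hae : (ball (0 : Ev) R ∩ D : Set _) =ᵐ[volume] ball (0 : Ev) R := by
    filter_upwards [hDae] with x hx
    exact propext ⟨fun h => h.1, fun h => ⟨h, hx⟩⟩
  rw [setLIntegral_congr hae] at hcv
  rw [integral_eq_lintegral_of_nonneg_ae (aoa fun x => (hdet x).le), Measure.real, ← hcv]
  · simp only [abs_of_pos (hdet _)]
  · exact (ContinuousLinearMap.continuous_det.measurable.comp ((measurable_fderiv ℝ v).const_add _)).aestronglyMeasurable

theorem det_pint {R t : ℝ} {v : Ev → Ev} {K : NNReal} (hv : LipschitzWith K v) (ht : 0 ≤ t) :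
    IntegrableOn (fun x => (ContinuousLinearMap.id ℝ Ev + t • fderiv ℝ v x).det) (ball 0 R) := by
  have hcont : Continuous fun B : Ev →L[ℝ] Ev => B.det := ContinuousLinearMap.continuous_det
  obtain ⟨C, ar⟩ := (isCompact_closedBall (ContinuousLinearMap.id ℝ Ev) (t * K)).exists_bound_of_continuousOn hcont.continuousOn
  have hm : Measurable fun x => ContinuousLinearMap.id ℝ Ev + t • fderiv ℝ v x := ((measurable_fderiv ℝ v).const_smul t).const_add _
  refine Measure.integrableOn_of_bounded (M := C) measure_ball_lt_top.ne (hcont.measurable.comp hm).aestronglyMeasurable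
    (aoa fun x => ar _ ?_)
  rw [mem_closedBall_iff_norm, add_sub_cancel_left, norm_smul, norm_of_nonneg ht]
  exact mul_le_mul_of_nonneg_left (norm_fderiv_le_of_lipschitz ℝ hv) ht

theorem int_det {R : ℝ} {v : Ev → Ev} {K : NNReal} (hv : LipschitzWith K v) (ae : ∀ x, R ≤ ‖x‖ → v x = 0) :
    ∫ x in ball 0 R, (ContinuousLinearMap.id ℝ Ev + fderiv ℝ v x).det = volume.real (ball (0 : Ev) R) := by
  have hdet1 : (ContinuousLinearMap.id ℝ Ev).det = 1 := by simp [ContinuousLinearMap.det]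
  have hc : ∀ᶠ B in 𝓝 (ContinuousLinearMap.id ℝ Ev), 0 < B.det :=
    ContinuousLinearMap.continuous_det.continuousAt.eventually_const_lt (show 0 < (ContinuousLinearMap.id ℝ Ev).det by rw [hdet1]; norm_num)
  obtain ⟨e, he, heb⟩ := Metric.eventually_nhds_iff_ball.1 hc
  set τ : ℝ := min (e / (2 * (K + 1))) (1 / (2 * (K + 1)))
  have bn : 0 < τ := lt_min (by positivity) (by positivity)
  have gm : τ * K < e := by
    have : τ * (2 * (K + 1)) ≤ e := (le_div_iff₀ (by positivity)).1 (min_le_left _ _)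
    nlinarith [K.2]
  have gl : τ * K < 1 := by
    have : τ * (2 * (K + 1)) ≤ 1 := (le_div_iff₀ (by positivity)).1 (min_le_right _ _)
    nlinarith [K.2]
  set t : ℕ → ℝ := fun j => τ * (1 / ((j:ℝ) + 1))
  have ht0 : ∀ j, 0 < t j := fun j => by positivity
  have htτ : ∀ j, t j ≤ τ := fun j => by
    refine mul_le_of_le_one_right bn.le ?_
    rw [div_le_one (by positivity)]; linarith [(Nat.cast_nonneg j : (0:ℝ) ≤ j)]
  have htj : Function.Injective t := by
    intro i j h
    have := mul_left_cancel₀ bn.ne' h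
    simpa using this
  have key : ∀ j, ∫ x in ball 0 R, (ContinuousLinearMap.id ℝ Ev + t j • fderiv ℝ v x).det = volume.real (ball (0 : Ev) R) := by
    intro j
    have hfd : ∀ x, fderiv ℝ (t j • v) x = t j • fderiv ℝ v x := fun x => congrFun (fderiv_const_smul_field _) x
    have hl : LipschitzWith ((t j).toNNReal * K) (t j • v) := LipschitzWith.of_dist_le_mul fun x y => by
      rw [Pi.smul_apply, Pi.smul_apply, dist_smul₀, NNReal.coe_mul, Real.coe_toNNReal _ (ht0 j).le, mul_assoc, norm_of_nonneg (ht0 j).le]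
      exact mul_le_mul_of_nonneg_left (hv.dist_le_mul x y) (ht0 j).le
    have hb : ∀ c : ℝ, τ * K < c → t j * K < c := fun c hc => (mul_le_mul_of_nonneg_right (htτ j) K.2).trans_lt hc
    have := int_det_pert (R := R) (v := t j • v) (K := (t j).toNNReal * K) (by rw [← NNReal.coe_lt_coe, NNReal.coe_mul, Real.coe_toNNReal _ (ht0 j).le]; exact hb 1 gl) hl
      (fun x hx => by rw [Pi.smul_apply, ae x hx, smul_zero]) fun x => by
        refine heb _ ?_
        rw [mem_ball_iff_norm, add_sub_cancel_left, hfd, norm_smul, norm_of_nonneg (ht0 j).le]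
        exact (mul_le_mul_of_nonneg_left (norm_fderiv_le_of_lipschitz ℝ hv) (ht0 j).le).trans_lt (hb e gm)
    simpa only [hfd] using this
  have hint := fun j => det_pint (R := R) hv (ht0 j).le
  rw [integral_congr_ae (aoa fun x => det_interp (fderiv ℝ v x) t htj)]
  rw [integral_finsetSum _ fun j _ => (hint j).mul_const _]
  simp_rw [integral_mul_const, key]
  rw [← mul_sum, ← Polynomial.eval_finsetSum, Lagrange.sum_basis htj.injOn ⟨0, by simp⟩, Polynomial.eval_one, mul_one]

end brou

section brou2

theorem det_zero_of_norm {r : Ev → Ev} {A : Ev →L[ℝ] Ev} {x : Ev} {c : ℝ} (hc : 0 < c)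
    (hr : HasFDerivAt r A x) (hn : ∀ᶠ y in 𝓝 x, ‖r y‖ = c) : A.det = 0 := by
  have aa : HasFDerivAt (fun y => ‖r y‖ ^ 2) (2 • (innerSL ℝ (r x)).comp A) x := hr.norm_sq
  have ab : HasFDerivAt (fun y => ‖r y‖ ^ 2) (0 : Ev →L[ℝ] ℝ) x :=
    (hasFDerivAt_const (c ^ 2) x).congr_of_eventuallyEq (by filter_upwards [hn] with y hy; rw [hy])
  have ad := aa.unique ab
  have ai : ∀ v, ⟪r x, A v⟫ = 0 := fun v => by
    have := congrArg (fun B : Ev →L[ℝ] ℝ => B v) ad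
    simpa using this
  by_contra hd
  have hs := (LinearMap.equivOfDetNeZero (A : Ev →ₗ[ℝ] Ev) hd).surjective (r x)
  obtain ⟨v, hv⟩ := hs
  have hv' : A v = r x := hv
  have := ai v
  rw [hv', real_inner_self_eq_norm_sq, hn.self_of_nhds] at this
  exact absurd this (by positivity)

theorem lip_of {E F : Type*} [NormedAddCommGroup E] [NormedAddCommGroup F] {f : E → F} {s : Set E} {C : ℝ}
    (h : ∀ x ∈ s, ∀ y ∈ s, ‖f x - f y‖ ≤ C * ‖x - y‖) : ∃ K : NNReal, LipschitzOnWith K f s :=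
  ⟨C.toNNReal, LipschitzOnWith.of_dist_le_mul fun x hx y hy => by
    rw [dist_eq_norm, dist_eq_norm]
    exact (h x hx y hy).trans (mul_le_mul_of_nonneg_right (Real.le_coe_toNNReal C) (norm_nonneg _))⟩

theorem lip_to {E F : Type*} [NormedAddCommGroup E] [NormedAddCommGroup F] {f : E → F} {s : Set E} {K : NNReal}
    (h : LipschitzOnWith K f s) : ∀ x ∈ s, ∀ y ∈ s, ‖f x - f y‖ ≤ K * ‖x - y‖ := fun x hx y hy => by
  simpa [dist_eq_norm] using h.dist_le_mul x hx y hy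

theorem no_retr {Ψ : Ev → Ev} {K : NNReal} (jo : LipschitzOnWith K Ψ (closedBall 0 1))
    (hb : ∀ x, ‖x‖ = 1 → Ψ x = x) : ∃ x ∈ closedBall 0 1, Ψ x = 0 := by
  by_contra! ae
  obtain ⟨x0, hx0, hmin⟩ := (isCompact_closedBall (0 : Ev) 1).exists_isMinOn ⟨0, by simp⟩ jo.continuousOn.norm
  set δ := ‖Ψ x0‖
  have ah : 0 < δ := norm_pos_iff.2 (ae x0 hx0)
  have bx : ∀ x ∈ closedBall (0 : Ev) 1, δ ≤ ‖Ψ x‖ := fun x hx => hmin hx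
  set π : Ev → Ev := fun x => (max 1 ‖x‖)⁻¹ • x with ec
  have br : ∀ x, π x ∈ closedBall (0 : Ev) 1 := fun x => by
    have : (0:ℝ) < max 1 ‖x‖ := lt_of_lt_of_le one_pos (le_max_left _ _)
    rw [mem_closedBall_zero_iff, ec]
    dsimp only
    rw [norm_smul, norm_inv, norm_of_nonneg this.le, inv_mul_le_iff₀ this, mul_one]
    exact le_max_right _ _
  have dz : ∀ x, ‖x‖ ≤ 1 → π x = x := fun x hx => by simp only [ec]; rw [max_eq_left hx, inv_one, one_smul]
  have fk : ∀ x, 1 ≤ ‖x‖ → ‖π x‖ = 1 := fun x hx => by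
    simp only [ec]; rw [max_eq_right hx, norm_smul, norm_inv, norm_norm, inv_mul_cancel₀ (by linarith)]
  set v : Ev → Ev := fun x => ‖Ψ (π x)‖⁻¹ • Ψ (π x) - π x with hv
  obtain ⟨K', cl⟩ : ∃ K', LipschitzOnWith K' v univ := by
    refine lip_of (C := (2 / δ * K + 1) * 2) fun x _ y _ => ?_
    have aa := nrm_lip ah (bx _ (br x)) (bx _ (br y))
    have ab := lip_to jo _ (br x) _ (br y)
    have ad : ‖π x - π y‖ ≤ 2 * ‖x - y‖ := prj_lip x y
    have ai : 0 < 2 / δ := by positivity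
    calc ‖v x - v y‖ = ‖(‖Ψ (π x)‖⁻¹ • Ψ (π x) - ‖Ψ (π y)‖⁻¹ • Ψ (π y)) - (π x - π y)‖ := by congr 1; simp only [hv]; abel
      _ ≤ 2 / δ * (K * ‖π x - π y‖) + ‖π x - π y‖ := (norm_sub_le _ _).trans (by gcongr; exact aa.trans (by gcongr))
      _ = (2 / δ * K + 1) * ‖π x - π y‖ := by ring
      _ ≤ (2 / δ * K + 1) * (2 * ‖x - y‖) := by gcongr
      _ = _ := by ring
  rw [lipschitzOnWith_univ] at cl
  have bj := int_det (R := 1) cl (fun x hx => by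
    simp only [hv]; rw [hb _ (fk x hx), fk x hx, inv_one, one_smul, sub_self])
  have hz : ∫ x in ball 0 1, (ContinuousLinearMap.id ℝ Ev + fderiv ℝ v x).det = 0 := by
    refine integral_eq_zero_of_ae ?_
    rw [EventuallyEq, ae_restrict_iff' measurableSet_ball]
    filter_upwards [cl.ae_differentiableAt] with x hx hxb
    refine det_zero_of_norm (r := fun y => y + v y) one_pos ((hasFDerivAt_id x).add hx.hasFDerivAt) ?_
    filter_upwards [isOpen_ball.mem_nhds hxb] with y hy
    rw [mem_ball_zero_iff] at hy
    simp only [hv]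
    have : ‖Ψ y‖ ≠ 0 := norm_ne_zero_iff.2 (ae y (mem_closedBall_zero_iff.2 hy.le))
    rw [dz y hy.le, add_sub_cancel, norm_smul, norm_inv, norm_norm, inv_mul_cancel₀ this]
  rw [hz] at bj
  have := measure_ball_pos volume (0 : Ev) one_pos
  exact (ENNReal.toReal_pos this.ne' measure_ball_lt_top.ne).ne bj

theorem brouwer {Φ : Ev → Ev} {K : NNReal} (fn : LipschitzOnWith K Φ (closedBall 0 1))
    (hb : ∀ x ∈ closedBall 0 1, ‖Φ x - x‖ ≤ 1/4) : ∃ x ∈ closedBall 0 1, Φ x = 0 := by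
  set π : Ev → Ev := fun x => (max 1 ‖x‖)⁻¹ • x with ec
  have br : ∀ x, π x ∈ closedBall (0 : Ev) 1 := fun x => by
    have : (0:ℝ) < max 1 ‖x‖ := lt_of_lt_of_le one_pos (le_max_left _ _)
    rw [mem_closedBall_zero_iff, ec]
    dsimp only
    rw [norm_smul, norm_inv, norm_of_nonneg this.le, inv_mul_le_iff₀ this, mul_one]
    exact le_max_right _ _
  have dz : ∀ x, ‖x‖ ≤ 1 → π x = x := fun x hx => by simp only [ec]; rw [max_eq_left hx, inv_one, one_smul]
  set v : Ev → Ev := fun x => Φ (π ((2:ℝ) • x)) - π ((2:ℝ) • x) with hv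
  have hvb : ∀ x, ‖v x‖ ≤ 1/4 := fun x => hb _ (br _)
  have hvl : ∀ x y, ‖v x - v y‖ ≤ (K + 1) * (4 * ‖x - y‖) := by
    intro x y
    have ab := lip_to fn _ (br ((2:ℝ) • x)) _ (br ((2:ℝ) • y))
    have ad : ‖π ((2:ℝ) • x) - π ((2:ℝ) • y)‖ ≤ 2 * ‖(2:ℝ) • x - (2:ℝ) • y‖ := prj_lip _ _
    rw [← smul_sub, norm_smul, norm_of_nonneg (by norm_num : (0:ℝ) ≤ 2)] at ad
    calc ‖v x - v y‖ = ‖(Φ (π ((2:ℝ) • x)) - Φ (π ((2:ℝ) • y))) - (π ((2:ℝ) • x) - π ((2:ℝ) • y))‖ := by congr 1; simp only [hv]; abel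
      _ ≤ (K + 1) * ‖π ((2:ℝ) • x) - π ((2:ℝ) • y)‖ := (norm_sub_le _ _).trans (by linarith)
      _ ≤ _ := by gcongr; linarith
  set l : Ev → ℝ := fun x => 1 - max (1/2) ‖x‖ with hl
  have hll : ∀ x y, |l x - l y| ≤ ‖x - y‖ := fun x y => by
    have h := abs_max_sub_max_le_abs ‖y‖ ‖x‖ (1/2)
    rw [max_comm _ (1/2), max_comm _ (1/2)] at h
    rw [show l x - l y = max (1/2) ‖y‖ - max (1/2) ‖x‖ by simp only [hl]; ring]
    exact h.trans ((abs_norm_sub_norm_le _ _).trans (norm_sub_rev _ _).le)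
  have hl0 : ∀ x, ‖x‖ ≤ 1 → 0 ≤ l x ∧ l x ≤ 1/2 := fun x hx => by
    simp only [hl]; constructor
    · have : max (1/2) ‖x‖ ≤ 1 := max_le (by norm_num) hx
      linarith
    · linarith [le_max_left (1/2) ‖x‖]
  obtain ⟨K', cl⟩ : ∃ K', LipschitzOnWith K' (fun x => x + l x • v x) (closedBall 0 1) := by
    refine lip_of (C := 1 + 1/4 + (K+1)*4) fun x hx y hy => ?_
    rw [mem_closedBall_zero_iff] at hx hy
    calc ‖(x + l x • v x) - (y + l y • v y)‖ = ‖(x - y) + (l x - l y) • v x + l y • (v x - v y)‖ := by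
          congr 1; module
      _ ≤ ‖x - y‖ + |l x - l y| * ‖v x‖ + |l y| * ‖v x - v y‖ := by
          refine (norm_add₃_le).trans ?_
          rw [norm_smul, norm_smul, norm_eq_abs, norm_eq_abs]
      _ ≤ ‖x - y‖ + ‖x - y‖ * (1/4) + 1 * ((K + 1) * (4 * ‖x - y‖)) := by
          gcongr
          · exact hll x y
          · exact hvb x
          · rw [abs_of_nonneg (hl0 y hy).1]; linarith [(hl0 y hy).2]
          · exact hvl x y
      _ = _ := by ring
  obtain ⟨x, hx, hx0⟩ := no_retr cl fun x hx => by
    have : l x = 0 := by simp only [hl]; rw [hx, max_eq_right (by norm_num)]; norm_num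
    rw [this, zero_smul, add_zero]
  rw [mem_closedBall_zero_iff] at hx
  have hx4 : ‖x‖ ≤ 1/4 := by
    rw [eq_neg_of_add_eq_zero_left hx0, norm_neg, norm_smul, norm_of_nonneg (hl0 x hx).1]
    nlinarith [hvb x, hl0 x hx, norm_nonneg (v x)]
  have ab : ‖(2:ℝ) • x‖ ≤ 1 := by rw [norm_smul, norm_of_nonneg (by norm_num)]; linarith
  refine ⟨(2:ℝ) • x, mem_closedBall_zero_iff.2 ab, ?_⟩
  have hlx : l x = 1/2 := by simp only [hl]; rw [max_eq_left (by linarith)]; norm_num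
  have := hx0
  simp only [hlx, hv, dz _ ab] at this
  have ad : (1/2 : ℝ) • Φ ((2:ℝ) • x) = 0 := by
    rw [← this, smul_sub, smul_smul]; norm_num
  exact (smul_eq_zero.1 ad).resolve_left (by norm_num)

theorem inv_dom {U : Set Ev} (cx : IsOpen U) {h hinv : Ev → Ev} {K : NNReal} (hh : LipschitzOnWith K h U)
    (hi : LipschitzOnWith K hinv (h '' U)) (hl : ∀ y ∈ U, hinv (h y) = y) : IsOpen (h '' U) := by
  obtain ⟨G, ak, ff⟩ := hi.extend_finite_dimension
  set K' := lipschitzExtensionConstant Ev * K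
  have kf : ∀ x ∈ U, G (h x) = x := fun x hx => (ff (mem_image_of_mem h hx)).symm.trans (hl x hx)
  rw [Metric.isOpen_iff]
  rintro _ ⟨x0, hx0, rfl⟩
  obtain ⟨r, hr, hrU⟩ := nhds_basis_closedBall.mem_iff.1 (cx.mem_nhds hx0)
  set ε := r / (8 * (K' + 1)) with ba
  have dk : 0 < ε := by positivity
  have gx : K' * ε ≤ r / 8 := by
    rw [ba, mul_div_assoc', div_le_div_iff₀ (by positivity) (by positivity)]
    nlinarith [K'.2]
  refine ⟨ε / 2, by positivity, fun c hc => ?_⟩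
  by_contra hcU
  set η := min (r / 8) (ε / (2 * (K + 1)))
  have gv : 0 < η := lt_min (by positivity) (by positivity)
  have dj : η ≤ r / 8 := min_le_left _ _
  have gu : K * η ≤ ε / 2 := by
    have : η * (2 * (K + 1)) ≤ ε := (le_div_iff₀ (by positivity)).1 (min_le_right _ _)
    nlinarith [K.2]
  obtain ⟨q, hqb, hqs⟩ : ∃ q ∈ ball x0 η, q ∉ G '' sphere c ε := by
    by_contra! hcon
    have aa : volume (G '' sphere c ε) = 0 := by
      refine le_antisymm ((vol_lip ak.lipschitzOnWith).trans ?_) bot_le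
      rw [Measure.addHaar_sphere_of_ne_zero _ _ dk.ne', mul_zero]
    exact (measure_ball_pos volume x0 gv).ne' (measure_mono_null hcon aa)
  have hqn : ‖q - x0‖ < η := mem_ball_iff_norm.1 hqb
  have hqU : q ∈ U := hrU (mem_closedBall_iff_norm.2 (by linarith))
  have hqc : ‖h q - c‖ < ε := by
    have aa := lip_to hh q hqU x0 hx0
    have ab : ‖h x0 - c‖ < ε / 2 := by rw [norm_sub_rev]; exact mem_ball_iff_norm.1 hc
    have ad : (K:ℝ) * ‖q - x0‖ ≤ ε / 2 := (mul_le_mul_of_nonneg_left hqn.le K.2).trans gu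
    calc _ = ‖(h q - h x0) + (h x0 - c)‖ := by congr 1; abel
      _ ≤ _ := norm_add_le _ _
      _ < ε := by linarith
  obtain ⟨jq, hx1, hmin⟩ := (isCompact_closedBall x0 r).exists_isMinOn ⟨x0, by simp [hr.le]⟩ ((hh.mono hrU).continuousOn.sub (continuousOn_const (c := c))).norm
  set δ := ‖h jq - c‖
  have ah : 0 < δ := norm_pos_iff.2 fun ae => hcU ⟨jq, hrU hx1, sub_eq_zero.1 ae⟩
  have bx : ∀ x ∈ closedBall x0 r, δ ≤ ‖h x - c‖ := fun x hx => hmin hx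
  set ρ : Ev → Ev := fun y => c + max ε ‖y - c‖ • (‖y - c‖⁻¹ • (y - c)) with au
  have dy : ∀ y, 0 < ‖y - c‖ → ε ≤ ‖y - c‖ → ρ y = y := fun y hy h => by
    simp only [au]; rw [max_eq_right h, smul_smul, mul_inv_cancel₀ hy.ne', one_smul, add_sub_cancel]
  have gq : ∀ y, 0 < ‖y - c‖ → ‖y - c‖ ≤ ε → ρ y ∈ sphere c ε := fun y hy h => by
    simp only [au]
    rw [max_eq_left h, mem_sphere_iff_norm, add_sub_cancel_left, norm_smul, norm_smul, norm_inv, norm_norm, inv_mul_cancel₀ hy.ne', mul_one, norm_of_nonneg dk.le]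
  have gp : ∀ y, 0 < ‖y - c‖ → ‖ρ y - y‖ ≤ ε := fun y hy => by
    rcases le_total ε ‖y - c‖ with h | h
    · rw [dy y hy h, sub_self, norm_zero]; exact dk.le
    · have : ρ y - y = (ε - ‖y - c‖) • (‖y - c‖⁻¹ • (y - c)) := by
        simp only [au]
        rw [max_eq_left h, sub_smul, smul_smul ‖y - c‖, mul_inv_cancel₀ hy.ne', one_smul]; abel
      rw [this, norm_smul, norm_smul, norm_inv, norm_norm, inv_mul_cancel₀ hy.ne', mul_one, norm_of_nonneg (by linarith)]
      linarith
  have hpos : ∀ x ∈ closedBall x0 r, 0 < ‖h x - c‖ := fun x hx => ah.trans_le (bx x hx)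
  have hin : ∀ x ∈ closedBall (0 : Ev) 1, x0 + r • x ∈ closedBall x0 r := fun x hx => by
    rw [mem_closedBall_zero_iff] at hx
    rw [mem_closedBall_iff_norm, add_sub_cancel_left, norm_smul, norm_of_nonneg hr.le]
    exact mul_le_of_le_one_right hr.le hx
  obtain ⟨R, bt⟩ := ((isCompact_closedBall x0 r).exists_bound_of_continuousOn ((hh.mono hrU).continuousOn.sub (continuousOn_const (c := c))))
  have go : ∀ x ∈ closedBall x0 r, ∀ y ∈ closedBall x0 r, ‖ρ (h x) - ρ (h y)‖ ≤ (1 + (ε + R) * (2 / δ)) * (K * ‖x - y‖) := by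
    intro x hx y hy
    have aa := lip_to hh x (hrU hx) y (hrU hy)
    have ab := nrm_lip ah (bx x hx) (bx y hy)
    rw [sub_sub_sub_cancel_right] at ab
    have ad : |max ε ‖h x - c‖ - max ε ‖h y - c‖| ≤ ‖h x - h y‖ := by
      rw [max_comm ε, max_comm ε]
      exact (abs_max_sub_max_le_abs ..).trans ((abs_norm_sub_norm_le _ _).trans (by rw [sub_sub_sub_cancel_right]))
    have da : ‖h y - c‖ ≤ R := bt y hy
    have ai : max ε ‖h y - c‖ ≤ ε + R := max_le (by linarith [norm_nonneg (h y - c)]) (by linarith)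
    have al : 0 ≤ max ε ‖h y - c‖ := dk.le.trans (le_max_left _ _)
    calc ‖ρ (h x) - ρ (h y)‖ = ‖(max ε ‖h x - c‖ - max ε ‖h y - c‖) • (‖h x - c‖⁻¹ • (h x - c)) +
          max ε ‖h y - c‖ • (‖h x - c‖⁻¹ • (h x - c) - ‖h y - c‖⁻¹ • (h y - c))‖ := by
            congr 1; simp only [au]; rw [sub_smul, smul_sub (max ε ‖h y - c‖)]; abel
      _ ≤ ‖h x - h y‖ * 1 + (ε + R) * (2 / δ * ‖h x - h y‖) := by
          refine (norm_add_le _ _).trans ?_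
          rw [norm_smul, norm_smul, norm_smul, norm_inv, norm_norm, inv_mul_cancel₀ (hpos x hx).ne', norm_eq_abs, norm_of_nonneg al]
          gcongr
          linarith
      _ = (1 + (ε + R) * (2 / δ)) * ‖h x - h y‖ := by ring
      _ ≤ _ := by
          have : 0 ≤ ε + R := al.trans ai
          gcongr
  obtain ⟨K2, ds⟩ : ∃ K2, LipschitzOnWith K2 (fun x => r⁻¹ • (G (ρ (h (x0 + r • x))) - q)) (closedBall 0 1) := by
    refine lip_of (C := r⁻¹ * (K' * ((1 + (ε + R) * (2 / δ)) * (K * r)))) fun x hx y hy => ?_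
    have aa := go _ (hin x hx) _ (hin y hy)
    rw [add_sub_add_left_eq_sub (r • x) (r • y) x0, ← smul_sub r x y, norm_smul r, norm_of_nonneg hr.le] at aa
    have ab := lip_to (lipschitzOnWith_univ.2 ak) (ρ (h (x0 + r • x))) trivial (ρ (h (x0 + r • y))) trivial
    rw [← smul_sub, sub_sub_sub_cancel_right, norm_smul, norm_inv, norm_of_nonneg hr.le]
    calc _ ≤ r⁻¹ * (K' * ((1 + (ε + R) * (2 / δ)) * (K * (r * ‖x - y‖)))) := by gcongr; exact ab.trans (by gcongr)
      _ = _ := by ring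
  obtain ⟨x, hx, hx0⟩ := brouwer ds fun x hx => by
    have dn := hin x hx
    have aa := lip_to (lipschitzOnWith_univ.2 ak) (ρ (h (x0 + r • x))) trivial (h (x0 + r • x)) trivial
    rw [kf _ (hrU dn)] at aa
    have ab : (K' : ℝ) * ‖ρ (h (x0 + r • x)) - h (x0 + r • x)‖ ≤ r / 8 := (mul_le_mul_of_nonneg_left (gp _ (hpos _ dn)) K'.2).trans gx
    have ad : r⁻¹ • (G (ρ (h (x0 + r • x))) - q) - x = r⁻¹ • ((G (ρ (h (x0 + r • x))) - (x0 + r • x)) - (q - x0)) := by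
      rw [show G (ρ (h (x0 + r • x))) - (x0 + r • x) - (q - x0) = (G (ρ (h (x0 + r • x))) - q) - r • x by abel,
        smul_sub _ _ (r • x), smul_smul, inv_mul_cancel₀ hr.ne', one_smul]
    rw [ad, norm_smul, norm_inv, norm_of_nonneg hr.le, inv_mul_le_iff₀ hr]
    refine (norm_sub_le _ _).trans ?_
    linarith
  have dn := hin x hx
  have im : G (ρ (h (x0 + r • x))) = q := sub_eq_zero.1 ((smul_eq_zero.1 hx0).resolve_left (inv_ne_zero hr.ne'))
  rcases le_total ε ‖h (x0 + r • x) - c‖ with aa | aa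
  · rw [dy _ (hpos _ dn) aa, kf _ (hrU dn)] at im
    rw [im] at aa; linarith
  · exact hqs ⟨_, gq _ (hpos _ dn) aa, im⟩

end brou2

section bdry

theorem loc_int {Ω : Set Ev} {u : Ev → ℝ}
    (loc : ∀ x ∈ Ω, ∃ r > 0, ball x r ⊆ Ω ∧ IntegrableOn u (ball x r)) {Q : Set Ev} (dr : IsCompact Q)
    (h : Q ⊆ Ω) : IntegrableOn u Q := by
  have : LocallyIntegrableOn u Ω := fun x hx => by
    obtain ⟨r, ae, -, ab⟩ := loc x hx
    exact ⟨_, mem_nhdsWithin_of_mem_nhds (ball_mem_nhds x ae), ab⟩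
  exact this.integrableOn_compact_subset h dr

theorem wd_glob {Ω : Set Ev} {u g : Ev → ℝ} {i : Fin n} (hg : Integrable g)
    (loc : ∀ x ∈ Ω, ∃ r > 0, ball x r ⊆ Ω ∧ IntegrableOn u (ball x r) ∧ WD (ball x r) i u g) :
    WD Ω i u g := by
  intro φ am hc ht
  set Q := tsupport φ with dr
  have ky : MeasurableSet Q := (isClosed_tsupport φ).measurableSet
  have hui : Integrable (Q.indicator u) := (integrable_indicator_iff ky).2
    (loc_int (fun x hx => (loc x hx).imp fun r h => ⟨h.1, h.2.1, h.2.2.1⟩) hc ht)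
  have key : ∀ ψ : Ev → ℝ, tsupport ψ ⊆ Q → ∀ j : Fin n,
      (fun x => u x * fderiv ℝ ψ x (single j 1)) = fun x => Q.indicator u x * fderiv ℝ ψ x (single j 1) := by
    intro ψ h j
    ext x
    by_cases hx : x ∈ Q
    · rw [indicator_of_mem hx]
    · have : fderiv ℝ ψ x = 0 := by
        by_contra db
        exact hx (h (support_fderiv_subset ℝ db))
      simp [this]
  have main : ∃ O : Set Ev, IsOpen O ∧ Q ⊆ O ∧ ∀ ψ : Ev → ℝ, ContDiff ℝ 1 ψ → HasCompactSupport ψ → tsupport ψ ⊆ O →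
      tsupport ψ ⊆ Q → ∫ x, Q.indicator u x * fderiv ℝ ψ x (single i 1) = - ∫ x, g x * ψ x := by
    refine IsCompact.induction_on (p := fun S => ∃ O : Set Ev, IsOpen O ∧ S ⊆ O ∧ ∀ ψ : Ev → ℝ, ContDiff ℝ 1 ψ → HasCompactSupport ψ → tsupport ψ ⊆ O →
      tsupport ψ ⊆ Q → ∫ x, Q.indicator u x * fderiv ℝ ψ x (single i 1) = - ∫ x, g x * ψ x) hc ?_ ?_ ?_ ?_
    · refine ⟨∅, isOpen_empty, le_rfl, fun ψ _ _ h _ => ?_⟩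
      have : ψ = 0 := tsupport_eq_empty_iff.1 (subset_empty_iff.1 h)
      simp [this]
    · rintro s t hst ⟨O, aa, ab, ad⟩
      exact ⟨O, aa, hst.trans ab, ad⟩
    · rintro s t ⟨O, aa, ab, ad⟩ ⟨O', ft, ji, jh⟩
      refine ⟨O ∪ O', aa.union ft, union_subset_union ab ji, fun ψ ct ca ep ef => ?_⟩
      obtain ⟨χ, fh, ki, gh, jk, -⟩ := cutoff aa (K := tsupport ψ \ O') (ca.diff ft) (fun x hx => (ep hx.1).resolve_right hx.2)
      have cr : tsupport (fun x => ψ x * χ x) ⊆ tsupport ψ := tsupport_mul_subset_left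
      have dm : tsupport (fun x => ψ x * χ x) ⊆ tsupport χ := tsupport_mul_subset_right
      have fw : tsupport (fun x => ψ x * (1 - χ x)) ⊆ tsupport ψ := tsupport_mul_subset_left
      have em : tsupport (fun x => ψ x * (1 - χ x)) ⊆ O' := by
        intro x hx
        by_contra h
        have := jk x ⟨fw hx, h⟩
        refine notMem_tsupport_iff_eventuallyEq.2 ?_ hx
        filter_upwards [this] with y hy
        simp [hy]
      have gg : ContDiff ℝ 1 fun x => ψ x * χ x := ct.mul fh
      have d2 : ContDiff ℝ 1 fun x => ψ x * (1 - χ x) := ct.mul (contDiff_const.sub fh)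
      have ag : HasCompactSupport fun x => ψ x * χ x := ca.mul_right
      have aq : HasCompactSupport fun x => ψ x * (1 - χ x) := ca.mul_right
      have ih := ad _ gg ag (dm.trans gh) (cr.trans ef)
      have ic := jh _ d2 aq em (fw.trans ef)
      have hd : ∀ x, fderiv ℝ ψ x (single i 1) = fderiv ℝ (fun x => ψ x * χ x) x (single i 1) +
          fderiv ℝ (fun x => ψ x * (1 - χ x)) x (single i 1) := by
        intro x
        rw [← add_apply, ← fderiv_add (gg.differentiable (by simp) x) (d2.differentiable (by simp) x)]
        congr 2
        ext y; simp only [Pi.add_apply]; ring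
      have he : ∀ x, ψ x = ψ x * χ x + ψ x * (1 - χ x) := fun x => by ring
      have bh := integral_add (int_mul_cc hui.locallyIntegrable (pd_cont gg i) (pd_cpt ag i)) (int_mul_cc hui.locallyIntegrable (pd_cont d2 i) (pd_cpt aq i))
      have bl := integral_add (int_mul_cc hg.locallyIntegrable gg.continuous ag) (int_mul_cc hg.locallyIntegrable d2.continuous aq)
      rw [integral_congr_ae (f := fun x => Q.indicator u x * fderiv ℝ ψ x (single i 1)) (aoa fun x => show _ = Q.indicator u x * fderiv ℝ (fun x => ψ x * χ x) x (single i 1) +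
          Q.indicator u x * fderiv ℝ (fun x => ψ x * (1 - χ x)) x (single i 1) by beta_reduce; rw [hd x, mul_add]),
        integral_congr_ae (f := fun x => g x * ψ x) (g := fun x => g x * (ψ x * χ x) + g x * (ψ x * (1 - χ x))) (aoa fun x => by ring)]
      refine bh.trans ?_
      rw [bl, neg_add]
      exact congrArg₂ _ ih ic
    · intro x hx
      obtain ⟨r, ae, aa, ab, ad⟩ := loc x (ht hx)
      refine ⟨_, mem_nhdsWithin_of_mem_nhds (ball_mem_nhds x ae), _, isOpen_ball, le_rfl, fun ψ ct ca ep ef => ?_⟩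
      rw [← key ψ ef i]
      exact ad ψ ct ca ep
  obtain ⟨O, -, ab, ad⟩ := main
  rw [key φ le_rfl i]
  exact ad φ am hc ab le_rfl

theorem path_est {v : Ev → ℝ} (hv : ContDiff ℝ 1 v) {γ : ℝ → Ev} {K : NNReal} (fm : LipschitzWith K γ) {ρ : ℝ} (au : 0 ≤ ρ) :
    ‖v (γ 0)‖ₑ ≤ ‖v (γ ρ)‖ₑ + ∫⁻ s in Icc 0 ρ, K * ‖fderiv ℝ v (γ s)‖ₑ := by
  obtain ⟨C, ar⟩ := hv.locallyLipschitz.locallyLipschitzOn.exists_lipschitzOnWith_of_compact (s := γ '' (uIcc 0 ρ)) (isCompact_uIcc.image fm.continuous)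
  have aa : AbsolutelyContinuousOnInterval (fun s => v (γ s)) 0 ρ :=
    (ar.comp fm.lipschitzOnWith (mapsTo_image _ _)).absolutelyContinuousOnInterval
  have ab := aa.integral_deriv_eq_sub
  rw [intervalIntegral.integral_of_le au] at ab
  have ad : ‖∫ s in Ioc 0 ρ, deriv (fun s => v (γ s)) s‖ₑ ≤ ∫⁻ s in Icc 0 ρ, K * ‖fderiv ℝ v (γ s)‖ₑ := by
    refine (enorm_integral_le_lintegral_enorm _).trans ((lintegral_mono_set Ioc_subset_Icc_self).trans (lintegral_mono_ae (ae_restrict_of_ae ?_)))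
    filter_upwards [fm.ae_differentiableAt_real] with s hs
    have e := (((hv.differentiable (by simp)) (γ s)).hasFDerivAt.comp_hasDerivAt s hs.hasDerivAt).deriv
    have ll : deriv (fun s => v (γ s)) s = _ := e
    rw [ll, mul_comm]
    refine (ContinuousLinearMap.le_opENorm _ _).trans ?_
    gcongr
    rw [← enorm_norm]
    have := norm_deriv_le_of_lipschitz fm (x₀ := s)
    rw [← ofReal_norm, norm_norm]
    exact (ofReal_le_ofReal this).trans (by simp)
  have ai : v (γ 0) = v (γ ρ) - ∫ s in Ioc 0 ρ, deriv (fun s => v (γ s)) s := by rw [ab]; ring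
  rw [ai]
  exact enorm_sub_le.trans (by gcongr)

theorem push_est {H G : Ev → Ev} {KH KG : NNReal} (bv : LipschitzWith KH H) (ak : LipschitzWith KG G) {e : Ev} {s : ℝ}
    {N P : Set Ev} (cj : MeasurableSet N) (ae : ∀ x ∈ N, G (H x) = x)
    (aa : ∀ x ∈ N, H (G (H x + s • e)) = H x + s • e) (ab : ∀ x ∈ N, G (H x + s • e) ∈ P) {F : Ev → ℝ≥0∞} (ld : Measurable F) :
    ∫⁻ x in N, F (G (H x + s • e)) ≤ ((KG * KH : NNReal) : ℝ≥0∞) ^ n * ∫⁻ x in P, F x := by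
  have hc : Continuous fun x => G (H x + s • e) := ak.continuous.comp (bv.continuous.add continuous_const)
  have hle : (volume.restrict N).map (fun x => G (H x + s • e)) ≤ (((KG * KH : NNReal) : ℝ≥0∞) ^ n) • volume.restrict P := by
    refine Measure.le_iff.2 fun S af => ?_
    rw [Measure.map_apply hc.measurable af, Measure.restrict_apply (hc.measurable af), Measure.smul_apply, smul_eq_mul,
      Measure.restrict_apply af]
    have hl : LipschitzWith (KG * KH) fun y => G (H y - s • e) :=
      ak.comp (by simpa using bv.sub (LipschitzWith.const (s • e)))
    refine le_trans (measure_mono ?_) (vol_lip (hl.lipschitzOnWith (s := S ∩ P)))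
    rintro x ⟨hx, hxN⟩
    refine ⟨_, ⟨hx, ab x hxN⟩, ?_⟩
    simp only [aa x hxN, add_sub_cancel_right, ae x hxN]
  rw [← lintegral_map ld hc.measurable, ← smul_eq_mul, ← lintegral_smul_measure]
  exact lintegral_mono' hle le_rfl

theorem smooth_est {H G : Ev → Ev} {KH KG : NNReal} (bv : LipschitzWith KH H) (ak : LipschitzWith KG G) {e : Ev}
    (he : ‖e‖ = 1) {ρ : ℝ} (au : 0 ≤ ρ)
    {N P P' : Set Ev} (cj : MeasurableSet N) (ae : ∀ x ∈ N, G (H x) = x)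
    (aa : ∀ x ∈ N, ∀ s ∈ Icc 0 ρ, H (G (H x + s • e)) = H x + s • e) (ab : ∀ x ∈ N, ∀ s ∈ Icc 0 ρ, G (H x + s • e) ∈ P)
    (ad : ∀ x ∈ N, G (H x + ρ • e) ∈ P') {v : Ev → ℝ} (hv : ContDiff ℝ 1 v) :
    ∫⁻ x in N, ‖v x‖ₑ ≤ ((KG * KH : NNReal) : ℝ≥0∞) ^ n * (∫⁻ x in P', ‖v x‖ₑ) +
      ∫⁻ _ in Icc 0 ρ, (KG : ℝ≥0∞) * (((KG * KH : NNReal) : ℝ≥0∞) ^ n * ∫⁻ x in P, ‖fderiv ℝ v x‖ₑ) := by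
  have hm : Measurable fun x => ‖fderiv ℝ v x‖ₑ := (hv.continuous_fderiv (by simp)).enorm.measurable
  have hm0 : Measurable fun x => ‖v x‖ₑ := hv.continuous.enorm.measurable
  have hc2 : Continuous fun p : Ev × ℝ => G (H p.1 + p.2 • e) := ak.continuous.comp
    ((bv.continuous.comp continuous_fst).add (continuous_snd.smul continuous_const))
  have hmm : Measurable fun p : Ev × ℝ => (KG : ℝ≥0∞) * ‖fderiv ℝ v (G (H p.1 + p.2 • e))‖ₑ :=
    (hm.comp hc2.measurable).const_mul _
  calc ∫⁻ x in N, ‖v x‖ₑ ≤ ∫⁻ x in N, (‖v (G (H x + ρ • e))‖ₑ + ∫⁻ s in Icc 0 ρ, KG * ‖fderiv ℝ v (G (H x + s • e))‖ₑ) := by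
        refine setLIntegral_mono' cj fun x hx => ?_
        have hl : LipschitzWith KG fun s : ℝ => G (H x + s • e) := by
          have : LipschitzWith 1 fun s : ℝ => H x + s • e := LipschitzWith.of_dist_le_mul fun a b => by
            rw [dist_add_left, dist_eq_norm, ← sub_smul, norm_smul, he]; simp [Real.dist_eq]
          have h := ak.comp this
          rw [mul_one] at h
          exact h
        have := path_est hv hl au
        simpa [ae x hx] using this
    _ = (∫⁻ x in N, ‖v (G (H x + ρ • e))‖ₑ) + ∫⁻ x in N, ∫⁻ s in Icc 0 ρ, KG * ‖fderiv ℝ v (G (H x + s • e))‖ₑ :=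
        lintegral_add_left (hm0.comp (ak.continuous.comp (bv.continuous.add continuous_const)).measurable) _
    _ ≤ _ := by
        refine add_le_add (push_est bv ak cj ae (fun x hx => aa x hx ρ ⟨au, le_rfl⟩) ad hm0) ?_
        rw [lintegral_lintegral_swap hmm.aemeasurable]
        refine setLIntegral_mono' measurableSet_Icc fun s hs => ?_
        rw [lintegral_const_mul']
        · gcongr
          exact push_est bv ak cj ae (fun x hx => aa x hx s hs) (fun x hx => ab x hx s hs) hm
        · exact ENNReal.coe_ne_top

theorem moll_L1e {u : Ev → ℝ} (hu : Integrable u) : Tendsto (fun k : ℕ => ∫⁻ x, ‖moll k u x - u x‖ₑ) atTop (𝓝 0) := by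
  have h : ∀ k, ∫⁻ x, ‖moll k u x - u x‖ₑ = ofReal (∫ x, ‖moll k u x - u x‖) := fun k =>
    (ofReal_integral_norm_eq_lintegral_enorm (isub (moll_int k hu) hu)).symm
  simp only [h]
  simpa using ENNReal.tendsto_ofReal (moll_L1 hu)

theorem enorm_clm (ℓ : Ev →L[ℝ] ℝ) : ‖ℓ‖ₑ ≤ ∑ i, ‖ℓ (es i)‖ₑ := by
  have h : ‖ℓ‖ ≤ ∑ i, ‖ℓ (es i)‖ := by
    refine ℓ.opNorm_le_bound (by positivity) fun a => ?_
    rw [clm_es ℓ a, sum_mul]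
    refine (norm_sum_le _ _).trans (sum_le_sum fun i _ => ?_)
    rw [norm_smul, mul_comm]
    gcongr
    exact norm_apply_le a i
  rw [← ofReal_norm]
  refine (ofReal_le_ofReal h).trans ?_
  rw [ENNReal.ofReal_sum_of_nonneg fun _ _ => norm_nonneg _]
  exact sum_le_sum fun i _ => (ofReal_norm _).le

theorem enorm_tri {s : Set Ev} {a b : Ev → ℝ} (ha : AEStronglyMeasurable a) (hb : AEStronglyMeasurable b) :
    ∫⁻ x in s, ‖a x‖ₑ ≤ (∫⁻ x in s, ‖b x‖ₑ) + ∫⁻ x, ‖a x - b x‖ₑ := by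
  calc ∫⁻ x in s, ‖a x‖ₑ ≤ ∫⁻ x in s, (‖b x‖ₑ + ‖a x - b x‖ₑ) := lintegral_mono fun x => by
        have := enorm_add_le (b x) (a x - b x)
        simpa using this
    _ = (∫⁻ x in s, ‖b x‖ₑ) + ∫⁻ x in s, ‖a x - b x‖ₑ := lintegral_add_left' hb.restrict.enorm _
    _ ≤ _ := by gcongr; exact Measure.restrict_le_self

theorem weak_est {Ω : Set Ev} (hΩ : IsOpen Ω) {u : Ev → ℝ} {g : Fin n → Ev → ℝ} (hg : ∀ i, Integrable (g i))
    (hu : ∀ Q, IsCompact Q → Q ⊆ Ω → IntegrableOn u Q) (hw : ∀ i, WD Ω i u (g i))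
    {H G : Ev → Ev} {KH KG : NNReal} (bv : LipschitzWith KH H) (ak : LipschitzWith KG G) {e : Ev}
    (he : ‖e‖ = 1) {ρ : ℝ} (au : 0 ≤ ρ)
    {N P P' : Set Ev} (cj : MeasurableSet N) (aj : IsCompact P) (co : P ⊆ Ω) (ix : MeasurableSet P') (la : P' ⊆ P)
    (ae : ∀ x ∈ N, G (H x) = x)
    (aa : ∀ x ∈ N, ∀ s ∈ Icc 0 ρ, H (G (H x + s • e)) = H x + s • e) (ab : ∀ x ∈ N, ∀ s ∈ Icc 0 ρ, G (H x + s • e) ∈ P)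
    (ad : ∀ x ∈ N, G (H x + ρ • e) ∈ P') :
    ∫⁻ x in N, ‖u x‖ₑ ≤ ((KG * KH : NNReal) : ℝ≥0∞) ^ n * (∫⁻ x in P', ‖u x‖ₑ) +
      (KG : ℝ≥0∞) * (((KG * KH : NNReal) : ℝ≥0∞) ^ n * ∑ i, ∫⁻ x, ‖g i x‖ₑ) * ofReal ρ := by
  obtain ⟨Q, dr, kb, dl⟩ := exists_compact_between aj hΩ co
  set U := Q.indicator u with cx
  have fd : Integrable U := (integrable_indicator_iff dr.measurableSet).2 (hu Q dr dl)
  have kx : ∀ i, WD (interior Q) i U (g i) := fun i => ((hw i).mono (interior_subset.trans dl)).congr_ae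
    (aoa fun x hx => indicator_of_mem (interior_subset hx) _) (aoa fun x _ => rfl)
  have iy : N ⊆ P := fun x hx => by
    have := ab x hx 0 ⟨le_rfl, au⟩
    rwa [zero_smul, add_zero, ae x hx] at this
  have ka : P ⊆ Q := kb.trans interior_subset
  have li : ∫⁻ x in N, ‖u x‖ₑ = ∫⁻ x in N, ‖U x‖ₑ := setLIntegral_congr_fun cj fun x hx => by
    simp only [cx, indicator_of_mem (ka (iy hx))]
  have lh : ∫⁻ x in P', ‖u x‖ₑ = ∫⁻ x in P', ‖U x‖ₑ := setLIntegral_congr_fun ix fun x hx => by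
    simp only [cx, indicator_of_mem (ka (la hx))]
  rw [li, lh]
  set C := ((KG * KH : NNReal) : ℝ≥0∞) ^ n with ar
  have kh : C ≠ ⊤ := ENNReal.pow_ne_top ENNReal.coe_ne_top
  obtain ⟨d, hd0, hd⟩ := aj.exists_cthickening_subset_open isOpen_interior kb
  obtain ⟨ap, hk0⟩ := exists_nat_one_div_lt hd0
  have T := fun i => moll_L1e (hg i)
  have T0 := moll_L1e fd
  set E : ℕ → ℝ≥0∞ := fun k => ∫⁻ x, ‖moll k U x - U x‖ₑ with ei
  set D : Fin n → ℕ → ℝ≥0∞ := fun i k => ∫⁻ x, ‖moll k (g i) x - g i x‖ₑ with cb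
  have lim : Tendsto (fun k => C * ((∫⁻ x in P', ‖U x‖ₑ) + E k) + KG * (C * ∑ i, ((∫⁻ x, ‖g i x‖ₑ) + D i k)) * ofReal ρ + E k)
      atTop (𝓝 (C * ((∫⁻ x in P', ‖U x‖ₑ) + 0) + KG * (C * ∑ i, ((∫⁻ x, ‖g i x‖ₑ) + 0)) * ofReal ρ + 0)) := by
    refine Tendsto.add (Tendsto.add (ENNReal.Tendsto.const_mul (tendsto_const_nhds.add T0) (Or.inr kh))
      (ENNReal.Tendsto.mul_const (ENNReal.Tendsto.const_mul (ENNReal.Tendsto.const_mul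
        (tendsto_finsetSum _ fun i _ => tendsto_const_nhds.add (T i)) (Or.inr kh)) (Or.inr ENNReal.coe_ne_top)) (Or.inr ofReal_ne_top))) T0
  simp only [add_zero] at lim
  refine ge_of_tendsto lim ((eventually_ge_atTop ap).mono fun k hk => ?_)
  have hkk : (ap:ℝ) ≤ k := by exact_mod_cast hk
  have hkd : 1 / ((k:ℝ) + 1) ≤ d := le_trans (one_div_le_one_div_of_le (by positivity) (by linarith)) hk0.le
  have hmi := moll_int k fd
  have S := smooth_est bv ak he au cj ae aa ab ad (v := moll k U) (moll_smooth k fd.locallyIntegrable (m := 1))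
  rw [lintegral_const, Measure.restrict_apply_univ, Real.volume_Icc, sub_zero] at S
  have hgr : ∫⁻ x in P, ‖fderiv ℝ (moll k U) x‖ₑ ≤ ∑ i, ((∫⁻ x, ‖g i x‖ₑ) + D i k) := by
    calc ∫⁻ x in P, ‖fderiv ℝ (moll k U) x‖ₑ ≤ ∫⁻ x in P, ∑ i, ‖moll k (g i) x‖ₑ := by
          refine setLIntegral_mono' aj.measurableSet fun x hx => (enorm_clm _).trans (sum_le_sum fun i _ => ?_)
          rw [moll_fderiv k fd.locallyIntegrable (kx i)]
          exact (Metric.closedBall_subset_closedBall hkd).trans ((Metric.closedBall_subset_cthickening hx d).trans hd)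
      _ = ∑ i, ∫⁻ x in P, ‖moll k (g i) x‖ₑ := lintegral_finsetSum' _ fun i _ => (moll_int k (hg i)).aestronglyMeasurable.restrict.enorm
      _ ≤ _ := sum_le_sum fun i _ => (enorm_tri (moll_int k (hg i)).aestronglyMeasurable (hg i).aestronglyMeasurable).trans (by
          gcongr; exact Measure.restrict_le_self)
  have ag := enorm_tri (s := P') hmi.aestronglyMeasurable fd.aestronglyMeasurable
  have aq := enorm_tri (s := N) fd.aestronglyMeasurable hmi.aestronglyMeasurable
  refine aq.trans (add_le_add (S.trans ?_) (le_of_eq ?_))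
  · gcongr
  · refine lintegral_congr fun x => ?_
    rw [← enorm_neg, neg_sub]

theorem bdry_est {Ω : Set Ev} (hΩ : IsOpen Ω) {u : Ev → ℝ} {g : Fin n → Ev → ℝ} (hg : ∀ i, Integrable (g i))
    (hu : ∀ Q, IsCompact Q → Q ⊆ Ω → IntegrableOn u Q) (hw : ∀ i, WD Ω i u (g i))
    {U : Set Ev} {H G : Ev → Ev} {KH KG : NNReal} {e cq : Ev} (he : ‖e‖ = 1) (cx : IsOpen U)
    (bv : LipschitzWith KH H) (ak : LipschitzWith KG G) {ρ : ℝ} (au : 0 < ρ) (et : ∀ x ∈ U, G (H x) = x)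
    (je : ∀ y ∈ closedBall cq (2 * ρ), H (G y) = y) (hpos : ∀ y ∈ closedBall cq (2 * ρ), 0 < ⟪e, y⟫ → G y ∈ Ω) :
    ∃ B : ℝ≥0∞, B < ⊤ ∧ ∀ δ ∈ Ioc 0 ρ, IntegrableOn u (U ∩ {x | H x ∈ ball cq ρ ∧ δ < ⟪e, H x⟫}) ∧
      ∫⁻ x in U ∩ {x | H x ∈ ball cq ρ ∧ δ < ⟪e, H x⟫}, ‖u x‖ₑ ≤ B := by
  set N : ℝ → Set Ev := fun δ => U ∩ {x | H x ∈ ball cq ρ ∧ δ < ⟪e, H x⟫} with cj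
  set P : ℝ → Set Ev := fun δ => G '' (closedBall cq (2 * ρ) ∩ {y | δ ≤ ⟪e, y⟫}) with aj
  have ke := bv.continuous
  have ho1 : IsOpen (H ⁻¹' (ball cq ρ)) := isOpen_ball.preimage ke
  have ho2 : ∀ δ, IsOpen {x | δ < ⟪e, H x⟫} := fun δ => isOpen_lt continuous_const (continuous_const.inner ke)
  have lc : ∀ δ, IsOpen (N δ) := fun δ => by
    have : N δ = U ∩ (H ⁻¹' (ball cq ρ) ∩ {x | δ < ⟪e, H x⟫}) := by
      ext x; simp [cj]
    rw [this]
    exact cx.inter (ho1.inter (ho2 δ))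
  have gb : ∀ δ, IsCompact (P δ) := fun δ => ((isCompact_closedBall cq (2 * ρ)).inter_right
    (isClosed_le continuous_const (continuous_const.inner continuous_id))).image ak.continuous
  have co : ∀ δ > 0, P δ ⊆ Ω := by
    rintro δ ah _ ⟨y, hy, rfl⟩
    exact hpos y hy.1 (lt_of_lt_of_le ah hy.2)
  have hin : ∀ (x : Ev) (s : ℝ), ⟪e, H x + s • e⟫ = ⟪e, H x⟫ + s := fun x s => by
    rw [inner_add_right, inner_smul_right, real_inner_self_eq_norm_sq, he]; ring
  have hball : ∀ x, H x ∈ ball cq ρ → ∀ s ∈ Icc 0 ρ, H x + s • e ∈ closedBall cq (2 * ρ) := by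
    intro x hx s hs
    rw [mem_closedBall_iff_norm, add_sub_right_comm]
    rw [mem_ball_iff_norm] at hx
    have := norm_add_le (H x - cq) (s • e)
    rw [norm_smul, he, norm_of_nonneg hs.1] at this
    linarith [hs.2]
  have iy : ∀ δ, N δ ⊆ P δ := fun δ x hx => by
    rw [← et x hx.1]
    exact mem_image_of_mem G ⟨Metric.closedBall_subset_closedBall (by linarith) (ball_subset_closedBall hx.2.1), hx.2.2.le⟩
  refine ⟨((KG * KH : NNReal) : ℝ≥0∞) ^ n * (∫⁻ x in P ρ, ‖u x‖ₑ) +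
      (KG : ℝ≥0∞) * (((KG * KH : NNReal) : ℝ≥0∞) ^ n * ∑ i, ∫⁻ x, ‖g i x‖ₑ) * ofReal ρ, ?_, fun δ ah => ⟨?_, ?_⟩⟩
  · exact ENNReal.add_lt_top.2 ⟨ENNReal.mul_lt_top (ENNReal.pow_lt_top ENNReal.coe_lt_top) (hu _ (gb ρ) (co ρ au)).2,
      ENNReal.mul_lt_top (ENNReal.mul_lt_top ENNReal.coe_lt_top (ENNReal.mul_lt_top (ENNReal.pow_lt_top ENNReal.coe_lt_top)
      (ENNReal.sum_lt_top.2 fun i _ => (hg i).2))) ofReal_lt_top⟩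
  · exact (hu _ (gb _) (co _ ah.1)).mono_set (iy _)
  · have el : P ρ ⊆ P δ := image_mono fun y hy => ⟨hy.1, ah.2.trans hy.2⟩
    have ek : ∀ x ∈ N δ, ∀ s ∈ Icc 0 ρ, G (H x + s • e) ∈ P δ := fun x hx s hs => by
      refine mem_image_of_mem G ⟨hball x hx.2.1 s hs, ?_⟩
      have := hx.2.2
      rw [mem_ofPred_eq, hin]; linarith [hs.1]
    have jl : ∀ x ∈ N δ, G (H x + ρ • e) ∈ P ρ := fun x hx => by
      refine mem_image_of_mem G ⟨hball x hx.2.1 ρ ⟨au.le, le_rfl⟩, ?_⟩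
      have := hx.2.2
      rw [mem_ofPred_eq, hin]; linarith [ah.1]
    exact weak_est hΩ hg hu hw bv ak he au.le (lc δ).measurableSet
      (gb δ) (co δ ah.1) (gb ρ).measurableSet el
      (fun x hx => et x hx.1) (fun x hx s hs => je _ (hball x hx.2.1 s hs)) ek jl

theorem bdry_un {Ω : Set Ev} {u : Ev → ℝ} {N : ℝ → Set Ev} {S : Set Ev} {q : Ev → ℝ} {ρ : ℝ} (au : 0 < ρ)
    (cj : ∀ δ, N δ = {x | x ∈ S ∧ δ < q x}) (af : ∀ x ∈ S, x ∈ Ω ↔ 0 < q x) {B : ℝ≥0∞} (av : B < ⊤)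
    (h : ∀ δ ∈ Ioc 0 ρ, IntegrableOn u (N δ) ∧ ∫⁻ x in N δ, ‖u x‖ₑ ≤ B) : IntegrableOn u (S ∩ Ω) := by
  have hun : S ∩ Ω = ⋃ m : ℕ, N (ρ / (m + 1)) := by
    ext x
    simp only [mem_iUnion]
    constructor
    · rintro ⟨aa, ad⟩
      have ai := (af x aa).1 ad
      obtain ⟨m, hm⟩ := exists_nat_one_div_lt (div_pos ai au)
      refine ⟨m, ?_⟩
      rw [cj]
      refine ⟨aa, ?_⟩
      rw [lt_div_iff₀ au] at hm
      rw [div_eq_mul_one_div, mul_comm]; exact hm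
    · rintro ⟨m, aa⟩
      rw [cj] at aa
      exact ⟨aa.1, (af x aa.1).2 (lt_trans (by positivity) aa.2)⟩
  have ah : ∀ m : ℕ, ρ / ((m:ℝ) + 1) ∈ Ioc 0 ρ := fun m => ⟨by positivity, div_le_self au.le (by
    have : (0:ℝ) ≤ m := by positivity
    linarith)⟩
  have hmono : Monotone fun m : ℕ => N (ρ / (m + 1)) := fun a b hab x hx => by
    simp only [cj] at hx ⊢
    refine ⟨hx.1, lt_of_le_of_lt ?_ hx.2⟩
    have : (a:ℝ) ≤ b := by exact_mod_cast hab
    gcongr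
  rw [hun]
  refine ⟨aestronglyMeasurable_iUnion_iff.2 fun m => (h _ (ah m)).1.aestronglyMeasurable, ?_⟩
  rw [HasFiniteIntegral, setLIntegral_iUnion_of_directed _ hmono.directed_le]
  exact lt_of_le_of_lt (iSup_le fun m => (h _ (ah m)).2) av

theorem bdry_pt {Ω : Set Ev} (hΩ : IsOpen Ω) {u : Ev → ℝ} {g : Fin n → Ev → ℝ} (hg : ∀ i, Integrable (g i))
    (hu : ∀ Q, IsCompact Q → Q ⊆ Ω → IntegrableOn u Q) (hw : ∀ i, WD Ω i u (g i))
    {U : Set Ev} {h hinv : Ev → Ev} {K : NNReal} {e x0 : Ev} (he : ‖e‖ = 1) (cx : IsOpen U) (hx0 : x0 ∈ U)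
    (hh : LipschitzOnWith K h U) (hi : LipschitzOnWith K hinv (h '' U)) (hl : ∀ y ∈ U, hinv (h y) = y)
    (hfl : h '' (U ∩ Ω) = (h '' U) ∩ {y : Ev | 0 < ⟪e, y⟫}) : ∃ t ∈ 𝓝 x0, IntegrableOn u (t ∩ Ω) := by
  obtain ⟨H, KH, bv, fe⟩ : ∃ H, ∃ KH : NNReal, LipschitzWith KH H ∧ EqOn h H U :=
    hh.extend_finite_dimension.imp fun H h => ⟨_, h⟩
  obtain ⟨G, KG, ak, ff⟩ : ∃ G, ∃ KG : NNReal, LipschitzWith KG G ∧ EqOn hinv G (h '' U) :=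
    hi.extend_finite_dimension.imp fun H h => ⟨_, h⟩
  have et : ∀ x ∈ U, G (H x) = x := fun x hx => by
    rw [← fe hx, ← ff (mem_image_of_mem h hx), hl x hx]
  have je : ∀ y ∈ h '' U, H (G y) = y := by
    rintro _ ⟨x, hx, rfl⟩
    rw [fe hx, et x hx]
  have hpos : ∀ y ∈ h '' U, 0 < ⟪e, y⟫ → G y ∈ Ω := by
    intro y hy ae
    have : y ∈ h '' (U ∩ Ω) := by rw [hfl]; exact ⟨hy, ae⟩
    obtain ⟨x, hx, rfl⟩ := this
    rw [fe hx.1, et x hx.1]; exact hx.2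
  have hpos' : ∀ x ∈ U, x ∈ Ω → 0 < ⟪e, H x⟫ := by
    intro x hx hxΩ
    have : h x ∈ h '' (U ∩ Ω) := mem_image_of_mem h ⟨hx, hxΩ⟩
    rw [hfl] at this
    rw [← fe hx]; exact this.2
  have dp := inv_dom cx hh hi hl
  obtain ⟨r, hr0, hr⟩ := Metric.isOpen_iff.1 dp (H x0) (by rw [← fe hx0]; exact mem_image_of_mem h hx0)
  obtain ⟨ρ, au, gn⟩ : ∃ ρ : ℝ, 0 < ρ ∧ 2 * ρ < r := ⟨r / 4, by linarith, by linarith⟩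
  have hcl : closedBall (H x0) (2 * ρ) ⊆ h '' U := (closedBall_subset_ball gn).trans hr
  obtain ⟨B, av, hest⟩ := bdry_est hΩ hg hu hw he cx bv ak au et (fun y hy => je y (hcl hy)) (fun y hy => hpos y (hcl hy))
  have hm : H x0 ∈ ball (H x0) ρ := mem_ball_self au
  have hm' : x0 ∈ U ∩ H ⁻¹' (ball (H x0) ρ) := mem_inter hx0 (mem_preimage.2 hm)
  have ho : IsOpen (U ∩ H ⁻¹' (ball (H x0) ρ)) := cx.inter (isOpen_ball.preimage bv.continuous)
  refine ⟨U ∩ H ⁻¹' (ball (H x0) ρ), ho.mem_nhds hm', ?_⟩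
  refine bdry_un (q := fun x => ⟪e, H x⟫) au (fun δ => ?_) (fun x hx => ⟨hpos' x hx.1, fun aa => ?_⟩) av hest
  · ext x
    exact and_assoc.symm
  · rw [← et x hx.1]
    exact hpos _ (by rw [← fe hx.1]; exact mem_image_of_mem h hx.1) aa

theorem u_int {Ω : Set Ev} (hΩ : IsLipschitzDomain Ω) (hb : Bornology.IsBounded Ω) {u : Ev → ℝ} {g : Fin n → Ev → ℝ} (hg : ∀ i, Integrable (g i))
    (hu : ∀ Q, IsCompact Q → Q ⊆ Ω → IntegrableOn u Q) (hw : ∀ i, WD Ω i u (g i)) : IntegrableOn u Ω := by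
  have hc : IsCompact (closure Ω) := hb.isCompact_closure
  have : IntegrableOn u (closure Ω ∩ Ω) := by
    refine IsCompact.induction_on (p := fun S => IntegrableOn u (S ∩ Ω) volume) hc (by simp) (fun s t hst h => h.mono_set (inter_subset_inter_left _ hst))
      (fun s t aa ab => by rw [union_inter_distrib_right]; exact aa.union ab) fun x hx => ?_
    by_cases hxΩ : x ∈ Ω
    · obtain ⟨r, ae, hr⟩ := nhds_basis_closedBall.mem_iff.1 (hΩ.1.mem_nhds hxΩ)
      exact ⟨_, mem_nhdsWithin_of_mem_nhds (Metric.closedBall_mem_nhds x ae), (hu _ (isCompact_closedBall x r) hr).mono_set inter_subset_left⟩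
    · obtain ⟨U, h, hinv, K, e, aa, ab, ad, ai, al, da, cy⟩ := hΩ.2.2.2 x (by rw [hΩ.1.frontier_eq]; exact ⟨hx, hxΩ⟩)
      obtain ⟨t, ht, jg⟩ := bdry_pt hΩ.1 hg hu hw aa ab ad ai al da cy
      exact ⟨t, mem_nhdsWithin_of_mem_nhds ht, jg⟩
  rwa [inter_eq_right.2 subset_closure] at this

end bdry

section asm

theorem mdot_tZ (T S : Ev → Fin N → Fin n → ℝ) (x : Ev) : mdot (T x) (S x) = ⟪tZ T x, tZ S x⟫ := by
  simp only [mdot, PiLp.inner_apply, RCLike.inner_apply, conj_trivial, tZ, Fintype.sum_prod_type, mul_comm]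

theorem mnorm_tZ (T : Ev → Fin N → Fin n → ℝ) (x : Ev) : mnorm (T x) = ‖tZ T x‖ := by
  rw [mnorm, mdot_tZ, real_inner_self_eq_norm_sq, Real.sqrt_sq (norm_nonneg _)]

theorem mdotA_tZ (a : ℝ → ℝ) (T S : Ev → Fin N → Fin n → ℝ) (x : Ev) :
    mdot (Amap a (T x)) (S x) = ⟪radA a (tZ T x), tZ S x⟫ := by
  have : tZ (fun x => Amap a (T x)) x = radA a (tZ T x) := by
    ext p
    rw [radA, ← mnorm_tZ]; simp [tZ, Amap]
  rw [← this, ← mdot_tZ]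

theorem int_mdot (T S : Ev → Fin N → Fin n → ℝ) (Ω : Set Ev) : ∫ x in Ω, mdot (T x) (S x) = ∫ x in Ω, ⟪tZ T x, tZ S x⟫ :=
  integral_congr_ae (aoa fun x => mdot_tZ T S x)

theorem int_mdotA (a : ℝ → ℝ) (T S : Ev → Fin N → Fin n → ℝ) (Ω : Set Ev) :
    ∫ x in Ω, mdot (Amap a (T x)) (S x) = ∫ x in Ω, ⟪radA a (tZ T x), tZ S x⟫ :=
  integral_congr_ae (aoa fun x => mdotA_tZ a T S x)

theorem coord_intμ {κ : Type*} [Fintype κ] {μ : Measure Ev} {g : Ev → EuclideanSpace ℝ κ} (hg : Integrable g μ) (a : κ) :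
    Integrable (fun x => g x a) μ := (EuclideanSpace.proj (𝕜 := ℝ) a).integrable_comp hg

theorem tZ_int {μ : Measure Ev} {D : Ev → Fin N → Fin n → ℝ} : Integrable D μ ↔ Integrable (tZ D) μ := by
  constructor
  · intro h
    exact toLp_int fun p => (h.eval p.1).eval p.2
  · intro h
    refine Integrable.of_eval fun a => Integrable.of_eval fun i => ?_
    exact coord_intμ h (a, i)

theorem int_supp {Ω : Set Ev} {u φ : Ev → ℝ} (h : tsupport φ ⊆ Ω) : ∫ x in Ω, u x * φ x = ∫ x, u x * φ x :=
  setIntegral_eq_integral_of_forall_compl_eq_zero fun x hx => by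
    rw [image_eq_zero_of_notMem_tsupport fun db => hx (h db), mul_zero]

theorem int_supp' {Ω : Set Ev} {u φ : Ev → ℝ} (h : tsupport φ ⊆ Ω) (i : Fin n) :
    ∫ x in Ω, u x * fderiv ℝ φ x (single i 1) = ∫ x, u x * fderiv ℝ φ x (single i 1) :=
  setIntegral_eq_integral_of_forall_compl_eq_zero fun x hx => by
    have : fderiv ℝ φ x = 0 := by
      by_contra db
      exact hx (h (support_fderiv_subset ℝ db))
    simp [this]

theorem hwd_iff {Ω : Set Ev} {u : Ev → Fin N → ℝ} {D : Ev → Fin N → Fin n → ℝ} : HasWeakDerivOn Ω u D ↔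
    (∀ a, IntegrableOn (fun x => u x a) Ω) ∧ (∀ a i, IntegrableOn (fun x => D x a i) Ω) ∧
      ∀ a i, WD Ω i (fun x => u x a) (fun x => D x a i) := by
  constructor
  · rintro ⟨aa, ab, ad⟩
    refine ⟨fun a => aa.eval a, fun a i => (Integrable.eval ab a).eval i, fun a i φ eo en cs => ?_⟩
    rw [← int_supp' cs, ← int_supp cs]
    exact ad φ eo en cs a i
  · rintro ⟨aa, ab, ad⟩
    refine ⟨Integrable.of_eval aa, Integrable.of_eval fun a => Integrable.of_eval fun i => ab a i, fun φ eo en cs a i => ?_⟩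
    rw [int_supp' cs, int_supp cs]
    exact ad a i φ eo en cs

theorem hwd_SS {Ω : Set Ev} (hΩ : MeasurableSet Ω) {u : Ev → Fin N → ℝ} {D : Ev → Fin N → Fin n → ℝ} (h : HasWeakDerivOn Ω u D) :
    (Ω.indicator (fun x => (WithLp.toLp 2 (u x) : WW N)), Ω.indicator (tZ D)) ∈ SS (N := N) Ω 0 := by
  have db := hwd_iff.1 h
  refine ⟨(integrable_indicator_iff hΩ).2 (toLp_int fun p => db.1 p), (integrable_indicator_iff hΩ).2 (tZ_int.1 h.2.1), fun a i => ?_, by simp, by simp⟩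
  refine (db.2.2 a i).congr_ae (aoa fun x hx => ?_) (aoa fun x hx => ?_)
  · simp [indicator_of_mem hx]
  · simp [indicator_of_mem hx, tZ]

theorem hwd_sub {Ω : Set Ev} (hΩ : MeasurableSet Ω) {u cd : Ev → Fin N → ℝ} {D D' : Ev → Fin N → Fin n → ℝ} (h : HasWeakDerivOn Ω u D)
    (db : HasWeakDerivOn Ω cd D') : HasWeakDerivOn Ω (fun x => u x - cd x) (fun x => D x - D' x) := by
  have k := hwd_iff.1 h
  have fo := hwd_iff.1 db
  refine hwd_iff.2 ⟨fun a => (k.1 a).sub (fo.1 a), fun a i => (k.2.1 a i).sub (fo.2.1 a i), fun a i => ?_⟩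
  have ind : ∀ {w : Ev → ℝ}, IntegrableOn w Ω → LocallyIntegrable (Ω.indicator w) := fun hw =>
    ((integrable_indicator_iff hΩ).2 hw).locallyIntegrable
  have ci : ∀ {w z : Ev → ℝ}, WD Ω i w z → WD Ω i (Ω.indicator w) (Ω.indicator z) := fun hw =>
    hw.congr_ae (aoa fun x hx => indicator_of_mem hx _) (aoa fun x hx => indicator_of_mem hx _)
  have := (ci (k.2.2 a i)).lin (ci (fo.2.2 a i)) (ind (k.1 a)) (ind (k.2.1 a i)) (ind (fo.1 a)) (ind (fo.2.1 a i)) 1 (-1)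
  refine this.congr_ae (aoa fun x hx => ?_) (aoa fun x hx => ?_)
  · simp [indicator_of_mem hx, sub_eq_add_neg]
  · simp [indicator_of_mem hx, sub_eq_add_neg]

theorem tok_of {Ω : Set Ev} (hΩ : MeasurableSet Ω) {T : Ev → Fin N → Fin n → ℝ} (hc : ContinuousOn T Ω) {M : ℝ}
    (hs : linfNormOn Ω T < ofReal M) : ∃ τ < M, TOk (volume.restrict Ω) (tZ T) τ := by
  have htop : linfNormOn Ω T ≠ ⊤ := (hs.trans ofReal_lt_top).ne
  refine ⟨(linfNormOn Ω T).toReal, ENNReal.toReal_lt_of_lt_ofReal hs, ?_, ?_⟩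
  · exact ((PiLp.continuous_toLp 2 _).comp_continuousOn (continuousOn_pi.2 fun p : Fin N × Fin n =>
      (continuous_apply p.2).comp_continuousOn ((continuous_apply p.1).comp_continuousOn hc))).aestronglyMeasurable hΩ
  · have : ∀ᵐ x ∂(volume.restrict Ω), ofReal (mnorm (T x)) ≤ linfNormOn Ω T := ENNReal.ae_le_essSup _
    filter_upwards [this] with x hx
    rw [← mnorm_tZ]
    exact (ENNReal.ofReal_le_iff_le_toReal htop).1 hx

theorem exist_sol {Ω : Set Ev} (hΩ : IsLipschitzDomain Ω) (hb : Bornology.IsBounded Ω) [SimplyConnectedSpace Ω]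
    {g : Ev → ZZ N n} (hg : IntegrableOn g Ω)
    (hcurl : ∀ x0 R, 0 < R → closedBall x0 R ⊆ Ω → ∀ φ : Ev → ℝ, ContDiff ℝ 1 φ → HasCompactSupport φ →
        tsupport φ ⊆ ball x0 R → ∀ b i j,
        ∫ x, g x (b, i) * fderiv ℝ φ x (es j) = ∫ x, g x (b, j) * fderiv ℝ φ x (es i)) :
    ∃ u : Ev → Fin N → ℝ, HasWeakDerivOn Ω u (fun x b i => g x (b, i)) := by
  have hm := hΩ.1.measurableSet
  have key : ∀ b : Fin N, ∃ u : Ev → ℝ, IntegrableOn u Ω ∧ ∀ i, WD Ω i u (fun x => g x (b, i)) := by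
    intro b
    set G : Fin n → Ev → ℝ := fun i => Ω.indicator (fun x => g x (b, i)) with ak
    have gc : ∀ i, Integrable (G i) := fun i => (integrable_indicator_iff hm).2 (coord_intμ hg (b, i))
    have ff : ∀ i x, x ∈ Ω → G i x = g x (b, i) := fun i x hx => indicator_of_mem hx _
    have hGint : ∀ φ : Ev → ℝ, tsupport φ ⊆ Ω → ∀ i j, ∫ x, G i x * fderiv ℝ φ x (es j) = ∫ x, g x (b, i) * fderiv ℝ φ x (es j) := by
      intro φ h i j
      rw [← int_supp' h j, ← int_supp' h j]
      exact setIntegral_congr_fun hm fun x hx => by simp only [ff i x hx]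
    obtain ⟨u, hu⟩ := glob hΩ.1 gc fun x hx => by
      obtain ⟨R, ae, bt⟩ := nhds_basis_closedBall.mem_iff.1 (hΩ.1.mem_nhds hx)
      have hsub : ball x R ⊆ Ω := ball_subset_closedBall.trans bt
      refine ⟨R / 2, half_pos ae, (ball_subset_ball (by linarith)).trans hsub, ?_⟩
      refine potential (half_pos ae) (half_lt_self ae) gc fun φ eo en cs i j => ?_
      rw [hGint φ (cs.trans hsub), hGint φ (cs.trans hsub)]
      exact hcurl x R ae bt φ eo en cs b i j
    have fb : ∀ i, WD Ω i u (G i) := fun i => wd_glob (gc i) fun x hx => by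
      obtain ⟨r, aa, ab, ad, ai⟩ := hu x hx
      exact ⟨r, aa, ab, ad, ai i⟩
    refine ⟨u, u_int hΩ hb gc (fun Q dr dl => loc_int (fun x hx => ?_) dr dl) fb, fun i =>
      (fb i).congr_ae (aoa fun x _ => rfl) (aoa fun x hx => (ff i x hx).symm)⟩
    obtain ⟨r, aa, ab, ad, ai⟩ := hu x hx
    exact ⟨r, aa, ab, ad⟩
  choose u hu hw using key
  exact ⟨fun x b => u b x, hwd_iff.2 ⟨hu, fun a i => coord_intμ hg (a, i), hw⟩⟩

theorem uniq_sol {Ω : Set Ev} (hΩ : IsOpen Ω) (hc : IsConnected Ω) (hb : Bornology.IsBounded Ω) {f a : ℝ → ℝ} {L M : ℝ} (hp : Prof f a L M)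
    {T : Ev → Fin N → Fin n → ℝ} {v w : Ev → Fin N → ℝ} {D E : Ev → Fin N → Fin n → ℝ}
    (hv : IsWeakSolution Ω a T v D) (hw : IsWeakSolution Ω a T w E) (zv : ZeroMean Ω v) (zw : ZeroMean Ω w) :
    v =ᵐ[volume.restrict Ω] w := by
  have hm := hΩ.measurableSet
  have hs := hwd_sub hm hv.1 hw.1
  have hs' := hwd_iff.1 hs
  have cb := tZ_int.1 hv.1.2.1
  have ei := tZ_int.1 hw.1.2.1
  have gd := tZ_int.1 hs.2.1
  have ag := (hv.2 _ _ hs).trans (hw.2 _ _ hs).symm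
  replace ag := ((int_mdotA a D _ Ω).symm.trans ag).trans (int_mdotA a E _ Ω)
  rw [← sub_eq_zero, ← integral_sub (hp.intA cb.1 gd) (hp.intA ei.1 gd)] at ag
  have hsub : ∀ x, tZ (fun x => D x - E x) x = tZ D x - tZ E x := fun x => by ext p; simp [tZ]
  simp only [hsub, ← inner_sub_left] at ag
  have hint := isub (hp.intA cb.1 gd) (hp.intA ei.1 gd)
  simp only [hsub, ← inner_sub_left] at hint
  have aq := (integral_eq_zero_iff_of_nonneg (fun x => hp.inner_nonneg (tZ D x) (tZ E x)) hint).1 ag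
  have cf : ∀ᵐ x, x ∈ Ω → tZ D x = tZ E x := by
    rw [← ae_restrict_iff' hm]
    filter_upwards [aq] with x hx using hp.inner_eq_zero hx
  have fin : ∀ b, ∀ᵐ x, x ∈ Ω → v x b - w x b = 0 := by
    intro b
    obtain ⟨c, hcc⟩ := wd_const hΩ hc.isPreconnected (u := fun x => v x b - w x b)
      (fun x R h => (hs'.1 b).mono_set (ball_subset_closedBall.trans h)) fun i =>
        (hs'.2.2 b i).congr_ae (aoa fun x _ => rfl) (by
          filter_upwards [cf] with x hx hxΩ
          have := congrArg (fun z : ZZ N n => z (b, i)) (hx hxΩ)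
          simp only [tZ] at this
          simp [this])
    have aa : ∫ x in Ω, (v x b - w x b) = 0 := by
      have := integral_sub ((hwd_iff.1 hv.1).1 b) ((hwd_iff.1 hw.1).1 b)
      rw [zv b, zw b, sub_zero] at this
      exact this
    rw [setIntegral_congr_ae hm (g := fun _ => c) hcc, setIntegral_const, smul_eq_mul] at aa
    have ab : volume.real Ω ≠ 0 := (ENNReal.toReal_pos (hΩ.measure_pos volume hc.nonempty).ne' hb.measure_lt_top.ne).ne'
    have ad : c = 0 := (mul_eq_zero.1 aa).resolve_left ab
    rw [ad] at hcc
    exact hcc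
  rw [EventuallyEq, ae_restrict_iff' hm]
  filter_upwards [ae_all_iff.2 fin] with x hx hxΩ
  ext b
  exact sub_eq_zero.1 (hx b hxΩ)

end asm

end

/-- **Theorem (Existence and uniqueness for the Neumann problem, Theorem 1.6).**
If `Ω ⊂ ℝⁿ` is a simply connected, bounded Lipschitz domain, `f ∈ C²([0,∞))` is strictly
convex with `f(0) = f'(0) = 0`, of linear growth `ν t − L ≤ f(t) ≤ L(t+1)` and with
`f''(t) ≤ L(1+t)⁻¹`, and `T₀ ∈ W^{2,∞}(Ω;ℝ^{N×n})` satisfies `‖T₀‖_{L^∞} < f^∞(1)`,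
then there is a weak solution `u ∈ W^{1,1}(Ω;ℝ^N)` of the Neumann problem, unique among
weak solutions with vanishing mean value. -/
theorem neumann_existence_uniqueness
    {n N : ℕ} (Ω : Set (EVec n))
    (hΩ : IsLipschitzDomain Ω) (hΩbdd : Bornology.IsBounded Ω)
    (hΩsc : SimplyConnectedSpace Ω)
    (ν L : ℝ) (hν : 0 < ν) (hνL : ν ≤ L)
    (f f' f'' : ℝ → ℝ)
    (hderiv : ∀ t ∈ Set.Ici (0:ℝ), HasDerivWithinAt f (f' t) (Set.Ici 0) t)
    (hderiv' : ∀ t ∈ Set.Ici (0:ℝ), HasDerivWithinAt f' (f'' t) (Set.Ici 0) t)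
    (hf''cont : ContinuousOn f'' (Set.Ici 0))
    (hstrict : StrictConvexOn ℝ (Set.Ici 0) f)
    (hf0 : f 0 = 0) (hf'0 : f' 0 = 0)
    (hgrowth : ∀ t ∈ Set.Ici (0:ℝ), ν * t - L ≤ f t ∧ f t ≤ L * (t + 1))
    (hsec : ∀ t ∈ Set.Ici (0:ℝ), f'' t ≤ L * (1 + t)⁻¹)
    (finf : ℝ) (hfinf : Filter.Tendsto (fun t => f t / t) Filter.atTop (nhds finf))
    (T₀ : EVec n → Fin N → Fin n → ℝ)
    (hT : MemW2inf Ω T₀)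
    (hTsmall : linfNormOn Ω T₀ < ENNReal.ofReal finf) :
    (∃ (u : EVec n → Fin N → ℝ) (Du : EVec n → Fin N → Fin n → ℝ),
        IsWeakSolution Ω f' T₀ u Du) ∧
    (∀ (v₁ : EVec n → Fin N → ℝ) (Dv₁ : EVec n → Fin N → Fin n → ℝ)
        (v₂ : EVec n → Fin N → ℝ) (Dv₂ : EVec n → Fin N → Fin n → ℝ),
      IsWeakSolution Ω f' T₀ v₁ Dv₁ → IsWeakSolution Ω f' T₀ v₂ Dv₂ →
      ZeroMean Ω v₁ → ZeroMean Ω v₂ →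
      v₁ =ᵐ[volume.restrict Ω] v₂) := by
  have hp := prof_of_hyp ν L hν hνL f f' f'' hderiv hderiv' hstrict hf0 hf'0 hgrowth hsec finf hfinf
  refine ⟨?_, fun v₁ D₁ v₂ D₂ aa ab z1 z2 => uniq_sol hΩ.1 hΩ.2.2.1 hΩbdd hp aa ab z1 z2⟩
  have hm := hΩ.1.measurableSet
  obtain ⟨C, DT, -, hd, -, hl⟩ := hT
  obtain ⟨τ, bn, hok⟩ := tok_of hm (fun x hx => (hd x hx).continuousWithinAt) hTsmall
  obtain ⟨d, Ld, hbp, dh, hdl⟩ := bp_of hΩ.1 hd hl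
  obtain ⟨g, hg, heul, hcurl⟩ := exists_g hΩ.1 hΩbdd hp hok bn hbp dh hdl
  obtain ⟨u, hu⟩ := exist_sol hΩ hΩbdd hg hcurl
  refine ⟨u, _, hu, fun φ Dφ h => ?_⟩
  refine (int_mdotA f' _ Dφ Ω).trans (Eq.trans ?_ (int_mdot T₀ Dφ Ω).symm)
  have hgz : ∀ x, tZ (fun x b i => g x (b, i)) x = g x := fun x => by ext p; simp [tZ]
  simp only [hgz]
  have e := heul _ (hwd_SS hm h)
  have k : ∀ F : EVec n → ZZ N n, ∫ x in Ω, ⟪F x, Ω.indicator (tZ Dφ) x⟫ = ∫ x in Ω, ⟪F x, tZ Dφ x⟫ := fun F =>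
    setIntegral_congr_fun hm fun x hx => by simp only [indicator_of_mem hx]
  rw [← k, ← k]
  exact e
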